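/- Let F ∈ ℤ[t] be an irreducible polynomial of degree g ≥ 2, and let 0 < δ < 1 and C > 1 be real constants. There exist constants y₀ and c > 0, depending only on F, δ and C, such that for all reals x, y, z with y₀ ≤ y ≤ x^{1−δ}, z = e^η y, and (log y)^{−C} ≤ η ≤ 1/100: H_F(x, y, z) − H_F(x/2, y, z) ≥ c · β · x/(max(1, −ξ) · (log y)^{G(β)}), where β = −log η/log log y, ξ = (β − (log 4 − 1)) · √(log log y), and G(β) = β if β ≥ log 4 − 1, while G(β) = ((1+β)/log 2) · log((1+β)/(e · log 2)) + 1 if 0 ≤ β ≤ log 4 − 1. -/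

import Mathlib

open Real MeasureTheory
open scoped Classical

/-- number of residues n mod d with F(n) ≡ 0 (mod d) -/
noncomputable def polyRho (F : Polynomial ℤ) (d : ℕ) : ℕ :=
  ((Finset.range d).filter (fun n => (d : ℤ) ∣ F.eval (n : ℤ))).card

/-- H_F(x,y,z): number of positive n ≤ x with F(n) having a divisor in (y,z] -/
noncomputable def polyH (F : Polynomial ℤ) (x y z : ℝ) : ℕ :=
  {n : ℕ | 0 < n ∧ (n : ℝ) ≤ x ∧
    ∃ d : ℕ, 0 < d ∧ (d : ℤ) ∣ F.eval (n : ℤ) ∧ y < (d : ℝ) ∧ (d : ℝ) ≤ z}.ncard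

/-- H(x,y,z): number of positive n ≤ x having a divisor in (y,z] -/
noncomputable def Hdiv (x y z : ℝ) : ℕ :=
  {n : ℕ | 0 < n ∧ (n : ℝ) ≤ x ∧
    ∃ d : ℕ, 0 < d ∧ d ∣ n ∧ y < (d : ℝ) ∧ (d : ℝ) ≤ z}.ncard

/-- L(a;σ) -/
noncomputable def Lfun (a : ℕ) (σ : ℝ) : ℝ :=
  (volume {x : ℝ | ∃ d : ℕ, d ∣ a ∧ Real.exp x < (d : ℝ) ∧ (d : ℝ) ≤ Real.exp (x + σ)}).toReal

/-- W(a;σ): ordered pairs of divisors near each other -/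
noncomputable def Wfun (a : ℕ) (σ : ℝ) : ℕ :=
  {p : ℕ × ℕ | p.1 ∣ a ∧ p.2 ∣ a ∧ |Real.log ((p.1 : ℝ) / (p.2 : ℝ))| ≤ σ}.ncard

/-- 𝒫(s,t): squarefree integers with all prime factors in (s,t] -/
def Psf (s t : ℝ) : Set ℕ :=
  {a : ℕ | 0 < a ∧ Squarefree a ∧ ∀ p : ℕ, p.Prime → p ∣ a → s < (p : ℝ) ∧ (p : ℝ) ≤ t}

/-- φ_F(n) = n ∏_{p|n} (1 - ρ(p)/p) -/
noncomputable def polyPhi (F : Polynomial ℤ) (n : ℕ) : ℝ :=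
  (n : ℝ) * ∏ p ∈ n.primeFactors, (1 - (polyRho F p : ℝ) / p)

/-- P⁺(n): largest prime factor, P⁺(1)=0 -/
def Pplus (n : ℕ) : ℕ := n.primeFactors.sup id

/-- h(n;X): least prime q with ∏_{p^ν ∥ n, p ≤ q} p^ν > √X -/
noncomputable def hfun (n : ℕ) (X : ℝ) : ℕ :=
  sInf {q : ℕ | q.Prime ∧
    Real.sqrt X < ∏ p ∈ n.primeFactors.filter (fun p => p ≤ q), (p : ℝ) ^ (n.factorization p)}

open Finset

/-- the primes in the interval `(u, v]` -/
noncomputable def primesIoc (u v : ℝ) : Finset ℕ :=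
  (range (⌊v⌋₊ + 1)).filter (fun p => p.Prime ∧ u < (p : ℝ) ∧ (p : ℝ) ≤ v)

theorem mem_primesIoc {u v : ℝ} {p : ℕ} :
    p ∈ primesIoc u v ↔ p.Prime ∧ u < (p : ℝ) ∧ (p : ℝ) ≤ v := by
  unfold primesIoc
  simp only [mem_filter, mem_range, and_iff_right_iff_imp]
  rintro ⟨_, _, h⟩
  exact Nat.lt_succ_of_le (Nat.le_floor h)

theorem primesIoc_subset {u v u' v' : ℝ} (hu : u' ≤ u) (hv : v ≤ v') :
    primesIoc u v ⊆ primesIoc u' v' := by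
  intro p hp
  rw [mem_primesIoc] at hp ⊢
  exact ⟨hp.1, by linarith [hp.2.1], by linarith [hp.2.2]⟩

theorem sum_log_primesIoc_le {u v : ℝ} (hv : 0 ≤ v) :
    ∑ p ∈ primesIoc u v, log p ≤ log 4 * v := by
  refine le_trans ?_ (Chebyshev.theta_le_log4_mul_x hv)
  rw [Chebyshev.theta_eq_sum_primesLE]
  refine sum_le_sum_of_subset_of_nonneg ?_ ?_
  · intro p hp
    rw [mem_primesIoc] at hp
    rw [Nat.mem_primesLE]
    exact ⟨Nat.le_floor hp.2.2, hp.1⟩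
  · intro p _ _
    exact log_natCast_nonneg p

theorem sum_log_div_primesIoc_two_pow (n : ℕ) :
    ∑ p ∈ primesIoc 0 (2 ^ n), log p / p ≤ 3 * n := by
  induction n with
  | zero =>
    have : primesIoc 0 (2 ^ 0) = ∅ := by
      ext p
      simp only [mem_primesIoc, pow_zero, Finset.notMem_empty, iff_false]
      rintro ⟨h1, _, h2⟩
      have := h1.two_le
      have h3 : (2:ℝ) ≤ p := by exact_mod_cast this
      linarith
    rw [this]; simp
  | succ n ih =>
    have h1 : primesIoc 0 (2 ^ (n + 1)) ⊆ primesIoc 0 (2 ^ n) ∪ primesIoc (2 ^ n) (2 ^ (n + 1)) := by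
      intro p hp
      rw [mem_union, mem_primesIoc, mem_primesIoc]
      rw [mem_primesIoc] at hp
      rcases le_or_gt (p : ℝ) (2 ^ n) with h | h
      · exact Or.inl ⟨hp.1, hp.2.1, h⟩
      · exact Or.inr ⟨hp.1, h, hp.2.2⟩
    have nn : ∀ p : ℕ, 0 ≤ log p / p := fun p =>
      div_nonneg (log_natCast_nonneg p) (Nat.cast_nonneg p)
    have h2 : ∑ p ∈ primesIoc (2 ^ n) (2 ^ (n + 1)), log p / p ≤ 3 := by
      have h3 : ∑ p ∈ primesIoc (2 ^ n) (2 ^ (n + 1)), log p / p ≤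
          ∑ p ∈ primesIoc (2 ^ n) (2 ^ (n + 1)), log p / 2 ^ n := by
        refine sum_le_sum (fun p hp => ?_)
        rw [mem_primesIoc] at hp
        exact div_le_div_of_nonneg_left (log_natCast_nonneg p) (by positivity) hp.2.1.le
      rw [← sum_div] at h3
      have h4 := sum_log_primesIoc_le (u := 2 ^ n) (v := 2 ^ (n + 1)) (by positivity)
      have h5 : (∑ p ∈ primesIoc (2 ^ n) (2 ^ (n + 1)), log p) / 2 ^ n ≤ 3 := by
        rw [div_le_iff₀ (by positivity)]
        have := log_two_lt_d9
        rw [log_four_eq] at h4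
        have h6 : (2:ℝ) ^ (n + 1) = 2 ^ n * 2 := pow_succ _ _
        have : (0:ℝ) < 2 ^ n := by positivity
        rw [h6] at h4 ⊢
        nlinarith
      linarith
    calc _ ≤ ∑ p ∈ primesIoc 0 (2 ^ n) ∪ primesIoc (2 ^ n) (2 ^ (n + 1)), log p / p :=
          sum_le_sum_of_subset_of_nonneg h1 (fun p _ _ => nn p)
      _ ≤ ∑ p ∈ primesIoc 0 (2 ^ n), log p / p
          + ∑ p ∈ primesIoc (2 ^ n) (2 ^ (n + 1)), log p / p := by
          rw [← Finset.sum_union_inter]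
          have := sum_nonneg (s := primesIoc 0 (2 ^ n) ∩ primesIoc (2 ^ n) (2 ^ (n + 1)))
            (fun p _ => nn p)
          linarith
      _ ≤ _ := by push_cast; linarith

theorem sum_log_div_primesIoc_le {u v : ℝ} (hu : 0 ≤ u) (hv : 2 ≤ v) :
    ∑ p ∈ primesIoc u v, log p / p ≤ 9 * log v := by
  have nn : ∀ p : ℕ, 0 ≤ log p / p := fun p =>
      div_nonneg (log_natCast_nonneg p) (Nat.cast_nonneg p)
  have h2 : log 2 ≤ log v := log_le_log (by norm_num) hv
  set n := ⌈log v / log 2⌉₊ with hn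
  have hl2 := log_two_gt_d9
  have h3 : v ≤ 2 ^ n := by
    rw [← log_le_log_iff (by linarith) (by positivity), log_pow,
      ← div_le_iff₀ (by linarith)]
    exact Nat.le_ceil _
  have h4 : (n : ℝ) ≤ 3 * log v := by
    have := (Nat.ceil_lt_add_one (show 0 ≤ log v / log 2 from
      div_nonneg (by linarith) (by linarith))).le
    rw [← hn] at this
    have h5 : log v / log 2 ≤ log v * 1.45 := by
      rw [div_le_iff₀ (by linarith)]
      nlinarith
    nlinarith
  calc _ ≤ ∑ p ∈ primesIoc 0 (2 ^ n), log p / p :=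
        sum_le_sum_of_subset_of_nonneg (primesIoc_subset hu h3) (fun p _ _ => nn p)
    _ ≤ 3 * n := sum_log_div_primesIoc_two_pow n
    _ ≤ _ := by linarith

theorem sum_inv_primesIoc_le {u v : ℝ} (hu : 1 < u) (hv : 2 ≤ v) :
    ∑ p ∈ primesIoc u v, (1 : ℝ) / p ≤ 9 * (log v / log u) := by
  have hl : 0 < log u := log_pos hu
  rw [← mul_div_assoc, le_div_iff₀ hl, sum_mul]
  refine le_trans (sum_le_sum (fun p hp => ?_)) (sum_log_div_primesIoc_le (by linarith) hv)
  rw [mem_primesIoc] at hp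
  rw [one_div, inv_mul_eq_div]
  have := log_le_log (by linarith) hp.2.1.le
  gcongr

section idealCount

open NumberField UniqueFactorizationMonoid

variable (K : Type*) [Field K] [NumberField K]

/-- number of integral ideals of given norm -/
noncomputable def idealCount (n : ℕ) : ℕ := Nat.card {I : Ideal (𝓞 K) // Ideal.absNorm I = n}

theorem absNorm_span_natCast' (n : ℕ) :
    Ideal.absNorm (Ideal.span {(n : 𝓞 K)}) = n ^ Module.finrank ℤ (𝓞 K) := by
  rw [Ideal.absNorm_span_singleton]
  have := Algebra.norm_algebraMap_of_basis (Module.Free.chooseBasis ℤ (𝓞 K)) (n : ℤ)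
  rw [← Module.finrank_eq_card_chooseBasisIndex] at this
  simp only [algebraMap_int_eq, eq_intCast, Int.cast_natCast] at this
  rw [this]
  simp [Int.natAbs_pow]

theorem idealCount_one : idealCount K 1 = 1 := by
  unfold idealCount
  simp_rw [Ideal.absNorm_eq_one_iff]
  simp

variable {K}

private theorem sup_span_of_mul {m n : ℕ} (h : Nat.Coprime m n) {L M : Ideal (𝓞 K)}
    (hL : Ideal.absNorm L = m) (hM : Ideal.absNorm M = n) :
    L * M ⊔ Ideal.span {(m : 𝓞 K)} = L := by
  have hm : Ideal.span {(m : 𝓞 K)} ≤ L := by rw [← hL]; exact Ideal.span_singleton_absNorm_le L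
  have hn : Ideal.span {(n : 𝓞 K)} ≤ M := by rw [← hM]; exact Ideal.span_singleton_absNorm_le M
  have h1 : M ⊔ Ideal.span {(m : 𝓞 K)} = ⊤ := by
    have h2 : IsCoprime (m : 𝓞 K) (n : 𝓞 K) := by
      have := (Nat.isCoprime_iff_coprime.mpr h).map (Int.castRingHom (𝓞 K))
      simpa using this
    have h3 := (Ideal.isCoprime_span_singleton_iff _ _).mpr h2
    rw [Ideal.isCoprime_iff_sup_eq] at h3
    rw [eq_top_iff, ← h3, sup_comm]
    exact sup_le_sup_right hn _
  apply le_antisymm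
  · exact sup_le Ideal.mul_le_left hm
  · calc L = L * (M ⊔ Ideal.span {(m : 𝓞 K)}) := by rw [h1, Ideal.mul_top]
      _ = L * M ⊔ L * Ideal.span {(m : 𝓞 K)} := Ideal.mul_sup _ _ _
      _ ≤ _ := sup_le_sup_left Ideal.mul_le_right _

theorem idealCount_mul {m n : ℕ} (h : Nat.Coprime m n) :
    idealCount K (m * n) = idealCount K m * idealCount K n := by
  unfold idealCount
  rw [← Nat.card_prod]
  symm
  refine Nat.card_congr (Equiv.ofBijective (fun x => ⟨x.1.1 * x.2.1, by
    rw [map_mul, x.1.2, x.2.2]⟩) ⟨?_, ?_⟩)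
  · rintro ⟨⟨L, hL⟩, ⟨M, hM⟩⟩ ⟨⟨L', hL'⟩, ⟨M', hM'⟩⟩ heq
    simp only [Subtype.mk.injEq] at heq
    have h1 := sup_span_of_mul h hL hM
    have h2 := sup_span_of_mul h hL' hM'
    have h3 := sup_span_of_mul h.symm hM hL
    have h4 := sup_span_of_mul h.symm hM' hL'
    rw [mul_comm] at h3 h4
    simp only [Prod.mk.injEq, Subtype.mk.injEq]
    exact ⟨by rw [← h1, ← h2, heq], by rw [← h3, ← h4, heq]⟩
  · rintro ⟨I, hI⟩
    have hmn : Ideal.span {(m : 𝓞 K)} * Ideal.span {(n : 𝓞 K)} ≤ I := by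
      rw [Ideal.span_singleton_mul_span_singleton, ← Nat.cast_mul, ← hI]
      exact Ideal.span_singleton_absNorm_le I
    have h1 : Ideal.span {(m : 𝓞 K)} ⊔ Ideal.span {(n : 𝓞 K)} = ⊤ := by
      have h2 : IsCoprime (m : 𝓞 K) (n : 𝓞 K) := by
        have := (Nat.isCoprime_iff_coprime.mpr h).map (Int.castRingHom (𝓞 K))
        simpa using this
      have h3 := (Ideal.isCoprime_span_singleton_iff _ _).mpr h2
      rwa [Ideal.isCoprime_iff_sup_eq] at h3
    have h2 : (I ⊔ Ideal.span {(m : 𝓞 K)}) * (I ⊔ Ideal.span {(n : 𝓞 K)}) = I := by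
      apply le_antisymm
      · rw [Ideal.sup_mul, Ideal.mul_sup (Ideal.span {(m : 𝓞 K)})]
        exact sup_le Ideal.mul_le_left (sup_le Ideal.mul_le_right hmn)
      · calc I = I * (Ideal.span {(m : 𝓞 K)} ⊔ Ideal.span {(n : 𝓞 K)}) := by
              rw [h1, Ideal.mul_top]
          _ = I * Ideal.span {(m : 𝓞 K)} ⊔ I * Ideal.span {(n : 𝓞 K)} := Ideal.mul_sup _ _ _
          _ ≤ _ := by
            refine sup_le ?_ ?_
            · rw [mul_comm]; exact Ideal.mul_mono le_sup_right le_sup_left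
            · exact Ideal.mul_mono le_sup_left le_sup_right
    have hprod := congrArg Ideal.absNorm h2
    rw [map_mul, hI] at hprod
    have hdm : Ideal.absNorm (I ⊔ Ideal.span {(m : 𝓞 K)}) ∣ m ^ Module.finrank ℤ (𝓞 K) := by
      rw [← absNorm_span_natCast']
      exact Ideal.absNorm_dvd_absNorm_of_le le_sup_right
    have hdn : Ideal.absNorm (I ⊔ Ideal.span {(n : 𝓞 K)}) ∣ n ^ Module.finrank ℤ (𝓞 K) := by
      rw [← absNorm_span_natCast']
      exact Ideal.absNorm_dvd_absNorm_of_le le_sup_right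
    set u := Ideal.absNorm (I ⊔ Ideal.span {(m : 𝓞 K)})
    set v := Ideal.absNorm (I ⊔ Ideal.span {(n : 𝓞 K)})
    have cu : Nat.Coprime u n := Nat.Coprime.coprime_dvd_left hdm (Nat.Coprime.pow_left _ h)
    have cv : Nat.Coprime v m := Nat.Coprime.coprime_dvd_left hdn (Nat.Coprime.pow_left _ h.symm)
    have h5 : u ∣ m := cu.dvd_of_dvd_mul_right (hprod ▸ Dvd.intro _ rfl)
    have h6 : m ∣ u := cv.symm.dvd_of_dvd_mul_right (hprod ▸ Dvd.intro _ rfl)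
    have h7 : v ∣ n := cv.dvd_of_dvd_mul_left (hprod ▸ Dvd.intro_left _ rfl)
    have h8 : n ∣ v := cu.symm.dvd_of_dvd_mul_left (hprod ▸ Dvd.intro_left _ rfl)
    exact ⟨⟨⟨_, Nat.dvd_antisymm h5 h6⟩, ⟨_, Nat.dvd_antisymm h7 h8⟩⟩, Subtype.ext h2⟩

theorem idealCount_prime_pow_le {p : ℕ} (hp : p.Prime) (e : ℕ) :
    idealCount K (p ^ e) ≤ (e + 1) ^ Module.finrank ℤ (𝓞 K) := by
  set d := Module.finrank ℤ (𝓞 K)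
  set S := (normalizedFactors (Ideal.span {(p : 𝓞 K)})).toFinset with hS
  have hp0 : Ideal.span {(p : 𝓞 K)} ≠ 0 := by
    have h1 := absNorm_span_natCast' K p
    intro h
    rw [h] at h1
    simp only [Ideal.zero_eq_bot, Ideal.absNorm_bot] at h1
    exact (pow_pos hp.pos _).ne h1
  have hnorm : ∀ P ∈ normalizedFactors (Ideal.span {(p : 𝓞 K)}), p ∣ Ideal.absNorm P := by
    intro P hP
    have h1 : P ∣ Ideal.span {(p : 𝓞 K)} := dvd_of_mem_normalizedFactors hP
    have h2 := Ideal.absNorm_dvd_absNorm_of_le (Ideal.dvd_iff_le.mp h1)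
    rw [absNorm_span_natCast'] at h2
    obtain ⟨f, _, hf⟩ := (Nat.dvd_prime_pow hp).mp h2
    have h3 : Ideal.absNorm P ≠ 1 := by
      rw [Ne, Ideal.absNorm_eq_one_iff]
      exact (Ideal.isPrime_of_prime (prime_of_normalized_factor P hP)).ne_top
    rw [hf] at h3 ⊢
    exact dvd_pow_self p (by rintro rfl; simp at h3)
  have hcard : S.card ≤ d := by
    refine (Multiset.toFinset_card_le _).trans ?_
    have h1 := Ideal.prod_normalizedFactors_eq_self hp0
    have h2 := congrArg Ideal.absNorm h1
    rw [absNorm_span_natCast', map_multiset_prod] at h2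
    have h3 : ∀ s : Multiset (Ideal (𝓞 K)), (∀ P ∈ s, p ∣ Ideal.absNorm P) →
        p ^ s.card ∣ (s.map Ideal.absNorm).prod := by
      intro s
      induction s using Multiset.induction with
      | empty => simp
      | cons a s ih =>
        intro h
        rw [Multiset.card_cons, Multiset.map_cons, Multiset.prod_cons, pow_succ']
        exact mul_dvd_mul (h a (Multiset.mem_cons_self a s))
          (ih (fun P hP => h P (Multiset.mem_cons_of_mem hP)))
    have h4 := h3 _ hnorm
    rw [h2] at h4
    exact (Nat.pow_dvd_pow_iff_le_right hp.one_lt).mp h4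
  have hfac : ∀ I : Ideal (𝓞 K), Ideal.absNorm I = p ^ e → I ≠ 0 ∧
      ∀ P ∈ normalizedFactors I, P ∈ S := by
    intro I hI
    have hI0 : I ≠ 0 := by
      rintro rfl
      simp only [Ideal.zero_eq_bot, Ideal.absNorm_bot] at hI
      exact (pow_pos hp.pos _).ne hI
    refine ⟨hI0, fun P hP => ?_⟩
    have h1 : P ∣ Ideal.span {(p : 𝓞 K)} ^ e := by
      refine (dvd_of_mem_normalizedFactors hP).trans ?_
      rw [Ideal.dvd_iff_le, Ideal.span_singleton_pow, ← Nat.cast_pow, ← hI]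
      exact Ideal.span_singleton_absNorm_le I
    have hPp := prime_of_normalized_factor P hP
    have h2 := hPp.dvd_of_dvd_pow h1
    rw [hS, Multiset.mem_toFinset]
    obtain ⟨q, hq, hPq⟩ := exists_mem_normalizedFactors_of_dvd hp0 hPp.irreducible h2
    rwa [associated_iff_eq.mp hPq]
  have hcount : ∀ I : Ideal (𝓞 K), Ideal.absNorm I = p ^ e → ∀ P ∈ S,
      (normalizedFactors I).count P < e + 1 := by
    intro I hI P hP
    obtain ⟨hI0, _⟩ := hfac I hI
    rw [Nat.lt_succ_iff]
    have h1 : P ^ (normalizedFactors I).count P ∣ I := by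
      conv_rhs => rw [← Ideal.prod_normalizedFactors_eq_self hI0]
      rw [← Multiset.prod_replicate]
      exact Multiset.prod_dvd_prod_of_le (Multiset.le_count_iff_replicate_le.mp le_rfl)
    have h2 := Ideal.absNorm_dvd_absNorm_of_le (Ideal.dvd_iff_le.mp h1)
    rw [hI, map_pow] at h2
    have h3 := hnorm P (Multiset.mem_toFinset.mp hP)
    have h4 := (pow_dvd_pow_of_dvd h3 _).trans h2
    exact (Nat.pow_dvd_pow_iff_le_right hp.one_lt).mp h4
  have : idealCount K (p ^ e) ≤ Nat.card (S → Fin (e + 1)) := by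
    unfold idealCount
    refine Nat.card_le_card_of_injective
      (fun I P => (⟨(normalizedFactors I.1).count P.1, hcount I.1 I.2 P.1 P.2⟩ : Fin (e + 1))) ?_
    rintro ⟨I, hI⟩ ⟨I', hI'⟩ heq
    rw [Subtype.mk.injEq]
    obtain ⟨hI0, hf⟩ := hfac I hI
    obtain ⟨hI0', hf'⟩ := hfac I' hI'
    rw [← Ideal.prod_normalizedFactors_eq_self hI0, ← Ideal.prod_normalizedFactors_eq_self hI0']
    congr 1
    ext P
    by_cases hP : P ∈ S
    · have := congrFun heq ⟨P, hP⟩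
      simpa using this
    · rw [Multiset.count_eq_zero_of_notMem (fun h => hP (hf P h)),
        Multiset.count_eq_zero_of_notMem (fun h => hP (hf' P h))]
  refine this.trans ?_
  rw [Nat.card_fun, Nat.card_eq_fintype_card, Fintype.card_fin, Nat.card_eq_fintype_card,
    Fintype.card_coe]
  exact Nat.pow_le_pow_right (by omega) hcard

end idealCount

/-- the residues modulo `d` (in `[0, d)`) at which `F` vanishes modulo `d` -/
noncomputable def rootsMod (F : Polynomial ℤ) (d : ℕ) : Finset ℕ :=
  (range d).filter (fun n : ℕ => (d : ℤ) ∣ F.eval (n : ℤ))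

/-- the number of roots of `F` modulo `d` -/
noncomputable def rootCount (F : Polynomial ℤ) (d : ℕ) : ℕ := (rootsMod F d).card

section idealCountPrime

open NumberField UniqueFactorizationMonoid

theorem exponent_ne_zero_of_adjoin_eq_top {K : Type*} [Field K] [NumberField K] (θ : 𝓞 K)
    (h : Algebra.adjoin ℚ {(θ : K)} = ⊤) : RingOfIntegers.exponent θ ≠ 0 := by
  have h_integral : IsIntegral ℤ (θ : K) := θ.isIntegral_coe
  set B := PowerBasis.ofAdjoinEqTop (K := ℚ) (Algebra.IsIntegral.isIntegral (θ : K)) h with hB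
  have hgen : B.gen = θ := PowerBasis.ofAdjoinEqTop_gen _ _
  have hBint : IsIntegral ℤ B.gen := by rw [hgen]; exact h_integral
  have hdint : IsIntegral ℤ (Algebra.discr ℚ B.basis) := by
    apply Algebra.discr_isIntegral
    intro i
    rw [B.basis_eq_pow]
    exact hBint.pow _
  obtain ⟨d, hd⟩ := IsIntegrallyClosed.isIntegral_iff.mp hdint
  have hd0 : d ≠ 0 := by
    rintro rfl
    have := Algebra.discr_not_zero_of_basis ℚ B.basis
    rw [← hd] at this
    simp at this
  have hmem : (algebraMap ℤ (𝓞 K) d) ∈ conductor ℤ θ := by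
    rw [mem_conductor_iff]
    intro b
    have h1 := Algebra.discr_mul_isIntegral_mem_adjoin (K := ℚ) (B := B) hBint
      (z := (b : K)) b.isIntegral_coe
    rw [hgen, ← hd] at h1
    have h2 : (Algebra.adjoin ℤ {θ}).map (algebraMap (𝓞 K) K).toIntAlgHom =
        Algebra.adjoin ℤ {(θ : K)} := by
      rw [AlgHom.map_adjoin]; simp
    rw [← h2] at h1
    obtain ⟨c, hc, hc'⟩ := h1
    have : algebraMap ℤ (𝓞 K) d * b = c := by
      apply RingOfIntegers.ext
      have hc'' : (c : K) = (algebraMap ℤ ℚ) d • (b : K) := hc'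
      rw [hc'', Algebra.smul_def]
      simp
    rw [this]; exact hc
  unfold RingOfIntegers.exponent
  rw [Ne, Ideal.absNorm_eq_zero_iff]
  intro h0
  have : d ∈ Ideal.under ℤ (conductor ℤ θ) := by
    rw [Ideal.mem_under] ; exact hmem
  rw [h0] at this
  exact hd0 (by simpa using this)

theorem exists_ringOfIntegers_minpoly_eq {F : Polynomial ℤ} (hF : Irreducible F)
    (hdeg : F.natDegree ≠ 0) :
    ∃ (K : Type) (_ : Field K) (_ : NumberField K) (θ : 𝓞 K),
      RingOfIntegers.exponent θ ≠ 0 ∧ minpoly ℤ θ = F.integralNormalization := by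
  have hF0 : F ≠ 0 := hF.ne_zero
  have hprim : F.IsPrimitive := hF.isPrimitive hdeg
  set Fq := F.map (Int.castRingHom ℚ) with hFq
  have hirr : Irreducible Fq := (Polynomial.IsPrimitive.Int.irreducible_iff_irreducible_map_cast hprim).mp hF
  have : Fact (Irreducible Fq) := ⟨hirr⟩
  let K := AdjoinRoot Fq
  have hK : NumberField K := by
    have h1 : FiniteDimensional ℚ K := (AdjoinRoot.powerBasis hirr.ne_zero).finite
    have h2 : CharZero K := algebraRat.charZero K
    exact ⟨⟩
  have hroot : Polynomial.aeval (AdjoinRoot.root Fq) F = 0 := by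
    have h := AdjoinRoot.eval₂_root Fq
    conv_lhs at h => arg 3; rw [hFq]
    rw [Polynomial.eval₂_map] at h
    rw [Polynomial.aeval_def, ← h]
    congr 1
  set t : K := algebraMap ℤ K F.leadingCoeff * AdjoinRoot.root Fq with ht
  have hf : Polynomial.aeval t F.integralNormalization = 0 := by
    apply Polynomial.integralNormalization_aeval_eq_zero hroot
    intro x hx; simpa using hx
  have htint : IsIntegral ℤ t := ⟨_, Polynomial.monic_integralNormalization hF0, hf⟩
  let θ : 𝓞 K := ⟨t, htint⟩
  have hlc : (algebraMap ℤ K F.leadingCoeff) ≠ 0 := by simpa using hF0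
  have hadj : Algebra.adjoin ℚ {(θ : K)} = ⊤ := by
    have htop : (⊤ : Subalgebra ℚ K) = Algebra.adjoin ℚ {AdjoinRoot.root Fq} :=
      (AdjoinRoot.adjoinRoot_eq_top (f := Fq)).symm
    rw [eq_top_iff, htop]
    apply Algebra.adjoin_le
    rintro _ rfl
    have h1 : AdjoinRoot.root Fq = algebraMap ℚ K (F.leadingCoeff : ℚ)⁻¹ * t := by
      rw [ht, ← mul_assoc]
      have : algebraMap ℚ K (F.leadingCoeff : ℚ)⁻¹ * algebraMap ℤ K F.leadingCoeff = 1 := by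
        rw [map_inv₀]
        simp only [map_intCast, eq_intCast]
        exact inv_mul_cancel₀ (by simpa using hF0)
      rw [this, one_mul]
    rw [h1]
    exact mul_mem (Subalgebra.algebraMap_mem _ _) (Algebra.subset_adjoin rfl)
  refine ⟨K, inferInstance, hK, θ, exponent_ne_zero_of_adjoin_eq_top θ hadj, ?_⟩
  have hmon := Polynomial.monic_integralNormalization hF0
  have hfθ : Polynomial.aeval θ F.integralNormalization = 0 := by
    have : algebraMap (𝓞 K) K (Polynomial.aeval θ F.integralNormalization) = 0 := by
      rw [← Polynomial.aeval_algebraMap_apply]; exact hf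
    exact (map_eq_zero_iff _ RingOfIntegers.coe_injective).mp this
  have hdvd : minpoly ℤ θ ∣ F.integralNormalization :=
    minpoly.isIntegrallyClosed_dvd θ.isIntegral hfθ
  refine (Polynomial.eq_of_monic_of_dvd_of_natDegree_le (minpoly.monic θ.isIntegral) hmon hdvd ?_).symm
  rw [Polynomial.natDegree_integralNormalization]
  have h1 : minpoly ℚ (θ : K) = (minpoly ℤ (θ : K)).map (algebraMap ℤ ℚ) :=
    minpoly.isIntegrallyClosed_eq_field_fractions' ℚ htint
  have h2 : minpoly ℤ (θ : K) = minpoly ℤ θ :=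
    minpoly.algebraMap_eq RingOfIntegers.coe_injective θ
  have h3 : (minpoly ℤ θ).natDegree = (minpoly ℚ (θ : K)).natDegree := by
    rw [h1, ← h2, Polynomial.natDegree_map_eq_of_injective]
    exact Int.cast_injective
  rw [h3]
  have h4 := PowerBasis.finrank (PowerBasis.ofAdjoinEqTop (K := ℚ)
    (Algebra.IsIntegral.isIntegral (θ : K)) hadj)
  have h5 : (PowerBasis.ofAdjoinEqTop (K := ℚ) (Algebra.IsIntegral.isIntegral (θ : K)) hadj).dim =
    (minpoly ℚ (θ : K)).natDegree := PowerBasis.ofAdjoinEqTop_dim _ _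
  rw [← h5, ← h4, PowerBasis.finrank (AdjoinRoot.powerBasis hirr.ne_zero), AdjoinRoot.powerBasis_dim, hFq,
    Polynomial.natDegree_map_eq_of_injective Int.cast_injective]

variable {K : Type*} [Field K] [NumberField K]

theorem idealCount_prime_eq_card_roots {θ : 𝓞 K} {p : ℕ} [hp : Fact p.Prime]
    (h : ¬ p ∣ RingOfIntegers.exponent θ) :
    idealCount K p =
      ((minpoly ℤ θ).map (Int.castRingHom (ZMod p))).roots.toFinset.card := by
  have hspan : (Ideal.span {(p : ℤ)}).IsMaximal := Int.ideal_span_isMaximal_of_prime p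
  have hnorm : ∀ P : Ideal.primesOver (Ideal.span {(p : ℤ)}) (𝓞 K),
      Ideal.absNorm P.1 = p ^ (P.1.inertiaDeg ℤ) := by
    intro P
    have h1 : P.1.LiesOver (Ideal.span {(p : ℤ)}) := P.2.2
    have h2 : P.1.IsMaximal := Ideal.primesOver.isMaximal P
    rw [Ideal.absNorm_eq_pow_inertiaDeg' P.1 hp.out, Ideal.inertiaDeg'_eq_inertiaDeg]
  set f := (minpoly ℤ θ).map (Int.castRingHom (ZMod p)) with hf
  have hf0 : f ≠ 0 := Polynomial.map_monic_ne_zero (minpoly.monic θ.isIntegral)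
  set E := Ideal.primesOverSpanEquivMonicFactorsMod h with hE
  have hdegE : ∀ P, (E P).1.natDegree = P.1.inertiaDeg ℤ := by
    intro P
    have := Ideal.inertiaDeg_primesOverSpanEquivMonicFactorsMod_symm_apply' h (E P).2
    rw [← this]
    simp [hE]
  have e1 : {I : Ideal (𝓞 K) // Ideal.absNorm I = p} ≃
      {P : Ideal.primesOver (Ideal.span {(p : ℤ)}) (𝓞 K) // P.1.inertiaDeg ℤ = 1} := by
    have hIp : ∀ I : {I : Ideal (𝓞 K) // Ideal.absNorm I = p}, I.1.IsPrime := fun I =>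
      Ideal.isPrime_of_irreducible_absNorm (by rw [I.2]; exact hp.out)
    have hIo : ∀ I : {I : Ideal (𝓞 K) // Ideal.absNorm I = p},
        I.1.LiesOver (Ideal.span {(p : ℤ)}) := by
      intro I
      refine ⟨?_⟩
      apply hspan.eq_of_le
      · rw [Ne, Ideal.comap_eq_top_iff]; exact (hIp I).ne_top
      · rw [Ideal.span_singleton_le_iff_mem, Ideal.mem_comap]
        have := Ideal.absNorm_mem I.1
        rw [I.2] at this
        simpa using this
    refine Equiv.ofBijective (fun I => ⟨⟨I.1, hIp I, hIo I⟩, ?_⟩) ⟨?_, ?_⟩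
    · have h1 := hnorm ⟨I.1, hIp I, hIo I⟩
      simp only [I.2] at h1
      exact (Nat.pow_right_injective hp.out.two_le (by simpa using h1)).symm
    · intro I J hIJ
      simpa [Subtype.ext_iff] using hIJ
    · rintro ⟨P, hP⟩
      exact ⟨⟨P.1, by rw [hnorm, hP, pow_one]⟩, rfl⟩
  have e2 : {P : Ideal.primesOver (Ideal.span {(p : ℤ)}) (𝓞 K) // P.1.inertiaDeg ℤ = 1} ≃
      {Q : RingOfIntegers.monicFactorsMod θ p // Q.1.natDegree = 1} :=
    E.subtypeEquiv (fun P => by rw [hdegE])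
  have hQ : ∀ Q : RingOfIntegers.monicFactorsMod θ p, Q.1.Monic := by
    intro Q
    have := Multiset.mem_toFinset.mp Q.2
    have h1 := normalize_normalized_factor _ this
    rw [← h1]
    exact Polynomial.monic_normalize (irreducible_of_normalized_factor _ this).ne_zero
  have e3 : {Q : RingOfIntegers.monicFactorsMod θ p // Q.1.natDegree = 1} ≃
      f.roots.toFinset := by
    symm
    refine Equiv.ofBijective (fun x => ⟨⟨Polynomial.X - Polynomial.C x.1, ?_⟩,
      Polynomial.natDegree_X_sub_C _⟩) ⟨?_, ?_⟩
    · rw [Multiset.mem_toFinset, Polynomial.mem_normalizedFactors_iff hf0]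
      refine ⟨Polynomial.irreducible_X_sub_C _, Polynomial.monic_X_sub_C _, ?_⟩
      rw [Polynomial.dvd_iff_isRoot]
      exact (Polynomial.mem_roots'.mp (Multiset.mem_toFinset.mp x.2)).2
    · intro x y hxy
      have h1 : (Polynomial.X - Polynomial.C x.1) = (Polynomial.X - Polynomial.C y.1) :=
        congrArg (fun z => z.1.1) hxy
      exact Subtype.ext (Polynomial.C_injective (sub_right_injective h1))
    · rintro ⟨Q, hQ1⟩
      have hm := hQ Q
      have hQX : Q.1 = Polynomial.X - Polynomial.C (- Q.1.coeff 0) := by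
        rw [Polynomial.C_neg, sub_neg_eq_add]
        exact hm.eq_X_add_C hQ1
      refine ⟨⟨- Q.1.coeff 0, ?_⟩, ?_⟩
      · rw [Multiset.mem_toFinset, Polynomial.mem_roots hf0, ← Polynomial.dvd_iff_isRoot, ← hQX]
        exact ((Polynomial.mem_normalizedFactors_iff hf0).mp (Multiset.mem_toFinset.mp Q.2)).2.2
      · ext1; ext1; exact hQX.symm
  unfold idealCount
  rw [Nat.card_congr ((e1.trans e2).trans e3), Nat.card_eq_fintype_card, Fintype.card_coe]

theorem card_roots_integralNormalization (F : Polynomial ℤ) (hF : 1 ≤ F.natDegree) {p : ℕ}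
    [hp : Fact p.Prime] (hlc : ¬ (p : ℤ) ∣ F.leadingCoeff) :
    (F.integralNormalization.map (Int.castRingHom (ZMod p))).roots.toFinset.card =
      rootCount F p := by
  have hF0 : F ≠ 0 := by rintro rfl; simp at hF
  have hl : (Int.castRingHom (ZMod p)) F.leadingCoeff ≠ 0 := by
    simpa [ZMod.intCast_zmod_eq_zero_iff_dvd] using
      (mt (ZMod.intCast_zmod_eq_zero_iff_dvd F.leadingCoeff p).mp hlc)
  have hf0 : F.integralNormalization.map (Int.castRingHom (ZMod p)) ≠ 0 :=
    Polynomial.map_monic_ne_zero (Polynomial.monic_integralNormalization hF0)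
  symm
  unfold rootCount rootsMod
  refine Finset.card_bij (fun n _ => (Int.castRingHom (ZMod p)) F.leadingCoeff * (n : ZMod p))
    ?_ ?_ ?_
  · intro n hn
    rw [mem_filter] at hn
    rw [Multiset.mem_toFinset, Polynomial.mem_roots hf0, Polynomial.IsRoot.def, Polynomial.eval_map,
      Polynomial.integralNormalization_eval₂_leadingCoeff_mul hF]
    have := (ZMod.intCast_zmod_eq_zero_iff_dvd _ p).mpr hn.2
    rw [← eq_intCast (Int.castRingHom (ZMod p)), ← Polynomial.eval₂_at_apply] at this
    simp at this
    simp [this]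
  · intro m hm n hn hmn
    have h1 := mul_left_cancel₀ hl hmn
    rw [mem_filter, mem_range] at hm hn
    rw [ZMod.natCast_eq_natCast_iff'] at h1
    rwa [Nat.mod_eq_of_lt hm.1, Nat.mod_eq_of_lt hn.1] at h1
  · intro b hb
    rw [Multiset.mem_toFinset, Polynomial.mem_roots hf0, Polynomial.IsRoot.def,
      Polynomial.eval_map] at hb
    have hbn : (Int.castRingHom (ZMod p)) F.leadingCoeff *
        (((b / (Int.castRingHom (ZMod p)) F.leadingCoeff).val : ℕ) : ZMod p) = b := by
      rw [ZMod.natCast_zmod_val]; field_simp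
    refine ⟨(b / (Int.castRingHom (ZMod p)) F.leadingCoeff).val, ?_, hbn⟩
    rw [mem_filter, mem_range]
    refine ⟨ZMod.val_lt _, ?_⟩
    rw [← hbn, Polynomial.integralNormalization_eval₂_leadingCoeff_mul hF] at hb
    have h2 := (mul_eq_zero.mp hb).resolve_left (pow_ne_zero _ hl)
    rw [← ZMod.intCast_zmod_eq_zero_iff_dvd, ← eq_intCast (Int.castRingHom (ZMod p)),
      ← Polynomial.eval₂_at_apply]
    rw [← h2]; simp

/-- The number of roots of `F` modulo `p` is the number of ideals of norm `p` in a suitable number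
field, for all large primes `p`. -/
theorem exists_idealCount_eq_rootCount {F : Polynomial ℤ} (hF : Irreducible F)
    (hdeg : F.natDegree ≠ 0) :
    ∃ (K : Type) (_ : Field K) (_ : NumberField K) (B : ℕ),
      ∀ p : ℕ, p.Prime → B < p → idealCount K p = rootCount F p := by
  obtain ⟨K, i1, i2, θ, hθ, hmin⟩ := exists_ringOfIntegers_minpoly_eq hF hdeg
  refine ⟨K, i1, i2, RingOfIntegers.exponent θ + F.leadingCoeff.natAbs, fun p hp hB => ?_⟩
  have : Fact p.Prime := ⟨hp⟩
  rw [idealCount_prime_eq_card_roots (θ := θ), hmin, card_roots_integralNormalization]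
  · omega
  · intro hd
    have := Int.le_of_dvd (by have : F.leadingCoeff ≠ 0 := by simpa using hF.ne_zero
                              omega) ((Int.dvd_natAbs).mpr hd)
    have h0 : F.leadingCoeff ≠ 0 := by simpa using hF.ne_zero
    omega
  · intro hd
    have := Nat.le_of_dvd (by omega) hd
    omega

end idealCountPrime

section idealCountEuler

open NumberField Filter Topology

variable (K : Type*) [Field K] [NumberField K]

/-- real term of the Dedekind zeta series -/
noncomputable def idealTerm (s : ℝ) (n : ℕ) : ℝ := idealCount K n * (n : ℝ) ^ (-s)

theorem idealTerm_nonneg (s : ℝ) (n : ℕ) : 0 ≤ idealTerm K s n := by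
  unfold idealTerm; positivity

theorem exists_summable_idealTerm :
    ∃ s₀ c C : ℝ, 1 < s₀ ∧ 0 < c ∧ 0 < C ∧ ∀ s : ℝ, 1 < s → s < s₀ →
      Summable (idealTerm K s) ∧ c ≤ (s - 1) * ∑' n, idealTerm K s n ∧
        (s - 1) * ∑' n, idealTerm K s n ≤ C := by
  have hκ := dedekindZeta_residue_pos K
  set κ := dedekindZeta_residue K with hκdef
  have h1 := (Metric.tendsto_nhds.mp (tendsto_sub_one_mul_dedekindZeta_nhdsGT K)) (κ / 2)
    (by positivity)
  obtain ⟨s₀, hs₀, hs⟩ := mem_nhdsGT_iff_exists_Ioo_subset.mp h1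
  refine ⟨s₀, κ / 2, 3 * κ / 2, hs₀, by positivity, by positivity, fun s h1s hs0 => ?_⟩
  have hd : dist (((s : ℂ) - 1) * dedekindZeta K s) (κ : ℂ) < κ / 2 := hs ⟨h1s, hs0⟩
  have hterm : ∀ n, LSeries.term
      (fun n ↦ ((Nat.card {I : Ideal (𝓞 K) // Ideal.absNorm I = n} : ℕ) : ℂ)) s n =
      ((idealTerm K s n : ℝ) : ℂ) := by
    intro n
    unfold idealTerm
    rcases eq_or_ne n 0 with rfl | hn
    · rw [LSeries.term_zero]
      rw [Nat.cast_zero, Real.zero_rpow (by linarith)]; simp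
    · rw [LSeries.term_of_ne_zero hn, rpow_neg (by positivity)]
      rw [Complex.ofReal_mul, Complex.ofReal_inv, Complex.ofReal_cpow (by positivity)]
      rw [div_eq_mul_inv]
      unfold idealCount
      norm_cast
  have hsum : LSeriesSummable
      (fun n ↦ ((Nat.card {I : Ideal (𝓞 K) // Ideal.absNorm I = n} : ℕ) : ℂ)) s := by
    by_contra hns
    have : dedekindZeta K s = 0 := LSeries.eq_zero_of_not_LSeriesSummable _ _ hns
    rw [this, mul_zero, dist_comm, dist_zero_right, Complex.norm_real, Real.norm_eq_abs,
      abs_of_pos hκ] at hd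
    linarith
  have hsum' : Summable (idealTerm K s) := by
    have : Summable (fun n => ((idealTerm K s n : ℝ) : ℂ)) := by
      refine Summable.congr (show Summable _ from hsum) (fun n => ?_)
      exact hterm n
    exact Complex.summable_ofReal.mp this
  refine ⟨hsum', ?_⟩
  have hz : dedekindZeta K s = ((∑' n, idealTerm K s n : ℝ) : ℂ) := by
    rw [Complex.ofReal_tsum]
    exact tsum_congr hterm
  rw [hz, ← Complex.ofReal_one, ← Complex.ofReal_sub, ← Complex.ofReal_mul, Complex.dist_eq,
    ← Complex.ofReal_sub, Complex.norm_real, Real.norm_eq_abs, abs_lt] at hd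
  constructor <;> linarith

theorem idealTerm_mul {s : ℝ} {m n : ℕ} (h : Nat.Coprime m n) :
    idealTerm K s (m * n) = idealTerm K s m * idealTerm K s n := by
  unfold idealTerm
  rw [idealCount_mul h]
  push_cast
  rw [Real.mul_rpow (by positivity) (by positivity)]
  ring

theorem log_one_add_sub_self_le {u : ℝ} (hu : 0 ≤ u) : |log (1 + u) - u| ≤ u ^ 2 := by
  have h1 := log_le_sub_one_of_pos (show 0 < 1 + u by linarith)
  have h2 := Real.one_sub_inv_le_log_of_pos (show 0 < 1 + u by linarith)
  have h3 : u - u ^ 2 ≤ 1 - (1 + u)⁻¹ := by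
    rw [← sub_nonneg]
    have : 1 - (1 + u)⁻¹ - (u - u ^ 2) = u ^ 3 / (1 + u) := by field_simp; ring
    rw [this]; positivity
  rw [abs_le]; constructor <;> nlinarith

theorem exists_log_tsum_idealTerm_prime :
    ∃ C : ℝ, 0 ≤ C ∧ ∀ s : ℝ, 1 < s → Summable (idealTerm K s) → ∀ p : ℕ, p.Prime →
      0 < ∑' e, idealTerm K s (p ^ e) ∧
      |log (∑' e, idealTerm K s (p ^ e)) - idealTerm K s p| ≤ C * (1 / (p : ℝ) ^ 2) := by
  set d := Module.finrank ℤ (𝓞 K) with hd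
  have hS : Summable (fun e : ℕ => ((e + 3 : ℕ) : ℝ) ^ d * (1 / 2 : ℝ) ^ e) := by
    have h1 := summable_pow_mul_geometric_of_norm_lt_one (R := ℝ) d (r := 1 / 2) (by norm_num)
    have h2 := (summable_nat_add_iff 3).mpr h1
    refine (h2.mul_left 8).congr (fun e => ?_)
    rw [pow_add]; ring
  set S := ∑' e : ℕ, ((e + 3 : ℕ) : ℝ) ^ d * (1 / 2 : ℝ) ^ e with hSdef
  have hS0 : 0 ≤ S := tsum_nonneg (fun e => by positivity)
  refine ⟨S + (2 ^ d + S) ^ 2, by positivity, fun s hs hsum p hp => ?_⟩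
  have hp2 : (2 : ℝ) ≤ p := by exact_mod_cast hp.two_le
  have hp0 : (0 : ℝ) < p := by linarith
  have hinj : Function.Injective (fun e : ℕ => p ^ e) := Nat.pow_right_injective hp.two_le
  have hsp : Summable (fun e => idealTerm K s (p ^ e)) := hsum.comp_injective hinj
  have hterm : ∀ e, idealTerm K s (p ^ e) ≤ ((e + 1 : ℕ) : ℝ) ^ d * (1 / p : ℝ) ^ e := by
    intro e
    unfold idealTerm
    have h1 : (idealCount K (p ^ e) : ℝ) ≤ ((e + 1 : ℕ) : ℝ) ^ d := by
      exact_mod_cast idealCount_prime_pow_le hp e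
    have h2 : ((p ^ e : ℕ) : ℝ) ^ (-s) ≤ (1 / p : ℝ) ^ e := by
      have h3 : (1 : ℝ) ≤ (p ^ e : ℕ) := by exact_mod_cast Nat.one_le_pow _ _ hp.pos
      calc ((p ^ e : ℕ) : ℝ) ^ (-s) ≤ ((p ^ e : ℕ) : ℝ) ^ (-1 : ℝ) :=
            rpow_le_rpow_of_exponent_le h3 (by linarith)
        _ = _ := by rw [rpow_neg_one]; push_cast; rw [one_div, inv_pow]
    exact mul_le_mul h1 h2 (by positivity) (by positivity)
  have ht0 : idealTerm K s (p ^ 0) = 1 := by simp [idealTerm, idealCount_one]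
  have hR := hsp.sum_add_tsum_nat_add 2
  rw [Finset.sum_range_succ, Finset.sum_range_one, ht0, pow_one] at hR
  set R := ∑' e, idealTerm K s (p ^ (e + 2)) with hRdef
  have hR0 : 0 ≤ R := tsum_nonneg (fun e => idealTerm_nonneg K s _)
  have hRle : R ≤ S * (1 / (p : ℝ) ^ 2) := by
    rw [hSdef, ← tsum_mul_right]
    refine Summable.tsum_le_tsum (fun e => ?_) ?_ (hS.mul_right _)
    · refine (hterm (e + 2)).trans ?_
      rw [pow_add (1 / (p : ℝ)) e 2, ← mul_assoc, one_div_pow (p : ℝ) 2]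
      have h1 : (1 / (p : ℝ)) ^ e ≤ (1 / 2) ^ e := by
        apply pow_le_pow_left₀ (by positivity)
        exact one_div_le_one_div_of_le (by norm_num) hp2
      have h2 : ((e + 2 + 1 : ℕ) : ℝ) = ((e + 3 : ℕ) : ℝ) := by norm_num [add_assoc]
      rw [h2]
      gcongr
    · exact hsp.comp_injective (add_left_injective 2)
  have ha0 : 0 ≤ idealTerm K s p := idealTerm_nonneg K s p
  have ha : idealTerm K s p ≤ 2 ^ d * (1 / p) := by
    have := hterm 1
    rw [pow_one, pow_one] at this
    norm_num at this ⊢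
    exact this
  rw [← hR, add_assoc]
  have hu : idealTerm K s p + R ≤ (2 ^ d + S) * (1 / p) := by
    have : (1 / (p : ℝ) ^ 2) ≤ 1 / p := by
      apply one_div_le_one_div_of_le hp0; nlinarith
    have := mul_le_mul_of_nonneg_left this hS0
    linarith
  refine ⟨by positivity, ?_⟩
  have h1 := log_one_add_sub_self_le (show 0 ≤ idealTerm K s p + R by positivity)
  have h2 : (idealTerm K s p + R) ^ 2 ≤ (2 ^ d + S) ^ 2 * (1 / (p : ℝ) ^ 2) := by
    have := pow_le_pow_left₀ (by positivity) hu 2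
    rwa [mul_pow, one_div_pow] at this
  rw [abs_le] at h1 ⊢
  constructor <;> linarith [h1.1, h1.2]

theorem exists_sum_idealTerm_primes :
    ∃ s₀ C : ℝ, 1 < s₀ ∧ ∀ s : ℝ, 1 < s → s < s₀ →
      Summable (fun p : Nat.Primes => idealTerm K s p) ∧
      |∑' p : Nat.Primes, idealTerm K s p - log (1 / (s - 1))| ≤ C := by
  obtain ⟨s₀, c, C, hs₀, hc, hC, H⟩ := exists_summable_idealTerm K
  obtain ⟨C', hC', H'⟩ := exists_log_tsum_idealTerm_prime K
  have hsq : Summable (fun p : Nat.Primes => C' * (1 / ((p : ℕ) : ℝ) ^ 2)) :=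
    ((Real.summable_one_div_nat_pow.mpr one_lt_two).comp_injective
      Subtype.val_injective).mul_left C'
  set Q := ∑' p : Nat.Primes, C' * (1 / ((p : ℕ) : ℝ) ^ 2) with hQ
  refine ⟨s₀, Q + |log c| + |log C|, hs₀, fun s h1 h2 => ?_⟩
  obtain ⟨hsum, hlo, hhi⟩ := H s h1 h2
  have hsp : Summable (fun p : Nat.Primes => idealTerm K s p) :=
    hsum.comp_injective Subtype.val_injective
  refine ⟨hsp, ?_⟩
  set P := ∑' n, idealTerm K s n with hP
  have hs1 : 0 < s - 1 := by linarith
  have hP0 : 0 < P := by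
    by_contra hcon
    have := mul_nonpos_of_nonneg_of_nonpos hs1.le (not_lt.mp hcon)
    linarith
  have heuler : HasProd (fun p : Nat.Primes ↦ ∑' e, idealTerm K s (p ^ e)) P := by
    refine EulerProduct.eulerProduct_hasProd (f := idealTerm K s) ?_
      (fun h => idealTerm_mul K h) ?_ ?_
    · simp [idealTerm, idealCount_one]
    · exact hsum.norm
    · unfold idealTerm
      rw [Nat.cast_zero (R := ℝ), Real.zero_rpow (by linarith), mul_zero]
  have hlog : HasSum (fun p : Nat.Primes ↦ log (∑' e, idealTerm K s (p ^ e)))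
      (log P) := by
    have h3 := (Real.continuousAt_log hP0.ne').tendsto.comp heuler
    refine h3.congr (fun T => ?_)
    simp only [Function.comp]
    rw [log_prod]
    intro p _
    exact (H' s h1 hsum p p.2).1.ne'
  have hdiff : |log P - ∑' p : Nat.Primes, idealTerm K s p| ≤ Q := by
    rw [← hlog.tsum_eq, ← hlog.summable.tsum_sub hsp]
    rw [← Real.norm_eq_abs]
    refine tsum_of_norm_bounded hsq.hasSum (fun p => ?_)
    rw [Real.norm_eq_abs]
    exact (H' s h1 hsum p p.2).2
  have hlogP : |log P - log (1 / (s - 1))| ≤ |log c| + |log C| := by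
    have e1 : log P - log (1 / (s - 1)) = log ((s - 1) * P) := by
      rw [log_mul hs1.ne' hP0.ne', one_div, log_inv]; ring
    rw [e1]
    have h3 := log_le_log hc hlo
    have h4 := log_le_log (lt_of_lt_of_le hc hlo) hhi
    rw [abs_le]
    constructor
    · linarith [neg_abs_le (log c), abs_nonneg (log C)]
    · linarith [le_abs_self (log C), abs_nonneg (log c)]
  rw [abs_le] at *
  constructor <;> linarith [hdiff.1, hdiff.2, hlogP.1, hlogP.2]

end idealCountEuler

section mertens

theorem sum_primes_le_tsum {f : Nat.Primes → ℝ} (hf : Summable f) (h : ∀ p, 0 ≤ f p)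
    (T : Finset Nat.Primes) : ∑ p ∈ T, f p ≤ ∑' p, f p :=
  hf.sum_le_tsum T (fun p _ => h p)

open NumberField

theorem sum_rpow_primesIoc_pow_le {x : ℝ} (hx : 2 ≤ x) (N : ℕ) :
    ∑ p ∈ primesIoc x (x ^ (N + 1)), (p : ℝ) ^ (-(1 + 1 / log x)) ≤
      ∑ n ∈ range N, 18 * (1 / 2 : ℝ) ^ n := by
  have hl : 0 < log x := log_pos (by linarith)
  induction N with
  | zero =>
    have : primesIoc x (x ^ (0 + 1)) = ∅ := by
      ext p
      simp only [mem_primesIoc, zero_add, pow_one, Finset.notMem_empty, iff_false, not_and]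
      intro _ h1 h2
      linarith
    rw [this]; simp
  | succ N ih =>
    have hsub : primesIoc x (x ^ (N + 1 + 1)) ⊆
        primesIoc x (x ^ (N + 1)) ∪ primesIoc (x ^ (N + 1)) (x ^ (N + 1 + 1)) := by
      intro p hp
      rw [mem_union, mem_primesIoc, mem_primesIoc]
      rw [mem_primesIoc] at hp
      by_cases h : (p : ℝ) ≤ x ^ (N + 1)
      · exact Or.inl ⟨hp.1, hp.2.1, h⟩
      · exact Or.inr ⟨hp.1, not_le.mp h, hp.2.2⟩
    have hx1 : 1 < x ^ (N + 1) := one_lt_pow₀ (by linarith) (by omega)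
    have hx2 : 2 ≤ x ^ (N + 1 + 1) := by
      calc (2 : ℝ) ≤ x := hx
        _ ≤ x ^ (N + 1 + 1) := le_self_pow₀ (by linarith) (by omega)
    have hblock : ∑ p ∈ primesIoc (x ^ (N + 1)) (x ^ (N + 1 + 1)),
        (p : ℝ) ^ (-(1 + 1 / log x)) ≤ 18 * (1 / 2 : ℝ) ^ N := by
      have h1 : ∀ p ∈ primesIoc (x ^ (N + 1)) (x ^ (N + 1 + 1)),
          (p : ℝ) ^ (-(1 + 1 / log x)) ≤ (1 / 2 : ℝ) ^ N * (1 / p) := by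
        intro p hp
        rw [mem_primesIoc] at hp
        have hp0 : (0 : ℝ) < p := by linarith [hp.2.1]
        rw [neg_add, rpow_add hp0, rpow_neg_one, mul_comm, one_div (p : ℝ)]
        apply mul_le_mul_of_nonneg_right _ (by positivity)
        rw [rpow_def_of_pos hp0]
        have h2 : ((N : ℝ) + 1) * log x ≤ log p := by
          have := log_le_log (by linarith) hp.2.1.le
          rwa [log_pow, Nat.cast_add, Nat.cast_one] at this
        have h3 : log p * -(1 / log x) ≤ -(N : ℝ) := by
          rw [mul_neg, neg_le_neg_iff, mul_one_div, le_div_iff₀ hl]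
          nlinarith
        calc exp (log p * -(1 / log x)) ≤ exp (-(N : ℝ)) :=
              exp_le_exp.mpr h3
          _ = (exp (-1)) ^ N := by rw [← exp_nat_mul]; ring_nf
          _ ≤ (1 / 2) ^ N := by
            apply pow_le_pow_left₀ (exp_pos _).le
            have := exp_neg_one_lt_d9
            linarith
      refine (sum_le_sum h1).trans ?_
      rw [← mul_sum, mul_comm]
      apply mul_le_mul_of_nonneg_right _ (by positivity)
      refine (sum_inv_primesIoc_le hx1 hx2).trans ?_
      rw [log_pow, log_pow, mul_div_mul_right _ _ hl.ne']
      have : ((N + 1 + 1 : ℕ) : ℝ) / ((N + 1 : ℕ) : ℝ) ≤ 2 := by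
        rw [div_le_iff₀ (by positivity)]; push_cast; nlinarith [(Nat.cast_nonneg N : (0 : ℝ) ≤ N)]
      linarith
    rw [Finset.sum_range_succ]
    refine (sum_le_sum_of_subset_of_nonneg hsub (fun _ _ _ => by positivity)).trans ?_
    refine (Finset.sum_union_inter (f := fun p : ℕ => (p : ℝ) ^ (-(1 + 1 / log x))) ▸
      le_add_of_nonneg_right (sum_nonneg fun _ _ => by positivity)).trans
      (add_le_add ih hblock)

theorem sum_rpow_primes_gt_le {x : ℝ} (hx : 2 ≤ x) (T : Finset ℕ)
    (hT : ∀ p ∈ T, p.Prime ∧ x < (p : ℝ)) :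
    ∑ p ∈ T, (p : ℝ) ^ (-(1 + 1 / log x)) ≤ 36 := by
  obtain ⟨N, hN⟩ := pow_unbounded_of_one_lt ((T.sup id : ℕ) : ℝ) (show 1 < x by linarith)
  have hsub : T ⊆ primesIoc x (x ^ (N + 1)) := by
    intro p hp
    rw [mem_primesIoc]
    refine ⟨(hT p hp).1, (hT p hp).2, ?_⟩
    have h1 : (p : ℝ) ≤ ((T.sup id : ℕ) : ℝ) := by
      exact_mod_cast Finset.le_sup (f := id) hp
    have h2 : x ^ N ≤ x ^ (N + 1) := pow_le_pow_right₀ (by linarith) (by omega)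
    linarith
  refine (sum_le_sum_of_subset_of_nonneg hsub (fun _ _ _ => by positivity)).trans ?_
  refine (sum_rpow_primesIoc_pow_le hx N).trans ?_
  rw [← mul_sum]
  have := sum_geometric_two_le N
  linarith

theorem sum_one_div_sub_rpow_primesIoc_le {x : ℝ} (hx : 2 ≤ x) :
    ∑ p ∈ primesIoc 0 x, (1 / (p : ℝ) - (p : ℝ) ^ (-(1 + 1 / log x))) ≤ 9 := by
  have hl : 0 < log x := log_pos (by linarith)
  have h1 : ∀ p ∈ primesIoc 0 x, (1 / (p : ℝ) - (p : ℝ) ^ (-(1 + 1 / log x))) ≤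
      (log p / p) * (1 / log x) := by
    intro p hp
    rw [mem_primesIoc] at hp
    have hp0 : (0 : ℝ) < p := hp.2.1
    rw [neg_add, rpow_add hp0, rpow_neg_one, rpow_def_of_pos hp0]
    have := add_one_le_exp (log p * -(1 / log x))
    have h2 : (p : ℝ)⁻¹ * (1 - exp (log p * -(1 / log x))) ≤
        (p : ℝ)⁻¹ * (log p * (1 / log x)) :=
      mul_le_mul_of_nonneg_left (by linarith) (by positivity)
    have e : log p / p * (1 / log x) = (p : ℝ)⁻¹ * (log p * (1 / log x)) := by
      rw [div_eq_mul_inv]; ring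
    rw [e, one_div (p : ℝ)]
    linarith [h2]
  refine (sum_le_sum h1).trans ?_
  rw [← sum_mul, mul_one_div, div_le_iff₀ hl]
  exact sum_log_div_primesIoc_le le_rfl hx

theorem exists_sum_idealCount_div_sub_loglog_le (K : Type*) [Field K] [NumberField K] :
    ∃ C : ℝ, ∀ x : ℝ, 2 ≤ x →
      |∑ p ∈ primesIoc 0 x, (idealCount K p : ℝ) / p - log (log x)| ≤ C := by
  obtain ⟨s₀, C₀, hs₀, H⟩ := exists_sum_idealTerm_primes K
  set D : ℝ := 2 ^ Module.finrank ℤ (𝓞 K) with hD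
  have hD0 : 0 ≤ D := by positivity
  have hbd : ∀ p : ℕ, p.Prime → (idealCount K p : ℝ) ≤ D := by
    intro p hp
    have := idealCount_prime_pow_le (K := K) hp 1
    rw [pow_one] at this
    rw [hD]; exact_mod_cast this
  have hmain : ∀ x : ℝ, 2 ≤ x → 1 + 1 / log x < s₀ →
      |∑ p ∈ primesIoc 0 x, (idealCount K p : ℝ) / p - log (log x)| ≤ C₀ + 36 * D + 9 * D := by
    intro x hx hxs
    have hl : 0 < log x := log_pos (by linarith)
    obtain ⟨hsum, hC⟩ := H (1 + 1 / log x) (by simp [hl]) hxs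
    set s := 1 + 1 / log x with hs
    have e1 : 1 / (s - 1) = log x := by rw [hs]; simp
    rw [e1] at hC
    set A := ∑ p ∈ primesIoc 0 x, idealTerm K s p with hA
    have hAle : A ≤ ∑' p : Nat.Primes, idealTerm K s p := by
      have : ∑ p ∈ ((primesIoc 0 x).subtype Nat.Prime : Finset Nat.Primes), idealTerm K s (p : ℕ) ≤
          ∑' p : Nat.Primes, idealTerm K s (p : ℕ) :=
        sum_primes_le_tsum hsum (fun p => idealTerm_nonneg K s p) _
      rwa [Finset.sum_subtype_of_mem (idealTerm K s)
        (fun p hp => (mem_primesIoc.mp hp).1)] at this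
    have hleA : ∑' p : Nat.Primes, idealTerm K s p ≤ A + 36 * D := by
      refine Real.tsum_le_of_sum_le (fun p => idealTerm_nonneg K s p) (fun T => ?_)
      set T' : Finset ℕ := T.map (⟨fun p : Nat.Primes => (p : ℕ), Subtype.val_injective⟩ :
        Nat.Primes ↪ ℕ) with hT'
      have eT : ∑ p ∈ T, idealTerm K s (p : ℕ) = ∑ p ∈ T', idealTerm K s p := by
        rw [hT', Finset.sum_map]; rfl
      rw [eT]
      have hT'p : ∀ p ∈ T', p.Prime := by
        intro p hp
        rw [hT', Finset.mem_map] at hp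
        obtain ⟨q, _, rfl⟩ := hp
        exact q.2
      rw [← Finset.sum_filter_add_sum_filter_not T' (fun p => (p : ℝ) ≤ x)]
      apply add_le_add
      · apply sum_le_sum_of_subset_of_nonneg
        · intro p hp
          rw [mem_filter] at hp
          rw [mem_primesIoc]
          exact ⟨hT'p p hp.1, by exact_mod_cast (hT'p p hp.1).pos, hp.2⟩
        · intro _ _ _; exact idealTerm_nonneg K s _
      · have h3 := sum_rpow_primes_gt_le hx (T'.filter (fun p => ¬ (p : ℝ) ≤ x)) (fun p hp => by
          rw [mem_filter] at hp
          exact ⟨hT'p p hp.1, not_le.mp hp.2⟩)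
        calc _ ≤ ∑ p ∈ T'.filter (fun p : ℕ => ¬ (p : ℝ) ≤ x), (p : ℝ) ^ (-s) * D := by
              apply sum_le_sum
              intro p hp
              rw [mem_filter] at hp
              unfold idealTerm
              rw [mul_comm]
              exact mul_le_mul_of_nonneg_left (hbd p (hT'p p hp.1)) (by positivity)
          _ ≤ _ := by
              rw [← sum_mul]
              exact mul_le_mul_of_nonneg_right h3 hD0
    have hB : |∑ p ∈ primesIoc 0 x, (idealCount K p : ℝ) / p - A| ≤ 9 * D := by
      rw [hA, ← sum_sub_distrib]
      have hnn : ∀ p ∈ primesIoc 0 x, 0 ≤ 1 / (p : ℝ) - (p : ℝ) ^ (-s) := by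
        intro p hp
        rw [mem_primesIoc] at hp
        rw [sub_nonneg, one_div, ← rpow_neg_one]
        apply rpow_le_rpow_of_exponent_le
        · exact_mod_cast hp.1.one_lt.le
        · rw [hs]; simp [hl.le]
      rw [abs_of_nonneg]
      · calc _ ≤ ∑ p ∈ primesIoc 0 x, (1 / (p : ℝ) - (p : ℝ) ^ (-s)) * D := by
              apply sum_le_sum
              intro p hp
              have := mul_le_mul_of_nonneg_left (hbd p (mem_primesIoc.mp hp).1) (hnn p hp)
              unfold idealTerm
              refine le_of_eq_of_le ?_ this
              ring
          _ ≤ _ := by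
              rw [← sum_mul]
              exact mul_le_mul_of_nonneg_right (sum_one_div_sub_rpow_primesIoc_le hx) hD0
      · apply sum_nonneg
        intro p hp
        have := mul_nonneg (Nat.cast_nonneg (α := ℝ) (idealCount K p)) (hnn p hp)
        unfold idealTerm
        refine this.trans_eq ?_
        ring
    rw [abs_le] at *
    constructor <;> linarith [hB.1, hB.2, hC.1, hC.2]
  set x₁ : ℝ := max 2 (exp (2 / (s₀ - 1))) with hx₁
  have hs₁ : 0 < s₀ - 1 := by linarith
  set S := ∑ p ∈ primesIoc 0 x₁, (idealCount K p : ℝ) / p with hS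
  refine ⟨max (C₀ + 36 * D + 9 * D) (S + |log (log 2)| + |log (log x₁)|),
    fun x hx => ?_⟩
  by_cases hxx : x < x₁
  · refine le_max_of_le_right ?_
    have h1 : 0 ≤ ∑ p ∈ primesIoc 0 x, (idealCount K p : ℝ) / p :=
      sum_nonneg fun _ _ => by positivity
    have h2 : ∑ p ∈ primesIoc 0 x, (idealCount K p : ℝ) / p ≤ S :=
      sum_le_sum_of_subset_of_nonneg (primesIoc_subset le_rfl hxx.le)
        (fun _ _ _ => by positivity)
    have h3 : log (log 2) ≤ log (log x) :=
      log_le_log (log_pos one_lt_two) (log_le_log two_pos hx)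
    have h4 : log (log x) ≤ log (log x₁) :=
      log_le_log (log_pos (by linarith)) (log_le_log (by linarith) hxx.le)
    rw [abs_le]
    constructor
    · linarith [le_abs_self (log (log x₁)), abs_nonneg (log (log 2))]
    · linarith [neg_abs_le (log (log 2)), abs_nonneg (log (log x₁))]
  · refine le_max_of_le_left (hmain x hx ?_)
    have h1 : exp (2 / (s₀ - 1)) ≤ x := (le_max_right _ _).trans (not_lt.mp hxx)
    have h2 : 2 / (s₀ - 1) ≤ log x := by
      have := log_le_log (exp_pos _) h1
      rwa [log_exp] at this
    have h3 : 0 < 2 / (s₀ - 1) := by positivity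
    have h4 : 1 / log x ≤ (s₀ - 1) / 2 := by
      rw [div_le_iff₀ (by linarith)]
      rw [div_le_iff₀ hs₁] at h2
      linarith
    linarith

/-- Mertens' theorem for the number of roots of an irreducible polynomial. -/
theorem exists_sum_rootCount_div_sub_loglog_le {F : Polynomial ℤ} (hF : Irreducible F)
    (hdeg : F.natDegree ≠ 0) :
    ∃ C : ℝ, ∀ x : ℝ, 2 ≤ x →
      |∑ p ∈ primesIoc 0 x, (rootCount F p : ℝ) / p - log (log x)| ≤ C := by
  obtain ⟨K, _, _, B, hB⟩ := exists_idealCount_eq_rootCount hF hdeg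
  obtain ⟨C, hC⟩ := exists_sum_idealCount_div_sub_loglog_le K
  set S := ∑ p ∈ primesIoc 0 B, |(rootCount F p : ℝ) / p - (idealCount K p : ℝ) / p| with hS
  refine ⟨C + S, fun x hx => ?_⟩
  have h1 : |∑ p ∈ primesIoc 0 x, (rootCount F p : ℝ) / p -
      ∑ p ∈ primesIoc 0 x, (idealCount K p : ℝ) / p| ≤ S := by
    rw [← sum_sub_distrib]
    refine (Finset.abs_sum_le_sum_abs _ _).trans ?_
    have h2 : ∀ p ∈ primesIoc 0 x, p ∉ (primesIoc 0 x).filter (fun p => p ≤ B) →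
        |(rootCount F p : ℝ) / p - (idealCount K p : ℝ) / p| = 0 := by
      intro p hp hpB
      have hpp := (mem_primesIoc.mp hp).1
      rw [mem_filter, not_and] at hpB
      rw [hB p hpp (not_le.mp (hpB hp)), sub_self, abs_zero]
    rw [← Finset.sum_subset (filter_subset _ _) h2]
    apply sum_le_sum_of_subset_of_nonneg
    · intro p hp
      rw [mem_filter, mem_primesIoc] at hp
      rw [mem_primesIoc]
      exact ⟨hp.1.1, hp.1.2.1, by exact_mod_cast hp.2⟩
    · intro _ _ _; positivity
  have h3 := hC x hx
  rw [abs_le] at *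
  constructor <;> linarith [h1.1, h1.2, h3.1, h3.2]

theorem rootCount_le_natDegree {F : Polynomial ℤ} (hF : F.natDegree ≠ 0) {p : ℕ} (hp : p.Prime)
    (hlc : ¬ (p : ℤ) ∣ F.leadingCoeff) : rootCount F p ≤ F.natDegree := by
  have : Fact p.Prime := ⟨hp⟩
  rw [← card_roots_integralNormalization F (Nat.one_le_iff_ne_zero.mpr hF) hlc]
  refine (Multiset.toFinset_card_le _).trans ((Polynomial.card_roots' _).trans ?_)
  refine Polynomial.natDegree_map_le.trans ?_
  rw [Polynomial.natDegree_integralNormalization]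

end mertens

section sieve

/-- The sum over subsets `s` of `P` of `a (#s) * ∏ p ∈ s, t p`. -/
noncomputable def cardWeightedSum (a : ℕ → ℝ) (P : Finset ℕ) (t : ℕ → ℝ) : ℝ :=
  ∑ s ∈ P.powerset, a s.card * ∏ p ∈ s, t p

theorem cardWeightedSum_empty (a : ℕ → ℝ) (t : ℕ → ℝ) : cardWeightedSum a ∅ t = a 0 := by
  simp [cardWeightedSum]

theorem cardWeightedSum_insert (a : ℕ → ℝ) {P : Finset ℕ} {p : ℕ} (hp : p ∉ P) (t : ℕ → ℝ) :
    cardWeightedSum a (insert p P) t =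
      cardWeightedSum a P t + t p * cardWeightedSum (fun n => a (n + 1)) P t := by
  unfold cardWeightedSum
  rw [Finset.sum_powerset_insert hp, mul_sum]
  congr 1
  refine sum_congr rfl (fun s hs => ?_)
  have hps : p ∉ s := fun h => hp (mem_powerset.mp hs h)
  rw [Finset.card_insert_of_notMem hps, prod_insert hps]
  ring

/-- Coefficients of the truncated alternating sum. -/
def altCoeff (k n : ℕ) : ℝ := if n < k then (-1) ^ n else 0

/-- Coefficients picking out the subsets of size `k`. -/
def diagCoeff (k n : ℕ) : ℝ := if n = k then 1 else 0

/-- Coefficients picking out the subsets of size at most `k`. -/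
def leCoeff (k n : ℕ) : ℝ := if n ≤ k then 1 else 0

theorem cardWeightedSum_zero (P : Finset ℕ) (t : ℕ → ℝ) :
    cardWeightedSum (fun _ => 0) P t = 0 := by
  simp [cardWeightedSum]

theorem cardWeightedSum_neg (a : ℕ → ℝ) (P : Finset ℕ) (t : ℕ → ℝ) :
    cardWeightedSum (fun n => -a n) P t = -cardWeightedSum a P t := by
  simp [cardWeightedSum]

theorem altCoeff_zero : altCoeff 0 = fun _ => 0 := by
  funext n; simp [altCoeff]

theorem altCoeff_succ (k : ℕ) : (fun n => altCoeff (k + 1) (n + 1)) = fun n => -altCoeff k n := by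
  funext n
  by_cases h : n < k <;> simp [altCoeff, h, pow_succ]

theorem diagCoeff_succ (k : ℕ) : (fun n => diagCoeff (k + 1) (n + 1)) = diagCoeff k := by
  funext n; simp [diagCoeff]

theorem diagCoeff_zero_succ : (fun n => diagCoeff 0 (n + 1)) = fun _ => 0 := by
  funext n; simp [diagCoeff]

theorem leCoeff_succ (k : ℕ) : (fun n => leCoeff (k + 1) (n + 1)) = leCoeff k := by
  funext n; simp [leCoeff]

theorem leCoeff_zero_succ : (fun n => leCoeff 0 (n + 1)) = fun _ => 0 := by
  funext n; simp [leCoeff]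

theorem cardWeightedSum_diag_zero (P : Finset ℕ) (t : ℕ → ℝ) :
    cardWeightedSum (diagCoeff 0) P t = 1 := by
  induction P using Finset.induction_on with
  | empty => simp [cardWeightedSum_empty, diagCoeff]
  | insert p P hp ih =>
    rw [cardWeightedSum_insert _ hp, ih, diagCoeff_zero_succ, cardWeightedSum_zero]; simp

theorem alternating_bounds (P : Finset ℕ) (t : ℕ → ℝ) (h0 : ∀ p ∈ P, 0 ≤ t p)
    (h1 : ∀ p ∈ P, t p ≤ 1) (k : ℕ) :
    0 ≤ (-1) ^ k * (∏ p ∈ P, (1 - t p) - cardWeightedSum (altCoeff k) P t) ∧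
    (-1) ^ k * (∏ p ∈ P, (1 - t p) - cardWeightedSum (altCoeff k) P t) ≤
      cardWeightedSum (diagCoeff k) P t := by
  induction P using Finset.induction_on generalizing k with
  | empty =>
    rcases k with _ | k
    · simp [cardWeightedSum_empty, altCoeff, diagCoeff]
    · simp [cardWeightedSum_empty, altCoeff, diagCoeff]
  | insert p P hp ih =>
    have ih' := ih (fun q hq => h0 q (mem_insert_of_mem hq))
      (fun q hq => h1 q (mem_insert_of_mem hq))
    have hp0 := h0 p (mem_insert_self _ _)
    have hp1 := h1 p (mem_insert_self _ _)
    rcases k with _ | k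
    · rw [cardWeightedSum_diag_zero, altCoeff_zero, cardWeightedSum_zero]
      simp only [pow_zero, sub_zero, one_mul]
      exact ⟨prod_nonneg (fun q hq => by linarith [h1 q hq]),
        Finset.prod_le_one (fun q hq => by linarith [h1 q hq]) (fun q hq => by linarith [h0 q hq])⟩
    · rw [prod_insert hp, cardWeightedSum_insert _ hp, cardWeightedSum_insert _ hp,
        altCoeff_succ, diagCoeff_succ, cardWeightedSum_neg]
      set V := ∏ q ∈ P, (1 - t q)
      set T := cardWeightedSum (altCoeff k) P t
      set T' := cardWeightedSum (altCoeff (k + 1)) P t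
      have e : (-1 : ℝ) ^ (k + 1) * ((1 - t p) * V - (T' + t p * -T)) =
          (-1) ^ (k + 1) * (V - T') + t p * ((-1) ^ k * (V - T)) := by ring
      rw [e]
      exact ⟨add_nonneg (ih' (k + 1)).1 (mul_nonneg hp0 (ih' k).1),
        add_le_add (ih' (k + 1)).2 (mul_le_mul_of_nonneg_left (ih' k).2 hp0)⟩

theorem cardWeightedSum_diag_nonneg (P : Finset ℕ) (t : ℕ → ℝ) (h0 : ∀ p ∈ P, 0 ≤ t p) (k : ℕ) :
    0 ≤ cardWeightedSum (diagCoeff k) P t := by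
  refine sum_nonneg (fun s hs => mul_nonneg ?_ (prod_nonneg
    (fun p hp => h0 p (mem_powerset.mp hs hp))))
  unfold diagCoeff; split_ifs <;> norm_num

theorem cardWeightedSum_diag_le (P : Finset ℕ) (t : ℕ → ℝ) (h0 : ∀ p ∈ P, 0 ≤ t p) (k : ℕ) :
    cardWeightedSum (diagCoeff k) P t ≤ (∑ p ∈ P, t p) ^ k / k.factorial := by
  induction P using Finset.induction_on generalizing k with
  | empty =>
    rcases k with _ | k <;> simp [cardWeightedSum_empty, diagCoeff]
  | insert p P hp ih =>
    have ih' := ih (fun q hq => h0 q (mem_insert_of_mem hq))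
    have hp0 := h0 p (mem_insert_self _ _)
    have hS : 0 ≤ ∑ q ∈ P, t q := sum_nonneg (fun q hq => h0 q (mem_insert_of_mem hq))
    rcases k with _ | k
    · rw [cardWeightedSum_diag_zero]; simp
    · rw [cardWeightedSum_insert _ hp, diagCoeff_succ, sum_insert hp]
      have : (∑ q ∈ P, t q) ^ (k + 1) + (k + 1) * (t p * (∑ q ∈ P, t q) ^ k) ≤
          (∑ q ∈ P, t q + t p) ^ (k + 1) := by
        have := pow_add_mul_le_add_pow hS (by linarith : 0 ≤ 2 * ∑ q ∈ P, t q + t p) (k + 1)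
        push_cast at this
        simpa [mul_comm, mul_left_comm, mul_assoc] using this
      calc _ ≤ (∑ q ∈ P, t q) ^ (k + 1) / (k + 1).factorial +
            t p * ((∑ q ∈ P, t q) ^ k / k.factorial) :=
            add_le_add (ih' (k + 1)) (mul_le_mul_of_nonneg_left (ih' k) hp0)
        _ = ((∑ q ∈ P, t q) ^ (k + 1) + (k + 1) * (t p * (∑ q ∈ P, t q) ^ k)) /
            (k + 1).factorial := by
            rw [Nat.factorial_succ]; push_cast
            have : (k.factorial : ℝ) ≠ 0 := by positivity
            field_simp
        _ ≤ _ := by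
            rw [add_comm (t p)]
            exact div_le_div_of_nonneg_right this (by positivity)

theorem cardWeightedSum_le_le (P : Finset ℕ) (t : ℕ → ℝ) (h0 : ∀ p ∈ P, 0 ≤ t p) (k : ℕ) :
    cardWeightedSum (leCoeff k) P t ≤ (1 + ∑ p ∈ P, t p) ^ k := by
  induction P using Finset.induction_on generalizing k with
  | empty => simp [cardWeightedSum_empty, leCoeff]
  | insert p P hp ih =>
    have ih' := ih (fun q hq => h0 q (mem_insert_of_mem hq))
    have hp0 := h0 p (mem_insert_self _ _)
    have hS : 0 ≤ ∑ q ∈ P, t q := sum_nonneg (fun q hq => h0 q (mem_insert_of_mem hq))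
    rcases k with _ | k
    · rw [cardWeightedSum_insert _ hp, leCoeff_zero_succ, cardWeightedSum_zero]
      simpa using ih' 0
    · rw [cardWeightedSum_insert _ hp, leCoeff_succ, sum_insert hp]
      set S := ∑ q ∈ P, t q
      calc _ ≤ (1 + S) ^ (k + 1) + t p * (1 + S) ^ k :=
            add_le_add (ih' (k + 1)) (mul_le_mul_of_nonneg_left (ih' k) hp0)
        _ = (1 + S) ^ k * (1 + (t p + S)) := by ring
        _ ≤ (1 + (t p + S)) ^ k * (1 + (t p + S)) := by
            refine mul_le_mul_of_nonneg_right (pow_le_pow_left₀ (by positivity) (by linarith) k)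
              (by positivity)
        _ = _ := by rw [pow_succ]

theorem cardWeightedSum_abs_le {a b : ℕ → ℝ} (hab : ∀ n, |a n| ≤ b n) (P : Finset ℕ) (t : ℕ → ℝ)
    (h0 : ∀ p ∈ P, 0 ≤ t p) :
    cardWeightedSum (fun n => |a n|) P t ≤ cardWeightedSum b P t :=
  sum_le_sum (fun _ hs => mul_le_mul_of_nonneg_right (hab _) (prod_nonneg
    (fun p hp => h0 p (mem_powerset.mp hs hp))))

theorem prod_sub_prod_le {ι : Type*} [DecidableEq ι] (s : Finset ι) (x y : ι → ℝ) (hx : ∀ i ∈ s, 0 ≤ x i)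
    (hxy : ∀ i ∈ s, x i ≤ y i) :
    ∏ i ∈ s, y i - ∏ i ∈ s, x i ≤ ∑ l ∈ s, (y l - x l) * ∏ i ∈ s.erase l, y i := by
  induction s using Finset.induction_on with
  | empty => simp
  | insert a s ha ih =>
    have ih' := ih (fun i hi => hx i (mem_insert_of_mem hi))
      (fun i hi => hxy i (mem_insert_of_mem hi))
    have hxa := hx a (mem_insert_self _ _)
    have hya := hxy a (mem_insert_self _ _)
    have hle : ∏ i ∈ s, x i ≤ ∏ i ∈ s, y i :=
      prod_le_prod (fun i hi => hx i (mem_insert_of_mem hi))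
        (fun i hi => hxy i (mem_insert_of_mem hi))
    rw [prod_insert ha, prod_insert ha, sum_insert ha, Finset.erase_insert ha]
    have e : ∑ l ∈ s, (y l - x l) * ∏ i ∈ (insert a s).erase l, y i =
        y a * ∑ l ∈ s, (y l - x l) * ∏ i ∈ s.erase l, y i := by
      rw [mul_sum]
      refine sum_congr rfl (fun l hl => ?_)
      have hla : a ≠ l := fun h => ha (h ▸ hl)
      rw [Finset.erase_insert_of_ne hla, prod_insert
        (fun h => ha (Finset.mem_of_mem_erase h))]
      ring
    rw [e]
    have h1 := mul_le_mul_of_nonneg_left ih' (hxa.trans hya)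
    have h2 := mul_le_mul_of_nonneg_left hle (sub_nonneg.mpr hya)
    nlinarith

theorem card_filter_range_mul_of_coprime {d p : ℕ} (hd : d ≠ 0) (hp : p ≠ 0)
    (hdp : Nat.Coprime d p) {A B : ℕ → Prop} (hA : ∀ m, A (m % d) ↔ A m)
    (hB : ∀ m, B (m % p) ↔ B m) :
    ((range (d * p)).filter (fun m => A m ∧ B m)).card =
      ((range d).filter A).card * ((range p).filter B).card := by
  rw [← Finset.card_product]
  refine Finset.card_nbij' (fun m => (m % d, m % p))
    (fun x => (Nat.chineseRemainder hdp x.1 x.2 : ℕ)) ?_ ?_ ?_ ?_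
  · intro m hm
    simp only [coe_filter, mem_range, Set.mem_ofPred_eq] at hm
    simp only [Finset.coe_product, coe_filter, mem_range, Set.mem_prod,
      Set.mem_ofPred_eq, hA, hB]
    exact ⟨⟨Nat.mod_lt _ (Nat.pos_of_ne_zero hd), hm.2.1⟩,
      Nat.mod_lt _ (Nat.pos_of_ne_zero hp), hm.2.2⟩
  · intro x hx
    simp only [Finset.coe_product, coe_filter, mem_range, Set.mem_prod,
      Set.mem_ofPred_eq] at hx
    have h := (Nat.chineseRemainder hdp x.1 x.2).2
    simp only [coe_filter, mem_range, Set.mem_ofPred_eq]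
    refine ⟨Nat.chineseRemainder_lt_mul hdp _ _ hd hp, ?_, ?_⟩
    · rw [← hA, h.1, hA]; exact hx.1.2
    · rw [← hB, h.2, hB]; exact hx.2.2
  · intro m hm
    simp only [coe_filter, mem_range, Set.mem_ofPred_eq] at hm
    have h := (Nat.chineseRemainder hdp (m % d) (m % p)).2
    have h' : (Nat.chineseRemainder hdp (m % d) (m % p) : ℕ) ≡ m [MOD d * p] :=
      (Nat.modEq_and_modEq_iff_modEq_mul hdp).mp
        ⟨h.1.trans (Nat.mod_modEq _ _), h.2.trans (Nat.mod_modEq _ _)⟩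
    exact Nat.ModEq.eq_of_lt_of_lt h' (Nat.chineseRemainder_lt_mul hdp _ _ hd hp) hm.1
  · intro x hx
    simp only [Finset.coe_product, coe_filter, mem_range, Set.mem_prod,
      Set.mem_ofPred_eq] at hx
    have h := (Nat.chineseRemainder hdp x.1 x.2).2
    exact Prod.ext (Eq.trans h.1 (Nat.mod_eq_of_lt hx.1.1)) (Eq.trans h.2 (Nat.mod_eq_of_lt hx.2.1))

/-- The number of residues modulo `p` satisfying `bad p`. -/
noncomputable def classCount (bad : ℕ → ℕ → Prop) (p : ℕ) : ℕ :=
  ((range p).filter (bad p)).card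

theorem card_filter_range_prod_primes {bad : ℕ → ℕ → Prop} (S : Finset ℕ)
    (hS : ∀ p ∈ S, p.Prime) (hbad : ∀ p ∈ S, ∀ m, bad p (m % p) ↔ bad p m) :
    ((range (∏ p ∈ S, p)).filter (fun m => ∀ p ∈ S, bad p m)).card =
      ∏ p ∈ S, classCount bad p := by
  induction S using Finset.induction_on with
  | empty => simp
  | insert p S hp ih =>
    have hS' : ∀ q ∈ S, q.Prime := fun q hq => hS q (mem_insert_of_mem hq)
    have hpp := hS p (mem_insert_self _ _)
    have hbad' : ∀ q ∈ S, ∀ m, bad q (m % q) ↔ bad q m :=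
      fun q hq => hbad q (mem_insert_of_mem hq)
    have hco : Nat.Coprime p (∏ q ∈ S, q) := by
      refine Nat.Coprime.prod_right (fun q hq => ?_)
      exact (Nat.coprime_primes hpp (hS' q hq)).mpr (fun h => hp (h ▸ hq))
    rw [prod_insert hp, prod_insert hp, ← ih hS' hbad']
    unfold classCount
    obtain ⟨Q, hQ⟩ : ∃ Q : ℕ → Prop, ∀ m, Q m ↔ ∀ q ∈ S, bad q m := ⟨_, fun _ => Iff.rfl⟩
    have h := card_filter_range_mul_of_coprime hpp.ne_zero
      (Finset.prod_ne_zero_iff.mpr (fun q hq => (hS' q hq).ne_zero)) hco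
      (hbad p (mem_insert_self _ _)) (B := Q) (fun m => by
        rw [hQ, hQ]
        refine forall₂_congr (fun q hq => ?_)
        rw [← hbad' q hq, ← hbad' q hq m, Nat.mod_mod_of_dvd _ (Finset.dvd_prod_of_mem _ hq)])
    calc _ = ((range (p * ∏ q ∈ S, q)).filter (fun m => bad p m ∧ Q m)).card := by
            congr 1; ext m; simp [hQ]
      _ = _ := h
      _ = _ := by congr 2; ext m; simp [hQ]

theorem abs_card_filter_Ico_sub_le {d : ℕ} (hd : 0 < d) {Q : ℕ → Prop}
    (hQ : ∀ m, Q (m % d) ↔ Q m) (M N : ℕ) :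
    |(((Ico M (M + N)).filter Q).card : ℝ) -
        N * ((((range d).filter Q).card : ℝ) / d)| ≤ ((range d).filter Q).card := by
  set R := ((range d).filter Q).card with hR
  have hper : Function.Periodic Q d := fun m => by
    apply propext
    rw [← hQ, Nat.add_mod_right, hQ]
  have hfull : ∀ M, ((Ico M (M + d)).filter Q).card = R := by
    intro M
    rw [Nat.filter_Ico_card_eq_of_periodic M d Q hper, Nat.count_eq_card_filter_range]
  have hmul : ∀ q, ((Ico M (M + d * q)).filter Q).card = q * R := by
    intro q
    induction q with
    | zero => simp
    | succ q ih =>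
      rw [mul_add_one, ← add_assoc, ← Finset.Ico_union_Ico_eq_Ico (b := M + d * q) (by omega)
        (by omega), Finset.filter_union, Finset.card_union_of_disjoint, ih, hfull]
      · ring
      · exact Finset.disjoint_filter_filter (Finset.Ico_disjoint_Ico_consecutive _ _ _)
  have hsplit : ((Ico M (M + N)).filter Q).card =
      (N / d) * R + ((Ico (M + d * (N / d)) (M + N)).filter Q).card := by
    have hle : d * (N / d) ≤ N := Nat.mul_div_le N d
    rw [← hmul, ← Finset.card_union_of_disjoint, ← Finset.filter_union,
      Finset.Ico_union_Ico_eq_Ico (by omega) (by omega)]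
    exact Finset.disjoint_filter_filter (Finset.Ico_disjoint_Ico_consecutive _ _ _)
  have hrem : ((Ico (M + d * (N / d)) (M + N)).filter Q).card ≤ R := by
    rw [← hfull (M + d * (N / d))]
    refine card_le_card (Finset.filter_subset_filter _ (Finset.Ico_subset_Ico_right ?_))
    have := Nat.div_add_mod N d
    have := Nat.mod_lt N hd
    omega
  have hN : (N : ℝ) = d * (N / d : ℕ) + (N % d : ℕ) := by
    exact_mod_cast (Nat.div_add_mod N d).symm
  have hmod : ((N % d : ℕ) : ℝ) / d ≤ 1 := by
    rw [div_le_one (by positivity)]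
    exact_mod_cast (Nat.mod_lt N hd).le
  have hmod0 : 0 ≤ ((N % d : ℕ) : ℝ) / d := by positivity
  have e : (N : ℝ) * ((R : ℝ) / d) = (N / d : ℕ) * R + ((N % d : ℕ) : ℝ) / d * R := by
    have : (d : ℝ) ≠ 0 := by positivity
    nth_rewrite 1 [hN]
    field_simp
  rw [hsplit, e]
  push_cast
  have h1 : (((Ico (M + d * (N / d)) (M + N)).filter Q).card : ℝ) ≤ R := by
    exact_mod_cast hrem
  have h0 : 0 ≤ (((Ico (M + d * (N / d)) (M + N)).filter Q).card : ℝ) := by positivity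
  have hR0 : 0 ≤ (R : ℝ) := by positivity
  rw [abs_le]
  constructor <;> nlinarith

/-- The indicator that `m` lies in one of the bad classes modulo `p`. -/
noncomputable def badInd (bad : ℕ → ℕ → Prop) (m p : ℕ) : ℝ := if bad p m then 1 else 0

theorem prod_badInd (bad : ℕ → ℕ → Prop) (m : ℕ) (S : Finset ℕ) :
    ∏ p ∈ S, badInd bad m p = if ∀ p ∈ S, bad p m then 1 else 0 := by
  unfold badInd
  rw [Finset.prod_ite_zero]
  simp

theorem abs_sum_prod_badInd_sub_le {bad : ℕ → ℕ → Prop} (S : Finset ℕ)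
    (hS : ∀ p ∈ S, p.Prime) (hbad : ∀ p ∈ S, ∀ m, bad p (m % p) ↔ bad p m) (M N : ℕ) :
    |∑ m ∈ Ico M (M + N), ∏ p ∈ S, badInd bad m p -
        N * ∏ p ∈ S, ((classCount bad p : ℝ) / p)| ≤ ∏ p ∈ S, (classCount bad p : ℝ) := by
  have hd : 0 < ∏ p ∈ S, p := prod_pos (fun p hp => (hS p hp).pos)
  obtain ⟨Q, hQ⟩ : ∃ Q : ℕ → Prop, ∀ m, Q m ↔ ∀ q ∈ S, bad q m := ⟨_, fun _ => Iff.rfl⟩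
  have h := abs_card_filter_Ico_sub_le hd (Q := Q) (fun m => by
    rw [hQ, hQ]
    refine forall₂_congr (fun q hq => ?_)
    rw [← hbad q hq, ← hbad q hq m, Nat.mod_mod_of_dvd _ (Finset.dvd_prod_of_mem _ hq)]) M N
  have e : ((range (∏ p ∈ S, p)).filter Q).card = ∏ p ∈ S, classCount bad p := by
    rw [← card_filter_range_prod_primes S hS hbad]
    congr 1; ext m; simp [hQ]
  rw [e] at h
  push_cast at h
  rw [← Finset.prod_div_distrib] at h
  have e2 : ∑ m ∈ Ico M (M + N), ∏ p ∈ S, badInd bad m p =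
      ((Ico M (M + N)).filter Q).card := by
    simp_rw [prod_badInd, ← hQ]
    rw [← Finset.sum_boole]
  rw [e2]
  exact h

theorem abs_sum_prod_cardWeightedSum_sub_le {bad : ℕ → ℕ → Prop} {J : ℕ} (P : Fin J → Finset ℕ)
    (hP : ∀ j, ∀ p ∈ P j, p.Prime) (hdisj : ∀ i j, i ≠ j → Disjoint (P i) (P j))
    (hbad : ∀ j, ∀ p ∈ P j, ∀ m, bad p (m % p) ↔ bad p m) (a : Fin J → ℕ → ℝ) (M N : ℕ) :
    |∑ m ∈ Ico M (M + N), ∏ j, cardWeightedSum (a j) (P j) (badInd bad m) -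
        N * ∏ j, cardWeightedSum (a j) (P j) (fun p => (classCount bad p : ℝ) / p)| ≤
      ∏ j, cardWeightedSum (fun n => |a j n|) (P j) (fun p => (classCount bad p : ℝ)) := by
  have expand : ∀ (a : Fin J → ℕ → ℝ) (t : ℕ → ℝ),
      ∏ j, cardWeightedSum (a j) (P j) t =
        ∑ x ∈ Fintype.piFinset (fun j => (P j).powerset),
          (∏ j, a j (x j).card) * ∏ p ∈ univ.biUnion x, t p := by
    intro a t
    unfold cardWeightedSum
    rw [Finset.prod_univ_sum]
    refine sum_congr rfl (fun x hx => ?_)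
    rw [Finset.prod_mul_distrib, Finset.prod_biUnion]
    intro i _ j _ hij
    rw [Fintype.mem_piFinset] at hx
    exact Finset.disjoint_of_subset_left (mem_powerset.mp (hx i))
      (Finset.disjoint_of_subset_right (mem_powerset.mp (hx j)) (hdisj i j hij))
  simp_rw [expand]
  rw [sum_comm, mul_sum, ← sum_sub_distrib]
  refine (Finset.abs_sum_le_sum_abs _ _).trans (sum_le_sum (fun x hx => ?_))
  rw [Fintype.mem_piFinset] at hx
  have hmem : ∀ p ∈ univ.biUnion x, ∃ j, p ∈ P j := by
    intro p hp
    obtain ⟨j, _, hj⟩ := mem_biUnion.mp hp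
    exact ⟨j, mem_powerset.mp (hx j) hj⟩
  have h := abs_sum_prod_badInd_sub_le (bad := bad) (univ.biUnion x)
    (fun p hp => by obtain ⟨j, hj⟩ := hmem p hp; exact hP j p hj)
    (fun p hp => by obtain ⟨j, hj⟩ := hmem p hp; exact hbad j p hj) M N
  rw [← mul_sum, mul_left_comm, ← mul_sub, abs_mul, Finset.abs_prod]
  exact mul_le_mul_of_nonneg_left h (prod_nonneg (fun _ _ => abs_nonneg _))

theorem abs_altCoeff_le (k n : ℕ) : |altCoeff k n| ≤ leCoeff k n := by
  unfold altCoeff leCoeff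
  split_ifs with h h' <;> simp_all
  omega

theorem abs_diagCoeff_le (k n : ℕ) : |diagCoeff k n| ≤ leCoeff k n := by
  unfold diagCoeff leCoeff
  split_ifs with h h' <;> simp_all

theorem classCount_le (bad : ℕ → ℕ → Prop) (p : ℕ) : classCount bad p ≤ p := by
  unfold classCount
  exact (Finset.card_filter_le _ _).trans (by simp)

theorem truncated_bounds_of_odd (P : Finset ℕ) (t : ℕ → ℝ) (h0 : ∀ p ∈ P, 0 ≤ t p)
    (h1 : ∀ p ∈ P, t p ≤ 1) {k : ℕ} (hk : Odd k) :
    ∏ p ∈ P, (1 - t p) ≤ cardWeightedSum (altCoeff k) P t ∧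
    cardWeightedSum (altCoeff k) P t ≤
      ∏ p ∈ P, (1 - t p) + cardWeightedSum (diagCoeff k) P t := by
  have h := alternating_bounds P t h0 h1 k
  rw [hk.neg_one_pow] at h
  constructor <;> linarith [h.1, h.2]

/-- The Brun–Hooley sieve, for a partition of the sifting primes into blocks. -/
theorem brun_hooley {bad : ℕ → ℕ → Prop} {J : ℕ} (P : Fin J → Finset ℕ)
    (hP : ∀ j, ∀ p ∈ P j, p.Prime) (hdisj : ∀ i j, i ≠ j → Disjoint (P i) (P j))
    (hbad : ∀ j, ∀ p ∈ P j, ∀ m, bad p (m % p) ↔ bad p m)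
    (k : Fin J → ℕ) (hk : ∀ j, Odd (k j)) (ε : Fin J → ℝ)
    (hE : ∀ j, cardWeightedSum (diagCoeff (k j)) (P j) (fun p => (classCount bad p : ℝ) / p) ≤
      ε j * ∏ p ∈ P j, (1 - (classCount bad p : ℝ) / p))
    (hε : ∑ j, ε j ≤ 1 / 4) (M N : ℕ)
    (hB : (J + 1) * ∏ j, (1 + ∑ p ∈ P j, (classCount bad p : ℝ)) ^ (k j) ≤
      1 / 4 * (N * ∏ j, ∏ p ∈ P j, (1 - (classCount bad p : ℝ) / p))) :
    1 / 2 * (N * ∏ j, ∏ p ∈ P j, (1 - (classCount bad p : ℝ) / p)) ≤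
      ((Ico M (M + N)).filter (fun m => ∀ j, ∀ p ∈ P j, ¬ bad p m)).card ∧
    (((Ico M (M + N)).filter (fun m => ∀ j, ∀ p ∈ P j, ¬ bad p m)).card : ℝ) ≤
      2 * (N * ∏ j, ∏ p ∈ P j, (1 - (classCount bad p : ℝ) / p)) := by
  set ω : ℕ → ℝ := fun p => (classCount bad p : ℝ) / p with hω
  set V : Fin J → ℝ := fun j => ∏ p ∈ P j, (1 - ω p) with hV
  set B : ℝ := ∏ j, (1 + ∑ p ∈ P j, (classCount bad p : ℝ)) ^ (k j) with hBdef
  have hω0 : ∀ p, 0 ≤ ω p := fun p => by positivity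
  have hω1 : ∀ p, ω p ≤ 1 := fun p =>
    div_le_one_of_le₀ (by exact_mod_cast classCount_le bad p) (by positivity)
  have hV0 : ∀ j, 0 ≤ V j := fun j => prod_nonneg (fun p _ => by linarith [hω1 p])
  set Mm : Fin J → ℝ := fun j => cardWeightedSum (altCoeff (k j)) (P j) ω with hMm
  have hVM : ∀ j, V j ≤ Mm j := fun j =>
    (truncated_bounds_of_odd (P j) ω (fun p _ => hω0 p) (fun p _ => hω1 p) (hk j)).1
  have hMV : ∀ j, Mm j ≤ V j + cardWeightedSum (diagCoeff (k j)) (P j) ω := fun j =>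
    (truncated_bounds_of_odd (P j) ω (fun p _ => hω0 p) (fun p _ => hω1 p) (hk j)).2
  have hE0 : ∀ j, 0 ≤ cardWeightedSum (diagCoeff (k j)) (P j) ω := fun j =>
    cardWeightedSum_diag_nonneg _ _ (fun p _ => hω0 p) _
  set x : ℕ → Fin J → ℝ := fun m j => ∏ p ∈ P j, (1 - badInd bad m p) with hx
  set y : ℕ → Fin J → ℝ := fun m j => cardWeightedSum (altCoeff (k j)) (P j) (badInd bad m) with hy
  set e : ℕ → Fin J → ℝ := fun m j => cardWeightedSum (diagCoeff (k j)) (P j) (badInd bad m) with he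
  have hb0 : ∀ m p, 0 ≤ badInd bad m p := fun m p => by unfold badInd; split_ifs <;> norm_num
  have hb1 : ∀ m p, badInd bad m p ≤ 1 := fun m p => by unfold badInd; split_ifs <;> norm_num
  have hx0 : ∀ m j, 0 ≤ x m j := fun m j => prod_nonneg (fun p _ => by linarith [hb1 m p])
  have hxy : ∀ m j, x m j ≤ y m j := fun m j =>
    (truncated_bounds_of_odd (P j) _ (fun p _ => hb0 m p) (fun p _ => hb1 m p) (hk j)).1
  have hyx : ∀ m j, y m j - x m j ≤ e m j := fun m j => by
    linarith [(truncated_bounds_of_odd (P j) _ (fun p _ => hb0 m p) (fun p _ => hb1 m p) (hk j)).2]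
  have hcount : (((Ico M (M + N)).filter (fun m => ∀ j, ∀ p ∈ P j, ¬ bad p m)).card : ℝ) =
      ∑ m ∈ Ico M (M + N), ∏ j, x m j := by
    rw [← Finset.sum_boole]
    refine sum_congr rfl (fun m _ => ?_)
    by_cases h : ∀ j, ∀ p ∈ P j, ¬ bad p m
    · rw [if_pos h]
      symm
      refine Finset.prod_eq_one (fun j _ => Finset.prod_eq_one (fun p hp => ?_))
      simp [badInd, h j p hp]
    · rw [if_neg h]
      push Not at h
      obtain ⟨j, p, hp, hbp⟩ := h
      symm
      refine Finset.prod_eq_zero (mem_univ j) (Finset.prod_eq_zero hp ?_)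
      simp [badInd, hbp]
  have herr : ∀ a : Fin J → ℕ → ℝ, (∀ j n, |a j n| ≤ leCoeff (k j) n) →
      |∑ m ∈ Ico M (M + N), ∏ j, cardWeightedSum (a j) (P j) (badInd bad m) -
        N * ∏ j, cardWeightedSum (a j) (P j) ω| ≤ B := by
    intro a ha
    refine (abs_sum_prod_cardWeightedSum_sub_le P hP hdisj hbad a M N).trans ?_
    refine prod_le_prod (fun j _ => ?_) (fun j _ => ?_)
    · exact sum_nonneg (fun s _ => mul_nonneg (abs_nonneg _)
        (prod_nonneg (fun _ _ => by positivity)))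
    · exact (cardWeightedSum_abs_le (ha j) _ _ (fun _ _ => by positivity)).trans
        (cardWeightedSum_le_le _ _ (fun _ _ => by positivity) _)
  have hmain := abs_le.mp (herr (fun j => altCoeff (k j)) (fun j n => abs_altCoeff_le _ _))
  have hMpos : 0 ≤ ∏ j, Mm j := prod_nonneg (fun j _ => (hV0 j).trans (hVM j))
  have hprodVM : ∏ j, V j ≤ ∏ j, Mm j :=
    prod_le_prod (fun j _ => hV0 j) (fun j _ => hVM j)
  have hB0 : 0 ≤ B := prod_nonneg (fun j _ => by positivity)
  rw [hcount]
  constructor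
  · have hl : ∀ l, ∑ m ∈ Ico M (M + N), e m l * ∏ j ∈ univ.erase l, y m j ≤
        N * (ε l * ∏ j, Mm j) + B := by
      intro l
      have h := abs_le.mp (herr (Function.update (fun j => altCoeff (k j)) l (diagCoeff (k l)))
        (fun j n => by
          by_cases hj : j = l
          · subst hj; simpa using abs_diagCoeff_le _ _
          · simpa [hj] using abs_altCoeff_le _ _))
      have e1 : ∀ t : ℕ → ℝ, ∏ j, cardWeightedSum
          (Function.update (fun j => altCoeff (k j)) l (diagCoeff (k l)) j) (P j) t =
          cardWeightedSum (diagCoeff (k l)) (P l) t *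
            ∏ j ∈ univ.erase l, cardWeightedSum (altCoeff (k j)) (P j) t := by
        intro t
        rw [← Finset.mul_prod_erase _ _ (mem_univ l), Function.update_self]
        congr 1
        refine prod_congr rfl (fun j hj => ?_)
        rw [Function.update_of_ne (Finset.ne_of_mem_erase hj)]
      simp_rw [e1] at h
      have h3 : cardWeightedSum (diagCoeff (k l)) (P l) ω *
            ∏ j ∈ univ.erase l, Mm j ≤ ε l * ∏ j, Mm j := by
        rw [← Finset.mul_prod_erase _ Mm (mem_univ l), ← mul_assoc]
        refine mul_le_mul_of_nonneg_right ?_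
          (prod_nonneg (fun j _ => (hV0 j).trans (hVM j)))
        by_cases hε0 : 0 ≤ ε l
        · exact (hE l).trans (mul_le_mul_of_nonneg_left (hVM l) hε0)
        · have h5 := hE l
          have h6 := hE0 l
          have h7 : V l = 0 := by
            by_contra h8
            have : 0 < V l := lt_of_le_of_ne (hV0 l) (Ne.symm h8)
            nlinarith [mul_pos (neg_pos.mpr (not_le.mp hε0)) this]
          have h9 : cardWeightedSum (diagCoeff (k l)) (P l) ω = 0 := by
            apply le_antisymm _ h6
            have : ε l * V l = 0 := by rw [h7, mul_zero]
            linarith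
          have h10 : Mm l = 0 := by
            apply le_antisymm _ ((hV0 l).trans (hVM l))
            linarith [hMV l]
          rw [h9, h10, mul_zero]
      have h4 : (N : ℝ) * (cardWeightedSum (diagCoeff (k l)) (P l) ω *
            ∏ j ∈ univ.erase l, Mm j) ≤ N * (ε l * ∏ j, Mm j) :=
        mul_le_mul_of_nonneg_left h3 (by positivity)
      linarith [h.2]
    have hpt : ∀ m, ∏ j, y m j - ∑ l, e m l * ∏ j ∈ univ.erase l, y m j ≤ ∏ j, x m j := by
      intro m
      have h := prod_sub_prod_le univ (x m) (y m) (fun j _ => hx0 m j) (fun j _ => hxy m j)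
      have h2 : ∑ l, (y m l - x m l) * ∏ j ∈ univ.erase l, y m j ≤
          ∑ l, e m l * ∏ j ∈ univ.erase l, y m j :=
        sum_le_sum (fun l _ => mul_le_mul_of_nonneg_right (hyx m l)
          (prod_nonneg (fun j _ => (hx0 m j).trans (hxy m j))))
      exact sub_le_comm.mp (h.trans h2)
    have hsum := sum_le_sum (fun m (_ : m ∈ Ico M (M + N)) => hpt m)
    rw [sum_sub_distrib, sum_comm] at hsum
    have hls : ∑ l, ∑ m ∈ Ico M (M + N), e m l * ∏ j ∈ univ.erase l, y m j ≤
        N * ((∑ l, ε l) * ∏ j, Mm j) + J * B := by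
      refine (sum_le_sum (fun l _ => hl l)).trans (le_of_eq ?_)
      rw [sum_add_distrib, ← mul_sum, sum_mul]
      simp
    have h1 : (N : ℝ) * ((∑ l, ε l) * ∏ j, Mm j) ≤ N * (1 / 4 * ∏ j, Mm j) :=
      mul_le_mul_of_nonneg_left (mul_le_mul_of_nonneg_right hε hMpos) (by positivity)
    have h2 : (N : ℝ) * ∏ j, V j ≤ N * ∏ j, Mm j :=
      mul_le_mul_of_nonneg_left hprodVM (by positivity)
    linarith [hmain.1]
  · have h1 : ∑ m ∈ Ico M (M + N), ∏ j, x m j ≤ ∑ m ∈ Ico M (M + N), ∏ j, y m j :=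
      sum_le_sum (fun m _ => prod_le_prod (fun j _ => hx0 m j) (fun j _ => hxy m j))
    have h2 : ∏ j, Mm j ≤ exp (1 / 4) * ∏ j, V j := by
      calc ∏ j, Mm j ≤ ∏ j, (exp (ε j) * V j) := by
            refine prod_le_prod (fun j _ => (hV0 j).trans (hVM j)) (fun j _ => ?_)
            nlinarith [hMV j, hE j, hV0 j, add_one_le_exp (ε j)]
        _ = exp (∑ j, ε j) * ∏ j, V j := by
            rw [Finset.prod_mul_distrib, exp_sum]
        _ ≤ _ := mul_le_mul_of_nonneg_right (exp_le_exp.mpr hε)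
            (prod_nonneg (fun j _ => hV0 j))
    have h3 : exp (1 / 4) ≤ 3 / 2 := by
      have := exp_bound_div_one_sub_of_interval (x := 1 / 4) (by norm_num) (by norm_num)
      norm_num at this ⊢; linarith
    have hV1 : 0 ≤ ∏ j, V j := prod_nonneg (fun j _ => hV0 j)
    have h4 : (N : ℝ) * ∏ j, Mm j ≤ N * (3 / 2 * ∏ j, V j) :=
      mul_le_mul_of_nonneg_left (h2.trans (mul_le_mul_of_nonneg_right h3 hV1)) (by positivity)
    have h5 : B ≤ (J + 1) * B := by nlinarith [Nat.cast_nonneg (α := ℝ) J]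
    have h6 : 0 ≤ (N : ℝ) * ∏ j, V j := by positivity
    linarith [hmain.2]

theorem exp_neg_two_mul_le_one_sub {t : ℝ} (h0 : 0 ≤ t) (h1 : t ≤ 1 / 2) :
    exp (-(2 * t)) ≤ 1 - t := by
  have h2 : 1 + 2 * t ≤ exp (2 * t) := by linarith [add_one_le_exp (2 * t)]
  rw [exp_neg]
  have h3 : (exp (2 * t))⁻¹ ≤ (1 + 2 * t)⁻¹ := inv_anti₀ (by linarith) h2
  refine h3.trans ?_
  rw [inv_le_iff_one_le_mul₀ (by linarith)]
  nlinarith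

theorem exp_neg_two_mul_sum_le_prod {P : Finset ℕ} {t : ℕ → ℝ} (h0 : ∀ p ∈ P, 0 ≤ t p)
    (h1 : ∀ p ∈ P, t p ≤ 1 / 2) : exp (-(2 * ∑ p ∈ P, t p)) ≤ ∏ p ∈ P, (1 - t p) := by
  rw [mul_sum, ← Finset.sum_neg_distrib, exp_sum]
  exact prod_le_prod (fun p _ => (exp_pos _).le)
    (fun p hp => exp_neg_two_mul_le_one_sub (h0 p hp) (h1 p hp))

theorem pow_div_factorial_le {S : ℝ} (hS : 0 ≤ S) (k : ℕ) :
    S ^ k / k.factorial ≤ exp (4 * S) / 4 ^ k := by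
  have h := Real.pow_div_factorial_le_exp (4 * S) (by positivity) k
  rw [mul_pow] at h
  rw [le_div_iff₀ (by positivity)]
  calc S ^ k / k.factorial * 4 ^ k = 4 ^ k * S ^ k / k.factorial := by ring
    _ ≤ _ := h

theorem sum_add_two_mul_div_two_pow_le (c : ℝ) (J : ℕ) :
    ∑ j ∈ range J, (c + 2 * j) / 2 ^ j = 2 * c + 4 - (2 * c + 4 + 4 * J) / 2 ^ J := by
  induction J with
  | zero => simp
  | succ J ih =>
    rw [Finset.sum_range_succ, ih]
    push_cast
    field_simp
    ring

/-- Index of the dyadic block (in the `log log` scale) containing `p`. -/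
noncomputable def blockIndex (w : ℝ) (p : ℕ) : ℕ := ⌊Real.logb 2 (log w / log p)⌋₊

theorem blockIndex_spec {w : ℝ} {p : ℕ} (hp : 2 ≤ p) (hpw : (p : ℝ) ≤ w) :
    2 ^ blockIndex w p * log p ≤ log w ∧
    log w < 2 ^ (blockIndex w p + 1) * log p := by
  have hp2 : (2 : ℝ) ≤ p := by exact_mod_cast hp
  have hlp : 0 < log p := log_pos (by linarith)
  have hlw : log p ≤ log w := log_le_log (by linarith) hpw
  have h1 : 1 ≤ log w / log p := by rwa [one_le_div hlp]
  have h0 : 0 ≤ Real.logb 2 (log w / log p) := Real.logb_nonneg (by norm_num) h1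
  have ha := Nat.floor_le h0
  have hb := Nat.lt_floor_add_one (Real.logb 2 (log w / log p))
  constructor
  · rw [Real.le_logb_iff_rpow_le (by norm_num) (by linarith), rpow_natCast,
      le_div_iff₀ hlp] at ha
    exact ha
  · rw [Real.logb_lt_iff_lt_rpow (by norm_num) (by linarith), ← Nat.cast_add_one,
      rpow_natCast, div_lt_iff₀ hlp] at hb
    exact hb

theorem exists_sieve_bounds (g : ℕ) : ∃ p₀ K : ℕ, 2 ≤ p₀ ∧ 1 ≤ K ∧
    ∀ w : ℝ, 2 ≤ w → ∀ P : Finset ℕ, P ⊆ primesIoc p₀ w → ∀ bad : ℕ → ℕ → Prop,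
      (∀ p ∈ P, ∀ m, bad p (m % p) ↔ bad p m) → (∀ p ∈ P, classCount bad p ≤ g) →
      ∀ M N : ℕ, w ^ K ≤ N →
      1 / 2 * (N * ∏ p ∈ P, (1 - (classCount bad p : ℝ) / p)) ≤
        ((Ico M (M + N)).filter (fun m => ∀ p ∈ P, ¬ bad p m)).card ∧
      (((Ico M (M + N)).filter (fun m => ∀ p ∈ P, ¬ bad p m)).card : ℝ) ≤
        2 * (N * ∏ p ∈ P, (1 - (classCount bad p : ℝ) / p)) := by
  set S : ℝ := 18 * (g + 1) with hS
  have hS0 : 0 ≤ S := by positivity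
  have hS1 : 0 < S := by positivity
  obtain ⟨b, hb⟩ := pow_unbounded_of_one_lt (exp (6 * S)) (one_lt_two)
  have hb1 : 1 ≤ b := by
    by_contra h
    have : b = 0 := by omega
    rw [this, pow_zero] at hb
    have := Real.one_lt_exp_iff.mpr (by positivity : 0 < 6 * S)
    linarith
  obtain ⟨K, hK⟩ := exists_nat_gt (2 + 2 * (2 * S + 1) + (8 * b + 12) : ℝ)
  have hK1 : 1 ≤ K := by
    have : (0 : ℝ) < K := by
      refine lt_trans ?_ hK
      positivity
    exact_mod_cast this
  refine ⟨2 * (g + 1), K, by omega, hK1, ?_⟩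
  intro w hw P hP bad hbad hω M N hN
  have hlw : 0 < log w := log_pos (by linarith)
  have hl2 : 0 < log 2 := log_pos (by norm_num)
  have hPp : ∀ p ∈ P, p.Prime ∧ 2 * (g + 1) < p ∧ (p : ℝ) ≤ w := by
    intro p hp
    have h := mem_primesIoc.mp (hP hp)
    exact ⟨h.1, by exact_mod_cast h.2.1, h.2.2⟩
  set J : ℕ := ⌊Real.logb 2 (log w / log 2)⌋₊ + 1 with hJ
  have hratio : 1 ≤ log w / log 2 := by
    rw [one_le_div hl2]; exact log_le_log (by norm_num) hw
  have hJlog : (J : ℝ) ≤ 2 * log w := by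
    have h1 : (2 : ℝ) ^ (J - 1) * log 2 ≤ log w := by
      have := (blockIndex_spec (w := w) (p := 2) le_rfl (by simpa using hw)).1
      simpa [blockIndex, hJ] using this
    have h2 : (J : ℝ) ≤ 2 ^ (J - 1) := by
      have h3 : J - 1 + 1 ≤ 2 ^ (J - 1) := Nat.lt_two_pow_self
      have h4 : J ≤ 2 ^ (J - 1) := by omega
      exact_mod_cast h4
    have h3 : (1 / 2 : ℝ) ≤ log 2 := by linarith [log_two_gt_d9]
    nlinarith
  set B : Fin J → Finset ℕ := fun j => P.filter (fun p => blockIndex w p = j) with hB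
  have hBP : ∀ j, ∀ p ∈ B j, p ∈ P := fun j p hp => (mem_filter.mp hp).1
  have hidx : ∀ p ∈ P, blockIndex w p < J := by
    intro p hp
    have h := hPp p hp
    refine Nat.lt_succ_of_le (Nat.floor_le_floor ?_)
    have hp2 : (2 : ℝ) ≤ p := by exact_mod_cast h.1.two_le
    refine Real.logb_le_logb_of_le (by norm_num) (div_pos hlw (log_pos (by linarith))) ?_
    exact div_le_div_of_nonneg_left hlw.le hl2 (log_le_log (by norm_num) hp2)
  have hall : ∀ Q : ℕ → Prop, (∀ j, ∀ p ∈ B j, Q p) ↔ ∀ p ∈ P, Q p := by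
    intro Q
    constructor
    · intro h p hp
      exact h ⟨blockIndex w p, hidx p hp⟩ p (mem_filter.mpr ⟨hp, rfl⟩)
    · exact fun h j p hp => h p (hBP j p hp)
  have hprod : ∀ f : ℕ → ℝ, ∏ j, ∏ p ∈ B j, f p = ∏ p ∈ P, f p := by
    intro f
    rw [Fin.prod_univ_eq_prod_range (fun j => ∏ p ∈ P.filter (fun p => blockIndex w p = j), f p) J]
    exact Finset.prod_fiberwise_of_maps_to (fun p hp => mem_range.mpr (hidx p hp)) f
  have hdisj : ∀ i j, i ≠ j → Disjoint (B i) (B j) := by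
    intro i j hij
    rw [Finset.disjoint_left]
    intro p hpi hpj
    exact hij (Fin.ext ((mem_filter.mp hpi).2.symm.trans (mem_filter.mp hpj).2))
  have hω0 : ∀ p, 0 ≤ (classCount bad p : ℝ) / p := fun p => by positivity
  have hωg : ∀ p ∈ P, (classCount bad p : ℝ) / p ≤ (g + 1) * (1 / (p : ℝ)) := by
    intro p hp
    have : (classCount bad p : ℝ) ≤ g + 1 := by exact_mod_cast (hω p hp).trans (by omega)
    rw [mul_one_div]
    exact div_le_div_of_nonneg_right this (by positivity)
  have hωhalf : ∀ p ∈ P, (classCount bad p : ℝ) / p ≤ 1 / 2 := by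
    intro p hp
    refine (hωg p hp).trans ?_
    have h : (2 * (g + 1) : ℝ) ≤ p := by exact_mod_cast (hPp p hp).2.1.le
    have hp0 : (0 : ℝ) < p := by exact_mod_cast (hPp p hp).1.pos
    rw [mul_one_div, div_le_div_iff₀ hp0 (by norm_num)]
    linarith
  have hblock : ∀ j : Fin J, ∀ p ∈ B j,
      exp (log w / 2 ^ ((j : ℕ) + 1)) < p ∧ (p : ℝ) ≤ exp (log w / 2 ^ (j : ℕ)) := by
    intro j p hp
    have hpP := hPp p (hBP j p hp)
    have h := blockIndex_spec hpP.1.two_le hpP.2.2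
    rw [(mem_filter.mp hp).2] at h
    have hp0 : (0 : ℝ) < p := by exact_mod_cast hpP.1.pos
    constructor
    · rw [← Real.lt_log_iff_exp_lt hp0, div_lt_iff₀' (by positivity)]
      exact h.2
    · rw [← log_le_iff_le_exp hp0, le_div_iff₀' (by positivity)]
      exact h.1
  have hsum : ∀ j : Fin J, ∑ p ∈ B j, (classCount bad p : ℝ) / p ≤ S := by
    intro j
    rcases (B j).eq_empty_or_nonempty with h | ⟨q, hq⟩
    · rw [h]; simpa using hS0
    · calc ∑ p ∈ B j, (classCount bad p : ℝ) / p ≤ ∑ p ∈ B j, ((g : ℝ) + 1) * (1 / (p : ℝ)) :=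
            sum_le_sum (fun p hp => hωg p (hBP j p hp))
        _ ≤ (g + 1) * ∑ p ∈ primesIoc (exp (log w / 2 ^ ((j : ℕ) + 1)))
              (exp (log w / 2 ^ (j : ℕ))), 1 / (p : ℝ) := by
            rw [← mul_sum]
            refine mul_le_mul_of_nonneg_left ?_ (by positivity)
            refine sum_le_sum_of_subset_of_nonneg (fun p hp => ?_) (fun _ _ _ => by positivity)
            rw [mem_primesIoc]
            exact ⟨(hPp p (hBP j p hp)).1, hblock j p hp⟩
        _ ≤ (g + 1) * (9 * 2) := by
            refine mul_le_mul_of_nonneg_left ?_ (by positivity)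
            refine (sum_inv_primesIoc_le ?_ ?_).trans (le_of_eq ?_)
            · rw [Real.one_lt_exp_iff]; positivity
            · have h2 : (2 : ℝ) ≤ q := by exact_mod_cast (hPp q (hBP j q hq)).1.two_le
              exact h2.trans (hblock j q hq).2
            · rw [log_exp, log_exp, pow_succ]
              field_simp
        _ = S := by rw [hS]; ring
  set k : Fin J → ℕ := fun j => 2 * (b + j) + 1 with hk
  have hV : ∀ j : Fin J, exp (-(2 * S)) ≤ ∏ p ∈ B j, (1 - (classCount bad p : ℝ) / p) := by
    intro j
    refine le_trans (exp_le_exp.mpr ?_)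
      (exp_neg_two_mul_sum_le_prod (fun p _ => hω0 p) (fun p hp => hωhalf p (hBP j p hp)))
    linarith [hsum j]
  have hmain := brun_hooley (bad := bad) B (fun j p hp => (hPp p (hBP j p hp)).1) hdisj
    (fun j p hp => hbad p (hBP j p hp)) k (fun j => ⟨b + j, rfl⟩)
    (fun j => exp (6 * S) / 4 ^ (k j)) (by
      intro j
      refine (cardWeightedSum_diag_le _ _ (fun p _ => hω0 p) _).trans ?_
      calc (∑ p ∈ B j, (classCount bad p : ℝ) / p) ^ k j / (k j).factorial
          ≤ S ^ k j / (k j).factorial := by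
            refine div_le_div_of_nonneg_right (pow_le_pow_left₀
              (sum_nonneg (fun p _ => hω0 p)) (hsum j) _) (by positivity)
        _ ≤ exp (4 * S) / 4 ^ k j := pow_div_factorial_le hS0 _
        _ = exp (6 * S) / 4 ^ (k j) * exp (-(2 * S)) := by
            rw [div_mul_eq_mul_div, ← exp_add]; ring_nf
        _ ≤ _ := mul_le_mul_of_nonneg_left (hV j) (by positivity)) (by
      have hj : ∀ j : Fin J, exp (6 * S) / 4 ^ (k j) ≤ 1 / 8 * (1 / 2) ^ (j : ℕ) := by
        intro j
        have e1 : (4 : ℝ) ^ (k j) = 4 * 16 ^ b * 16 ^ (j : ℕ) := by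
          rw [hk]; simp only [pow_succ, mul_add, pow_add, pow_mul]; norm_num; ring
        have e2 : (16 : ℝ) ^ b = 2 ^ b * 8 ^ b := by rw [← mul_pow]; norm_num
        have e3 : (8 : ℝ) ≤ 8 ^ b := le_self_pow₀ (by norm_num) (by omega)
        have e4 : (16 : ℝ) ^ (j : ℕ) = 2 ^ (j : ℕ) * 8 ^ (j : ℕ) := by rw [← mul_pow]; norm_num
        have e5 : (1 : ℝ) ≤ 8 ^ (j : ℕ) := one_le_pow₀ (by norm_num)
        rw [e1, one_div_pow, mul_one_div, div_div, div_le_div_iff₀ (by positivity) (by positivity),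
          e2, e4, one_mul]
        have f1 : exp (6 * S) * (8 * 2 ^ (j : ℕ)) ≤ 2 ^ b * (8 ^ b * 2 ^ (j : ℕ)) :=
          mul_le_mul hb.le (mul_le_mul_of_nonneg_right e3 (by positivity)) (by positivity)
            (by positivity)
        have f2 : (2 : ℝ) ^ b * (8 ^ b * 2 ^ (j : ℕ)) * 1 ≤
            2 ^ b * (8 ^ b * 2 ^ (j : ℕ)) * (4 * 8 ^ (j : ℕ)) :=
          mul_le_mul_of_nonneg_left (by linarith) (by positivity)
        nlinarith
      refine (sum_le_sum (fun j _ => hj j)).trans ?_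
      rw [← mul_sum, Fin.sum_univ_eq_sum_range (fun j => (1 / 2 : ℝ) ^ j)]
      have h2 : ∑ i ∈ range J, (1 / 2 : ℝ) ^ i ≤ 2 := sum_geometric_two_le J
      linarith) M N (by
      have hBj : ∀ j : Fin J, 1 + ∑ p ∈ B j, (classCount bad p : ℝ) ≤
          exp (2 * (log w / 2 ^ (j : ℕ))) := by
        intro j
        rcases (B j).eq_empty_or_nonempty with h | ⟨q, hq⟩
        · rw [h]; simp; positivity
        · set v := exp (log w / 2 ^ (j : ℕ)) with hv
          have hv1 : (2 * (g + 1) : ℝ) ≤ v := by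
            refine le_trans ?_ (hblock j q hq).2
            exact_mod_cast (hPp q (hBP j q hq)).2.1.le
          have hcard : ((B j).card : ℝ) ≤ v := by
            have : B j ⊆ Ioc 0 ⌊v⌋₊ := by
              intro p hp
              rw [mem_Ioc]
              exact ⟨(hPp p (hBP j p hp)).1.pos, Nat.le_floor (hblock j p hp).2⟩
            have h1 := card_le_card this
            rw [Nat.card_Ioc, Nat.sub_zero] at h1
            exact (Nat.cast_le.mpr h1).trans (Nat.floor_le (by positivity))
          have h1 : ∑ p ∈ B j, (classCount bad p : ℝ) ≤ (B j).card * g := by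
            rw [← nsmul_eq_mul]
            exact sum_le_card_nsmul _ _ _ (fun p hp => by exact_mod_cast hω p (hBP j p hp))
          have e : exp (2 * (log w / 2 ^ (j : ℕ))) = v * v := by
            rw [hv, ← exp_add]; ring_nf
          rw [e]
          have hg0 : (0 : ℝ) ≤ g := by positivity
          nlinarith
      have hprodB : ∏ j, (1 + ∑ p ∈ B j, (classCount bad p : ℝ)) ^ (k j) ≤
          exp ((8 * b + 12) * log w) := by
        calc _ ≤ ∏ j : Fin J, exp (2 * (log w / 2 ^ (j : ℕ))) ^ (k j) :=
              prod_le_prod (fun j _ => by positivity)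
                (fun j _ => pow_le_pow_left₀ (by positivity) (hBj j) _)
          _ = exp (∑ j : Fin J, 2 * log w * (((2 * b + 1 : ℝ) + 2 * (j : ℕ)) / 2 ^ (j : ℕ))) := by
              rw [exp_sum]
              refine prod_congr rfl (fun j _ => ?_)
              rw [← exp_nat_mul]
              congr 1
              rw [hk]; push_cast; ring
          _ ≤ _ := by
              rw [exp_le_exp, ← mul_sum, Fin.sum_univ_eq_sum_range
                (fun j => ((2 * b + 1 : ℝ) + 2 * j) / 2 ^ j), sum_add_two_mul_div_two_pow_le]
              have : 0 ≤ (2 * (2 * b + 1 : ℝ) + 4 + 4 * J) / 2 ^ J := by positivity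
              nlinarith
      have hprodV : exp (-(2 * S * J)) ≤
          ∏ j, ∏ p ∈ B j, (1 - (classCount bad p : ℝ) / p) := by
        have e : exp (-(2 * S * J)) = ∏ _j : Fin J, exp (-(2 * S)) := by
          rw [prod_const, card_univ, Fintype.card_fin, ← exp_nat_mul]
          congr 1; ring
        rw [e]
        exact prod_le_prod (fun j _ => (exp_pos _).le) (fun j _ => hV j)
      have hJ1 : (J : ℝ) + 1 ≤ exp J := add_one_le_exp _
      have h4 : (4 : ℝ) ≤ exp (2 * log w) := by
        have : exp (2 * log w) = w * w := by
          rw [two_mul, exp_add, exp_log (by linarith)]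
        rw [this]; nlinarith
      have hNe : exp ((2 + 2 * (2 * S + 1) + (8 * b + 12)) * log w) ≤ N := by
        refine le_trans ?_ hN
        rw [← rpow_natCast, rpow_def_of_pos (by linarith), exp_le_exp, mul_comm]
        exact mul_le_mul_of_nonneg_left hK.le hlw.le
      have hchain : 4 * ((J + 1) * exp ((8 * b + 12) * log w)) * exp (2 * S * J) ≤ N := by
        refine le_trans ?_ hNe
        calc 4 * ((J + 1) * exp ((8 * b + 12) * log w)) * exp (2 * S * J)
            ≤ exp (2 * log w) * (exp J * exp ((8 * b + 12) * log w)) *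
              exp (2 * S * J) := by gcongr
          _ = exp (2 * log w + (J + (8 * b + 12) * log w) + 2 * S * J) := by
              rw [← exp_add, ← exp_add, ← exp_add]
          _ ≤ _ := by
              rw [exp_le_exp]
              nlinarith
      have h5 : (J + 1) * ∏ j, (1 + ∑ p ∈ B j, (classCount bad p : ℝ)) ^ (k j) ≤
          (J + 1) * exp ((8 * b + 12) * log w) :=
        mul_le_mul_of_nonneg_left hprodB (by positivity)
      refine h5.trans ?_
      have h6 : (N : ℝ) * exp (-(2 * S * J)) ≤
          N * ∏ j, ∏ p ∈ B j, (1 - (classCount bad p : ℝ) / p) :=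
        mul_le_mul_of_nonneg_left hprodV (by positivity)
      have h7 : 4 * ((J + 1) * exp ((8 * b + 12) * log w)) ≤
          N * exp (-(2 * S * J)) := by
        rw [exp_neg, ← div_eq_mul_inv, le_div_iff₀ (exp_pos _)]
        exact hchain
      linarith)
  rw [hprod] at hmain
  have hset : (Ico M (M + N)).filter (fun m => ∀ j, ∀ p ∈ B j, ¬ bad p m) =
      (Ico M (M + N)).filter (fun m => ∀ p ∈ P, ¬ bad p m) := by
    ext m
    simp only [mem_filter, hall]
  rw [hset] at hmain
  exact hmain

theorem rootCount_X {p : ℕ} (hp : 0 < p) : rootCount Polynomial.X p = 1 := by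
  rw [rootCount, Finset.card_eq_one]
  refine ⟨0, ?_⟩
  ext n
  simp only [rootsMod, mem_filter, mem_range, Polynomial.eval_X, Finset.mem_singleton]
  constructor
  · rintro ⟨h1, h2⟩
    exact Nat.eq_zero_of_dvd_of_lt (by exact_mod_cast h2) h1
  · rintro rfl; simp [hp]

theorem exists_prod_one_sub_inv_le (p₀ : ℕ) : ∃ C : ℝ, 0 < C ∧ ∀ w : ℝ, 2 ≤ w →
    ∏ p ∈ primesIoc p₀ w, (1 - 1 / (p : ℝ)) ≤ C / log w := by
  obtain ⟨C, hC⟩ := exists_sum_rootCount_div_sub_loglog_le (F := Polynomial.X)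
    Polynomial.irreducible_X (by simp)
  refine ⟨exp (C + p₀), exp_pos _, fun w hw => ?_⟩
  have hl : 0 < log w := log_pos (by linarith)
  have h1 := (abs_le.mp (hC w hw)).1
  have h2 : ∑ p ∈ primesIoc 0 w, (rootCount Polynomial.X p : ℝ) / p =
      ∑ p ∈ primesIoc 0 w, 1 / (p : ℝ) := by
    refine sum_congr rfl (fun p hp => ?_)
    rw [rootCount_X (mem_primesIoc.mp hp).1.pos]; simp
  rw [h2] at h1
  have h3 : ∑ p ∈ primesIoc 0 w, 1 / (p : ℝ) ≤ p₀ + ∑ p ∈ primesIoc p₀ w, 1 / (p : ℝ) := by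
    have hsub : primesIoc 0 w ⊆ Ioc 0 p₀ ∪ primesIoc p₀ w := by
      intro p hp
      have h := mem_primesIoc.mp hp
      rw [mem_union, mem_Ioc, mem_primesIoc]
      by_cases hpp : p ≤ p₀
      · exact Or.inl ⟨h.1.pos, hpp⟩
      · exact Or.inr ⟨h.1, by exact_mod_cast not_le.mp hpp, h.2.2⟩
    refine (sum_le_sum_of_subset_of_nonneg hsub (fun _ _ _ => by positivity)).trans ?_
    have hui := Finset.sum_union_inter (s₁ := Ioc 0 p₀) (s₂ := primesIoc p₀ w)
      (f := fun p : ℕ => 1 / (p : ℝ))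
    have hin : 0 ≤ ∑ p ∈ Ioc 0 p₀ ∩ primesIoc p₀ w, 1 / (p : ℝ) :=
      sum_nonneg (fun _ _ => by positivity)
    have hle : ∑ p ∈ Ioc 0 p₀, 1 / (p : ℝ) ≤ p₀ := by
      have := sum_le_card_nsmul (Ioc 0 p₀) (fun p : ℕ => 1 / (p : ℝ)) 1 (fun p hp => by
        have : (1 : ℝ) ≤ p := by exact_mod_cast (mem_Ioc.mp hp).1
        rw [div_le_one (by linarith)]; exact this)
      simpa using this
    linarith
  calc ∏ p ∈ primesIoc p₀ w, (1 - 1 / (p : ℝ))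
      ≤ ∏ p ∈ primesIoc p₀ w, exp (-(1 / (p : ℝ))) := by
        refine prod_le_prod (fun p hp => ?_) (fun p _ => ?_)
        · have : (1 : ℝ) ≤ p := by exact_mod_cast (mem_primesIoc.mp hp).1.one_lt.le
          rw [sub_nonneg, div_le_one (by linarith)]; exact this
        · linarith [add_one_le_exp (-(1 / (p : ℝ)))]
    _ = exp (-∑ p ∈ primesIoc p₀ w, 1 / (p : ℝ)) := by
        rw [← Finset.sum_neg_distrib, exp_sum]
    _ ≤ exp (C + p₀ - log (log w)) := exp_le_exp.mpr (by linarith)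
    _ = _ := by rw [exp_sub, exp_log hl]

/-- The Brun–Titchmarsh inequality, with an unspecified constant. -/
theorem exists_card_primesIoc_le : ∃ C : ℝ, 0 < C ∧ ∀ u h : ℝ, 0 ≤ u → 2 ≤ h →
    ((primesIoc u (u + h)).card : ℝ) ≤ C * h / log h := by
  obtain ⟨p₀, K, hp₀, hK, H⟩ := exists_sieve_bounds 1
  obtain ⟨C₁, hC₁, hprod⟩ := exists_prod_one_sub_inv_le p₀
  refine ⟨2 * (K + 1) + 2 + 4 * C₁ * (K + 1), by positivity, fun u h hu hh => ?_⟩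
  have hlh : 0 < log h := log_pos (by linarith)
  set N := ⌈h⌉₊ + 1 with hN
  set M := ⌊u⌋₊ with hM
  have hNh : h ≤ N := by
    rw [hN]; push_cast; linarith [Nat.le_ceil h]
  have hN2 : (N : ℝ) ≤ 2 * h := by
    rw [hN]; push_cast; linarith [Nat.ceil_lt_add_one (by linarith : 0 ≤ h)]
  have hsub : primesIoc u (u + h) ⊆ Ico M (M + N) := by
    intro p hp
    have hp' := mem_primesIoc.mp hp
    rw [mem_Ico]
    constructor
    · exact_mod_cast (Nat.floor_le hu).trans hp'.2.1.le
    · have h1 := Nat.lt_floor_add_one u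
      have h2 : (p : ℝ) < (M + N : ℕ) := by
        rw [hN, hM]; push_cast; linarith [Nat.le_ceil h]
      exact_mod_cast h2
  set w : ℝ := h ^ (1 / ((K : ℝ) + 1)) with hw
  have hlw : log w = log h / (K + 1) := by
    rw [hw, log_rpow (by linarith)]; ring
  have hw0 : 0 < w := rpow_pos_of_pos (by linarith) _
  rw [le_div_iff₀ hlh]
  by_cases hw2 : 2 ≤ w
  · have hwK : w ^ K ≤ N := by
      refine le_trans ?_ hNh
      rw [hw, ← rpow_natCast, ← rpow_mul (by linarith)]
      calc h ^ (1 / ((K : ℝ) + 1) * K) ≤ h ^ (1 : ℝ) := by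
            refine rpow_le_rpow_of_exponent_le (by linarith) ?_
            rw [one_div_mul_eq_div, div_le_one (by positivity)]; linarith
        _ = h := rpow_one h
    obtain ⟨bad, hbad⟩ : ∃ bad : ℕ → ℕ → Prop, ∀ p m, bad p m ↔ p ∣ m := ⟨_, fun _ _ => Iff.rfl⟩
    have hcc : ∀ p ∈ primesIoc p₀ w, classCount bad p = 1 := by
      intro p hp
      have hpp := (mem_primesIoc.mp hp).1
      rw [classCount, Finset.card_eq_one]
      refine ⟨0, ?_⟩
      ext n
      simp only [mem_filter, mem_range, Finset.mem_singleton, hbad]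
      exact ⟨fun h => Nat.eq_zero_of_dvd_of_lt h.2 h.1, by rintro rfl; simp [hpp.pos]⟩
    have hs := (H w hw2 (primesIoc p₀ w) subset_rfl bad
      (fun p _ m => by rw [hbad, hbad, Nat.dvd_mod_iff dvd_rfl]) (fun p hp => (hcc p hp).le) M N hwK).2
    have he : ∏ p ∈ primesIoc p₀ w, (1 - (classCount bad p : ℝ) / p) =
        ∏ p ∈ primesIoc p₀ w, (1 - 1 / (p : ℝ)) :=
      prod_congr rfl (fun p hp => by rw [hcc p hp]; simp)
    rw [he] at hs
    have hsub2 : primesIoc u (u + h) ⊆ Ioc 0 ⌊w⌋₊ ∪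
        (Ico M (M + N)).filter (fun m => ∀ p ∈ primesIoc p₀ w, ¬ bad p m) := by
      intro q hq
      have hq' := mem_primesIoc.mp hq
      rw [mem_union, mem_Ioc, mem_filter]
      by_cases hqw : (q : ℝ) ≤ w
      · exact Or.inl ⟨hq'.1.pos, Nat.le_floor hqw⟩
      · refine Or.inr ⟨hsub hq, fun p hp hpq => hqw ?_⟩
        have hp' := mem_primesIoc.mp hp
        rw [(Nat.prime_dvd_prime_iff_eq hp'.1 hq'.1).mp ((hbad _ _).mp hpq)] at hp'
        exact hp'.2.2
    have hcard : ((primesIoc u (u + h)).card : ℝ) ≤ w +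
        ((Ico M (M + N)).filter (fun m => ∀ p ∈ primesIoc p₀ w, ¬ bad p m)).card := by
      have h1 := (card_le_card hsub2).trans (Finset.card_union_le _ _)
      rw [Nat.card_Ioc, Nat.sub_zero] at h1
      refine (Nat.cast_le.mpr h1).trans ?_
      push_cast
      linarith [Nat.floor_le hw0.le]
    have hp1 := hprod w hw2
    rw [hlw, div_div_eq_mul_div] at hp1
    have h3 : (N : ℝ) * ∏ p ∈ primesIoc p₀ w, (1 - 1 / (p : ℝ)) ≤
        2 * h * (C₁ * (K + 1) / log h) := by
      refine (mul_le_mul_of_nonneg_left hp1 (by positivity)).trans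
        (mul_le_mul_of_nonneg_right hN2 (by positivity))
    have h4 : w * log h ≤ 2 * h := by
      have e1 : w ≤ h ^ (1 / 2 : ℝ) := by
        refine rpow_le_rpow_of_exponent_le (by linarith) ?_
        have : (1 : ℝ) ≤ K := by exact_mod_cast hK
        exact one_div_le_one_div_of_le (by norm_num) (by linarith)
      have e2 : log h ≤ 2 * h ^ (1 / 2 : ℝ) := by
        have := log_le_rpow_div (by linarith : 0 ≤ h) (by norm_num : (0 : ℝ) < 1 / 2)
        linarith
      calc w * log h ≤ h ^ (1 / 2 : ℝ) * (2 * h ^ (1 / 2 : ℝ)) :=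
            mul_le_mul e1 e2 hlh.le (by positivity)
        _ = 2 * (h ^ (1 / 2 : ℝ) * h ^ (1 / 2 : ℝ)) := by ring
        _ = 2 * h := by rw [← rpow_add (by linarith)]; norm_num
    have h5 : ((primesIoc u (u + h)).card : ℝ) ≤ w + 2 * (2 * h * (C₁ * (K + 1) / log h)) := by
      linarith
    calc _ ≤ (w + 2 * (2 * h * (C₁ * (K + 1) / log h))) * log h :=
          mul_le_mul_of_nonneg_right h5 hlh.le
      _ = w * log h + 4 * h * (C₁ * (K + 1)) := by field_simp; ring
      _ ≤ 2 * h + 4 * h * (C₁ * (K + 1)) := by linarith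
      _ ≤ _ := by
          have : 0 ≤ 2 * ((K : ℝ) + 1) * h := by positivity
          nlinarith
  · have hlw2 : log h ≤ K + 1 := by
      have h1 : log w ≤ log 2 := log_le_log hw0 (not_le.mp hw2).le
      rw [hlw, div_le_iff₀ (by positivity)] at h1
      nlinarith [log_two_lt_d9]
    have h1 := card_le_card hsub
    rw [Nat.card_Ico, Nat.add_sub_cancel_left] at h1
    have h2 : ((primesIoc u (u + h)).card : ℝ) ≤ N := by exact_mod_cast h1
    calc _ ≤ (2 * h) * (K + 1) := mul_le_mul (h2.trans hN2) hlw2 hlh.le (by positivity)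
      _ ≤ _ := by
          have : 0 ≤ (2 + 4 * C₁ * ((K : ℝ) + 1)) * h := by positivity
          nlinarith

end sieve

section normForm

open Polynomial

variable {R : Type*} [CommRing R] {g : ℕ}

theorem norm_eq_prod_of_vandermonde (b : Module.Basis (Fin g) ℤ R) {θ : R} (hb : ∀ i, b i = θ ^ (i : ℕ)) (φ : Fin g → R →+* ℂ)
    (hφ : Function.Injective fun k => φ k θ) (A : R) :
    ((Algebra.norm ℤ A : ℤ) : ℂ) = ∏ k, φ k A := by
  set L := Algebra.leftMulMatrix b A with hL
  set W : Matrix (Fin g) (Fin g) ℂ := Matrix.vandermonde (fun k => φ k θ) with hW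
  have hWdet : W.det ≠ 0 := Matrix.det_vandermonde_ne_zero_iff.mpr hφ
  have hWb : ∀ k i, W k i = φ k (b i) := by
    intro k i
    rw [hb, hW, Matrix.vandermonde_apply, map_pow]
  have hmul : W * L.map (Int.castRingHom ℂ) = Matrix.diagonal (fun k => φ k A) * W := by
    ext k j
    rw [Matrix.mul_apply, Matrix.diagonal_mul, hWb, ← (φ k).map_mul]
    conv_rhs => rw [← b.sum_repr (A * b j)]
    rw [map_sum]
    refine sum_congr rfl (fun i _ => ?_)
    rw [hWb, Matrix.map_apply, hL, Algebra.leftMulMatrix_eq_repr_mul, zsmul_eq_mul, (φ k).map_mul,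
      map_intCast, mul_comm]
    simp
  have hdet := congrArg Matrix.det hmul
  rw [Matrix.det_mul, Matrix.det_mul, Matrix.det_diagonal, mul_comm] at hdet
  have h := mul_right_cancel₀ hWdet hdet
  rw [← h, Algebra.norm_eq_matrix_det b, ← RingHom.mapMatrix_apply, ← RingHom.map_det]
  rfl

theorem dvd_norm_of_map_eq_zero (b : Module.Basis (Fin g) ℤ R) {q : ℕ} (φ : R →+* ZMod q) {E : R} (hE : φ E = 0) :
    (q : ℤ) ∣ Algebra.norm ℤ E := by
  rw [← ZMod.intCast_zmod_eq_zero_iff_dvd, Algebra.norm_eq_matrix_det b]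
  set L := Algebra.leftMulMatrix b E with hL
  have h1 : ∀ x : R, φ (E * x) = 0 := fun x => by rw [map_mul, hE, zero_mul]
  have h2 : ∀ j, (L.det : ZMod q) * φ (b j) = 0 := by
    intro j
    have h3 : E * ∑ i, L.adjugate i j • b i = (L.det : ℤ) • b j := by
      apply b.repr.injective
      ext i
      rw [← Algebra.leftMulMatrix_mulVec_repr]
      have e : (⇑(b.repr (∑ i, L.adjugate i j • b i)) : Fin g → ℤ) = fun i => L.adjugate i j :=
        b.repr_sum_self _
      rw [e, ← hL]
      have h4 := congrFun (congrFun (Matrix.mul_adjugate L) i) j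
      rw [Matrix.mul_apply] at h4
      simp only [Matrix.mulVec, dotProduct, h4]
      simp [-zsmul_eq_mul, Finsupp.single_apply, Matrix.one_apply, eq_comm]
    have h5 := congrArg φ h3
    rw [h1, zsmul_eq_mul, map_mul, map_intCast] at h5
    exact h5.symm
  have h6 : (1 : ZMod q) = ∑ j, (b.repr 1 j : ZMod q) * φ (b j) := by
    conv_lhs => rw [← map_one φ, ← b.sum_repr 1]
    rw [map_sum]
    refine sum_congr rfl (fun j _ => ?_)
    rw [zsmul_eq_mul, map_mul, map_intCast]
  calc (L.det : ZMod q) = L.det * 1 := (mul_one _).symm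
    _ = ∑ j, (b.repr 1 j : ZMod q) * ((L.det : ZMod q) * φ (b j)) := by
        rw [h6, mul_sum]
        exact sum_congr rfl (fun j _ => by ring)
    _ = 0 := sum_eq_zero (fun j _ => by rw [h2, mul_zero])

theorem exists_mul_eq_norm (b : Module.Basis (Fin g) ℤ R) (A : R) : ∃ B : R, A * B = (Algebra.norm ℤ A : ℤ) := by
  rw [Algebra.norm_eq_matrix_det b]
  set L := Algebra.leftMulMatrix b A with hL
  refine ⟨∑ i, (L.adjugate.mulVec (b.repr 1)) i • b i, ?_⟩
  apply b.repr.injective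
  ext i
  rw [← Algebra.leftMulMatrix_mulVec_repr]
  have e : (⇑(b.repr (∑ i, (L.adjugate.mulVec (b.repr 1)) i • b i)) : Fin g → ℤ) =
      L.adjugate.mulVec (b.repr 1) := b.repr_sum_self _
  have e2 : ((L.det : ℤ) : R) = L.det • (1 : R) := by simp
  rw [e, ← hL, Matrix.mulVec_mulVec, Matrix.mul_adjugate, e2, map_smul, Matrix.smul_mulVec,
    Matrix.one_mulVec]
  simp

/-- The index form: the determinant of the coordinates of the powers of `γ`. -/
noncomputable def powerIndex (b : Module.Basis (Fin g) ℤ R) (γ : R) : ℤ := (b.toMatrix (fun j : Fin g => γ ^ (j : ℕ))).det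

theorem powerIndex_mul_det_vandermonde (b : Module.Basis (Fin g) ℤ R) {θ : R} (hb : ∀ i, b i = θ ^ (i : ℕ))
    (φ : Fin g → R →+* ℂ) (γ : R) :
    (Matrix.vandermonde (fun k => φ k θ)).det * (powerIndex b γ : ℂ) =
      (Matrix.vandermonde (fun k => φ k γ)).det := by
  have hmul : Matrix.vandermonde (fun k => φ k θ) *
      (b.toMatrix (fun j : Fin g => γ ^ (j : ℕ))).map (Int.castRingHom ℂ) =
      Matrix.vandermonde (fun k => φ k γ) := by
    ext k j
    rw [Matrix.mul_apply, Matrix.vandermonde_apply, ← map_pow]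
    conv_rhs => rw [← b.sum_repr (γ ^ (j : ℕ))]
    rw [map_sum]
    refine sum_congr rfl (fun i _ => ?_)
    rw [Matrix.vandermonde_apply, Matrix.map_apply, Module.Basis.toMatrix_apply, zsmul_eq_mul,
      (φ k).map_mul, map_intCast, mul_comm, hb, (φ k).map_pow]
    simp
  have hdet := congrArg Matrix.det hmul
  rw [Matrix.det_mul] at hdet
  rw [← hdet, powerIndex, ← RingHom.mapMatrix_apply, ← RingHom.map_det]
  simp

theorem exists_aeval_eq_powerIndex_smul (b : Module.Basis (Fin g) ℤ R) (γ x : R) :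
    ∃ G : ℤ[X], aeval γ G = (powerIndex b γ : R) * x := by
  set P := b.toMatrix (fun j : Fin g => γ ^ (j : ℕ)) with hP
  set c := P.adjugate.mulVec (b.repr x) with hc
  refine ⟨∑ j : Fin g, C (c j) * X ^ (j : ℕ), ?_⟩
  have e1 : aeval γ (∑ j : Fin g, C (c j) * X ^ (j : ℕ)) = ∑ j : Fin g, c j • γ ^ (j : ℕ) := by
    simp
  have e2 : (powerIndex b γ : R) * x = P.det • x := by
    rw [zsmul_eq_mul]; rfl
  rw [e1, e2]
  apply b.repr.injective
  ext i
  have h := congrFun (show P.mulVec c = P.det • (b.repr x : Fin g → ℤ) by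
    rw [hc, Matrix.mulVec_mulVec, Matrix.mul_adjugate, Matrix.smul_mulVec, Matrix.one_mulVec]) i
  rw [map_smul, map_sum]
  simp only [Matrix.mulVec, dotProduct, Pi.smul_apply] at h
  rw [Finsupp.smul_apply, ← h, Finsupp.finsetSum_apply]
  refine sum_congr rfl (fun j _ => ?_)
  rw [map_smul, Finsupp.smul_apply, hP, Module.Basis.toMatrix_apply, smul_eq_mul, mul_comm]

theorem norm_dvd_of_dvd_intCast (b : Module.Basis (Fin g) ℤ R) {θ : R} (hb : ∀ i, b i = θ ^ (i : ℕ)) (hg : 0 < g) {A : R} {μ : ℤ}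
    (hμ : A ∣ θ - (μ : R)) {n : ℤ} (hn : A ∣ (n : R)) : Algebra.norm ℤ A ∣ n := by
  set z : Fin g := ⟨0, hg⟩ with hz
  have hbz : b z = 1 := by rw [hb]; simp [hz]
  set t : Fin g → R := fun j => if j = z then (n : R) else b j - ((μ ^ (j : ℕ) : ℤ) : R) with ht
  have hdvd : ∀ j, ∃ s, t j = A * s := by
    intro j
    by_cases hj : j = z
    · obtain ⟨s, hs⟩ := hn
      exact ⟨s, by simp [ht, hj, hs]⟩
    · obtain ⟨s, hs⟩ := hμ.trans (sub_dvd_pow_sub_pow θ (μ : R) (j : ℕ))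
      exact ⟨s, by simp [ht, hj, hb, hs]⟩
  choose s hs using hdvd
  have hT : b.toMatrix t = Algebra.leftMulMatrix b A * b.toMatrix s := by
    ext i j
    rw [Module.Basis.toMatrix_apply, hs, ← Algebra.leftMulMatrix_mulVec_repr, Matrix.mul_apply]
    rfl
  have hrepr : ∀ m : ℤ, b.repr (m : R) = Finsupp.single z m := by
    intro m
    have : (m : R) = m • b z := by rw [hbz]; simp
    rw [this, map_smul, b.repr_self, Finsupp.smul_single, smul_eq_mul, mul_one]
  have hdet : (b.toMatrix t).det = n := by
    rw [Matrix.det_of_isUpperTriangular]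
    · rw [Finset.prod_eq_single z]
      · rw [Module.Basis.toMatrix_apply, ht]
        simp only [if_true]
        rw [hrepr]; simp
      · intro j _ hj
        rw [Module.Basis.toMatrix_apply, ht]
        simp only [if_neg hj]
        rw [map_sub, hrepr, b.repr_self]
        simp [Ne.symm hj]
      · simp
    · intro i j hij
      have hij' : j < i := hij
      have hiz : i ≠ z := by
        rintro rfl
        exact absurd hij' (by simp [hz, Fin.lt_def])
      rw [Module.Basis.toMatrix_apply, ht]
      by_cases hj : j = z
      · simp only [if_pos hj]
        rw [hrepr]; simp [Ne.symm hiz]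
      · simp only [if_neg hj]
        rw [map_sub, hrepr, b.repr_self]
        simp [Ne.symm hiz, hij'.ne]
  rw [hT, Matrix.det_mul, ← Algebra.norm_eq_matrix_det b] at hdet
  exact ⟨_, hdet.symm⟩

theorem exists_root_of_isCoprime_powerIndex (b : Module.Basis (Fin g) ℤ R) {θ : R} (hb : ∀ i, b i = θ ^ (i : ℕ)) (hg : 0 < g)
    (a : ℤ) (γ : R) (hco : IsCoprime (Algebra.norm ℤ ((a : R) + γ)) (powerIndex b γ)) :
    ∃ μ : ℤ, ∀ h : ℤ[X], ((a : R) + γ) ∣ aeval θ h →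
      Algebra.norm ℤ ((a : R) + γ) ∣ h.eval μ := by
  set A : R := (a : R) + γ with hA
  obtain ⟨u, v, huv⟩ := hco
  obtain ⟨G, hG⟩ := exists_aeval_eq_powerIndex_smul b γ θ
  obtain ⟨B, hB⟩ := exists_mul_eq_norm b A
  have hev : ∀ (x : R) (m : ℤ) (h : ℤ[X]), A ∣ x - (m : R) → A ∣ aeval x h - ((h.eval m : ℤ) : R) := by
    intro x m h hx
    have e : ((h.eval m : ℤ) : R) = aeval (m : R) h := by
      have := Polynomial.aeval_algebraMap_apply R m h
      simpa using this.symm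
    rw [e]
    exact hx.trans (by simpa [aeval_def, eval₂_eq_eval_map] using
      Polynomial.sub_dvd_eval_sub x (m : R) (h.map (algebraMap ℤ R)))
  have hγ : A ∣ γ - ((-a : ℤ) : R) := by
    push_cast; rw [hA]; exact dvd_of_eq (by ring)
  have hGd := hev γ (-a) G hγ
  rw [hG] at hGd
  refine ⟨v * G.eval (-a), fun h hh => ?_⟩
  have hμ : A ∣ θ - ((v * G.eval (-a) : ℤ) : R) := by
    have e : θ - ((v * G.eval (-a) : ℤ) : R) =
        (u : R) * θ * (A * B) + v * ((powerIndex b γ : R) * θ - ((G.eval (-a) : ℤ) : R)) := by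
      have h1 : ((u * Algebra.norm ℤ A + v * powerIndex b γ : ℤ) : R) = 1 := by rw [huv]; simp
      push_cast at h1 ⊢
      rw [hB]
      linear_combination -θ * h1
    rw [e]
    exact dvd_add ((dvd_mul_right A B).mul_left _) (hGd.mul_left _)
  refine norm_dvd_of_dvd_intCast b hb hg hμ ?_
  have h2 := hev θ _ h hμ
  exact (dvd_sub_right hh).mp h2

theorem exists_common_root_of_dvd_norm (b : Module.Basis (Fin g) ℤ R) {θ : R} {f : ℤ[X]} (hf : aeval θ f = 0) {p : ℕ}
    [Fact p.Prime] {a : ℤ[X]} (hp : (p : ℤ) ∣ Algebra.norm ℤ (aeval θ a)) :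
    ∃ α : AlgebraicClosure (ZMod p), aeval α f = 0 ∧ aeval α a = 0 := by
  by_contra hcon
  push Not at hcon
  have hco : IsCoprime (f.map (Int.castRingHom (ZMod p))) (a.map (Int.castRingHom (ZMod p))) := by
    rw [Polynomial.isCoprime_iff_aeval_ne_zero_of_isAlgClosed (ZMod p) (AlgebraicClosure (ZMod p))]
    intro α
    have e : ∀ h : ℤ[X], aeval α (h.map (Int.castRingHom (ZMod p))) = aeval α h := fun h => by
      have := Polynomial.aeval_map_algebraMap (ZMod p) α h
      simpa using this
    rw [e, e]
    by_cases h : aeval α f = 0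
    · exact Or.inr (hcon α h)
    · exact Or.inl h
  obtain ⟨U, V, hUV⟩ := hco
  obtain ⟨U, rfl⟩ := Polynomial.map_surjective _ (ZMod.ringHom_surjective (Int.castRingHom (ZMod p))) U
  obtain ⟨V, rfl⟩ := Polynomial.map_surjective _ (ZMod.ringHom_surjective (Int.castRingHom (ZMod p))) V
  have h0 : ((U * f + V * a - 1).map (Int.castRingHom (ZMod p))) = 0 := by
    simp only [Polynomial.map_sub, Polynomial.map_add, Polynomial.map_mul, Polynomial.map_one]
    rw [hUV, sub_self]
  have hdvd : C (p : ℤ) ∣ U * f + V * a - 1 := by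
    rw [Polynomial.C_dvd_iff_dvd_coeff]
    intro i
    have := congrArg (fun h => Polynomial.coeff h i) h0
    simp only [Polynomial.coeff_map, Polynomial.coeff_zero] at this
    exact (ZMod.intCast_zmod_eq_zero_iff_dvd _ p).mp this
  obtain ⟨W, hW⟩ := hdvd
  have h1 := congrArg (aeval θ) hW
  simp only [map_sub, map_add, map_mul, map_one, hf, mul_zero, zero_add, aeval_C] at h1
  have h2 : aeval θ V * aeval θ a = 1 + (p : R) * aeval θ W := by
    have : (algebraMap ℤ R) (p : ℤ) = (p : R) := by simp
    rw [this] at h1; linear_combination h1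
  have h3 := congrArg (Algebra.norm ℤ) h2
  rw [map_mul] at h3
  have h4 : (p : ℤ) ∣ Algebra.norm ℤ (1 + (p : R) * aeval θ W) - 1 := by
    rw [Algebra.norm_eq_matrix_det b, ← ZMod.intCast_zmod_eq_zero_iff_dvd, Int.cast_sub,
      show (((Algebra.leftMulMatrix b (1 + (p : R) * aeval θ W)).det : ℤ) : ZMod p) =
        Int.castRingHom (ZMod p) _ from rfl, RingHom.map_det, map_add, map_mul, map_one]
    have : (Algebra.leftMulMatrix b) ((p : ℕ) : R) = (p : Matrix (Fin g) (Fin g) ℤ) := by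
      rw [map_natCast]
    rw [this, map_add, map_one, map_mul, map_natCast,
      ← map_natCast (algebraMap (ZMod p) (Matrix (Fin g) (Fin g) (ZMod p))), CharP.cast_eq_zero,
      map_zero, zero_mul, add_zero, Matrix.det_one]
    simp
  have h5 : (p : ℤ) ∣ 1 := by
    have h6 := hp.mul_left (Algebra.norm ℤ (aeval θ V))
    rw [h3] at h6
    exact (dvd_sub_right h6).mp h4
  exact (Nat.Prime.one_lt Fact.out).ne' (Nat.dvd_one.mp (by exact_mod_cast h5))

end normForm

section sieveNorm

open Polynomial

variable {R : Type*} [CommRing R] {g : ℕ}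

theorem norm_intCast_add_eq_eval (b : Module.Basis (Fin g) ℤ R) (γ : R) (a : ℤ) :
    Algebra.norm ℤ ((a : R) + γ) = (-(Algebra.leftMulMatrix b γ)).charpoly.eval a := by
  rw [Algebra.norm_eq_matrix_det b, Matrix.eval_charpoly, map_add, map_intCast, sub_neg_eq_add]
  congr 2

/-- the condition that `p` divides the norm of `1 + Q₀ m + γ` -/
def DvdNorm (Q₀ : ℕ) (γ : R) (p m : ℕ) : Prop :=
  (p : ℤ) ∣ Algebra.norm ℤ (((1 + Q₀ * m : ℤ) : R) + γ)

theorem dvdNorm_mod_iff (b : Module.Basis (Fin g) ℤ R) (Q₀ : ℕ) (γ : R) (p m : ℕ) :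
    DvdNorm Q₀ γ p (m % p) ↔ DvdNorm Q₀ γ p m := by
  rw [DvdNorm, DvdNorm, norm_intCast_add_eq_eval b, norm_intCast_add_eq_eval b]
  refine dvd_iff_dvd_of_dvd_sub ((?_ : (p : ℤ) ∣ _).trans (Polynomial.sub_dvd_eval_sub _ _ _))
  have h : (p : ℤ) ∣ ((m % p : ℕ) : ℤ) - m := by
    rw [Int.natCast_mod]
    exact Int.ModEq.dvd (Int.mod_modEq _ _).symm
  have e : (1 + Q₀ * ((m % p : ℕ) : ℤ) : ℤ) - (1 + Q₀ * m) = Q₀ * (((m % p : ℕ) : ℤ) - m) := by ring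
  rw [e]
  exact h.mul_left _

theorem natCast_inj_of_lt {F : Type*} [Field F] {p : ℕ} [CharP F p] {m m' : ℕ} (hm : m < p)
    (hm' : m' < p) (h : (m : F) = m') : m = m' := by
  have := (CharP.natCast_eq_natCast F p).mp h
  rwa [Nat.ModEq, Nat.mod_eq_of_lt hm, Nat.mod_eq_of_lt hm'] at this

theorem classCount_norm_le (b : Module.Basis (Fin g) ℤ R) (Q₀ : ℕ) (γ : R) {p : ℕ}
    (hp : p.Prime) (hQ : ¬ p ∣ Q₀) :
    classCount (DvdNorm Q₀ γ) p ≤ g := by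
  have : Fact p.Prime := ⟨hp⟩
  have hQ' : (Q₀ : ZMod p) ≠ 0 := by rwa [Ne, ZMod.natCast_eq_zero_iff]
  set H := (-(Algebra.leftMulMatrix b γ)).charpoly with hH
  have hmon : H.Monic := Matrix.charpoly_monic _
  have hdeg : H.natDegree = g := by
    rw [hH, Matrix.charpoly_natDegree_eq_dim, Fintype.card_fin]
  set H' := H.map (Int.castRingHom (ZMod p)) with hH'
  have h0 : H' ≠ 0 := (hmon.map _).ne_zero
  have hc : H'.roots.toFinset.card ≤ g := by
    refine (Multiset.toFinset_card_le _).trans ((Polynomial.card_roots' _).trans ?_)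
    rw [hH', hmon.natDegree_map, hdeg]
  refine le_trans ?_ hc
  refine card_le_card_of_injOn (fun m => (1 + Q₀ * m : ZMod p)) ?_ ?_
  · intro m hm
    have hm := (mem_filter.mp hm).2
    rw [DvdNorm, norm_intCast_add_eq_eval b, ← hH, ← ZMod.intCast_zmod_eq_zero_iff_dvd] at hm
    have : (1 + Q₀ * m : ZMod p) = Int.castRingHom (ZMod p) (1 + Q₀ * m) := by simp
    simp only [Finset.mem_coe, Multiset.mem_toFinset, Polynomial.mem_roots h0, Polynomial.IsRoot]
    rw [this, hH', Polynomial.eval_map_apply]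
    exact hm
  · intro m hm m' hm' h
    have hm := mem_range.mp (mem_filter.mp hm).1
    have hm' := mem_range.mp (mem_filter.mp hm').1
    exact natCast_inj_of_lt (F := ZMod p) hm hm' (mul_left_cancel₀ hQ' (add_left_cancel h))

theorem card_filter_Ico_mod_eq_le {p : ℕ} (hp : 0 < p) (c o M : ℕ) :
    (((Ico o (o + M)).filter (fun v => v % p = c)).card : ℝ) ≤ M / p + 1 := by
  have h := abs_card_filter_Ico_sub_le hp (Q := fun v => v % p = c) (by simp) o M
  have h1 : ((range p).filter (fun v => v % p = c)).card ≤ 1 := by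
    rw [Finset.card_le_one]
    intro a ha a' ha'
    simp only [mem_filter, mem_range] at ha ha'
    rw [Nat.mod_eq_of_lt ha.1] at ha
    rw [Nat.mod_eq_of_lt ha'.1] at ha'
    exact ha.2.trans ha'.2.symm
  have h1' : (((range p).filter (fun v => v % p = c)).card : ℝ) ≤ 1 := by exact_mod_cast h1
  have h2 : (((Ico o (o + M)).filter (fun v => v % p = c)).card : ℝ) -
      M * (((range p).filter (fun v => v % p = c)).card / p) ≤
      ((range p).filter (fun v => v % p = c)).card := by
    refine le_of_eq_of_le ?_ ((abs_le.mp h).2.trans (le_of_eq ?_)) <;> congr!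
  have h3 : (M : ℝ) * (((range p).filter (fun v => v % p = c)).card / p) ≤ M / p := by
    rw [div_eq_mul_one_div (M : ℝ)]
    gcongr
  linarith

theorem sum_classCount_norm_le (b : Module.Basis (Fin g) ℤ R) {θ : R} {f : ℤ[X]}
    (hfm : f.Monic) (hfg : f.natDegree = g) (hf : aeval θ f = 0) (Q₀ : ℕ) (τ : ℤ[X]) (o M : ℕ)
    {p : ℕ} [hp : Fact p.Prime] (hQ : ¬ p ∣ Q₀) :
    (∑ v ∈ Ico o (o + M),
        (classCount (DvdNorm Q₀ (aeval θ (C ((Q₀ * v : ℕ) : ℤ) * X + τ))) p : ℝ)) ≤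
      M * (f.map (Int.castRingHom (ZMod p))).roots.toFinset.card + g * (M / p + 1) := by
  set Ω := AlgebraicClosure (ZMod p) with hΩ
  have hQ' : (Q₀ : Ω) ≠ 0 := by rwa [Ne, CharP.cast_eq_zero_iff Ω p]
  set fΩ := f.map (Int.castRingHom Ω) with hfΩ
  have hfΩ0 : fΩ ≠ 0 := (hfm.map _).ne_zero
  set A : Finset Ω := fΩ.roots.toFinset with hA
  have hAc : A.card ≤ g := by
    refine (Multiset.toFinset_card_le _).trans ((Polynomial.card_roots' _).trans ?_)
    rw [hfΩ, hfm.natDegree_map, hfg]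
  set B := (f.map (Int.castRingHom (ZMod p))).roots.toFinset with hB
  set ι := algebraMap (ZMod p) Ω with hι
  have hAB : (A.filter (· ∈ Set.range ι)).card ≤ B.card := by
    have : A.filter (· ∈ Set.range ι) ⊆ B.image ι := by
      intro α hα
      obtain ⟨hα1, x, rfl⟩ := mem_filter.mp hα
      rw [mem_image]
      refine ⟨x, ?_, rfl⟩
      rw [hB, Multiset.mem_toFinset, Polynomial.mem_roots (hfm.map _).ne_zero]
      rw [hA, Multiset.mem_toFinset, Polynomial.mem_roots hfΩ0] at hα1
      have e : fΩ = (f.map (Int.castRingHom (ZMod p))).map ι := by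
        rw [Polynomial.map_map, hfΩ]; congr 1
      rw [Polynomial.IsRoot, e, Polynomial.eval_map_apply, map_eq_zero] at hα1
      exact hα1
    exact (card_le_card this).trans Finset.card_image_le
  set S : Ω → Finset (ℕ × ℕ) := fun α => (Ico o (o + M) ×ˢ range p).filter
    (fun x => (1 : Ω) + Q₀ * x.2 + Q₀ * x.1 * α + aeval α τ = 0) with hS
  have hSinj : ∀ α, Set.InjOn Prod.fst (S α : Set (ℕ × ℕ)) := by
    intro α x hx x' hx' h
    simp only [hS, coe_filter, mem_product, mem_Ico, mem_range,
      Set.mem_ofPred_eq] at hx hx'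
    refine Prod.ext h (natCast_inj_of_lt (F := Ω) hx.1.2 hx'.1.2 (mul_left_cancel₀ hQ' ?_))
    have e := hx.2.trans hx'.2.symm
    rw [h] at e
    linear_combination e
  have hS1 : ∀ α, ((S α).card : ℝ) ≤ M := by
    intro α
    have := card_le_card_of_injOn (s := S α) (t := Ico o (o + M)) Prod.fst
      (fun x hx => (mem_product.mp (mem_filter.mp hx).1).1) (hSinj α)
    rw [Nat.card_Ico] at this
    exact_mod_cast this.trans (by omega)
  have hS2 : ∀ α, α ∉ Set.range ι → ((S α).card : ℝ) ≤ M / p + 1 := by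
    intro α hα
    obtain hemp | ⟨x₀, hx₀⟩ := (S α).eq_empty_or_nonempty
    · rw [hemp, Finset.card_empty, Nat.cast_zero]; positivity
    have := card_le_card_of_injOn (s := S α)
      (t := (Ico o (o + M)).filter (fun v => v % p = x₀.1 % p)) Prod.fst (fun x hx => by
        refine mem_filter.mpr ⟨(mem_product.mp (mem_filter.mp hx).1).1, ?_⟩
        have e := (mem_filter.mp hx).2.trans (mem_filter.mp hx₀).2.symm
        by_contra hne
        have hne' : (x.1 : ZMod p) - x₀.1 ≠ 0 := by
          rw [sub_ne_zero, Ne, ZMod.natCast_eq_natCast_iff']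
          exact hne
        refine hα ⟨((x₀.2 : ZMod p) - x.2) / (x.1 - x₀.1), ?_⟩
        have hne'' := (map_ne_zero ι).mpr hne'
        rw [map_sub, map_natCast, map_natCast] at hne''
        rw [map_div₀, map_sub, map_sub, map_natCast, map_natCast, map_natCast, map_natCast,
          div_eq_iff hne'']
        refine mul_left_cancel₀ hQ' ?_
        linear_combination -e) (hSinj α)
    exact (Nat.cast_le.mpr this).trans (card_filter_Ico_mod_eq_le hp.out.pos _ _ _)
  have hmain : (∑ v ∈ Ico o (o + M),
      classCount (DvdNorm Q₀ (aeval θ (C ((Q₀ * v : ℕ) : ℤ) * X + τ))) p) ≤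
      ∑ α ∈ A, (S α).card := by
    refine le_trans (le_of_eq ?_) ((card_le_card
      (s := (Ico o (o + M) ×ˢ range p).filter
        (fun x => DvdNorm Q₀ (aeval θ (C ((Q₀ * x.1 : ℕ) : ℤ) * X + τ)) p x.2)) ?_).trans
          Finset.card_biUnion_le)
    · rw [Finset.card_filter, Finset.sum_product]
      exact sum_congr rfl (fun v _ => Finset.card_filter _ _)
    · intro x hx
      obtain ⟨hx1, hx2⟩ := mem_filter.mp hx
      have e : (((1 + Q₀ * x.2 : ℤ) : R) + aeval θ (C ((Q₀ * x.1 : ℕ) : ℤ) * X + τ)) =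
          aeval θ (C (1 + Q₀ * x.2 : ℤ) + (C ((Q₀ * x.1 : ℕ) : ℤ) * X + τ)) := by simp
      rw [DvdNorm, e] at hx2
      obtain ⟨α, h1, h2⟩ := exists_common_root_of_dvd_norm b hf hx2
      refine mem_biUnion.mpr ⟨α, ?_, mem_filter.mpr ⟨hx1, ?_⟩⟩
      · rw [hA, Multiset.mem_toFinset, Polynomial.mem_roots hfΩ0, Polynomial.IsRoot, hfΩ,
          Polynomial.eval_map]
        exact h1
      · rw [← h2]; simp; ring
  have hcast : (∑ v ∈ Ico o (o + M),
      (classCount (DvdNorm Q₀ (aeval θ (C ((Q₀ * v : ℕ) : ℤ) * X + τ))) p : ℝ)) ≤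
      ∑ α ∈ A, ((S α).card : ℝ) := by exact_mod_cast hmain
  refine hcast.trans ?_
  rw [← Finset.sum_filter_add_sum_filter_not A (· ∈ Set.range ι)]
  refine add_le_add ?_ ?_
  · refine (sum_le_card_nsmul _ _ _ (fun α _ => hS1 α)).trans ?_
    rw [nsmul_eq_mul, mul_comm]
    gcongr
  · refine (sum_le_card_nsmul _ _ _ (fun α hα => hS2 α (mem_filter.mp hα).2)).trans ?_
    rw [nsmul_eq_mul]
    gcongr
    exact (Finset.card_filter_le _ _).trans hAc

end sieveNorm

section sieveAverage

open Polynomial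

theorem exp_neg_add_sq_le_one_sub {t : ℝ} (h0 : 0 ≤ t) (h1 : t ≤ 1 / 2) :
    exp (-(t + t ^ 2)) ≤ 1 - t := by
  have h2 := Real.quadratic_le_exp_of_nonneg (x := t + t ^ 2) (by positivity)
  have h4 : 0 ≤ 1 - t := by linarith
  have h3 : 1 ≤ (1 - t) * exp (t + t ^ 2) := by
    refine le_trans ?_ (mul_le_mul_of_nonneg_left h2 h4)
    have h5 : 0 ≤ t ^ 2 * (1 - t - t ^ 2 - t ^ 3) := by
      refine mul_nonneg (sq_nonneg t) ?_
      have h6 : t ^ 2 ≤ 1 / 4 := by nlinarith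
      have h7 : t ^ 3 ≤ 1 / 8 := by nlinarith
      linarith
    nlinarith
  rw [exp_neg, inv_le_iff_one_le_mul₀ (exp_pos _)]
  exact h3

theorem sum_inv_sq_primesIoc_le (u v : ℝ) : ∑ p ∈ primesIoc u v, 1 / (p : ℝ) ^ 2 ≤ 2 := by
  have h := sum_Ioo_inv_sq_le (α := ℝ) 0 (⌊v⌋₊ + 1)
  norm_num at h
  simp only [one_div]
  refine (sum_le_sum_of_subset_of_nonneg (fun p hp => ?_)
    (fun i _ _ => by positivity)).trans h
  rw [mem_primesIoc] at hp
  have := hp.1.pos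
  have h2 := Nat.le_floor hp.2.2
  exact Finset.mem_Ioo.mpr ⟨this, by omega⟩

/-- Jensen's inequality for the exponential, with a bound for the average. -/
theorem card_mul_exp_neg_le_sum {ι : Type*} (s : Finset ι) (X : ι → ℝ) (B : ℝ)
    (h : ∑ i ∈ s, X i ≤ s.card * B) :
    s.card * exp (-B) ≤ ∑ i ∈ s, exp (-X i) := by
  have h1 : ∀ i ∈ s, exp (-B) * (1 + B - X i) ≤ exp (-X i) := by
    intro i _
    have h2 : exp (-X i) = exp (-B) * exp (B - X i) := by
      rw [← exp_add]; ring_nf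
    rw [h2]
    gcongr
    linarith [add_one_le_exp (B - X i)]
  refine le_trans ?_ (sum_le_sum h1)
  rw [← mul_sum, sum_sub_distrib, sum_const, nsmul_eq_mul, mul_comm]
  gcongr
  linarith

theorem exists_sum_card_sieve_ge {F : ℤ[X]} (hF : Irreducible F) (hdeg : F.natDegree ≠ 0)
    {R : Type*} [CommRing R] (b : Module.Basis (Fin F.natDegree) ℤ R) {θ : R}
    (hf : aeval θ F.integralNormalization = 0) :
    ∃ p₁ K : ℕ, ∃ c : ℝ, 0 < c ∧ 2 ≤ p₁ ∧ F.leadingCoeff.natAbs ≤ p₁ ∧ 1 ≤ K ∧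
      ∀ w : ℝ, 2 ≤ w → ∀ Q₀ M N o : ℕ, w ≤ M → w ^ K ≤ N →
      (∀ p : ℕ, p.Prime → p₁ < p → ¬ p ∣ Q₀) → ∀ τ : ℤ[X], ∀ s : ℕ → ℕ,
      c * N * M / log w ≤ ∑ v ∈ Ico o (o + M),
        ((((Ico (s v) (s v + N)).filter (fun m => ∀ p ∈ primesIoc p₁ w,
          ¬ DvdNorm Q₀ (aeval θ (C ((Q₀ * v : ℕ) : ℤ) * X + τ)) p m)).card : ℕ) : ℝ) := by
  set g := F.natDegree with hg
  obtain ⟨p₀, K, hp₀, hK, hsieve⟩ := exists_sieve_bounds g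
  obtain ⟨C₀, hC₀⟩ := exists_sum_rootCount_div_sub_loglog_le hF hdeg
  have hF0 : F ≠ 0 := hF.ne_zero
  set p₁ := max p₀ (max F.leadingCoeff.natAbs (2 * g)) with hp₁
  have hp₁0 : p₀ ≤ p₁ := le_max_left _ _
  have hp₁1 : F.leadingCoeff.natAbs ≤ p₁ := (le_max_left _ _).trans (le_max_right _ _)
  have hp₁2 : 2 * g ≤ p₁ := (le_max_right _ _).trans (le_max_right _ _)
  refine ⟨p₁, K, 1 / 2 * exp (-(2 * g ^ 2 + (C₀ + 2 * g + 18 * g))), by positivity, by omega,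
    hp₁1, hK, ?_⟩
  intro w hw Q₀ M N o hM hN hQ τ s
  set P := primesIoc p₁ w with hP
  have hPp : ∀ p ∈ P, p.Prime ∧ p₁ < p ∧ (p : ℝ) ≤ w := by
    intro p hp
    rw [hP, mem_primesIoc] at hp
    exact ⟨hp.1, by exact_mod_cast hp.2.1, hp.2.2⟩
  obtain ⟨γ, hγ⟩ : ∃ γ : ℕ → R, ∀ v, γ v = aeval θ (C ((Q₀ * v : ℕ) : ℤ) * X + τ) :=
    ⟨_, fun _ => rfl⟩
  simp only [← hγ]
  have hcc : ∀ v, ∀ p ∈ P, classCount (DvdNorm Q₀ (γ v)) p ≤ g := fun v p hp =>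
    classCount_norm_le b Q₀ _ (hPp p hp).1 (hQ p (hPp p hp).1 (hPp p hp).2.1)
  set X : ℕ → ℝ := fun v => ∑ p ∈ P, (classCount (DvdNorm Q₀ (γ v)) p : ℝ) / p with hX
  have hlogw : 0 < log w := log_pos (by linarith)
  have hsum2 : ∑ p ∈ P, (1 : ℝ) / (p : ℝ) ^ 2 ≤ 2 := sum_inv_sq_primesIoc_le _ _
  have hlow : ∀ v, 1 / 2 * N * exp (-(2 * (g : ℝ) ^ 2)) * exp (-X v) ≤
      ((((Ico (s v) (s v + N)).filter (fun m => ∀ p ∈ P,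
          ¬ DvdNorm Q₀ (γ v) p m)).card : ℕ) : ℝ) := by
    intro v
    refine le_trans ?_ (hsieve w hw P (primesIoc_subset (by exact_mod_cast hp₁0) le_rfl)
      (DvdNorm Q₀ (γ v)) (fun p _ m => dvdNorm_mod_iff b _ _ _ _) (hcc v) (s v) N hN).1
    rw [mul_assoc, mul_assoc, ← exp_add]
    gcongr
    have h1 : exp (∑ p ∈ P, -((classCount (DvdNorm Q₀ (γ v)) p : ℝ) / p +
        ((classCount (DvdNorm Q₀ (γ v)) p : ℝ) / p) ^ 2)) ≤
        ∏ p ∈ P, (1 - (classCount (DvdNorm Q₀ (γ v)) p : ℝ) / p) := by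
      rw [exp_sum]
      refine prod_le_prod (fun p _ => (exp_pos _).le) (fun p hp => ?_)
      refine exp_neg_add_sq_le_one_sub (by positivity) ?_
      have h2 := (hPp p hp).2.1
      rw [div_le_div_iff₀ (by exact_mod_cast (hPp p hp).1.pos) two_pos]
      have h3 := hcc v p hp
      have : classCount (DvdNorm Q₀ (γ v)) p * 2 ≤ 1 * p := by omega
      exact_mod_cast this
    refine le_trans ?_ h1
    gcongr
    rw [Finset.sum_neg_distrib, sum_add_distrib, neg_add, add_comm]
    have h4 : ∑ p ∈ P, ((classCount (DvdNorm Q₀ (γ v)) p : ℝ) / p) ^ 2 ≤ 2 * (g : ℝ) ^ 2 := by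
      calc _ ≤ ∑ p ∈ P, (g : ℝ) ^ 2 * (1 / (p : ℝ) ^ 2) := by
            refine sum_le_sum (fun p hp => ?_)
            rw [div_pow, mul_one_div]
            have := hcc v p hp
            gcongr
        _ ≤ 2 * (g : ℝ) ^ 2 := by
            rw [← mul_sum]; nlinarith [sq_nonneg (g : ℝ)]
    rw [hX]; linarith
  have hav : ∑ v ∈ Ico o (o + M), X v ≤
      (Ico o (o + M)).card * (log (log w) + (C₀ + 2 * g + 18 * g)) := by
    rw [Nat.card_Ico, Nat.add_sub_cancel_left, hX, sum_comm]
    have h1 : ∀ p ∈ P, ∑ v ∈ Ico o (o + M), (classCount (DvdNorm Q₀ (γ v)) p : ℝ) / p ≤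
        M * ((rootCount F p : ℝ) / p) + g * M * (1 / (p : ℝ) ^ 2) + g * (1 / (p : ℝ)) := by
      intro p hp
      obtain ⟨hpp, hp1, -⟩ := hPp p hp
      have : Fact p.Prime := ⟨hpp⟩
      have hlc : ¬ (p : ℤ) ∣ F.leadingCoeff := by
        intro h
        have := Nat.le_of_dvd (Int.natAbs_pos.mpr (leadingCoeff_ne_zero.mpr hF0))
          (Int.natCast_dvd.mp h)
        omega
      have h2 := sum_classCount_norm_le b (monic_integralNormalization hF0)
        (natDegree_integralNormalization) hf Q₀ τ o M (p := p) (hQ p hpp hp1)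
      rw [card_roots_integralNormalization F (Nat.one_le_iff_ne_zero.mpr hdeg) hlc] at h2
      simp only [← hγ] at h2
      rw [← sum_div]
      have hp0 : (0 : ℝ) < p := by exact_mod_cast hpp.pos
      refine (div_le_div_of_nonneg_right h2 hp0.le).trans (le_of_eq ?_)
      field_simp
      ring
    refine (sum_le_sum h1).trans ?_
    rw [sum_add_distrib, sum_add_distrib, ← mul_sum, ← mul_sum,
      ← mul_sum]
    have h3 : ∑ p ∈ P, (rootCount F p : ℝ) / p ≤ log (log w) + C₀ := by
      refine le_trans (sum_le_sum_of_subset_of_nonneg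
        (primesIoc_subset (Nat.cast_nonneg p₁) le_rfl) (fun _ _ _ => by positivity)) ?_
      linarith [(abs_le.mp (hC₀ w hw)).2]
    have h4 : ∑ p ∈ P, 1 / (p : ℝ) ≤ 18 * M := by
      have hp12 : (2 : ℝ) ≤ p₁ := by exact_mod_cast (by omega : 2 ≤ p₁)
      refine (sum_inv_primesIoc_le (by linarith) hw).trans ?_
      have h5 : log w ≤ w := by linarith [log_le_sub_one_of_pos (by linarith : 0 < w)]
      have h6 : 1 / 2 ≤ log p₁ := by
        have := log_le_log two_pos hp12
        linarith [log_two_gt_d9]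
      have h7 : log w / log p₁ ≤ 2 * M := by
        rw [div_le_iff₀ (by linarith)]
        nlinarith
      linarith
    have hM0 : (0 : ℝ) ≤ M := Nat.cast_nonneg _
    have h5 := mul_le_mul_of_nonneg_left h3 hM0
    have h6 := mul_le_mul_of_nonneg_left hsum2 (by positivity : (0 : ℝ) ≤ g * M)
    have h7 := mul_le_mul_of_nonneg_left h4 (by positivity : (0 : ℝ) ≤ g)
    linarith
  have hJ := card_mul_exp_neg_le_sum _ _ _ hav
  rw [Nat.card_Ico, Nat.add_sub_cancel_left, neg_add, exp_add, exp_neg (log _),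
    exp_log hlogw] at hJ
  calc _ = 1 / 2 * N * exp (-(2 * (g : ℝ) ^ 2)) *
        (M * ((log w)⁻¹ * exp (-(C₀ + 2 * g + 18 * g)))) := by
        rw [neg_add, exp_add]; ring
    _ ≤ 1 / 2 * N * exp (-(2 * (g : ℝ) ^ 2)) *
        ∑ v ∈ Ico o (o + M), exp (-X v) := by gcongr
    _ ≤ _ := by
        rw [mul_sum]
        exact sum_le_sum (fun v _ => hlow v)

end sieveAverage

section geometry

open Polynomial

theorem exists_interval_prod_norm {g : ℕ} (hg : 0 < g) (z : Fin g → ℂ) {T ℓ : ℝ} (hT : 0 < T)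
    (hz : ∀ k, ‖z k‖ ≤ T / 20) (hℓ : 0 < ℓ) :
    ∃ s : ℝ, 9 / 10 * T ≤ s ∧ s ≤ 11 / 10 * T ∧ ∀ a : ℝ, s < a → a ≤ s + ℓ * T / (2 * g) →
      T ^ g < ∏ k, ‖(a : ℂ) + z k‖ ∧ ∏ k, ‖(a : ℂ) + z k‖ ≤ exp ℓ * T ^ g := by
  have hg0 : (0 : ℝ) < g := by exact_mod_cast hg
  set H : ℝ → ℝ := fun a => ∏ k, ‖(a : ℂ) + z k‖ with hH
  have hcont : Continuous H := by
    refine continuous_finsetProd _ (fun k _ => ?_)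
    fun_prop
  have hup : ∀ a : ℝ, 0 ≤ a → ∀ k, ‖(a : ℂ) + z k‖ ≤ a + T / 20 := by
    intro a ha k
    refine (norm_add_le _ _).trans (add_le_add ?_ (hz k))
    rw [Complex.norm_real, Real.norm_eq_abs, abs_of_nonneg ha]
  have hlo : ∀ a : ℝ, 0 ≤ a → ∀ k, a - T / 20 ≤ ‖(a : ℂ) + z k‖ := by
    intro a ha k
    have h1 : ‖(a : ℂ)‖ ≤ ‖(a : ℂ) + z k‖ + ‖z k‖ := by
      simpa using norm_sub_le ((a : ℂ) + z k) (z k)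
    rw [Complex.norm_real, Real.norm_eq_abs, abs_of_nonneg ha] at h1
    linarith [hz k]
  have h1 : H (9 / 10 * T) ≤ T ^ g := by
    calc H (9 / 10 * T) ≤ ∏ _k : Fin g, T := prod_le_prod (fun _ _ => norm_nonneg _)
          (fun k _ => (hup _ (by positivity) k).trans (by linarith))
      _ = T ^ g := by simp
  have h2 : T ^ g ≤ H (11 / 10 * T) := by
    calc T ^ g = ∏ _k : Fin g, T := by simp
      _ ≤ H (11 / 10 * T) := prod_le_prod (fun _ _ => hT.le)
          (fun k _ => le_trans (by linarith) (hlo _ (by positivity) k))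
  obtain ⟨s, hs, hHs⟩ := intermediate_value_Icc (by linarith : 9 / 10 * T ≤ 11 / 10 * T)
    hcont.continuousOn ⟨h1, h2⟩
  refine ⟨s, hs.1, hs.2, fun a hsa ha => ?_⟩
  have hs0 : 0 ≤ s := by linarith [hs.1]
  rw [← hHs]
  have hpos : ∀ k, 0 < ‖(s : ℂ) + z k‖ := fun k =>
    lt_of_lt_of_le (by linarith [hs.1]) (hlo s hs0 k)
  constructor
  · refine Finset.prod_lt_prod_of_nonempty (fun k _ => hpos k) (fun k _ => ?_)
      ⟨⟨0, hg⟩, mem_univ _⟩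
    have hre : -(z k).re ≤ T / 20 := (neg_le_abs _).trans ((Complex.abs_re_le_norm _).trans (hz k))
    rw [Complex.norm_def, Complex.norm_def]
    refine Real.sqrt_lt_sqrt (Complex.normSq_nonneg _) ?_
    rw [Complex.normSq_apply, Complex.normSq_apply]
    simp only [Complex.add_re, Complex.add_im, Complex.ofReal_re, Complex.ofReal_im]
    have : 0 < s + (z k).re := by linarith [hs.1]
    nlinarith
  · calc H a ≤ ∏ k, (‖(s : ℂ) + z k‖ * exp (ℓ / g)) := by
          refine prod_le_prod (fun _ _ => norm_nonneg _) (fun k _ => ?_)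
          have h3 : ‖(a : ℂ) + z k‖ ≤ ‖(s : ℂ) + z k‖ + (a - s) := by
            have e : (a : ℂ) + z k = ((s : ℂ) + z k) + ((a - s : ℝ) : ℂ) := by push_cast; ring
            rw [e]
            refine (norm_add_le _ _).trans ?_
            rw [Complex.norm_real, Real.norm_eq_abs, abs_of_pos (by linarith)]
          have h4 := hlo s hs0 k
          have h5 := add_one_le_exp (ℓ / g)
          have h6 : a - s ≤ ℓ / g * (T / 2) := by
            have : ℓ * T / (2 * g) = ℓ / g * (T / 2) := by field_simp
            linarith
          have h7 : 0 < ℓ / g := by positivity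
          have h8 : ℓ / g * (T / 2) ≤ ℓ / g * ‖(s : ℂ) + z k‖ := by
            gcongr; linarith [hs.1]
          have h9 := mul_le_mul_of_nonneg_left h5 (hpos k).le
          linarith
      _ = exp ℓ * H s := by
          rw [Finset.prod_mul_distrib, prod_const, card_univ, Fintype.card_fin,
            ← exp_nat_mul, mul_comm]
          congr 2
          field_simp

theorem norm_det_vandermonde_le {g : ℕ} (z : Fin g → ℂ) {B : ℝ} (hB : 1 ≤ B)
    (hz : ∀ k, ‖z k‖ ≤ B) : ‖(Matrix.vandermonde z).det‖ ≤ (2 * B) ^ (g * g) := by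
  rw [Matrix.det_vandermonde, norm_prod, pow_mul]
  have h0 : (1 : ℝ) ≤ 2 * B := by linarith
  calc _ ≤ ∏ _i : Fin g, (2 * B) ^ g := by
        refine prod_le_prod (fun _ _ => norm_nonneg _) (fun i _ => ?_)
        rw [norm_prod]
        calc _ ≤ ∏ _j ∈ Finset.Ioi i, (2 * B) := by
              refine prod_le_prod (fun _ _ => norm_nonneg _) (fun j _ => ?_)
              refine (norm_sub_le _ _).trans ?_
              linarith [hz i, hz j]
          _ ≤ (2 * B) ^ g := by
              rw [prod_const]
              refine pow_le_pow_right₀ h0 ((Finset.card_le_univ _).trans ?_)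
              rw [Fintype.card_fin]
    _ = _ := by simp

theorem card_mul_log_le_of_prime_dvd {D : ℕ} (hD : D ≠ 0) {w : ℝ} (hw : 0 < w) (S : Finset ℕ)
    (hS : ∀ p ∈ S, p.Prime ∧ p ∣ D ∧ w ≤ p) : S.card * log w ≤ log D := by
  have h1 : (∏ p ∈ S, p) ∣ D := Finset.prod_primes_dvd D (fun p hp => (hS p hp).1.prime)
    (fun p hp => (hS p hp).2.1)
  have h2 : w ^ S.card ≤ D := by
    calc w ^ S.card = ∏ _p ∈ S, w := by simp
      _ ≤ ∏ p ∈ S, (p : ℝ) := prod_le_prod (fun _ _ => hw.le) (fun p hp => (hS p hp).2.2)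
      _ ≤ D := by
          rw [← Nat.cast_prod]
          exact_mod_cast Nat.le_of_dvd (Nat.pos_of_ne_zero hD) h1
  rw [← log_pow]
  exact log_le_log (by positivity) h2

variable {R : Type*} [CommRing R] {g : ℕ}

theorem powerIndex_bounds (b : Module.Basis (Fin g) ℤ R) {θ : R} (hb : ∀ i, b i = θ ^ (i : ℕ))
    (φ : Fin g → R →+* ℂ) (hφ : Function.Injective fun k => φ k θ) :
    ∃ C : ℝ, 0 < C ∧ ∀ (γ : R) (B : ℝ), 1 ≤ B → (∀ k, ‖φ k γ‖ ≤ B) →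
      (Function.Injective fun k => φ k γ) →
      powerIndex b γ ≠ 0 ∧ (((powerIndex b γ).natAbs : ℕ) : ℝ) ≤ C * B ^ (g * g) := by
  have hV := Matrix.det_vandermonde_ne_zero_iff.mpr hφ
  have hV0 := norm_pos_iff.mpr hV
  refine ⟨2 ^ (g * g) / ‖(Matrix.vandermonde (fun k => φ k θ)).det‖, by positivity, ?_⟩
  intro γ B hB hγ hinj
  have h := powerIndex_mul_det_vandermonde b hb φ γ
  have hW := Matrix.det_vandermonde_ne_zero_iff.mpr hinj
  constructor
  · intro h0
    rw [h0, Int.cast_zero, mul_zero] at h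
    exact hW h.symm
  · have h1 := norm_det_vandermonde_le _ hB hγ
    rw [← h, norm_mul, Complex.norm_intCast] at h1
    rw [Nat.cast_natAbs, Int.cast_abs, div_mul_eq_mul_div, le_div_iff₀ hV0, mul_comm, ← mul_pow]
    exact h1

/-- The element `θ² u₀ + θ³ u₁ + ⋯` of the box. -/
noncomputable def boxTail (Q₀ : ℕ) {r : ℕ} (u : Fin r → ℕ) : ℤ[X] :=
  ∑ i, C ((Q₀ * u i : ℕ) : ℤ) * X ^ ((i : ℕ) + 2)

/-- In a suitable box, the elements `γ` are generic and small. -/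
theorem exists_box_constants {g : ℕ} (r : ℕ) (φ : Fin g → R →+* ℂ) {θ : R}
    (hφ : Function.Injective fun k => φ k θ) {Q₀ : ℕ} (hQ₀ : 0 < Q₀) :
    ∃ R₁ : ℕ, ∃ Cγ : ℝ, 1 ≤ Cγ ∧ ∀ (M : ℕ) (u : Fin r → ℕ) (v : ℕ), (∀ i, u i < M) →
      R₁ * M ≤ v → v < R₁ * M + M →
      (∀ k, ‖φ k (aeval θ (C ((Q₀ * v : ℕ) : ℤ) * X + boxTail Q₀ u))‖ ≤ Cγ * M) ∧
      Function.Injective fun k => φ k (aeval θ (C ((Q₀ * v : ℕ) : ℤ) * X + boxTail Q₀ u)) := by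
  obtain ⟨B, hB1, hB⟩ : ∃ B : ℝ, 1 ≤ B ∧ ∀ k, ‖φ k θ‖ ≤ B := by
    refine ⟨1 + ∑ k, ‖φ k θ‖, by have : 0 ≤ ∑ k, ‖φ k θ‖ := by positivity
                                 linarith, fun k => ?_⟩
    have := single_le_sum (f := fun k => ‖φ k θ‖) (fun _ _ => norm_nonneg _)
      (mem_univ k)
    linarith
  obtain ⟨d, hd0, hd⟩ : ∃ d : ℝ, 0 < d ∧ ∀ k l, k ≠ l → d ≤ ‖φ k θ - φ l θ‖ := by
    obtain h | h := isEmpty_or_nonempty (Fin g)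
    · exact ⟨1, one_pos, fun k => h.elim k⟩
    set F : Fin g × Fin g → ℝ := fun x => if x.1 = x.2 then 1 else ‖φ x.1 θ - φ x.2 θ‖ with hF
    obtain ⟨x₀, hx₀⟩ := Finite.exists_min F
    refine ⟨F x₀, ?_, fun k l hkl => ?_⟩
    · simp only [hF]
      split_ifs with h
      · exact one_pos
      · exact norm_pos_iff.mpr (sub_ne_zero.mpr (fun h' => h (hφ h')))
    · have := hx₀ (k, l)
      rwa [show F (k, l) = ‖φ k θ - φ l θ‖ by simp [hF, hkl]] at this
  set S : ℝ := ∑ i : Fin r, B ^ ((i : ℕ) + 2) with hS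
  have hS0 : 0 ≤ S := by positivity
  obtain ⟨R₁, hR₁⟩ := exists_nat_gt (2 * S / d)
  rw [div_lt_iff₀ hd0] at hR₁
  have hQ1 : (1 : ℝ) ≤ Q₀ := by exact_mod_cast hQ₀
  refine ⟨R₁, Q₀ * ((R₁ + 1) * B + S), ?_, ?_⟩
  · have : (1 : ℝ) ≤ (R₁ + 1) * B + S := by
      have : (0 : ℝ) ≤ R₁ := Nat.cast_nonneg _
      nlinarith
    nlinarith
  intro M u v hu hv1 hv2
  have hform : ∀ k, φ k (aeval θ (C ((Q₀ * v : ℕ) : ℤ) * X + boxTail Q₀ u)) =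
      Q₀ * (v * φ k θ + ∑ i, u i * (φ k θ) ^ ((i : ℕ) + 2)) := by
    intro k
    simp [boxTail, map_sum, mul_add, mul_sum, mul_assoc]
  simp only [hform]
  have hv2' : (v : ℝ) ≤ (R₁ + 1) * M := by
    have : v ≤ (R₁ + 1) * M := by rw [add_mul, one_mul]; exact hv2.le
    exact_mod_cast this
  have hv1' : (R₁ : ℝ) * M ≤ v := by exact_mod_cast hv1
  have hM1 : (1 : ℝ) ≤ M := by
    have : 1 ≤ M := by omega
    exact_mod_cast this
  have hsum : ∀ k, ‖∑ i, (u i : ℂ) * (φ k θ) ^ ((i : ℕ) + 2)‖ ≤ M * S := by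
    intro k
    rw [hS, mul_sum]
    refine (norm_sum_le _ _).trans (sum_le_sum (fun i _ => ?_))
    rw [norm_mul, norm_pow, Complex.norm_natCast]
    have h1 : (u i : ℝ) ≤ M := by exact_mod_cast (hu i).le
    have := hB k
    gcongr
  constructor
  · intro k
    rw [norm_mul, Complex.norm_natCast, mul_assoc]
    refine mul_le_mul_of_nonneg_left ?_ (by positivity)
    refine (norm_add_le _ _).trans ?_
    rw [norm_mul, Complex.norm_natCast]
    have h1 : (v : ℝ) * ‖φ k θ‖ ≤ (R₁ + 1) * M * B := by
      have := hB k
      gcongr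
    linarith [hsum k]
  · intro k l hkl
    by_contra hne
    simp only at hkl
    have hQ : (Q₀ : ℂ) ≠ 0 := by exact_mod_cast hQ₀.ne'
    have h1 := mul_left_cancel₀ hQ hkl
    have h2 : (v : ℂ) * (φ k θ - φ l θ) = (∑ i, (u i : ℂ) * (φ l θ) ^ ((i : ℕ) + 2)) -
        ∑ i, (u i : ℂ) * (φ k θ) ^ ((i : ℕ) + 2) := by linear_combination h1
    have h3 := congrArg norm h2
    rw [norm_mul, Complex.norm_natCast] at h3
    have h4 := (norm_sub_le (∑ i, (u i : ℂ) * (φ l θ) ^ ((i : ℕ) + 2))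
      (∑ i, (u i : ℂ) * (φ k θ) ^ ((i : ℕ) + 2)))
    have h5 := hsum k
    have h6 := hsum l
    have h7 : (v : ℝ) * d ≤ v * ‖φ k θ - φ l θ‖ := by
      have := hd k l hne
      gcongr
    have h8 : (R₁ : ℝ) * M * d ≤ v * d := by gcongr
    nlinarith

end geometry

section orderSetup

open Polynomial

theorem exists_order_of_irreducible {F : ℤ[X]} (hF : Irreducible F) (hdeg : F.natDegree ≠ 0) :
    ∃ (R : Type) (_ : CommRing R) (_ : IsDomain R) (θ : R)
      (b : Module.Basis (Fin F.natDegree) ℤ R) (φ : Fin F.natDegree → R →+* ℂ),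
      (∀ i, b i = θ ^ (i : ℕ)) ∧ aeval θ F.integralNormalization = 0 ∧
      (Function.Injective fun k => φ k θ) ∧
      ∀ (q : ℕ) (μ : ℤ), (q : ℤ) ∣ F.integralNormalization.eval μ →
        ∃ ψ : R →+* ZMod q, ψ θ = μ := by
  set f := F.integralNormalization with hf
  have hfm : f.Monic := monic_integralNormalization hF.ne_zero
  have hfg : f.natDegree = F.natDegree := natDegree_integralNormalization
  have hirr : Irreducible f := by
    obtain ⟨K, _, _, θ, -, hθ⟩ := exists_ringOfIntegers_minpoly_eq hF hdeg
    rw [hf, ← hθ]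
    exact minpoly.irreducible (Algebra.IsIntegral.isIntegral θ)
  have : IsDomain (AdjoinRoot f) := AdjoinRoot.isDomain_of_prime hirr.prime
  have hirrQ : Irreducible (f.map (algebraMap ℤ ℚ)) :=
    (hfm.irreducible_iff_irreducible_map_fraction_map).mp hirr
  have hcard : Fintype.card ((f.map (algebraMap ℤ ℚ)).rootSet ℂ) = F.natDegree := by
    rw [card_rootSet_eq_natDegree hirrQ.separable (IsAlgClosed.splits _), hfm.natDegree_map, hfg]
  let e := (Fintype.equivFinOfCardEq hcard).symm
  have hroot : ∀ k, eval₂ (Int.castRingHom ℂ) (e k : ℂ) f = 0 := by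
    intro k
    have h := (mem_rootSet.mp (e k).2).2
    rw [aeval_map_algebraMap] at h
    exact h
  let pb := AdjoinRoot.powerBasis' hfm
  have hdim : pb.dim = F.natDegree := hfg
  refine ⟨AdjoinRoot f, inferInstance, this, AdjoinRoot.root f, pb.basis.reindex (finCongr hdim),
    fun k => AdjoinRoot.lift (Int.castRingHom ℂ) (e k : ℂ) (hroot k), ?_, ?_, ?_, ?_⟩
  · intro i
    rw [Module.Basis.reindex_apply, pb.basis_eq_pow]
    simp [pb]
  · refine Eq.trans ?_ (AdjoinRoot.eval₂_root f)
    rw [aeval_def]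
    congr 1
  · intro k l h
    simp only [AdjoinRoot.lift_root] at h
    exact e.injective (Subtype.ext h)
  · intro q μ hq
    refine ⟨AdjoinRoot.lift (Int.castRingHom (ZMod q)) (μ : ZMod q) ?_, AdjoinRoot.lift_root _⟩
    rw [show (μ : ZMod q) = Int.castRingHom (ZMod q) μ from rfl, eval₂_at_apply]
    exact (ZMod.intCast_zmod_eq_zero_iff_dvd _ q).mpr hq

end orderSetup

section normToRoot

open Polynomial

variable {R : Type*} [CommRing R] {g : ℕ}

theorem map_aeval_eq_intCast_eval {q : ℕ} {θ : R} {μ : ℤ} {ψ : R →+* ZMod q} (hψ : ψ θ = μ)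
    (P : ℤ[X]) : ψ (aeval θ P) = (P.eval μ : ℤ) := by
  rw [aeval_def, hom_eval₂, hψ, RingHom.ext_int (ψ.comp (algebraMap ℤ R)) (Int.castRingHom _)]
  exact eval₂_at_intCast (Int.castRingHom (ZMod q)) μ

theorem exists_mem_rootsMod_of_norm {F : ℤ[X]} (hdeg : F.natDegree ≠ 0)
    (b : Module.Basis (Fin g) ℤ R) {θ : R} (hb : ∀ i, b i = θ ^ (i : ℕ)) (hg : 0 < g)
    (hf : aeval θ F.integralNormalization = 0)
    (hψ : ∀ (q : ℕ) (μ : ℤ), (q : ℤ) ∣ F.integralNormalization.eval μ →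
        ∃ ψ : R →+* ZMod q, ψ θ = μ) (a : ℤ) (P : ℤ[X])
    (hlc : IsCoprime F.leadingCoeff (Algebra.norm ℤ ((a : R) + aeval θ P)))
    (h0 : Algebra.norm ℤ ((a : R) + aeval θ P) ≠ 0)
    (hco : IsCoprime (Algebra.norm ℤ ((a : R) + aeval θ P)) (powerIndex b (aeval θ P))) :
    ∃ ν ∈ rootsMod F (Algebra.norm ℤ ((a : R) + aeval θ P)).natAbs,
      ∃ ψ : R →+* ZMod (Algebra.norm ℤ ((a : R) + aeval θ P)).natAbs,
        ψ θ = (F.leadingCoeff * (ν : ℤ) : ℤ) ∧ ψ ((a : R) + aeval θ P) = 0 := by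
  obtain ⟨μ, hμ⟩ := exists_root_of_isCoprime_powerIndex b hb hg a (aeval θ P) hco
  set n := Algebra.norm ℤ ((a : R) + aeval θ P) with hn
  set q := n.natAbs with hq
  have hqn : ∀ x : ℤ, n ∣ x ↔ (q : ℤ) ∣ x := fun x => by rw [hq, Int.natAbs_dvd]
  have hfμ : (q : ℤ) ∣ F.integralNormalization.eval μ :=
    (hqn _).mp (hμ _ (by rw [hf]; exact dvd_zero _))
  have hAμ : (q : ℤ) ∣ (C a + P).eval μ := (hqn _).mp (hμ _ (by simp))
  have hq0 : 0 < q := Int.natAbs_pos.mpr h0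
  obtain ⟨s, t, hst⟩ := hlc
  set ν : ℕ := ((s * μ) % (q : ℤ)).toNat with hν
  have hq0' : (q : ℤ) ≠ 0 := by exact_mod_cast hq0.ne'
  have hν0 : (ν : ℤ) = (s * μ) % (q : ℤ) := Int.toNat_of_nonneg (Int.emod_nonneg _ hq0')
  have hνq : ν < q := by
    have := Int.emod_lt_of_pos (s * μ) (by exact_mod_cast hq0 : (0 : ℤ) < q)
    rw [← hν0] at this
    exact_mod_cast this
  have hνμ : (q : ℤ) ∣ F.leadingCoeff * ν - μ := by
    have h1 : (q : ℤ) ∣ (ν : ℤ) - s * μ := by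
      rw [hν0]
      exact Int.ModEq.dvd (Int.mod_modEq _ _).symm
    have h2 : (q : ℤ) ∣ n := by rw [hq]; exact Int.natAbs_dvd.mpr dvd_rfl
    have e : F.leadingCoeff * ν - μ = F.leadingCoeff * (ν - s * μ) - t * μ * n := by
      linear_combination μ * hst
    rw [e]
    exact dvd_sub (h1.mul_left _) (h2.mul_left _)
  obtain ⟨ψ, hψθ⟩ := hψ q μ hfμ
  have hcast : ((F.leadingCoeff * ν : ℤ) : ZMod q) = μ := by
    rw [← sub_eq_zero, ← Int.cast_sub, ZMod.intCast_zmod_eq_zero_iff_dvd]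
    exact hνμ
  refine ⟨ν, ?_, ψ, by rw [hcast, hψθ], ?_⟩
  · rw [rootsMod, mem_filter, mem_range]
    refine ⟨hνq, ?_⟩
    have h1 : (q : ℤ) ∣ F.integralNormalization.eval (F.leadingCoeff * ν) :=
      (dvd_iff_dvd_of_dvd_sub (hνμ.trans (sub_dvd_eval_sub _ _ _))).mpr hfμ
    have h2 := integralNormalization_eval₂_leadingCoeff_mul (p := F)
      (Nat.one_le_iff_ne_zero.mpr hdeg) (RingHom.id ℤ) (ν : ℤ)
    simp only [RingHom.id_apply, eval₂_id] at h2
    rw [h2] at h1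
    have hcop : IsCoprime (q : ℤ) (F.leadingCoeff ^ (F.natDegree - 1)) := by
      refine IsCoprime.pow_right ?_
      rw [hq, Int.isCoprime_iff_gcd_eq_one, Int.gcd, Int.natAbs_natCast, ← Int.gcd,
        ← Int.isCoprime_iff_gcd_eq_one]
      exact IsCoprime.symm ⟨s, t, hst⟩
    exact hcop.dvd_of_dvd_mul_left h1
  · have e : ((a : R) + aeval θ P) = aeval θ (C a + P) := by simp
    rw [e, map_aeval_eq_intCast_eval hψθ]
    exact (ZMod.intCast_zmod_eq_zero_iff_dvd _ _).mpr hAμ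

theorem eq_of_common_root [IsDomain R] (b : Module.Basis (Fin g) ℤ R) {θ : R}
    (hb : ∀ i, b i = θ ^ (i : ℕ)) (φ : Fin g → R →+* ℂ) (hφ : Function.Injective fun k => φ k θ)
    {T : ℝ} {q : ℕ} (hq : T ^ g ≤ q) (hg : 0 < g) {A A' : R}
    (hA : ∀ k, ‖φ k (A - A')‖ < T) {ψ : R →+* ZMod q} (h : ψ A = 0) (h' : ψ A' = 0) : A = A' := by
  have h1 := dvd_norm_of_map_eq_zero b ψ (E := A - A') (by rw [map_sub, h, h', sub_zero])
  have h2 := norm_eq_prod_of_vandermonde b hb φ hφ (A - A')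
  have h3 : |((Algebra.norm ℤ (A - A') : ℤ) : ℝ)| < q := by
    rw [← Complex.norm_intCast, h2, norm_prod]
    refine lt_of_lt_of_le ?_ hq
    have : ∏ k : Fin g, ‖φ k (A - A')‖ < ∏ _k : Fin g, T := by
      by_cases h0 : ∀ k, 0 < ‖φ k (A - A')‖
      · exact Finset.prod_lt_prod_of_nonempty (fun k _ => h0 k) (fun k _ => hA k)
          ⟨⟨0, hg⟩, mem_univ _⟩
      · push Not at h0
        obtain ⟨k, hk⟩ := h0
        have hk0 : ‖φ k (A - A')‖ = 0 := le_antisymm hk (norm_nonneg _)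
        rw [Finset.prod_eq_zero (mem_univ k) hk0]
        have : 0 < T := lt_of_le_of_lt (norm_nonneg _) (hA k)
        exact prod_pos (fun _ _ => this)
    simpa using this
  have h4 : Algebra.norm ℤ (A - A') = 0 := by
    refine Int.eq_zero_of_abs_lt_dvd h1 ?_
    exact_mod_cast h3
  have : Module.Finite ℤ R := Module.Finite.of_basis b
  have : Module.Free ℤ R := Module.Free.of_basis b
  exact sub_eq_zero.mp (Algebra.norm_eq_zero_iff.mp h4)

theorem repr_aeval_of_natDegree_lt (b : Module.Basis (Fin g) ℤ R) {θ : R}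
    (hb : ∀ i, b i = θ ^ (i : ℕ)) {P : ℤ[X]} (hP : P.natDegree < g) (i : Fin g) :
    b.repr (aeval θ P) i = P.coeff i := by
  rw [aeval_eq_sum_range' hP, ← Fin.sum_univ_eq_sum_range (fun i => P.coeff i • θ ^ i) g]
  simp only [← hb]
  rw [b.repr_sum_self]

theorem coeff_boxTail (Q₀ : ℕ) {r : ℕ} (u : Fin r → ℕ) (n : ℕ) :
    (boxTail Q₀ u).coeff n = ∑ i : Fin r, if n = (i : ℕ) + 2 then ((Q₀ * u i : ℕ) : ℤ) else 0 := by
  simp only [boxTail, finsetSum_coeff, coeff_C_mul, coeff_X_pow, mul_ite, mul_one, mul_zero]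

theorem box_coord_inj (b : Module.Basis (Fin g) ℤ R) {θ : R} (hb : ∀ i, b i = θ ^ (i : ℕ))
    {r : ℕ} (hr : r + 2 = g) {Q₀ : ℕ} (hQ₀ : 0 < Q₀) {u u' : Fin r → ℕ} {v v' m m' : ℕ}
    (h : ((1 + Q₀ * m : ℤ) : R) + aeval θ (C ((Q₀ * v : ℕ) : ℤ) * X + boxTail Q₀ u) =
      ((1 + Q₀ * m' : ℤ) : R) + aeval θ (C ((Q₀ * v' : ℕ) : ℤ) * X + boxTail Q₀ u')) :
    u = u' ∧ v = v' ∧ m = m' := by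
  set P : (Fin r → ℕ) → ℕ → ℕ → ℤ[X] := fun u v m =>
    C (1 + Q₀ * m : ℤ) + (C ((Q₀ * v : ℕ) : ℤ) * X + boxTail Q₀ u) with hP
  have hdeg : ∀ u v m, (P u v m).natDegree < g := by
    intro u v m
    refine lt_of_le_of_lt (b := r + 1) ?_ (by omega)
    refine natDegree_add_le_of_degree_le (by rw [natDegree_C]; omega)
      (natDegree_add_le_of_degree_le ((natDegree_C_mul_le _ _).trans (natDegree_X_le.trans (by omega))) ?_)
    refine natDegree_sum_le_of_forall_le _ _ (fun i _ => ?_)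
    exact (natDegree_C_mul_X_pow_le _ _).trans (by omega)
  have haev : ∀ u v m, aeval θ (P u v m) =
      ((1 + Q₀ * m : ℤ) : R) + aeval θ (C ((Q₀ * v : ℕ) : ℤ) * X + boxTail Q₀ u) := by
    intro u v m
    rw [hP, map_add, aeval_C]; simp
  rw [← haev, ← haev] at h
  have hcoeff : ∀ i : ℕ, i < g → (P u v m).coeff i = (P u' v' m').coeff i := by
    intro i hi
    rw [← repr_aeval_of_natDegree_lt b hb (hdeg u v m) ⟨i, hi⟩, h,
      repr_aeval_of_natDegree_lt b hb (hdeg u' v' m') ⟨i, hi⟩]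
  have hQ : (Q₀ : ℤ) ≠ 0 := by exact_mod_cast hQ₀.ne'
  have c0 : ∀ u v m, (P u v m).coeff 0 = 1 + Q₀ * m := by
    intro u v m
    simp [hP, boxTail, coeff_X_pow]
  have c1 : ∀ u v m, (P u v m).coeff 1 = Q₀ * v := by
    intro u v m
    rw [hP, coeff_add, coeff_add, coeff_boxTail, coeff_C_of_ne_zero one_ne_zero, coeff_C_mul,
      coeff_X_one, sum_eq_zero (fun i _ => if_neg (by omega))]
    push_cast
    ring
  have c2 : ∀ u v m, ∀ i : Fin r, (P u v m).coeff (i + 2) = Q₀ * u i := by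
    intro u v m i
    rw [hP, coeff_add, coeff_add, coeff_boxTail, coeff_C_of_ne_zero (by omega), coeff_C_mul,
      coeff_X_of_ne_one (by omega), Finset.sum_eq_single i (fun j _ hj => if_neg (fun h =>
        hj (Fin.ext (by omega)))) (by simp), if_pos rfl]
    push_cast
    ring
  refine ⟨?_, ?_, ?_⟩
  · funext i
    have := hcoeff (i + 2) (by omega)
    rw [c2, c2] at this
    exact_mod_cast mul_left_cancel₀ hQ this
  · have := hcoeff 1 (by omega)
    rw [c1, c1] at this
    exact_mod_cast mul_left_cancel₀ hQ this
  · have := hcoeff 0 (by omega)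
    rw [c0, c0] at this
    exact_mod_cast mul_left_cancel₀ hQ (add_left_cancel this)

theorem not_dvdNorm_of_dvd (b : Module.Basis (Fin g) ℤ R) {θ : R} {f : ℤ[X]}
    (hf : aeval θ f = 0) {r : ℕ} {Q₀ p : ℕ} (hp : p.Prime) (hpQ : p ∣ Q₀) (u : Fin r → ℕ)
    (v m : ℕ) : ¬ DvdNorm Q₀ (aeval θ (C ((Q₀ * v : ℕ) : ℤ) * X + boxTail Q₀ u)) p m := by
  intro h
  have : Fact p.Prime := ⟨hp⟩
  have e : (((1 + Q₀ * m : ℤ) : R) + aeval θ (C ((Q₀ * v : ℕ) : ℤ) * X + boxTail Q₀ u)) =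
      aeval θ (C (1 + Q₀ * m : ℤ) + (C ((Q₀ * v : ℕ) : ℤ) * X + boxTail Q₀ u)) := by simp
  rw [DvdNorm, e] at h
  obtain ⟨α, -, h2⟩ := exists_common_root_of_dvd_norm b hf h
  have hQ : (Q₀ : AlgebraicClosure (ZMod p)) = 0 := (CharP.cast_eq_zero_iff _ p _).mpr hpQ
  simp [boxTail, hQ] at h2

theorem card_not_coprime_powerIndex_le (b : Module.Basis (Fin g) ℤ R) (Q₀ : ℕ) (γ : R)
    (hD : powerIndex b γ ≠ 0) {p₁ : ℕ} {w : ℝ} (hw : 1 < w)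
    (hQ : ∀ p : ℕ, p.Prime → p₁ < p → ¬ p ∣ Q₀) (hp₁w : p₁ ≤ w)
    (hsmall : ∀ p : ℕ, p.Prime → p ≤ p₁ → ∀ m, ¬ DvdNorm Q₀ γ p m) (s N : ℕ) :
    (((Ico s (s + N)).filter (fun m => (∀ p ∈ primesIoc p₁ w, ¬ DvdNorm Q₀ γ p m) ∧
      ¬ IsCoprime (Algebra.norm ℤ (((1 + Q₀ * m : ℤ) : R) + γ)) (powerIndex b γ))).card : ℝ) *
      log w ≤ log ((powerIndex b γ).natAbs : ℕ) * (g * (N / w + 1)) := by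
  set D := (powerIndex b γ).natAbs with hDdef
  have hD0 : D ≠ 0 := Int.natAbs_ne_zero.mpr hD
  set S := D.primeFactors.filter (fun p : ℕ => w < p) with hS
  have hSp : ∀ p ∈ S, p.Prime ∧ p ∣ D ∧ w ≤ p := by
    intro p hp
    obtain ⟨h1, h2⟩ := mem_filter.mp hp
    exact ⟨Nat.prime_of_mem_primeFactors h1, Nat.dvd_of_mem_primeFactors h1, h2.le⟩
  have hcard := card_mul_log_le_of_prime_dvd hD0 (by linarith : 0 < w) S hSp
  have hsub : (Ico s (s + N)).filter (fun m => (∀ p ∈ primesIoc p₁ w,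
      ¬ DvdNorm Q₀ γ p m) ∧
      ¬ IsCoprime (Algebra.norm ℤ (((1 + Q₀ * m : ℤ) : R) + γ)) (powerIndex b γ)) ⊆
      S.biUnion (fun p => (Ico s (s + N)).filter (DvdNorm Q₀ γ p)) := by
    intro m hm
    obtain ⟨hm1, hm2, hm3⟩ := mem_filter.mp hm
    rw [Int.isCoprime_iff_gcd_eq_one] at hm3
    obtain ⟨p, hp, hpd⟩ := Nat.exists_prime_and_dvd hm3
    have hp1 : DvdNorm Q₀ γ p m := by
      rw [DvdNorm, Int.natCast_dvd]
      exact hpd.trans (Nat.gcd_dvd_left _ _)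
    have hp2 : p ∣ D := hpd.trans (Nat.gcd_dvd_right _ _)
    have hp3 : p₁ < p := by
      by_contra hle
      exact hsmall p hp (not_lt.mp hle) m hp1
    have hp4 : w < p := by
      by_contra hle
      exact hm2 p (mem_primesIoc.mpr ⟨hp, by exact_mod_cast hp3, not_lt.mp hle⟩) hp1
    exact mem_biUnion.mpr ⟨p, mem_filter.mpr
      ⟨Nat.mem_primeFactors.mpr ⟨hp, hp2, hD0⟩, hp4⟩, mem_filter.mpr ⟨hm1, hp1⟩⟩
  have hone : ∀ p ∈ S, (((Ico s (s + N)).filter (DvdNorm Q₀ γ p)).card : ℝ) ≤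
      g * (N / w + 1) := by
    intro p hp
    obtain ⟨hpp, -, hpw⟩ := hSp p hp
    have hp1 : p₁ < p := by
      have : (p₁ : ℝ) < p := lt_of_le_of_lt hp₁w (mem_filter.mp hp).2
      exact_mod_cast this
    have h1 := (abs_le.mp (abs_card_filter_Ico_sub_le hpp.pos (Q := DvdNorm Q₀ γ p)
      (dvdNorm_mod_iff b Q₀ γ p) s N)).2
    have h2 : (((range p).filter (DvdNorm Q₀ γ p)).card : ℝ) ≤ g := by
      exact_mod_cast classCount_norm_le b Q₀ γ hpp (hQ p hpp hp1)
    have h3 : (N : ℝ) * (((range p).filter (DvdNorm Q₀ γ p)).card / p) ≤ N * (g / w) := by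
      gcongr
    have h4 : (N : ℝ) * (g / w) = g * (N / w) := by ring
    linarith
  have h5 : (((Ico s (s + N)).filter (fun m => (∀ p ∈ primesIoc p₁ w,
      ¬ DvdNorm Q₀ γ p m) ∧ ¬ IsCoprime (Algebra.norm ℤ (((1 + Q₀ * m : ℤ) : R) + γ))
      (powerIndex b γ))).card : ℝ) ≤ S.card * (g * (N / w + 1)) := by
    refine (Nat.cast_le.mpr ((card_le_card hsub).trans Finset.card_biUnion_le)).trans ?_
    rw [Nat.cast_sum, ← nsmul_eq_mul]
    exact sum_le_card_nsmul _ _ _ hone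
  have hlog : 0 ≤ log w := log_nonneg hw.le
  have hgN : 0 ≤ (g : ℝ) * (N / w + 1) := by positivity
  calc _ ≤ S.card * (g * (N / w + 1)) * log w := by gcongr
    _ = S.card * log w * (g * (N / w + 1)) := by ring
    _ ≤ _ := by gcongr

end normToRoot

section boxCounting

open Polynomial

variable {R : Type*} [CommRing R] {g : ℕ}

noncomputable abbrev boxPoly (Q₀ : ℕ) {r : ℕ} (u : Fin r → ℕ) (v : ℕ) : ℤ[X] :=
  C ((Q₀ * v : ℕ) : ℤ) * X + boxTail Q₀ u

theorem isCoprime_of_forall_prime_le {a n : ℤ} {p₁ : ℕ} (ha : a ≠ 0) (hap : a.natAbs ≤ p₁)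
    (h : ∀ p : ℕ, p.Prime → p ≤ p₁ → ¬ (p : ℤ) ∣ n) : IsCoprime a n := by
  rw [Int.isCoprime_iff_gcd_eq_one]
  by_contra hne
  obtain ⟨p, hp, hpd⟩ := Nat.exists_prime_and_dvd hne
  have h1 : p ∣ a.natAbs := hpd.trans (Nat.gcd_dvd_left _ _)
  have h2 : p ∣ n.natAbs := hpd.trans (Nat.gcd_dvd_right _ _)
  exact h p hp ((Nat.le_of_dvd (Int.natAbs_pos.mpr ha) h1).trans hap) (Int.natCast_dvd.mpr h2)

theorem card_le_sum_rootCount_of_box [IsDomain R] {F : ℤ[X]} (hdeg : F.natDegree ≠ 0)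
    (b : Module.Basis (Fin F.natDegree) ℤ R) {θ : R} (hb : ∀ i, b i = θ ^ (i : ℕ))
    (φ : Fin F.natDegree → R →+* ℂ)
    (hφ : Function.Injective fun k => φ k θ) (hf : aeval θ F.integralNormalization = 0)
    (hψ : ∀ (q : ℕ) (μ : ℤ), (q : ℤ) ∣ F.integralNormalization.eval μ →
        ∃ ψ : R →+* ZMod q, ψ θ = μ)
    {r : ℕ} (hr : r + 2 = F.natDegree) {Q₀ p₁ : ℕ} (hQ₀ : 0 < Q₀)
    (hlc : F.leadingCoeff.natAbs ≤ p₁) (hpQ : ∀ p : ℕ, p.Prime → p ≤ p₁ → p ∣ Q₀)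
    {T ℓ w : ℝ} (hT : 0 < T) (Q : Finset ℕ)
    (hQ : ∀ q : ℕ, T ^ F.natDegree < q → q ≤ exp ℓ * T ^ F.natDegree →
      (∀ p : ℕ, p.Prime → p ∣ q → w < p) → q ∈ Q)
    (S : Finset (Σ _ : (Fin r → ℕ) × ℕ, ℕ))
    (hγ : ∀ t ∈ S, ∀ k, ‖φ k (aeval θ (boxPoly Q₀ t.1.1 t.1.2))‖ ≤ T / 20)
    (hm : ∀ t ∈ S, 9 / 10 * T ≤ 1 + Q₀ * t.2 ∧ (1 + Q₀ * t.2 : ℝ) ≤ 16 / 10 * T)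
    (hnorm : ∀ t ∈ S, T ^ F.natDegree <
      ∏ k, ‖((1 + Q₀ * t.2 : ℝ) : ℂ) + φ k (aeval θ (boxPoly Q₀ t.1.1 t.1.2))‖ ∧
      ∏ k, ‖((1 + Q₀ * t.2 : ℝ) : ℂ) + φ k (aeval θ (boxPoly Q₀ t.1.1 t.1.2))‖ ≤
        exp ℓ * T ^ F.natDegree)
    (hsieve : ∀ t ∈ S, ∀ p ∈ primesIoc p₁ w,
      ¬ DvdNorm Q₀ (aeval θ (boxPoly Q₀ t.1.1 t.1.2)) p t.2)
    (hcop : ∀ t ∈ S, IsCoprime (Algebra.norm ℤ (((1 + Q₀ * t.2 : ℤ) : R) +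
      aeval θ (boxPoly Q₀ t.1.1 t.1.2))) (powerIndex b (aeval θ (boxPoly Q₀ t.1.1 t.1.2)))) :
    S.card ≤ ∑ q ∈ Q, rootCount F q := by
  have hg : 0 < F.natDegree := Nat.pos_of_ne_zero hdeg
  have key : ∀ t ∈ S, ∃ x : Σ _ : ℕ, ℕ, x ∈ Q.sigma (fun q => rootsMod F q) ∧
      T ^ F.natDegree ≤ x.1 ∧ ∃ ψ : R →+* ZMod x.1,
        ψ θ = (F.leadingCoeff * (x.2 : ℤ) : ℤ) ∧
        ψ (((1 + Q₀ * t.2 : ℤ) : R) + aeval θ (boxPoly Q₀ t.1.1 t.1.2)) = 0 := by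
    intro t ht
    set n := Algebra.norm ℤ (((1 + Q₀ * t.2 : ℤ) : R) + aeval θ (boxPoly Q₀ t.1.1 t.1.2)) with hn
    have hnn : ((n.natAbs : ℕ) : ℝ) =
        ∏ k, ‖((1 + Q₀ * t.2 : ℝ) : ℂ) + φ k (aeval θ (boxPoly Q₀ t.1.1 t.1.2))‖ := by
      rw [Nat.cast_natAbs, Int.cast_abs, ← Complex.norm_intCast,
        norm_eq_prod_of_vandermonde b hb φ hφ, norm_prod]
      refine prod_congr rfl (fun k _ => ?_)
      rw [map_add, map_intCast]
      push_cast
      rfl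
    obtain ⟨h1, h2⟩ := hnorm t ht
    rw [← hnn] at h1 h2
    have hsm : ∀ p : ℕ, p.Prime → p ≤ p₁ → ¬ (p : ℤ) ∣ n := fun p hp hle =>
      not_dvdNorm_of_dvd b hf hp (hpQ p hp hle) t.1.1 t.1.2 t.2
    have hn0 : n ≠ 0 := by
      intro h0
      rw [h0, Int.natAbs_zero, Nat.cast_zero] at h1
      exact absurd h1 (not_lt.mpr (by positivity))
    have hF0 : F.leadingCoeff ≠ 0 := leadingCoeff_ne_zero.mpr (by
      rintro rfl; simp at hdeg)
    obtain ⟨ν, hν, ψ, hψ1, hψ2⟩ := exists_mem_rootsMod_of_norm hdeg b hb hg hf hψ _ _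
      (isCoprime_of_forall_prime_le hF0 hlc hsm) hn0 (hcop t ht)
    refine ⟨⟨n.natAbs, ν⟩, Finset.mem_sigma.mpr ⟨hQ _ h1 h2 ?_, hν⟩, h1.le, ψ, hψ1, hψ2⟩
    intro p hp hpd
    have hpn : (p : ℤ) ∣ n := Int.natCast_dvd.mpr hpd
    by_contra hle
    by_cases hp1 : p ≤ p₁
    · exact hsm p hp hp1 hpn
    · exact hsieve t ht p (mem_primesIoc.mpr ⟨hp, by exact_mod_cast not_le.mp hp1,
        not_lt.mp hle⟩) hpn
  choose! x hx using key
  have hcard : S.card ≤ (Q.sigma (fun q => rootsMod F q)).card := by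
    refine card_le_card_of_injOn x (fun t ht => (hx t ht).1) ?_
    intro t ht t' ht' hxx
    obtain ⟨-, h1, ψ, h2, h3⟩ := hx t ht
    obtain ⟨-, -, h4⟩ := hx t' ht'
    rw [← hxx] at h4
    obtain ⟨ψ', h5, h6⟩ := h4
    have h7 : ψ (((1 + Q₀ * t'.2 : ℤ) : R) + aeval θ (boxPoly Q₀ t'.1.1 t'.1.2)) = 0 := by
      rw [map_add, map_intCast, map_aeval_eq_intCast_eval h2]
      rw [map_add, map_intCast, map_aeval_eq_intCast_eval h5] at h6
      exact h6
    have hAA := eq_of_common_root b hb φ hφ h1 hg (A := ((1 + Q₀ * t.2 : ℤ) : R) +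
      aeval θ (boxPoly Q₀ t.1.1 t.1.2)) (A' := ((1 + Q₀ * t'.2 : ℤ) : R) +
      aeval θ (boxPoly Q₀ t'.1.1 t'.1.2)) (fun k => ?_) h3 h7
    · obtain ⟨e1, e2, e3⟩ := box_coord_inj b hb hr hQ₀ hAA
      rcases t with ⟨⟨u, v⟩, m⟩
      rcases t' with ⟨⟨u', v'⟩, m'⟩
      simp only at e1 e2 e3
      subst e1 e2 e3
      rfl
    · have e : φ k (((1 + Q₀ * t.2 : ℤ) : R) + aeval θ (boxPoly Q₀ t.1.1 t.1.2) -
          (((1 + Q₀ * t'.2 : ℤ) : R) + aeval θ (boxPoly Q₀ t'.1.1 t'.1.2))) =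
          (((1 + Q₀ * t.2 : ℝ) - (1 + Q₀ * t'.2 : ℝ) : ℝ) : ℂ) +
          φ k (aeval θ (boxPoly Q₀ t.1.1 t.1.2)) - φ k (aeval θ (boxPoly Q₀ t'.1.1 t'.1.2)) := by
        simp only [map_add, map_sub, map_intCast]
        push_cast
        ring
      rw [e]
      have b1 := hγ t ht k
      have b2 := hγ t' ht' k
      have b3 : ‖(((1 + Q₀ * t.2 : ℝ) - (1 + Q₀ * t'.2 : ℝ) : ℝ) : ℂ)‖ ≤ 7 / 10 * T := by
        rw [Complex.norm_real, Real.norm_eq_abs, abs_le]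
        have := hm t ht
        have := hm t' ht'
        constructor <;> linarith
      refine lt_of_le_of_lt ((norm_sub_le _ _).trans (add_le_add (norm_add_le _ _) le_rfl)) ?_
      linarith
  rw [Finset.card_sigma] at hcard
  exact hcard

theorem exists_start_prod_norm {g : ℕ} (hg : 2 ≤ g) (z : Fin g → ℂ) {T ℓ : ℝ} (hT : 0 < T)
    (hz : ∀ k, ‖z k‖ ≤ T / 20) (hℓ : 0 < ℓ) (hℓ1 : ℓ ≤ 1) {Q₀ N : ℕ} (hQ₀ : 0 < Q₀)
    (hN : Q₀ * (N : ℝ) ≤ ℓ * T / (2 * g) - 1) :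
    ∃ m₀ : ℕ, ∀ m ∈ Ico m₀ (m₀ + N),
      (9 / 10 * T ≤ 1 + Q₀ * m ∧ (1 + Q₀ * m : ℝ) ≤ 16 / 10 * T) ∧
      (T ^ g < ∏ k, ‖((1 + Q₀ * m : ℝ) : ℂ) + z k‖ ∧
      ∏ k, ‖((1 + Q₀ * m : ℝ) : ℂ) + z k‖ ≤ exp ℓ * T ^ g) := by
  have hg2 : (2 : ℝ) ≤ g := by exact_mod_cast hg
  have hQ₀r : (0 : ℝ) < Q₀ := by exact_mod_cast hQ₀
  obtain ⟨s, hs1, hs2, hs3⟩ := exists_interval_prod_norm (by omega) z hT hz hℓ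
  refine ⟨⌈s / Q₀⌉₊, fun m hm => ?_⟩
  obtain ⟨hm1, hm2⟩ := mem_Ico.mp hm
  have e1 : s / Q₀ ≤ m := (Nat.le_ceil _).trans (by exact_mod_cast hm1)
  have e2 : (m : ℝ) ≤ s / Q₀ + N := by
    have h1 : (⌈s / Q₀⌉₊ : ℝ) < s / Q₀ + 1 := Nat.ceil_lt_add_one
      (div_nonneg (by linarith) (by linarith))
    have h2 : (m : ℝ) + 1 ≤ ⌈s / Q₀⌉₊ + N := by exact_mod_cast hm2
    linarith
  have e3 : s ≤ Q₀ * m := by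
    rw [div_le_iff₀ hQ₀r] at e1
    linarith
  have e4 : (Q₀ : ℝ) * m ≤ s + Q₀ * N := by
    have := mul_le_mul_of_nonneg_left e2 hQ₀r.le
    rw [mul_add, mul_div_cancel₀ _ hQ₀r.ne'] at this
    exact this
  have e5 : ℓ * T / (2 * g) ≤ T / 4 := by
    rw [div_le_iff₀ (by positivity)]
    nlinarith
  exact ⟨⟨by linarith, by linarith⟩, hs3 _ (by linarith) (by linarith)⟩

theorem discard_bound {g : ℕ} {C' T w N A c₀ : ℝ} (hC' : 0 ≤ C') (hT : 0 ≤ log T)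
    (hw : 0 < w) (hwN : w ≤ N) (hc₀ : 0 < c₀) (hA : 4 * g * C' / c₀ ≤ A)
    (hTw : A * log T ≤ w) :
    C' * log T * (g * (N / w + 1)) ≤ c₀ / 2 * N := by
  have hN : 0 < N := hw.trans_le hwN
  rw [div_le_iff₀ hc₀] at hA
  have h1 : N / w + 1 ≤ 2 * N / w := by
    rw [div_add_one hw.ne']
    gcongr
    linarith
  have h2 : (g : ℝ) * (N / w + 1) ≤ g * (2 * N / w) := by gcongr
  have h3 : C' * log T * (g * (N / w + 1)) ≤ C' * log T * (g * (2 * N / w)) := by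
    gcongr
  refine h3.trans ?_
  have h4 : C' * log T * (g * (2 * N / w)) = (4 * g * C') * log T * N / (2 * w) := by
    field_simp
    ring
  rw [h4, div_le_iff₀ (by linarith)]
  have h5 : 4 * g * C' * log T ≤ A * c₀ * log T := by gcongr
  have h6 : A * c₀ * log T ≤ c₀ * w := by nlinarith
  calc 4 * g * C' * log T * N ≤ c₀ * w * N := mul_le_mul_of_nonneg_right (h5.trans h6) hN.le
    _ = c₀ / 2 * N * (2 * w) := by ring

set_option maxHeartbeats 800000 in
theorem exists_sum_rootCount_rough_ge {F : ℤ[X]} (hF : Irreducible F) (hdeg : 2 ≤ F.natDegree) :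
    ∃ K : ℕ, ∃ c A : ℝ, 0 < c ∧ 1 ≤ A ∧ 1 ≤ K ∧ ∀ T w ℓ : ℝ, A ≤ w → 0 < ℓ → ℓ ≤ 1 →
      A * w ^ K ≤ ℓ * T → A * log T ≤ w → ∀ Q : Finset ℕ,
      (∀ q : ℕ, T ^ F.natDegree < q → q ≤ exp ℓ * T ^ F.natDegree →
        (∀ p : ℕ, p.Prime → p ∣ q → w < p) → q ∈ Q) →
      c * ℓ * T ^ F.natDegree / log w ≤ ((∑ q ∈ Q, rootCount F q : ℕ) : ℝ) := by
  have hdeg0 : F.natDegree ≠ 0 := by omega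
  obtain ⟨R, iR, iD, θ, b, φ, hb, hf, hφ, hψ⟩ := exists_order_of_irreducible hF hdeg0
  obtain ⟨p₁, K, c₀, hc₀, hp₁2, hlc, hK, hsieve⟩ := exists_sum_card_sieve_ge hF hdeg0 b hf
  obtain ⟨r, hr⟩ : ∃ r, r + 2 = F.natDegree := ⟨F.natDegree - 2, by omega⟩
  set Q₀ := primorial p₁ with hQ₀def
  have hQ₀ : 0 < Q₀ := primorial_pos _
  have hpQ : ∀ p : ℕ, p.Prime → (p ∣ Q₀ ↔ p ≤ p₁) := fun p hp => hp.dvd_primorial_iff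
  obtain ⟨R₁, Cγ, hCγ, hbox⟩ := exists_box_constants r φ hφ hQ₀
  obtain ⟨Cp, hCp, hpow⟩ := powerIndex_bounds b hb φ hφ
  have hg2 : (2 : ℝ) ≤ F.natDegree := by exact_mod_cast hdeg
  have hQ₀r : (1 : ℝ) ≤ Q₀ := by exact_mod_cast hQ₀
  set C' := |log Cp| + F.natDegree * F.natDegree with hC'
  have hC'0 : 0 ≤ C' := by positivity
  set A := 3 + p₁ + 40 * Cγ + 4 * F.natDegree * (1 + Q₀) + 4 * F.natDegree * C' / c₀ with hA
  have a1 : 0 ≤ 4 * F.natDegree * C' / c₀ := by positivity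
  have a2 : 0 ≤ 4 * (F.natDegree : ℝ) * (1 + Q₀) := by positivity
  have a3 : (0 : ℝ) ≤ p₁ := by positivity
  refine ⟨K, (1 / (40 * Cγ)) ^ (r + 1) * (1 / (4 * F.natDegree * Q₀)) * (c₀ / 2), A, by positivity,
    by linarith, hK, ?_⟩
  intro T w ℓ hAw hℓ hℓ1 hT hTw Q hQ
  have hw3 : 3 ≤ w := by linarith
  have hwK : w ≤ w ^ K := le_self_pow₀ (by linarith) (by omega)
  have hwK1 : 1 ≤ w ^ K := by linarith
  have hlogw : 0 < log w := log_pos (by linarith)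
  have hA0 : 0 < A := by linarith
  have hTpos : 0 < T := by
    have : 0 < ℓ * T := lt_of_lt_of_le (by positivity) hT
    exact pos_of_mul_pos_right this hℓ.le
  have hℓT : ℓ * T ≤ T := by nlinarith
  have hT3 : 3 ≤ T := by nlinarith
  have hlogT : 1 ≤ log T := by
    rw [le_log_iff_exp_le hTpos]
    linarith [exp_one_lt_d9]
  -- the box size
  set M := ⌊T / (20 * Cγ)⌋₊ with hM
  have hTC : w ≤ T / (40 * Cγ) := by
    rw [le_div_iff₀ (by positivity)]
    have h1 : 40 * Cγ * w ≤ A * w := by gcongr; linarith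
    have h2 : A * w ≤ A * w ^ K := by gcongr
    linarith
  have hM1 : (M : ℝ) ≤ T / (20 * Cγ) := Nat.floor_le (by positivity)
  have hM2 : T / (40 * Cγ) ≤ M := by
    have h1 : T / (20 * Cγ) < M + 1 := Nat.lt_floor_add_one _
    have h2 : T / (20 * Cγ) = 2 * (T / (40 * Cγ)) := by field_simp; norm_num
    linarith
  have hwM : w ≤ M := hTC.trans hM2
  have hM0 : (1 : ℝ) ≤ M := by linarith
  have hCM : Cγ * M ≤ T / 20 := by
    have := mul_le_mul_of_nonneg_left hM1 (by linarith : 0 ≤ Cγ)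
    have e : Cγ * (T / (20 * Cγ)) = T / 20 := by field_simp
    linarith
  -- the length of the sieved interval
  set N := ⌊(ℓ * T / (2 * F.natDegree) - 1) / Q₀⌋₊ with hN
  have hgQ : 4 * F.natDegree * (1 + Q₀) * w ^ K ≤ ℓ * T := by
    refine le_trans ?_ hT
    gcongr
    linarith [abs_nonneg (log Cp)]
  have hX1 : 1 + (Q₀ : ℝ) ≤ ℓ * T / (4 * F.natDegree) := by
    rw [le_div_iff₀ (by positivity)]
    have : 4 * F.natDegree * (1 + Q₀) * 1 ≤ 4 * F.natDegree * (1 + Q₀) * w ^ K := by gcongr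
    linarith
  have hhalf : ℓ * T / (2 * F.natDegree) = 2 * (ℓ * T / (4 * F.natDegree)) := by field_simp; norm_num
  have hN1 : Q₀ * (N : ℝ) ≤ ℓ * T / (2 * F.natDegree) - 1 := by
    have := Nat.floor_le (a := (ℓ * T / (2 * F.natDegree) - 1) / Q₀)
      (div_nonneg (by linarith) (by linarith))
    rw [le_div_iff₀ (by linarith)] at this
    linarith
  have hN2 : ℓ * T / (4 * F.natDegree * Q₀) ≤ N := by
    have h1 : (ℓ * T / (2 * F.natDegree) - 1) / Q₀ < N + 1 := Nat.lt_floor_add_one _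
    rw [div_lt_iff₀ (by linarith)] at h1
    have h2 : ℓ * T / (4 * F.natDegree * Q₀) = ℓ * T / (4 * F.natDegree) / Q₀ := by rw [div_div]
    rw [h2, div_le_iff₀ (by linarith)]
    linarith
  have hNw : w ^ K ≤ N := by
    refine le_trans ?_ hN2
    rw [le_div_iff₀ (by positivity)]
    nlinarith
  have hwN : w ≤ N := hwK.trans hNw
  -- starting points
  have hstart : ∀ (u : Fin r → ℕ) (v : ℕ), ∃ m₀ : ℕ, (∀ i, u i < M) →
      v ∈ Ico (R₁ * M) (R₁ * M + M) → ∀ m ∈ Ico m₀ (m₀ + N),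
      (9 / 10 * T ≤ 1 + Q₀ * m ∧ (1 + Q₀ * m : ℝ) ≤ 16 / 10 * T) ∧
      (T ^ F.natDegree < ∏ k, ‖((1 + Q₀ * m : ℝ) : ℂ) + φ k (aeval θ (boxPoly Q₀ u v))‖ ∧
      ∏ k, ‖((1 + Q₀ * m : ℝ) : ℂ) + φ k (aeval θ (boxPoly Q₀ u v))‖ ≤
        exp ℓ * T ^ F.natDegree) := by
    intro u v
    by_cases h : (∀ i, u i < M) ∧ v ∈ Ico (R₁ * M) (R₁ * M + M)
    · obtain ⟨hv1, hv2⟩ := mem_Ico.mp h.2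
      obtain ⟨m₀, hm₀⟩ := exists_start_prod_norm hdeg
        (fun k => φ k (aeval θ (boxPoly Q₀ u v))) hTpos
        (fun k => ((hbox M u v h.1 hv1 hv2).1 k).trans hCM) hℓ hℓ1 hQ₀ hN1
      exact ⟨m₀, fun _ _ => hm₀⟩
    · exact ⟨0, fun h1 h2 => absurd ⟨h1, h2⟩ h⟩
  choose m₀ hm₀ using hstart
  obtain ⟨good, hgood⟩ : ∃ good : (Fin r → ℕ) → ℕ → Finset ℕ, ∀ u v, good u v =
      (Ico (m₀ u v) (m₀ u v + N)).filter (fun m => (∀ p ∈ primesIoc p₁ w,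
        ¬ DvdNorm Q₀ (aeval θ (boxPoly Q₀ u v)) p m) ∧
        IsCoprime (Algebra.norm ℤ (((1 + Q₀ * m : ℤ) : R) + aeval θ (boxPoly Q₀ u v)))
          (powerIndex b (aeval θ (boxPoly Q₀ u v)))) := ⟨_, fun _ _ => rfl⟩
  have hdisc : ∀ (u : Fin r → ℕ) (v : ℕ), (∀ i, u i < M) →
      v ∈ Ico (R₁ * M) (R₁ * M + M) →
      ((((Ico (m₀ u v) (m₀ u v + N)).filter (fun m => ∀ p ∈ primesIoc p₁ w,
          ¬ DvdNorm Q₀ (aeval θ (boxPoly Q₀ u v)) p m)).card : ℕ) : ℝ) - c₀ / 2 * N / log w ≤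
        (good u v).card := by
    intro u v hu hv
    obtain ⟨hv1, hv2⟩ := mem_Ico.mp hv
    obtain ⟨hn1, hn2⟩ := hbox M u v hu hv1 hv2
    have hCM1 : 1 ≤ Cγ * M := one_le_mul_of_one_le_of_one_le hCγ hM0
    obtain ⟨hD, hD'⟩ := hpow _ _ hCM1 hn1 hn2
    have hbad := card_not_coprime_powerIndex_le b Q₀ _ hD (by linarith : 1 < w)
      (fun p hp hlt h => absurd ((hpQ p hp).mp h) (by omega)) (by linarith : (p₁ : ℝ) ≤ w)
      (fun p hp hle m => not_dvdNorm_of_dvd b hf hp ((hpQ p hp).mpr hle) u v m) (m₀ u v) N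
    have hlogD : log ((powerIndex b (aeval θ (boxPoly Q₀ u v))).natAbs : ℕ) ≤
        C' * log T := by
      have hpos : (0 : ℝ) < ((powerIndex b (aeval θ (boxPoly Q₀ u v))).natAbs : ℕ) := by
        exact_mod_cast Int.natAbs_pos.mpr hD
      have h1 : Cp * (Cγ * M) ^ (F.natDegree * F.natDegree) ≤ Cp * T ^ (F.natDegree * F.natDegree) := by
        gcongr
        linarith
      refine (log_le_log hpos (hD'.trans h1)).trans ?_
      rw [log_mul hCp.ne' (by positivity), log_pow, hC', add_mul]
      push_cast
      have h2 := le_abs_self (log Cp)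
      have h3 : |log Cp| * 1 ≤ |log Cp| * log T := by gcongr
      linarith
    have hstep := discard_bound (g := F.natDegree) hC'0 (by linarith) (by linarith) hwN hc₀
      (by rw [hA]; linarith : 4 * F.natDegree * C' / c₀ ≤ A) hTw
    have hle : log ((powerIndex b (aeval θ (boxPoly Q₀ u v))).natAbs : ℕ) *
        (F.natDegree * (N / w + 1)) ≤ c₀ / 2 * N := by
      refine le_trans ?_ hstep
      gcongr
    have hbad2 := (le_div_iff₀ hlogw).mpr (hbad.trans hle)
    have hsplit : (((Ico (m₀ u v) (m₀ u v + N)).filter (fun m => ∀ p ∈ primesIoc p₁ w,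
          ¬ DvdNorm Q₀ (aeval θ (boxPoly Q₀ u v)) p m)).card : ℝ) ≤ (good u v).card +
        ((Ico (m₀ u v) (m₀ u v + N)).filter (fun m => (∀ p ∈ primesIoc p₁ w,
          ¬ DvdNorm Q₀ (aeval θ (boxPoly Q₀ u v)) p m) ∧
      ¬ IsCoprime (Algebra.norm ℤ (((1 + Q₀ * m : ℤ) : R) + aeval θ (boxPoly Q₀ u v)))
        (powerIndex b (aeval θ (boxPoly Q₀ u v))))).card := by
      rw [hgood]
      norm_cast
      refine (card_le_card ?_).trans (Finset.card_union_le _ _)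
      intro m hm
      obtain ⟨hm1, hm2⟩ := mem_filter.mp hm
      rw [mem_union, mem_filter, mem_filter]
      tauto
    linarith
  set U := Fintype.piFinset (fun _ : Fin r => range M) with hU
  have hUcard : (U.card : ℝ) = (M : ℝ) ^ r := by
    rw [hU, Fintype.card_piFinset]
    simp
  have hUmem : ∀ u ∈ U, ∀ i, u i < M := fun u hu i =>
    mem_range.mp (Fintype.mem_piFinset.mp hu i)
  set S := (U ×ˢ Ico (R₁ * M) (R₁ * M + M)).sigma (fun t => good t.1 t.2) with hS
  have hSmem : ∀ t ∈ S, (∀ i, t.1.1 i < M) ∧ t.1.2 ∈ Ico (R₁ * M) (R₁ * M + M) ∧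
      t.2 ∈ good t.1.1 t.1.2 := by
    intro t ht
    obtain ⟨h1, h2⟩ := Finset.mem_sigma.mp ht
    obtain ⟨h3, h4⟩ := mem_product.mp h1
    exact ⟨hUmem _ h3, h4, h2⟩
  have hSle := card_le_sum_rootCount_of_box hdeg0 b hb φ hφ hf hψ hr hQ₀ hlc
    (fun p hp hle => (hpQ p hp).mpr hle) hTpos Q hQ S
    (fun t ht k => by
      obtain ⟨h1, h2, -⟩ := hSmem t ht
      obtain ⟨hv1, hv2⟩ := mem_Ico.mp h2
      exact ((hbox M _ _ h1 hv1 hv2).1 k).trans hCM)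
    (fun t ht => by
      obtain ⟨h1, h2, h3⟩ := hSmem t ht
      rw [hgood] at h3
      exact (hm₀ _ _ h1 h2 _ (mem_filter.mp h3).1).1)
    (fun t ht => by
      obtain ⟨h1, h2, h3⟩ := hSmem t ht
      rw [hgood] at h3
      exact (hm₀ _ _ h1 h2 _ (mem_filter.mp h3).1).2)
    (fun t ht => by
      obtain ⟨h1, h2, h3⟩ := hSmem t ht
      rw [hgood] at h3
      exact (mem_filter.mp h3).2.1)
    (fun t ht => by
      obtain ⟨h1, h2, h3⟩ := hSmem t ht
      rw [hgood] at h3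
      exact (mem_filter.mp h3).2.2)
  have hScard : (M : ℝ) ^ r * (c₀ / 2 * N * M / log w) ≤ S.card := by
    rw [hS, Finset.card_sigma, Finset.sum_product, Nat.cast_sum, ← hUcard, ← nsmul_eq_mul]
    refine card_nsmul_le_sum _ _ _ (fun u hu => ?_)
    have h1 := hsieve w (by linarith) Q₀ M N (R₁ * M) hwM hNw
      (fun p hp hlt h => absurd ((hpQ p hp).mp h) (by omega)) (boxTail Q₀ u) (m₀ u)
    have h2 : ∑ v ∈ Ico (R₁ * M) (R₁ * M + M),
        (((((Ico (m₀ u v) (m₀ u v + N)).filter (fun m => ∀ p ∈ primesIoc p₁ w,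
          ¬ DvdNorm Q₀ (aeval θ (boxPoly Q₀ u v)) p m)).card : ℕ) : ℝ) -
          c₀ / 2 * N / log w) ≤
        ∑ v ∈ Ico (R₁ * M) (R₁ * M + M), ((good u v).card : ℝ) :=
      sum_le_sum (fun v hv => hdisc u v (hUmem u hu) hv)
    rw [sum_sub_distrib, sum_const, Nat.card_Ico, nsmul_eq_mul] at h2
    rw [Nat.cast_sum]
    refine le_trans ?_ h2
    refine le_trans ?_ (sub_le_sub_right h1 _)
    rw [Nat.add_sub_cancel_left]
    apply le_of_eq
    ring
  refine le_trans ?_ (hScard.trans (by exact_mod_cast hSle))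
  have hpowM : (T / (40 * Cγ)) ^ (r + 1) ≤ (M : ℝ) ^ (r + 1) := by gcongr
  calc (1 / (40 * Cγ)) ^ (r + 1) * (1 / (4 * F.natDegree * Q₀)) * (c₀ / 2) * ℓ * T ^ F.natDegree / log w
      = (T / (40 * Cγ)) ^ (r + 1) * ((c₀ / 2) * (ℓ * T / (4 * F.natDegree * Q₀)) / log w) := by
        rw [← hr, div_pow, div_pow, one_pow]
        field_simp
        ring
    _ ≤ (M : ℝ) ^ (r + 1) * ((c₀ / 2) * N / log w) := by gcongr
    _ = _ := by ring

end boxCounting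

section roughCell

open Polynomial Filter

theorem eventually_const_mul_log_rpow_le (A s : ℝ) {r : ℝ} (hr : 0 < r) :
    ∀ᶠ y : ℝ in atTop, A * log y ^ s ≤ y ^ r := by
  have h := (isLittleO_log_rpow_rpow_atTop s hr).bound (show 0 < 1 / (|A| + 1) by positivity)
  filter_upwards [h, eventually_ge_atTop 1] with y hy hy1
  have h1 : 0 ≤ log y ^ s := rpow_nonneg (log_nonneg hy1) _
  have h2 : 0 ≤ y ^ r := rpow_nonneg (by linarith) _
  rw [Real.norm_of_nonneg h1, Real.norm_of_nonneg h2, div_mul_eq_mul_div, one_mul,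
    le_div_iff₀ (by positivity)] at hy
  nlinarith [le_abs_self A, mul_le_mul_of_nonneg_right (le_abs_self A) h1]

theorem exists_sum_rootCount_div_rough_ge {F : ℤ[X]} (hF : Irreducible F)
    (hdeg : 2 ≤ F.natDegree) :
    ∃ κ : ℝ, 0 < κ ∧ κ ≤ 1 / 4 ∧ ∀ C' : ℝ, ∃ c y₁ : ℝ, 0 < c ∧ 3 ≤ y₁ ∧ ∀ y t ℓ : ℝ,
      y₁ ≤ y → √y ≤ t → t ≤ 2 * y → 0 < ℓ → log y ^ (-C') ≤ ℓ → ℓ ≤ 1 → ∀ Q : Finset ℕ,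
      (∀ q : ℕ, q ∈ Q ↔ t < q ∧ q ≤ exp ℓ * t ∧ ∀ p : ℕ, p.Prime → p ∣ q → y ^ κ < p) →
      c * ℓ / log y ≤ ∑ q ∈ Q, (rootCount F q : ℝ) / q := by
  obtain ⟨K, c₀, A, hc₀, hA, hK, hmain⟩ := exists_sum_rootCount_rough_ge hF hdeg
  have hg0 : (2 : ℝ) ≤ F.natDegree := by exact_mod_cast hdeg
  have hK0 : (1 : ℝ) ≤ K := by exact_mod_cast hK
  set κ : ℝ := 1 / (4 * F.natDegree * K) with hκ
  have hκ0 : 0 < κ := by positivity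
  refine ⟨κ, hκ0, ?_, fun C' => ?_⟩
  · rw [hκ]
    gcongr
    nlinarith
  obtain ⟨y₁, hy₁⟩ := eventually_atTop.mp
    ((eventually_const_mul_log_rpow_le A C' (show 0 < 1 / (4 * (F.natDegree : ℝ)) by
      positivity)).and ((eventually_const_mul_log_rpow_le (2 * A) 1 hκ0).and
      (tendsto_rpow_atTop hκ0 |>.eventually_ge_atTop A)))
  refine ⟨c₀ / κ / exp 1, max y₁ 3, by positivity, le_max_right _ _, ?_⟩
  intro y t ℓ hy ht1 ht2 hℓ hℓL hℓ1 Q hQ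
  obtain ⟨hb1, hb2, hb3⟩ := hy₁ y ((le_max_left _ _).trans hy)
  have hy3 : 3 ≤ y := (le_max_right _ _).trans hy
  have hy0 : 0 < y := by linarith
  have hlogy : 0 < log y := log_pos (by linarith)
  have ht0 : 0 < t := (Real.sqrt_pos.mpr hy0).trans_le ht1
  set T : ℝ := t ^ (1 / (F.natDegree : ℝ)) with hT
  have hTg : T ^ F.natDegree = t := by
    rw [hT, ← rpow_natCast, ← rpow_mul ht0.le, one_div_mul_cancel (by linarith),
      rpow_one]
  have hwK : (y ^ κ) ^ K = y ^ (1 / (4 * (F.natDegree : ℝ))) := by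
    rw [← rpow_natCast, ← rpow_mul hy0.le]
    congr 1
    rw [hκ]
    field_simp
  have hTy : y ^ (1 / (4 * (F.natDegree : ℝ))) * y ^ (1 / (4 * (F.natDegree : ℝ))) ≤ T := by
    have h1 : (√y) ^ (1 / (F.natDegree : ℝ)) ≤ T := by
      rw [hT]
      gcongr
    refine le_trans (le_of_eq ?_) h1
    rw [Real.sqrt_eq_rpow, ← rpow_mul hy0.le, ← rpow_add hy0]
    congr 1
    field_simp
    norm_num
  have hlog2 : A * y ^ (1 / (4 * (F.natDegree : ℝ))) ≤ ℓ * T := by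
    rw [rpow_neg hlogy.le, inv_le_iff_one_le_mul₀ (by positivity)] at hℓL
    have hz : 0 < y ^ (1 / (4 * (F.natDegree : ℝ))) := by positivity
    set Z := y ^ (1 / (4 * (F.natDegree : ℝ))) with hZ
    calc A * Z ≤ A * Z * (ℓ * log y ^ C') := le_mul_of_one_le_right (by positivity) hℓL
      _ = ℓ * (Z * (A * log y ^ C')) := by ring
      _ ≤ ℓ * (Z * Z) := by gcongr
      _ ≤ ℓ * T := by gcongr
  have hlogT : A * log T ≤ y ^ κ := by
    refine le_trans ?_ hb2
    rw [rpow_one, hT, log_rpow ht0]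
    have h1 : log t ≤ 2 * log y := by
      rw [← log_rpow hy0]
      refine log_le_log ht0 (ht2.trans ?_)
      norm_cast
      nlinarith
    have h2 : 1 / (F.natDegree : ℝ) * log t ≤ 1 / 2 * (2 * log y) :=
      calc 1 / (F.natDegree : ℝ) * log t ≤ 1 / (F.natDegree : ℝ) * (2 * log y) := by
            gcongr
        _ ≤ _ := by gcongr
    nlinarith
  have hfin := hmain T (y ^ κ) ℓ hb3 hℓ hℓ1 (by rw [hwK]; exact hlog2) hlogT Q
    (fun q h1 h2 h3 => (hQ q).mpr ⟨by rwa [hTg] at h1, by rwa [hTg] at h2, h3⟩)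
  rw [hTg, log_rpow hy0] at hfin
  have hsum : ((∑ q ∈ Q, rootCount F q : ℕ) : ℝ) / (exp 1 * t) ≤
      ∑ q ∈ Q, (rootCount F q : ℝ) / q := by
    rw [Nat.cast_sum, sum_div]
    refine sum_le_sum (fun q hq => ?_)
    obtain ⟨h1, h2, -⟩ := (hQ q).mp hq
    have h3 : (q : ℝ) ≤ exp 1 * t := h2.trans (by gcongr)
    have h4 : (0 : ℝ) < q := ht0.trans h1
    gcongr
  refine le_trans ?_ hsum
  rw [le_div_iff₀ (by positivity)]
  refine le_trans (le_of_eq ?_) hfin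
  field_simp

end roughCell

section progressionSieve

open Polynomial

theorem exists_dvd_of_dvd_eval_derivative {F : ℤ[X]} (hF : Irreducible F)
    (hdeg : F.natDegree ≠ 0) :
    ∃ D : ℤ, D ≠ 0 ∧ ∀ n d : ℤ, d ∣ F.eval n → d ∣ F.derivative.eval n → d ∣ D := by
  have hirr := (IsPrimitive.Int.irreducible_iff_irreducible_map_cast
    (hF.isPrimitive hdeg)).mp hF
  obtain ⟨a, b, hab⟩ := hirr.separable
  obtain ⟨s, hs, hs'⟩ := IsLocalization.integerNormalization_spec (nonZeroDivisors ℤ) a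
  obtain ⟨t, ht, ht'⟩ := IsLocalization.integerNormalization_spec (nonZeroDivisors ℤ) b
  set A := IsLocalization.integerNormalization (nonZeroDivisors ℤ) a with hA
  set B := IsLocalization.integerNormalization (nonZeroDivisors ℤ) b with hB
  refine ⟨s * t, mul_ne_zero (nonZeroDivisors.ne_zero hs) (nonZeroDivisors.ne_zero ht), ?_⟩
  have key : C t * A * F + C s * B * F.derivative = C (s * t) := by
    apply Polynomial.map_injective (Int.castRingHom ℚ) Int.cast_injective
    have hs2 : A.map (Int.castRingHom ℚ) = C (s : ℚ) * a := by
      rw [← smul_eq_C_mul]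
      exact hs'.trans (by ext; simp)
    have ht2 : B.map (Int.castRingHom ℚ) = C (t : ℚ) * b := by
      rw [← smul_eq_C_mul]
      exact ht'.trans (by ext; simp)
    rw [Polynomial.map_add, Polynomial.map_mul, Polynomial.map_mul, Polynomial.map_mul,
      Polynomial.map_mul, hs2, ht2, map_C, map_C, map_C, ← derivative_map]
    simp only [eq_intCast, Int.cast_mul, C_mul]
    linear_combination (C (s : ℚ) * C (t : ℚ)) * hab
  intro n d h1 h2
  have := congrArg (eval n) key
  simp only [eval_add, eval_mul, eval_C] at this
  rw [← this]
  exact dvd_add (h1.mul_left _) (h2.mul_left _)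

theorem eval_ne_zero_of_irreducible {F : ℤ[X]} (hF : Irreducible F) (hdeg : 2 ≤ F.natDegree)
    (n : ℤ) : F.eval n ≠ 0 := by
  intro h
  obtain ⟨G, hG⟩ := dvd_iff_isRoot.mpr h
  rcases hF.isUnit_or_isUnit hG with h1 | h1
  · have := natDegree_eq_zero_of_isUnit h1
    rw [natDegree_X_sub_C] at this
    omega
  · have h2 := natDegree_eq_zero_of_isUnit h1
    have h3 := natDegree_mul_le (p := X - C n) (q := G)
    rw [← hG, natDegree_X_sub_C, h2] at h3
    omega

theorem exists_natAbs_eval_le (F : ℤ[X]) :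
    ∃ C : ℝ, 1 ≤ C ∧ ∀ n : ℕ, 1 ≤ n → (((F.eval (n : ℤ)).natAbs : ℕ) : ℝ) ≤ C * n ^ F.natDegree := by
  refine ⟨1 + ∑ i ∈ range (F.natDegree + 1), |(F.coeff i : ℝ)|, ?_, fun n hn => ?_⟩
  · have : 0 ≤ ∑ i ∈ range (F.natDegree + 1), |(F.coeff i : ℝ)| :=
      sum_nonneg (fun _ _ => abs_nonneg _)
    linarith
  · have hn1 : (1 : ℝ) ≤ n := by exact_mod_cast hn
    rw [Nat.cast_natAbs, Int.cast_abs, eval_eq_sum_range]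
    push_cast
    rw [add_mul, one_mul, sum_mul]
    refine (Finset.abs_sum_le_sum_abs _ _).trans (le_add_of_nonneg_of_le (by positivity) ?_)
    refine sum_le_sum (fun i hi => ?_)
    rw [abs_mul, abs_of_nonneg (by positivity : (0 : ℝ) ≤ (n : ℝ) ^ i)]
    gcongr
    exact Nat.lt_succ_iff.mp (mem_range.mp hi)

/-- `p` divides the cofactor of `A` in `F (ν + A m)` -/
def DvdCofactor (F : ℤ[X]) (A ν p m : ℕ) : Prop :=
  ((p * A : ℕ) : ℤ) ∣ F.eval ((ν + A * m : ℕ) : ℤ)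

theorem dvdCofactor_mod_iff (F : ℤ[X]) (A ν p m : ℕ) :
    DvdCofactor F A ν p (m % p) ↔ DvdCofactor F A ν p m := by
  unfold DvdCofactor
  refine dvd_iff_dvd_of_dvd_sub (dvd_trans ?_ (sub_dvd_eval_sub _ _ F))
  have h : (p : ℤ) ∣ ((m % p : ℕ) : ℤ) - m := by
    rw [Int.natCast_mod]
    exact Int.ModEq.dvd (Int.mod_modEq _ _).symm
  have e : ((ν + A * (m % p) : ℕ) : ℤ) - ((ν + A * m : ℕ) : ℤ) =
      (((m % p : ℕ) : ℤ) - m) * A := by push_cast; ring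
  rw [e, Nat.cast_mul]
  exact mul_dvd_mul_right h _

theorem classCount_dvdCofactor_le {F : ℤ[X]} {D : ℤ}
    (hD : ∀ n d : ℤ, d ∣ F.eval n → d ∣ F.derivative.eval n → d ∣ D) {A ν p : ℕ} (hp : p.Prime)
    (hpD : ¬ (p : ℤ) ∣ D) (hν : (A : ℤ) ∣ F.eval (ν : ℤ)) (hA : 0 < A) :
    classCount (DvdCofactor F A ν) p ≤ rootCount F p := by
  have hA0 : (A : ℤ) ≠ 0 := by exact_mod_cast hA.ne'
  by_cases hpA : p ∣ A
  · have h1 : 1 ≤ rootCount F p := by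
      refine card_pos.mpr ⟨ν % p, mem_filter.mpr
        ⟨mem_range.mpr (Nat.mod_lt _ hp.pos), ?_⟩⟩
      have h2 : (p : ℤ) ∣ F.eval (ν : ℤ) := dvd_trans (by exact_mod_cast hpA) hν
      refine (dvd_iff_dvd_of_dvd_sub (dvd_trans ?_ (sub_dvd_eval_sub _ _ F))).mpr h2
      rw [Int.natCast_mod]
      exact Int.ModEq.dvd (Int.mod_modEq _ _).symm
    refine le_trans (Finset.card_le_one.mpr ?_) h1
    intro m hm m' hm'
    obtain ⟨hm1, hm2⟩ := mem_filter.mp hm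
    obtain ⟨hm1', hm2'⟩ := mem_filter.mp hm'
    obtain ⟨e, he⟩ := hν
    have hpow : ((p * A : ℕ) : ℤ) ∣ (A : ℤ) ^ 2 := by
      rw [pow_two, Nat.cast_mul]
      exact mul_dvd_mul_right (by exact_mod_cast hpA) _
    have hlin : ∀ m : ℕ, DvdCofactor F A ν p m → (p : ℤ) ∣ e + F.derivative.eval (ν : ℤ) * m := by
      intro m hm
      obtain ⟨k, hk⟩ := F.binomExpansion (ν : ℤ) ((A * m : ℕ) : ℤ)
      unfold DvdCofactor at hm
      rw [Nat.cast_add, hk, he] at hm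
      have h3 : ((p * A : ℕ) : ℤ) ∣ k * ((A * m : ℕ) : ℤ) ^ 2 := by
        rw [Nat.cast_mul A m, mul_pow]
        exact ((hpow.mul_right _).mul_left _)
      rw [dvd_add_left h3] at hm
      have e2 : (A : ℤ) * e + F.derivative.eval (ν : ℤ) * ((A * m : ℕ) : ℤ) =
          (e + F.derivative.eval (ν : ℤ) * m) * A := by push_cast; ring
      rw [e2, Nat.cast_mul] at hm
      exact Int.dvd_of_mul_dvd_mul_right hA0 hm
    have h4 := dvd_sub (hlin m hm2) (hlin m' hm2')
    have e3 : e + F.derivative.eval (ν : ℤ) * m - (e + F.derivative.eval (ν : ℤ) * m') =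
        F.derivative.eval (ν : ℤ) * ((m : ℤ) - m') := by ring
    rw [e3] at h4
    rcases (Nat.prime_iff_prime_int.mp hp).dvd_or_dvd h4 with h5 | h5
    · exact absurd (hD ν p (by rw [he]; exact Dvd.dvd.mul_right (by exact_mod_cast hpA) _) h5) hpD
    · have := (Nat.modEq_iff_dvd.mpr h5)
      exact ((Nat.ModEq.eq_of_lt_of_lt this (mem_range.mp hm1')
        (mem_range.mp hm1))).symm
  · have hcop : Nat.Coprime p A := (Nat.Prime.coprime_iff_not_dvd hp).mpr hpA
    refine card_le_card_of_injOn (fun m => (ν + A * m) % p) ?_ ?_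
    · intro m hm
      obtain ⟨hm1, hm2⟩ := mem_filter.mp hm
      refine mem_filter.mpr ⟨mem_range.mpr (Nat.mod_lt _ hp.pos), ?_⟩
      have h2 : (p : ℤ) ∣ F.eval ((ν + A * m : ℕ) : ℤ) :=
        dvd_trans (by push_cast; exact dvd_mul_right _ _) hm2
      refine (dvd_iff_dvd_of_dvd_sub (dvd_trans ?_ (sub_dvd_eval_sub _ _ F))).mpr h2
      rw [Int.natCast_mod]
      exact Int.ModEq.dvd (Int.mod_modEq _ _).symm
    · intro m hm m' hm' h
      obtain ⟨hm1, -⟩ := mem_filter.mp hm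
      obtain ⟨hm1', -⟩ := mem_filter.mp hm'
      have h1 : ν + A * m ≡ ν + A * m' [MOD p] := h
      have h2 := Nat.ModEq.add_left_cancel' _ h1
      have h3 := Nat.ModEq.cancel_left_of_coprime hcop h2
      exact Nat.ModEq.eq_of_lt_of_lt h3 (mem_range.mp hm1) (mem_range.mp hm1')

theorem exists_card_progression_sieve_ge {F : ℤ[X]} (hF : Irreducible F)
    (hdeg : F.natDegree ≠ 0) :
    ∃ p₀ K : ℕ, ∃ c : ℝ, 0 < c ∧ 2 ≤ p₀ ∧ F.leadingCoeff.natAbs ≤ p₀ ∧ 1 ≤ K ∧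
      ∀ A ν : ℕ, 0 < A → ν < A → (A : ℤ) ∣ F.eval (ν : ℤ) → ∀ w x : ℝ, 2 ≤ w →
      4 * A * w ^ K ≤ x →
      c * x / (A * log w) ≤ (((Icc 1 ⌊x⌋₊).filter (fun n : ℕ => x / 2 < n ∧
        n % A = ν ∧ ∀ p ∈ primesIoc p₀ w, ¬ ((p * A : ℕ) : ℤ) ∣ F.eval (n : ℤ))).card : ℝ) := by
  set g := F.natDegree with hg
  obtain ⟨p₀, K, hp₀, hK, hsieve⟩ := exists_sieve_bounds g
  obtain ⟨C₀, hC₀⟩ := exists_sum_rootCount_div_sub_loglog_le hF hdeg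
  obtain ⟨D, hD0, hD⟩ := exists_dvd_of_dvd_eval_derivative hF hdeg
  have hF0 : F ≠ 0 := hF.ne_zero
  obtain ⟨p₁, hp₁0, hp₁1, hp₁2, hp₁3⟩ : ∃ p₁ : ℕ, p₀ ≤ p₁ ∧ F.leadingCoeff.natAbs ≤ p₁ ∧
      2 * g ≤ p₁ ∧ D.natAbs ≤ p₁ :=
    ⟨p₀ + F.leadingCoeff.natAbs + 2 * g + D.natAbs, by omega, by omega, by omega, by omega⟩
  refine ⟨p₁, K, 1 / 8 * exp (-(2 * g ^ 2 + C₀)), by positivity, by omega, hp₁1, hK, ?_⟩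
  intro A ν hA hνA hν w x hw hx
  set P := primesIoc p₁ w with hP
  have hPp : ∀ p ∈ P, p.Prime ∧ p₁ < p ∧ (p : ℝ) ≤ w := by
    intro p hp
    rw [hP, mem_primesIoc] at hp
    exact ⟨hp.1, by exact_mod_cast hp.2.1, hp.2.2⟩
  have hcc : ∀ p ∈ P, classCount (DvdCofactor F A ν) p ≤ rootCount F p := by
    intro p hp
    refine classCount_dvdCofactor_le hD (hPp p hp).1 ?_ hν hA
    intro h
    have := Nat.le_of_dvd (Int.natAbs_pos.mpr hD0) (Int.natCast_dvd.mp h)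
    have := (hPp p hp).2.1
    omega
  have hrg : ∀ p ∈ P, rootCount F p ≤ g := by
    intro p hp
    refine rootCount_le_natDegree hdeg (hPp p hp).1 ?_
    intro h
    have := Nat.le_of_dvd (Int.natAbs_pos.mpr (leadingCoeff_ne_zero.mpr hF0))
      (Int.natCast_dvd.mp h)
    have := (hPp p hp).2.1
    omega
  have hA0 : (0 : ℝ) < A := by exact_mod_cast hA
  have hlogw : 0 < log w := log_pos (by linarith)
  have hwK : 2 ≤ w ^ K := hw.trans (le_self_pow₀ (by linarith) (by omega))
  obtain ⟨u, hu⟩ : ∃ u : ℕ, u = ⌊x / (2 * A)⌋₊ := ⟨_, rfl⟩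
  have hx0 : 0 < x := lt_of_lt_of_le (by positivity) hx
  have hxA : 2 * w ^ K ≤ x / (2 * A) := by
    rw [le_div_iff₀ (by positivity)]; linarith
  have hu1 : (u : ℝ) ≤ x / (2 * A) := hu ▸ Nat.floor_le (by positivity)
  have hu2 : x / (2 * A) < u + 1 := hu ▸ Nat.lt_floor_add_one _
  have hu3 : 1 ≤ u := by
    have : (0 : ℝ) < u := by linarith
    exact_mod_cast this
  obtain ⟨N, rfl⟩ : ∃ N, u = N + 1 := ⟨u - 1, by omega⟩
  push_cast at hu1 hu2
  have hN : w ^ K ≤ N := by linarith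
  have hN2 : x / (4 * A) ≤ N := by
    have : x / (4 * A) = x / (2 * A) / 2 := by field_simp; norm_num
    linarith
  have hlow := (hsieve w hw P (primesIoc_subset (by exact_mod_cast hp₁0) le_rfl)
      (DvdCofactor F A ν) (fun p _ m => dvdCofactor_mod_iff F A ν p m)
      (fun p hp => (hcc p hp).trans (hrg p hp)) (N + 2) N hN).1
  have hcard : ((Ico (N + 2) (N + 2 + N)).filter
      (fun m => ∀ p ∈ P, ¬ DvdCofactor F A ν p m)).card ≤
      ((Icc 1 ⌊x⌋₊).filter (fun n : ℕ => x / 2 < n ∧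
        n % A = ν ∧ ∀ p ∈ P, ¬ ((p * A : ℕ) : ℤ) ∣ F.eval (n : ℤ))).card := by
    refine card_le_card_of_injOn (fun m => ν + A * m) (fun m hm => ?_) ?_
    · obtain ⟨hm1, hm2⟩ := mem_filter.mp hm
      obtain ⟨hm3, hm4⟩ := mem_Ico.mp hm1
      refine mem_filter.mpr ⟨mem_Icc.mpr ⟨?_, Nat.le_floor ?_⟩, ?_, ?_, hm2⟩
      · have : 0 < A * m := Nat.mul_pos hA (by omega)
        change 1 ≤ ν + A * m
        omega
      · have h1 : (ν : ℝ) ≤ A := by exact_mod_cast hνA.le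
        have h2 : (m : ℝ) + 1 ≤ N + 2 + N := by exact_mod_cast hm4
        rw [le_div_iff₀ (by positivity)] at hu1
        push_cast
        nlinarith
      · have h2 : (N : ℝ) + 2 ≤ m := by exact_mod_cast hm3
        rw [div_lt_iff₀ (by positivity)] at hu2
        push_cast
        nlinarith [(Nat.cast_nonneg ν : (0 : ℝ) ≤ ν)]
      · rw [Nat.add_mul_mod_self_left, Nat.mod_eq_of_lt hνA]
    · intro m _ m' _ h
      exact Nat.eq_of_mul_eq_mul_left hA (Nat.add_left_cancel h)
  refine le_trans ?_ (hlow.trans (by exact_mod_cast hcard))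
  have hprod : exp (-(2 * g ^ 2 + C₀)) * (log w)⁻¹ ≤
      ∏ p ∈ P, (1 - (classCount (DvdCofactor F A ν) p : ℝ) / p) := by
    have h1 : exp (∑ p ∈ P, -((rootCount F p : ℝ) / p + ((rootCount F p : ℝ) / p) ^ 2)) ≤
        ∏ p ∈ P, (1 - (classCount (DvdCofactor F A ν) p : ℝ) / p) := by
      rw [exp_sum]
      refine prod_le_prod (fun p _ => (exp_pos _).le) (fun p hp => ?_)
      have hp0 : (0 : ℝ) < p := by exact_mod_cast (hPp p hp).1.pos
      refine (exp_neg_add_sq_le_one_sub (by positivity) ?_).trans ?_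
      · have h2 := (hPp p hp).2.1
        rw [div_le_div_iff₀ hp0 two_pos]
        have h3 := hrg p hp
        have : rootCount F p * 2 ≤ 1 * p := by omega
        exact_mod_cast this
      · have := hcc p hp
        gcongr
    refine le_trans ?_ h1
    rw [← exp_log (inv_pos.mpr hlogw), ← exp_add, log_inv]
    gcongr
    rw [Finset.sum_neg_distrib, sum_add_distrib]
    have h3 : ∑ p ∈ P, (rootCount F p : ℝ) / p ≤ log (log w) + C₀ := by
      refine le_trans (sum_le_sum_of_subset_of_nonneg
        (primesIoc_subset (Nat.cast_nonneg p₁) le_rfl) (fun _ _ _ => by positivity)) ?_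
      linarith [(abs_le.mp (hC₀ w hw)).2]
    have h4 : ∑ p ∈ P, ((rootCount F p : ℝ) / p) ^ 2 ≤ 2 * (g : ℝ) ^ 2 := by
      have hsum2 : ∑ p ∈ P, (1 : ℝ) / (p : ℝ) ^ 2 ≤ 2 := sum_inv_sq_primesIoc_le _ _
      calc _ ≤ ∑ p ∈ P, (g : ℝ) ^ 2 * (1 / (p : ℝ) ^ 2) := by
            refine sum_le_sum (fun p hp => ?_)
            rw [div_pow, mul_one_div]
            have := hrg p hp
            gcongr
        _ ≤ 2 * (g : ℝ) ^ 2 := by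
            rw [← mul_sum]; nlinarith [sq_nonneg (g : ℝ)]
    linarith
  calc _ = 1 / 2 * (x / (4 * A) * (exp (-(2 * g ^ 2 + C₀)) * (log w)⁻¹)) := by
        field_simp; norm_num
    _ ≤ _ := by gcongr

end progressionSieve

section divisorCells

open Polynomial

theorem rootCount_mul_rootCount_le (F : ℤ[X]) {a q : ℕ} (h : a.Coprime q) (ha : 0 < a)
    (hq : 0 < q) : rootCount F a * rootCount F q ≤ rootCount F (a * q) := by
  unfold rootCount
  rw [← Finset.card_product]
  have key : ∀ d n m : ℕ, n ≡ m [MOD d] → (d : ℤ) ∣ F.eval (m : ℤ) → (d : ℤ) ∣ F.eval (n : ℤ) := by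
    intro d n m hnm hm
    refine (dvd_iff_dvd_of_dvd_sub (dvd_trans ?_ (sub_dvd_eval_sub _ _ F))).mpr hm
    exact (Nat.modEq_iff_dvd.mp hnm.symm)
  refine card_le_card_of_injOn (fun z => (Nat.chineseRemainder h z.1 z.2 : ℕ)) ?_ ?_
  · rintro ⟨i, j⟩ hz
    obtain ⟨h1, h2⟩ := mem_product.mp hz
    have h1' := (mem_filter.mp h1).2
    have h2' := (mem_filter.mp h2).2
    have hc := (Nat.chineseRemainder h i j).2
    refine mem_filter.mpr ⟨mem_range.mpr
      (Nat.chineseRemainder_lt_mul h i j ha.ne' hq.ne'), ?_⟩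
    rw [Nat.cast_mul]
    exact IsCoprime.mul_dvd (Nat.isCoprime_iff_coprime.mpr h) (key _ _ _ hc.1 h1') (key _ _ _ hc.2 h2')
  · rintro ⟨i, j⟩ hz ⟨i', j'⟩ hz' he
    obtain ⟨h1, h2⟩ := mem_product.mp hz
    obtain ⟨h3, h4⟩ := mem_product.mp hz'
    have h1 := mem_range.mp (mem_filter.mp h1).1
    have h2 := mem_range.mp (mem_filter.mp h2).1
    have h3 := mem_range.mp (mem_filter.mp h3).1
    have h4 := mem_range.mp (mem_filter.mp h4).1
    have hc := (Nat.chineseRemainder h i j).2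
    have hc' := (Nat.chineseRemainder h i' j').2
    simp only at he h1 h2 h3 h4
    rw [he] at hc
    exact Prod.ext (Nat.ModEq.eq_of_lt_of_lt (hc.1.symm.trans hc'.1) h1 h3)
      (Nat.ModEq.eq_of_lt_of_lt (hc.2.symm.trans hc'.2) h2 h4)

theorem card_rough_divisors_le {W : ℝ} (hW : 1 ≤ W) (k : ℕ) :
    ∀ n : ℕ, 0 < n → (n : ℝ) ≤ W ^ k →
      (n.divisors.filter (fun q => ∀ p : ℕ, p.Prime → p ∣ q → W < p)).card ≤ 2 ^ k := by
  induction k with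
  | zero =>
    intro n hn h
    have : n = 1 := by
      have : n ≤ 1 := by exact_mod_cast (by simpa using h : (n : ℝ) ≤ 1)
      omega
    subst this
    exact (Finset.card_filter_le _ _).trans (by simp)
  | succ k ih =>
    intro n hn h
    by_cases hp : ∃ p : ℕ, p.Prime ∧ p ∣ n ∧ W < p
    · obtain ⟨p, hpp, ⟨m, rfl⟩, hWp⟩ := hp
      have hm : 0 < m := Nat.pos_of_mul_pos_left hn
      have hmk : (m : ℝ) ≤ W ^ k := by
        push_cast at h
        have : W * (m : ℝ) ≤ W * W ^ k := by
          rw [pow_succ'] at h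
          exact le_trans (by gcongr) h
        exact le_of_mul_le_mul_left this (by linarith)
      have ih' := ih m hm hmk
      set T := m.divisors.filter (fun q => ∀ p : ℕ, p.Prime → p ∣ q → W < p) with hT
      calc _ ≤ (T ∪ T.image (p * ·)).card := by
            refine card_le_card (fun q hq => ?_)
            obtain ⟨hq1, hq2⟩ := mem_filter.mp hq
            have hqd := Nat.dvd_of_mem_divisors hq1
            by_cases hpq : p ∣ q
            · obtain ⟨r, rfl⟩ := hpq
              refine Finset.mem_union_right _ (mem_image.mpr ⟨r, ?_, rfl⟩)
              refine mem_filter.mpr ⟨Nat.mem_divisors.mpr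
                ⟨Nat.dvd_of_mul_dvd_mul_left hpp.pos hqd, hm.ne'⟩, fun p' hp' h' => ?_⟩
              exact hq2 p' hp' (h'.mul_left _)
            · refine Finset.mem_union_left _ (mem_filter.mpr ⟨Nat.mem_divisors.mpr
                ⟨?_, hm.ne'⟩, hq2⟩)
              exact Nat.Coprime.dvd_of_dvd_mul_left
                ((Nat.Prime.coprime_iff_not_dvd hpp).mpr hpq).symm hqd
        _ ≤ T.card + T.card := (Finset.card_union_le _ _).trans
            (Nat.add_le_add_left Finset.card_image_le _)
        _ ≤ 2 ^ (k + 1) := by rw [pow_succ]; omega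
    · push Not at hp
      have : n.divisors.filter (fun q => ∀ p : ℕ, p.Prime → p ∣ q → W < p) ⊆ {1} := by
        intro q hq
        obtain ⟨hq1, hq2⟩ := mem_filter.mp hq
        rw [Finset.mem_singleton]
        by_contra hne
        obtain ⟨p, hpp, hpq⟩ := Nat.exists_prime_and_dvd hne
        exact absurd (hq2 p hpp hpq) (not_lt.mpr (hp p hpp
          (hpq.trans (Nat.dvd_of_mem_divisors hq1))))
      exact (card_le_card this).trans (by simpa using Nat.one_le_two_pow)

theorem card_le_polyH_sub (F : ℤ[X]) {x y z : ℝ} (hx : 0 ≤ x) (S : Finset ℕ)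
    (hS : ∀ n ∈ S, x / 2 < n ∧ (n : ℝ) ≤ x ∧
      ∃ d : ℕ, 0 < d ∧ (d : ℤ) ∣ F.eval (n : ℤ) ∧ y < (d : ℝ) ∧ (d : ℝ) ≤ z) :
    (S.card : ℝ) ≤ (polyH F x y z : ℝ) - (polyH F (x / 2) y z : ℝ) := by
  unfold polyH
  set T : ℝ → Set ℕ := fun x => {n : ℕ | 0 < n ∧ (n : ℝ) ≤ x ∧
    ∃ d : ℕ, 0 < d ∧ (d : ℤ) ∣ F.eval (n : ℤ) ∧ y < (d : ℝ) ∧ (d : ℝ) ≤ z} with hT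
  have hfin : ∀ x, 0 ≤ x → (T x).Finite := fun x hx =>
    (Set.finite_Iic ⌊x⌋₊).subset (fun n hn => Nat.le_floor hn.2.1)
  have hdisj : Disjoint (S : Set ℕ) (T (x / 2)) := by
    rw [Set.disjoint_left]
    intro n hn hn'
    exact absurd hn'.2.1 (not_le.mpr (hS n hn).1)
  have hsub : (S : Set ℕ) ∪ T (x / 2) ⊆ T x := by
    rintro n (hn | hn)
    · obtain ⟨h1, h2, h3⟩ := hS n hn
      refine ⟨?_, h2, h3⟩
      have : (0 : ℝ) < n := by linarith
      exact_mod_cast this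
    · exact ⟨hn.1, hn.2.1.trans (by linarith), hn.2.2⟩
  have h := Set.ncard_le_ncard hsub (hfin x hx)
  rw [Set.ncard_union_eq hdisj S.finite_toSet (hfin _ (by linarith)), Set.ncard_coe_finset] at h
  have h' : (S.card : ℝ) + ((T (x / 2)).ncard : ℝ) ≤ ((T x).ncard : ℝ) := by exact_mod_cast h
  linarith

/-- the index of the logarithmic cell of width `η / 2` attached to the codivisor of `d` near `y` -/
noncomputable def cellIndex (η y : ℝ) (d : ℕ) : ℤ := ⌈2 * log (y / d) / η⌉

/-- the number of distinct cells met by the divisors of `a` -/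
noncomputable def cellCount (η y : ℝ) (a : ℕ) : ℕ := (a.divisors.image (cellIndex η y)).card

/-- the integers in `(u, v]` all of whose prime factors exceed `W` -/
noncomputable def roughIoc (W u v : ℝ) : Finset ℕ :=
  (Icc 1 ⌊v⌋₊).filter (fun q : ℕ => u < q ∧ ∀ p : ℕ, p.Prime → p ∣ q → W < p)

theorem mem_roughIoc {W u v : ℝ} (hu : 0 ≤ u) {q : ℕ} : q ∈ roughIoc W u v ↔
    u < q ∧ (q : ℝ) ≤ v ∧ ∀ p : ℕ, p.Prime → p ∣ q → W < p := by
  unfold roughIoc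
  rw [mem_filter, mem_Icc]
  constructor
  · rintro ⟨⟨h1, h2⟩, h3, h4⟩
    exact ⟨h3, (Nat.le_floor_iff' (by omega)).mp h2, h4⟩
  · rintro ⟨h1, h2, h3⟩
    have : (0 : ℝ) < q := by linarith
    exact ⟨⟨by exact_mod_cast this, Nat.le_floor h2⟩, h1, h3⟩

/-- the rough codivisors in the cells of the divisors of `a` -/
noncomputable def cellCodivisors (W η y : ℝ) (a : ℕ) : Finset ℕ :=
  (a.divisors.image (cellIndex η y)).biUnion
    (fun m => roughIoc W (exp (m * (η / 2))) (exp (η / 2) * exp (m * (η / 2))))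

theorem exp_cellIndex_bounds {η y : ℝ} (hη : 0 < η) (hy : 0 < y) {d : ℕ} (hd : 0 < d) :
    y / d ≤ exp (cellIndex η y d * (η / 2)) ∧
      exp (cellIndex η y d * (η / 2)) ≤ exp (η / 2) * (y / d) := by
  have hd0 : (0 : ℝ) < d := by exact_mod_cast hd
  have h1 : 2 * log (y / d) / η ≤ cellIndex η y d := Int.le_ceil _
  have h2 : (cellIndex η y d : ℝ) < 2 * log (y / d) / η + 1 := Int.ceil_lt_add_one _
  have e : 2 * log (y / d) / η * (η / 2) = log (y / d) := by field_simp
  constructor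
  · rw [← log_le_iff_le_exp (by positivity), ← e]
    gcongr
  · rw [← exp_log (div_pos hy hd0)]
    rw [← exp_add]
    gcongr
    calc _ ≤ (2 * log (y / d) / η + 1) * (η / 2) := by gcongr
      _ = _ := by rw [add_mul, e]; ring

theorem exists_mem_cellCodivisors {W η y : ℝ} (hη : 0 < η) (hη1 : η ≤ 1 / 100) (hy : 0 < y)
    {a q : ℕ} (hq : q ∈ cellCodivisors W η y a) :
    (∃ d : ℕ, d ∣ a ∧ y < (q * d : ℕ) ∧ ((q * d : ℕ) : ℝ) ≤ exp η * y) ∧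
      (q : ℝ) ≤ 2 * y ∧ 0 < q ∧ ∀ p : ℕ, p.Prime → p ∣ q → W < p := by
  obtain ⟨m, hm, hq⟩ := mem_biUnion.mp hq
  obtain ⟨d, hd, rfl⟩ := mem_image.mp hm
  have hd0 := Nat.pos_of_mem_divisors hd
  have hdr : (0 : ℝ) < d := by exact_mod_cast hd0
  obtain ⟨h1, h2⟩ := exp_cellIndex_bounds hη hy hd0
  obtain ⟨h3, h4, h5⟩ := (mem_roughIoc (exp_pos _).le).mp hq
  have h6 : (q : ℝ) ≤ exp η * (y / d) := by
    refine h4.trans ?_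
    have : exp η = exp (η / 2) * exp (η / 2) := by
      rw [← exp_add]; congr 1; ring
    rw [this, mul_assoc]
    gcongr
  have h7 : (q : ℝ) * d ≤ exp η * y := by
    calc (q : ℝ) * d ≤ exp η * (y / d) * d := by gcongr
      _ = _ := by field_simp
  have h8 : exp η ≤ 2 := by
    calc exp η ≤ exp (log 2) := by
          gcongr; linarith [log_two_gt_d9]
      _ = 2 := exp_log two_pos
  have hq0 : (0 : ℝ) < q := (exp_pos _).trans h3
  refine ⟨⟨d, Nat.dvd_of_mem_divisors hd, ?_, by push_cast; exact h7⟩, ?_, by exact_mod_cast hq0, h5⟩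
  · push_cast
    have := h1.trans_lt h3
    rwa [div_lt_iff₀ hdr] at this
  · have hd1 : (1 : ℝ) ≤ d := by exact_mod_cast hd0
    nlinarith

theorem exists_sum_cellCodivisors_ge {F : ℤ[X]} (hF : Irreducible F) (hdeg : 2 ≤ F.natDegree) :
    ∃ κ : ℝ, 0 < κ ∧ κ ≤ 1 / 4 ∧ ∀ C' : ℝ, ∃ c y₁ : ℝ, 0 < c ∧ 3 ≤ y₁ ∧ ∀ y η : ℝ, y₁ ≤ y →
      0 < η → log y ^ (-C') ≤ η → η ≤ 1 / 100 → ∀ a : ℕ, 0 < a → (a : ℝ) ≤ √y →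
      c * η / log y * cellCount η y a ≤
        ∑ q ∈ cellCodivisors (y ^ κ) η y a, (rootCount F q : ℝ) / q := by
  obtain ⟨κ, hκ, hκ4, h⟩ := exists_sum_rootCount_div_rough_ge hF hdeg
  refine ⟨κ, hκ, hκ4, fun C' => ?_⟩
  obtain ⟨c, y₁, hc, hy₁, h⟩ := h (C' + 1)
  refine ⟨c / 2, max y₁ (exp 2), by positivity, hy₁.trans (le_max_left _ _), ?_⟩
  intro y η hy hη hηC hη1 a ha hay
  have hy1 : y₁ ≤ y := (le_max_left _ _).trans hy
  have hy0 : 0 < y := by linarith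
  have hlog : 2 ≤ log y := by
    rw [le_log_iff_exp_le hy0]; exact (le_max_right _ _).trans hy
  have hlog0 : 0 < log y := by linarith
  unfold cellCodivisors
  rw [sum_biUnion]
  · have hterm : ∀ m ∈ a.divisors.image (cellIndex η y), c / 2 * η / log y ≤
        ∑ q ∈ roughIoc (y ^ κ) (exp (m * (η / 2)))
          (exp (η / 2) * exp (m * (η / 2))), (rootCount F q : ℝ) / q := by
      intro m hm
      obtain ⟨d, hd, rfl⟩ := mem_image.mp hm
      have hd0 := Nat.pos_of_mem_divisors hd
      have hdr : (1 : ℝ) ≤ d := by exact_mod_cast hd0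
      have hda : (d : ℝ) ≤ √y := le_trans (by exact_mod_cast Nat.divisor_le hd) hay
      obtain ⟨h1, h2⟩ := exp_cellIndex_bounds hη hy0 hd0
      have hsq : √y * √y = y := Real.mul_self_sqrt hy0.le
      have := h y (exp (cellIndex η y d * (η / 2))) (η / 2) hy1 ?_ ?_ (by linarith) ?_
        (by linarith) _ (fun q => mem_roughIoc (exp_pos _).le)
      · refine le_trans (le_of_eq ?_) this
        ring
      · refine le_trans ?_ h1
        rw [le_div_iff₀ (by linarith)]
        calc √y * d ≤ √y * √y := by gcongr
          _ = y := hsq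
      · refine h2.trans ?_
        have h8 : exp (η / 2) ≤ 2 := by
          calc exp (η / 2) ≤ exp (log 2) := by
                gcongr; linarith [log_two_gt_d9]
            _ = 2 := exp_log two_pos
        have : y / d ≤ y := div_le_self hy0.le hdr
        gcongr
      · calc log y ^ (-(C' + 1)) = log y ^ (-C') * (log y)⁻¹ := by
              rw [neg_add, rpow_add hlog0, rpow_neg_one]
          _ ≤ η * 2⁻¹ := by gcongr
          _ = η / 2 := by ring
    calc _ = ∑ m ∈ a.divisors.image (cellIndex η y), c / 2 * η / log y := by
          rw [sum_const, nsmul_eq_mul, mul_comm, cellCount]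
      _ ≤ _ := sum_le_sum hterm
  · have key : ∀ m m' : ℤ, ∀ q, q ∈ roughIoc (y ^ κ) (exp (m * (η / 2)))
          (exp (η / 2) * exp (m * (η / 2))) →
        q ∈ roughIoc (y ^ κ) (exp (m' * (η / 2)))
          (exp (η / 2) * exp (m' * (η / 2))) → m ≤ m' := by
      intro m m' q hq hq'
      obtain ⟨h1, -, -⟩ := (mem_roughIoc (exp_pos _).le).mp hq
      obtain ⟨-, h2, -⟩ := (mem_roughIoc (exp_pos _).le).mp hq'
      have h3 := h1.trans_le h2
      rw [← exp_add, exp_lt_exp] at h3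
      have h4 : (m : ℝ) < m' + 1 := by
        by_contra hcon
        push Not at hcon
        nlinarith
      have : m < m' + 1 := by exact_mod_cast h4
      omega
    intro m _ m' _ hne
    rw [Function.onFun, Finset.disjoint_left]
    intro q hq hq'
    exact hne (le_antisymm (key m m' q hq hq') (key m' m q hq' hq))

theorem eq_of_rough_cofactor {p₀ : ℕ} {V w : ℝ} (hVw : V ≤ w) {n : ℤ} {a a' q q' : ℕ}
    (ha : Squarefree a) (ha' : Squarefree a')
    (hpa : ∀ p : ℕ, p.Prime → p ∣ a → p₀ < p ∧ (p : ℝ) ≤ V)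
    (hpa' : ∀ p : ℕ, p.Prime → p ∣ a' → p₀ < p ∧ (p : ℝ) ≤ V)
    (hq : ∀ p : ℕ, p.Prime → p ∣ q → V < p) (hq' : ∀ p : ℕ, p.Prime → p ∣ q' → V < p)
    (hd : ((a * q : ℕ) : ℤ) ∣ n) (hd' : ((a' * q' : ℕ) : ℤ) ∣ n)
    (hs : ∀ p ∈ primesIoc p₀ w, ¬ ((p * (a * q) : ℕ) : ℤ) ∣ n)
    (hs' : ∀ p ∈ primesIoc p₀ w, ¬ ((p * (a' * q') : ℕ) : ℤ) ∣ n) : a = a' := by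
  have key : ∀ a a' q q' : ℕ, (∀ p : ℕ, p.Prime → p ∣ a' → p₀ < p ∧ (p : ℝ) ≤ V) →
      (∀ p : ℕ, p.Prime → p ∣ q → V < p) → ((a * q : ℕ) : ℤ) ∣ n → ((a' * q' : ℕ) : ℤ) ∣ n →
      (∀ p ∈ primesIoc p₀ w, ¬ ((p * (a * q) : ℕ) : ℤ) ∣ n) →
      ∀ p : ℕ, p.Prime → p ∣ a' → p ∣ a := by
    intro a a' q q' hpa' hq hd hd' hs p hp hpa
    obtain ⟨h1, h2⟩ := hpa' p hp hpa
    obtain ⟨k, rfl⟩ := hd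
    have hpn : (p : ℤ) ∣ ((a * q : ℕ) : ℤ) * k :=
      dvd_trans (by exact_mod_cast hpa.mul_right _) hd'
    rcases (Nat.prime_iff_prime_int.mp hp).dvd_or_dvd hpn with h | h
    · rcases hp.dvd_mul.mp (by exact_mod_cast h) with h | h
      · exact h
      · exact absurd (hq p hp h) (not_lt.mpr h2)
    · refine absurd ?_ (hs p (mem_primesIoc.mpr ⟨hp, by exact_mod_cast h1, h2.trans hVw⟩))
      rw [Nat.cast_mul, mul_comm]
      exact mul_dvd_mul_left _ h
  rw [← Nat.prod_primeFactors_of_squarefree ha, ← Nat.prod_primeFactors_of_squarefree ha']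
  congr 1
  ext p
  simp only [Nat.mem_primeFactors]
  constructor
  · rintro ⟨h1, h2, -⟩
    exact ⟨h1, key a' a q' q hpa hq' hd' hd hs' p h1 h2, ha'.ne_zero⟩
  · rintro ⟨h1, h2, -⟩
    exact ⟨h1, key a a' q q' hpa' hq hd hd' hs p h1 h2, ha.ne_zero⟩

theorem dvd_of_rough_cofactor {p₀ : ℕ} {V w : ℝ} {n : ℤ} {a q q' : ℕ} (hp₀ : (p₀ : ℝ) ≤ V)
    (hpa : ∀ p : ℕ, p.Prime → p ∣ a → (p : ℝ) ≤ V)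
    (hq : ∀ p : ℕ, p.Prime → p ∣ q → V < p) (hqw : (q : ℝ) ≤ w) (hq0 : 0 < q)
    (hd : ((a * q : ℕ) : ℤ) ∣ n) (hd' : ((a * q' : ℕ) : ℤ) ∣ n)
    (hs' : ∀ p ∈ primesIoc p₀ w, ¬ ((p * (a * q') : ℕ) : ℤ) ∣ n) : q ∣ q' := by
  obtain ⟨k, rfl⟩ := hd'
  have h1 : (q : ℤ) ∣ ((a * q' : ℕ) : ℤ) * k := dvd_trans (by push_cast; exact dvd_mul_left _ _) hd
  have h1' : q ∣ a * q' * k.natAbs := by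
    have := Int.natAbs_dvd_natAbs.mpr h1
    rwa [Int.natAbs_mul, Int.natAbs_natCast, Int.natAbs_natCast] at this
  have hcop : Nat.Coprime q k.natAbs := by
    refine Nat.coprime_of_dvd (fun p hp hpq hpk => ?_)
    refine hs' p (mem_primesIoc.mpr ⟨hp, ?_, ?_⟩) ?_
    · exact_mod_cast hp₀.trans_lt (hq p hp hpq)
    · exact le_trans (by exact_mod_cast Nat.le_of_dvd hq0 hpq) hqw
    · rw [Nat.cast_mul, mul_comm]
      exact mul_dvd_mul_left _ (Int.natCast_dvd.mpr hpk)
  have hcop' : Nat.Coprime q a :=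
    Nat.coprime_of_dvd (fun p hp hpq hpa' => absurd (hq p hp hpq) (not_lt.mpr (hpa p hp hpa')))
  exact hcop'.dvd_of_dvd_mul_left (hcop.dvd_of_dvd_mul_right h1')

theorem mod_mem_rootsMod {F : ℤ[X]} {A n : ℕ} (hA : 0 < A) (h : (A : ℤ) ∣ F.eval (n : ℤ)) :
    n % A ∈ rootsMod F A := by
  refine mem_filter.mpr ⟨mem_range.mpr (Nat.mod_lt _ hA), ?_⟩
  refine (dvd_iff_dvd_of_dvd_sub (dvd_trans ?_ (sub_dvd_eval_sub _ _ F))).mpr h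
  rw [Int.natCast_mod]
  exact Int.ModEq.dvd (Int.mod_modEq _ _).symm

set_option maxHeartbeats 1000000 in
theorem exists_polyH_sub_ge {F : ℤ[X]} (hF : Irreducible F) (hdeg : 2 ≤ F.natDegree) {δ : ℝ}
    (hδ0 : 0 < δ) (hδ1 : δ < 1) :
    ∃ κ : ℝ, ∃ p₀ : ℕ, 0 < κ ∧ κ ≤ 1 / 4 ∧ 2 ≤ p₀ ∧ F.leadingCoeff.natAbs ≤ p₀ ∧ ∀ C' : ℝ,
      ∃ c y₁ : ℝ, 0 < c ∧ 3 ≤ y₁ ∧ ∀ x y η : ℝ, y₁ ≤ y → 0 < x → y ≤ x ^ (1 - δ) → 0 < η →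
      log y ^ (-C') ≤ η → η ≤ 1 / 100 → ∀ 𝒜 : Finset ℕ,
      (∀ a ∈ 𝒜, Squarefree a ∧ (a : ℝ) ≤ y ^ (δ / 2) ∧
        ∀ p : ℕ, p.Prime → p ∣ a → p₀ < p ∧ (p : ℝ) ≤ y ^ κ) →
      c * x * η / log y ^ 2 * ∑ a ∈ 𝒜, (rootCount F a : ℝ) / a * cellCount η y a ≤
        (polyH F x y (exp η * y) : ℝ) - (polyH F (x / 2) y (exp η * y) : ℝ) := by
  have hdeg0 : F.natDegree ≠ 0 := by omega
  obtain ⟨κ₀, hκ₀, hκ₀4, hcell⟩ := exists_sum_cellCodivisors_ge hF hdeg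
  obtain ⟨p₀, K, c₂, hc₂, hp₀, hlc, hK, hsieve⟩ := exists_card_progression_sieve_ge hF hdeg0
  obtain ⟨CF, hCF1, hCF⟩ := exists_natAbs_eval_le F
  have hK0 : (0 : ℝ) < K := by exact_mod_cast hK
  obtain ⟨κ₂, hκ₂def⟩ : ∃ κ₂ : ℝ, κ₂ = δ / (4 * K) := ⟨_, rfl⟩
  have hκ₂ : 0 < κ₂ := by rw [hκ₂def]; positivity
  obtain ⟨κ, hκdef⟩ : ∃ κ : ℝ, κ = min κ₀ κ₂ := ⟨_, rfl⟩
  have hκ : 0 < κ := by rw [hκdef]; exact lt_min hκ₀ hκ₂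
  have hκκ₀ : κ ≤ κ₀ := hκdef ▸ min_le_left _ _
  have hκκ₂ : κ ≤ κ₂ := hκdef ▸ min_le_right _ _
  refine ⟨κ, p₀, hκ, hκκ₀.trans hκ₀4, hp₀, hlc, fun C' => ?_⟩
  obtain ⟨c₁, y₂, hc₁, hy₂, hcell⟩ := hcell C'
  obtain ⟨k₀, hk₀⟩ : ∃ k₀ : ℕ, ((F.natDegree : ℝ) + 1) ≤ κ₂ / 2 * κ₀ * k₀ := by
    obtain ⟨k, hk⟩ := exists_nat_ge (((F.natDegree : ℝ) + 1) / (κ₂ / 2 * κ₀))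
    refine ⟨k, ?_⟩
    rwa [div_le_iff₀ (by positivity), mul_comm] at hk
  have hlarge : ∀ A r : ℝ, 0 < r → ∀ᶠ y : ℝ in Filter.atTop, A ≤ y ^ r := fun A r hr =>
    (tendsto_rpow_atTop hr).eventually_ge_atTop A
  obtain ⟨y₃, hy₃⟩ := Filter.eventually_atTop.mp ((hlarge p₀ κ hκ).and ((hlarge 8 (δ / 4)
    (by positivity)).and ((hlarge 2 (κ₂ / 2) (by positivity)).and (Filter.eventually_ge_atTop CF))))
  refine ⟨c₁ * c₂ / (2 * 2 ^ k₀), max y₂ y₃, by positivity, hy₂.trans (le_max_left _ _), ?_⟩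
  intro x y η hy hx0 hyx hη hηC hη1 𝒜 h𝒜
  have hyy₂ : y₂ ≤ y := (le_max_left _ _).trans hy
  have hyy₃ : y₃ ≤ y := (le_max_right _ _).trans hy
  have hy3 : 3 ≤ y := hy₂.trans hyy₂
  have hy0 : 0 < y := by linarith
  have hx1 : 1 < x := by
    by_contra hcon
    have := rpow_le_one hx0.le (not_lt.mp hcon) (by linarith : 0 ≤ 1 - δ)
    linarith
  have hyx' : y ≤ x := hyx.trans (by
    nth_rewrite 2 [← rpow_one x]
    exact rpow_le_rpow_of_exponent_le hx1.le (by linarith))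
  obtain ⟨hVp₀, -, -, -⟩ := hy₃ y hyy₃
  obtain ⟨-, hx8, hx2, hxCF⟩ := hy₃ x (hyy₃.trans hyx')
  have hlogy : 1 ≤ log y := by
    rw [le_log_iff_exp_le hy0]; linarith [exp_one_lt_d9]
  obtain ⟨w, hwdef⟩ : ∃ w : ℝ, w = min (2 * y) (x ^ κ₂) := ⟨_, rfl⟩
  have hw2y : w ≤ 2 * y := hwdef ▸ min_le_left _ _
  have hwx : w ≤ x ^ κ₂ := hwdef ▸ min_le_right _ _
  have hxκ : 2 ≤ x ^ κ₂ := hx2.trans (rpow_le_rpow_of_exponent_le hx1.le (by linarith))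
  have hw2 : 2 ≤ w := by rw [hwdef]; exact le_min (by linarith) hxκ
  have hVw : y ^ κ ≤ w := by
    rw [hwdef]
    refine le_min ?_ ?_
    · calc y ^ κ ≤ y ^ (1 : ℝ) := rpow_le_rpow_of_exponent_le (by linarith) (by linarith)
        _ ≤ 2 * y := by rw [rpow_one]; linarith
    · calc y ^ κ ≤ y ^ κ₂ := rpow_le_rpow_of_exponent_le (by linarith) hκκ₂
        _ ≤ x ^ κ₂ := by gcongr
  have hVV : y ^ κ ≤ y ^ κ₀ := rpow_le_rpow_of_exponent_le (by linarith) hκκ₀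
  have hwK : w ^ K ≤ x ^ (δ / 4) := by
    calc w ^ K ≤ (x ^ κ₂) ^ K := by gcongr
      _ = x ^ (δ / 4) := by
        rw [← rpow_natCast, ← rpow_mul hx0.le]
        congr 1
        rw [hκ₂def]; field_simp
  have hAx : ∀ a q : ℕ, (a : ℝ) ≤ y ^ (δ / 2) → (q : ℝ) ≤ 2 * y →
      4 * ((a * q : ℕ) : ℝ) * w ^ K ≤ x := by
    intro a q ha hq
    push_cast
    calc 4 * ((a : ℝ) * q) * w ^ K ≤ 4 * (y ^ (δ / 2) * (2 * y)) * x ^ (δ / 4) := by gcongr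
      _ = 8 * (y ^ (δ / 2) * y ^ (1 : ℝ)) * x ^ (δ / 4) := by rw [rpow_one]; ring
      _ = 8 * y ^ (δ / 2 + 1) * x ^ (δ / 4) := by rw [← rpow_add hy0]
      _ ≤ x ^ (δ / 4) * (x ^ (1 - δ)) ^ (δ / 2 + 1) * x ^ (δ / 4) := by gcongr
      _ = x ^ (δ / 4 + (1 - δ) * (δ / 2 + 1) + δ / 4) := by
          rw [← rpow_mul hx0.le, ← rpow_add hx0, ← rpow_add hx0]
      _ ≤ x ^ (1 : ℝ) := rpow_le_rpow_of_exponent_le hx1.le (by nlinarith)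
      _ = x := rpow_one x
  have hFn : ∀ n : ℕ, 1 ≤ n → (n : ℝ) ≤ x →
      (((F.eval (n : ℤ)).natAbs : ℕ) : ℝ) ≤ x ^ ((F.natDegree : ℝ) + 1) := by
    intro n hn hnx
    refine (hCF n hn).trans ?_
    rw [rpow_add hx0, rpow_one, mul_comm, rpow_natCast]
    gcongr
  have hlogw : 0 < log w := log_pos (by linarith)
  have hlogw2 : log w ≤ 2 * log y := by
    have : log w ≤ log (2 * y) := log_le_log (by linarith) hw2y
    rw [log_mul two_ne_zero hy0.ne'] at this
    linarith [log_two_lt_d9]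
  obtain ⟨QQ, hQQ⟩ : ∃ QQ : ℕ → Finset ℕ, ∀ a, QQ a = cellCodivisors (y ^ κ₀) η y a :=
    ⟨_, fun _ => rfl⟩
  have hQ : ∀ a, ∀ q ∈ QQ a, (∃ d : ℕ, d ∣ a ∧ y < (q * d : ℕ) ∧
      ((q * d : ℕ) : ℝ) ≤ exp η * y) ∧ (q : ℝ) ≤ 2 * y ∧ 0 < q ∧
      ∀ p : ℕ, p.Prime → p ∣ q → y ^ κ₀ < p := by
    intro a q hq
    rw [hQQ] at hq
    exact exists_mem_cellCodivisors hη hη1 hy0 hq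
  obtain ⟨S, hSmem⟩ : ∃ S : ℕ → Finset ℕ, ∀ A n, n ∈ S A ↔ (1 ≤ n ∧ (n : ℝ) ≤ x ∧ x / 2 < n ∧
      (A : ℤ) ∣ F.eval (n : ℤ) ∧ ∀ p ∈ primesIoc p₀ w, ¬ ((p * A : ℕ) : ℤ) ∣ F.eval (n : ℤ)) := by
    refine ⟨fun A => (Icc 1 ⌊x⌋₊).filter (fun n : ℕ => x / 2 < n ∧
      (A : ℤ) ∣ F.eval (n : ℤ) ∧ ∀ p ∈ primesIoc p₀ w, ¬ ((p * A : ℕ) : ℤ) ∣ F.eval (n : ℤ)), ?_⟩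
    intro A n
    rw [mem_filter, mem_Icc, Nat.le_floor_iff hx0.le, and_assoc]
  have hScard : ∀ A : ℕ, 0 < A → 4 * (A : ℝ) * w ^ K ≤ x →
      rootCount F A * (c₂ * x / (A * log w)) ≤ ((S A).card : ℝ) := by
    intro A hA hAw
    rw [Finset.card_eq_sum_card_fiberwise (f := fun n => n % A) (t := rootsMod F A)
      (fun n hn => mod_mem_rootsMod hA ((hSmem A n).mp hn).2.2.2.1), rootCount,
      ← nsmul_eq_mul, ← sum_const, Nat.cast_sum]
    refine sum_le_sum (fun ν hν => ?_)
    obtain ⟨hν1, hν2⟩ := mem_filter.mp hν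
    refine (hsieve A ν hA (mem_range.mp hν1) hν2 w x hw2 hAw).trans ?_
    refine Nat.cast_le.mpr (card_le_card (fun n hn => ?_))
    obtain ⟨h1, h2, h3, h4⟩ := mem_filter.mp hn
    obtain ⟨h5, h6⟩ := mem_Icc.mp h1
    refine mem_filter.mpr ⟨(hSmem A n).mpr ⟨h5, (Nat.le_floor_iff hx0.le).mp h6, h2, ?_, h4⟩,
      h3⟩
    refine (dvd_iff_dvd_of_dvd_sub (dvd_trans ?_ (sub_dvd_eval_sub _ _ F))).mpr hν2
    rw [← h3, Int.natCast_mod]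
    exact Int.ModEq.dvd (Int.mod_modEq _ _)
  set T : Finset (Σ _ : (Σ _ : ℕ, ℕ), ℕ) := (𝒜.sigma QQ).sigma (fun z => S (z.1 * z.2)) with hT
  have hTmem : ∀ t ∈ T, t.1.1 ∈ 𝒜 ∧ t.1.2 ∈ QQ t.1.1 ∧ t.2 ∈ S (t.1.1 * t.1.2) := by
    intro t ht
    obtain ⟨h1, h2⟩ := Finset.mem_sigma.mp ht
    obtain ⟨h3, h4⟩ := Finset.mem_sigma.mp h1
    exact ⟨h3, h4, h2⟩
  have hfiber : ∀ n ∈ T.image (fun t => t.2), (T.filter (fun t => t.2 = n)).card ≤ 2 ^ k₀ := by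
    intro n hn
    have hn' : 1 ≤ n ∧ (n : ℝ) ≤ x := by
      obtain ⟨t, ht, rfl⟩ := mem_image.mp hn
      have := (hSmem _ _).mp (hTmem t ht).2.2
      exact ⟨this.1, this.2.1⟩
    have heqa : ∀ t ∈ T, ∀ t' ∈ T, t.2 = n → t'.2 = n → t.1.1 = t'.1.1 := by
      intro t ht t' ht' e e'
      obtain ⟨h1, h2, h3⟩ := hTmem t ht
      obtain ⟨h1', h2', h3'⟩ := hTmem t' ht'
      rw [hSmem, e] at h3
      rw [hSmem, e'] at h3'
      exact eq_of_rough_cofactor hVw (h𝒜 _ h1).1 (h𝒜 _ h1').1 (h𝒜 _ h1).2.2 (h𝒜 _ h1').2.2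
        (fun p hp hpq => hVV.trans_lt ((hQ _ _ h2).2.2.2 p hp hpq))
        (fun p hp hpq => hVV.trans_lt ((hQ _ _ h2').2.2.2 p hp hpq))
        h3.2.2.2.1 h3'.2.2.2.1 h3.2.2.2.2 h3'.2.2.2.2
    rcases le_total (2 * y) (x ^ κ₂) with hcase | hcase
    · have hw : w = 2 * y := by rw [hwdef, min_eq_left hcase]
      refine (Finset.card_le_one.mpr ?_).trans Nat.one_le_two_pow
      rintro ⟨⟨a, q⟩, n₁⟩ ht ⟨⟨a', q'⟩, n₂⟩ ht'
      obtain ⟨ht, e⟩ := mem_filter.mp ht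
      obtain ⟨ht', e'⟩ := mem_filter.mp ht'
      obtain rfl : a = a' := heqa _ ht _ ht' e e'
      obtain ⟨h1, h2, h3⟩ := hTmem _ ht
      obtain ⟨h1', h2', h3'⟩ := hTmem _ ht'
      simp only at e e' h1 h2 h3 h1' h2' h3'
      subst e
      subst e'
      rw [hSmem] at h3 h3'
      have hq := dvd_of_rough_cofactor hVp₀ (fun p hp hpa => ((h𝒜 _ h1).2.2 p hp hpa).2)
        (fun p hp hpq => hVV.trans_lt ((hQ _ _ h2).2.2.2 p hp hpq))
        (by rw [hw]; exact (hQ _ _ h2).2.1) (hQ _ _ h2).2.2.1 h3.2.2.2.1 h3'.2.2.2.1 h3'.2.2.2.2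
      have hq' := dvd_of_rough_cofactor hVp₀ (fun p hp hpa => ((h𝒜 _ h1).2.2 p hp hpa).2)
        (fun p hp hpq => hVV.trans_lt ((hQ _ _ h2').2.2.2 p hp hpq))
        (by rw [hw]; exact (hQ _ _ h2').2.1) (hQ _ _ h2').2.2.1 h3'.2.2.2.1 h3.2.2.2.1 h3.2.2.2.2
      obtain rfl := Nat.dvd_antisymm hq hq'
      rfl
    · have hW1 : 1 ≤ y ^ κ₀ := Real.one_le_rpow (by linarith) hκ₀.le
      have hFnn : 0 < (F.eval (n : ℤ)).natAbs :=
        Int.natAbs_pos.mpr (eval_ne_zero_of_irreducible hF hdeg n)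
      have hyge : x ^ (κ₂ / 2) ≤ y := by
        have e : x ^ κ₂ = x ^ (κ₂ / 2) * x ^ (κ₂ / 2) := by
          rw [← rpow_add hx0]; congr 1; ring
        rw [e] at hcase
        nlinarith
      have hFW : (((F.eval (n : ℤ)).natAbs : ℕ) : ℝ) ≤ (y ^ κ₀) ^ k₀ := by
        refine (hFn n hn'.1 hn'.2).trans ?_
        calc x ^ ((F.natDegree : ℝ) + 1) ≤ x ^ (κ₂ / 2 * κ₀ * k₀) :=
              rpow_le_rpow_of_exponent_le hx1.le hk₀
          _ = ((x ^ (κ₂ / 2)) ^ κ₀) ^ k₀ := by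
              rw [← rpow_natCast, ← rpow_mul hx0.le, ← rpow_mul hx0.le]
          _ ≤ (y ^ κ₀) ^ k₀ := by gcongr
      refine le_trans (card_le_card_of_injOn (fun t => t.1.2) ?_ ?_)
        (card_rough_divisors_le hW1 k₀ _ hFnn hFW)
      · intro t ht
        obtain ⟨ht, e⟩ := mem_filter.mp ht
        obtain ⟨h1, h2, h3⟩ := hTmem _ ht
        rw [hSmem, e] at h3
        refine mem_filter.mpr ⟨Nat.mem_divisors.mpr ⟨?_, hFnn.ne'⟩, (hQ _ _ h2).2.2.2⟩
        exact (Dvd.intro_left _ rfl).trans (Int.natCast_dvd.mp h3.2.2.2.1)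
      · rintro ⟨⟨a, q⟩, n₁⟩ ht ⟨⟨a', q'⟩, n₂⟩ ht' (rfl : q = q')
        obtain ⟨ht, e⟩ := mem_filter.mp ht
        obtain ⟨ht', e'⟩ := mem_filter.mp ht'
        obtain rfl : a = a' := heqa _ ht _ ht' e e'
        simp only at e e'
        subst e
        subst e'
        rfl
  have hTcard := Finset.card_le_mul_card_image T (2 ^ k₀) hfiber
  have hH := card_le_polyH_sub F (y := y) (z := exp η * y) hx0.le
    (T.image (fun t => t.2)) (fun n hn => by
      obtain ⟨t, ht, rfl⟩ := mem_image.mp hn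
      obtain ⟨h1, h2, h3⟩ := hTmem _ ht
      rw [hSmem] at h3
      obtain ⟨⟨d, hd, hd1, hd2⟩, -, hq0, -⟩ := hQ _ _ h2
      have hd0 : 0 < d := Nat.pos_of_dvd_of_pos hd (Nat.pos_of_ne_zero (h𝒜 _ h1).1.ne_zero)
      refine ⟨h3.2.2.1, h3.2.1, t.1.2 * d, Nat.mul_pos hq0 hd0, ?_, hd1, hd2⟩
      refine dvd_trans ?_ h3.2.2.2.1
      rw [mul_comm]
      exact_mod_cast Nat.mul_dvd_mul_right hd _)
  refine le_trans ?_ hH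
  have hTlow : c₁ * c₂ * x * η / (2 * log y ^ 2) *
      ∑ a ∈ 𝒜, (rootCount F a : ℝ) / a * cellCount η y a ≤ (T.card : ℝ) := by
    rw [hT, Finset.card_sigma, Finset.sum_sigma, Nat.cast_sum, mul_sum]
    refine sum_le_sum (fun a ha => ?_)
    obtain ⟨hsq, hay, hpa⟩ := h𝒜 a ha
    have ha0 : 0 < a := Nat.pos_of_ne_zero hsq.ne_zero
    have har : (0 : ℝ) < a := by exact_mod_cast ha0
    have hay' : (a : ℝ) ≤ √y := by
      rw [Real.sqrt_eq_rpow]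
      exact hay.trans (rpow_le_rpow_of_exponent_le (by linarith) (by linarith))
    have hc := hcell y η hyy₂ hη hηC hη1 a ha0 hay'
    rw [← hQQ] at hc
    calc _ = c₂ * x / (2 * log y) * ((rootCount F a : ℝ) / a) *
          (c₁ * η / log y * cellCount η y a) := by field_simp
      _ ≤ c₂ * x / (2 * log y) * ((rootCount F a : ℝ) / a) *
          ∑ q ∈ QQ a, (rootCount F q : ℝ) / q := by gcongr
      _ = ∑ q ∈ QQ a, c₂ * x / (2 * log y) * ((rootCount F a : ℝ) / a) *
          ((rootCount F q : ℝ) / q) := mul_sum _ _ _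
      _ ≤ _ := by
        rw [Nat.cast_sum]
        refine sum_le_sum (fun q hq => ?_)
        obtain ⟨-, hq2, hq0, hqp⟩ := hQ a q hq
        have hqr : (0 : ℝ) < q := by exact_mod_cast hq0
        have hcop : a.Coprime q := Nat.coprime_of_dvd (fun p hp hpa' hpq =>
          absurd (hqp p hp hpq) (not_lt.mpr ((hpa p hp hpa').2.trans hVV)))
        have hrho : (rootCount F a : ℝ) * rootCount F q ≤ rootCount F (a * q) := by
          exact_mod_cast rootCount_mul_rootCount_le F hcop ha0 hq0
        refine le_trans ?_ (hScard (a * q) (Nat.mul_pos ha0 hq0) (hAx a q hay hq2))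
        calc _ = (rootCount F a * rootCount F q : ℝ) * (c₂ * x / (a * q * (2 * log y))) := by
              field_simp
          _ ≤ rootCount F (a * q) * (c₂ * x / (a * q * log w)) := by gcongr
          _ = _ := by push_cast; rfl
  have hT' : (T.card : ℝ) ≤ 2 ^ k₀ * ((T.image (fun t => t.2)).card : ℝ) := by
    exact_mod_cast hTcard
  have h2k : (0 : ℝ) < 2 ^ k₀ := by positivity
  rw [← mul_le_mul_iff_right₀ h2k]
  refine le_trans (le_of_eq ?_) (hTlow.trans hT')
  field_simp

end divisorCells

section primeBlocks

open Polynomial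

theorem exists_prime_blocks {F : ℤ[X]} (hF : Irreducible F) (hdeg : F.natDegree ≠ 0) :
    ∃ N : ℕ → ℕ, ∃ C : ℝ, 1 ≤ C ∧ Monotone N ∧ ∃ j₀ : ℕ, ∀ j, j₀ ≤ j →
      2 ^ j / C ≤ log (N j) ∧ log (N j) ≤ C * 2 ^ j ∧
      log 2 ≤ ∑ p ∈ primesIoc (N j) (N (j + 1)), (rootCount F p : ℝ) / p := by
  obtain ⟨C₀, hC₀⟩ := exists_sum_rootCount_div_sub_loglog_le hF hdeg
  have hC₀0 : 0 ≤ C₀ := (abs_nonneg _).trans (hC₀ 2 le_rfl)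
  set S : ℕ → ℝ := fun n => ∑ p ∈ primesIoc 0 n, (rootCount F p : ℝ) / p with hS
  have hSb : ∀ n : ℕ, 2 ≤ n → |S n - log (log n)| ≤ C₀ := fun n hn =>
    hC₀ n (by exact_mod_cast hn)
  set θ : ℕ → ℝ := fun j => j * log 2 + 1 - (1 / 2) ^ j with hθ
  have hθmono : Monotone θ := by
    refine monotone_nat_of_le_succ (fun j => ?_)
    simp only [hθ, pow_succ]
    push_cast
    have : (0 : ℝ) < (1 / 2) ^ j := by positivity
    nlinarith [log_two_gt_d9]
  have hex : ∀ j, ∃ n, θ j ≤ S n := by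
    intro j
    have ht : Filter.Tendsto (fun n : ℕ => log (log n)) Filter.atTop Filter.atTop :=
      Real.tendsto_log_atTop.comp (Real.tendsto_log_atTop.comp tendsto_natCast_atTop_atTop)
    obtain ⟨n, hn, hn2⟩ := ((ht.eventually_ge_atTop (θ j + C₀)).and
      (Filter.eventually_ge_atTop 2)).exists
    exact ⟨n, by linarith [(abs_le.mp (hSb n hn2)).1]⟩
  set N : ℕ → ℕ := fun j => Nat.find (hex j) with hN
  have hN1 : ∀ j, θ j ≤ S (N j) := fun j => Nat.find_spec (hex j)
  have hN2 : ∀ j n, n < N j → S n < θ j := fun j n hn => not_le.mp (Nat.find_min (hex j) hn)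
  have hNmono : Monotone N := by
    intro i j hij
    exact Nat.find_min' (hex i) ((hθmono hij).trans (hN1 j))
  have hS1 : S 1 = 0 := by
    refine sum_eq_zero (fun p hp => ?_)
    obtain ⟨h1, -, h3⟩ := mem_primesIoc.mp hp
    have : p ≤ 1 := by exact_mod_cast h3
    have := h1.two_le
    omega
  have hS0 : S 0 = 0 := by
    refine sum_eq_zero (fun p hp => ?_)
    obtain ⟨h1, -, h3⟩ := mem_primesIoc.mp hp
    have : p ≤ 0 := by exact_mod_cast h3
    have := h1.two_le
    omega
  have hNge2 : ∀ j, 1 ≤ j → 2 ≤ N j := by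
    intro j hj
    by_contra hcon
    have h1 := hN1 j
    have h2 : S (N j) = 0 := by
      have : N j = 0 ∨ N j = 1 := by omega
      rcases this with h | h <;> rw [h] <;> assumption
    have h3 := hθmono hj
    simp only [hθ] at h3 h1
    norm_num at h3
    linarith [log_two_gt_d9]
  have hjlog : ∀ j : ℕ, exp (j * log 2) = 2 ^ j := by
    intro j
    rw [exp_nat_mul, exp_log two_pos]
  have hlow : ∀ j, 1 ≤ j → 2 ^ j / (2 * exp (1 + C₀)) ≤ log (N j) := by
    intro j hj
    have h2 := hNge2 j hj
    have hl : 0 < log (N j) := log_pos (by exact_mod_cast h2)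
    have h3 := (abs_le.mp (hSb _ h2)).2
    have h4 : (j : ℝ) * log 2 - C₀ ≤ log (log (N j)) := by
      have := hN1 j
      have h5 : ((1 : ℝ) / 2) ^ j ≤ 1 := pow_le_one₀ (by norm_num) (by norm_num)
      simp only [hθ] at this
      linarith
    rw [le_log_iff_exp_le hl, exp_sub, hjlog] at h4
    refine le_trans ?_ h4
    have : exp C₀ ≤ 2 * exp (1 + C₀) := by
      have : exp C₀ ≤ exp (1 + C₀) := exp_le_exp.mpr (by linarith)
      linarith [exp_pos C₀]
    gcongr
  have hup : ∀ j, 1 ≤ j → log (N j) ≤ 2 * exp (1 + C₀) * 2 ^ j := by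
    intro j hj
    have h2 := hNge2 j hj
    obtain ⟨n, hn⟩ : ∃ n, N j = n + 1 := ⟨N j - 1, by omega⟩
    by_cases hn2 : 2 ≤ n
    · have h3 := (abs_le.mp (hSb n hn2)).1
      have h4 := hN2 j n (by omega)
      have hl : 0 < log n := log_pos (by exact_mod_cast hn2)
      have h5 : log (log n) ≤ j * log 2 + (1 + C₀) := by
        have : (0 : ℝ) < (1 / 2) ^ j := by positivity
        simp only [hθ] at h4
        linarith
      rw [log_le_iff_le_exp hl, exp_add, hjlog] at h5
      have h6 : log (N j) ≤ 2 * log n := by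
        rw [hn, ← log_rpow (by positivity)]
        refine log_le_log (by positivity) ?_
        have : (2 : ℝ) ≤ n := by exact_mod_cast hn2
        push_cast
        norm_num
        nlinarith
      linarith
    · have hnr : (N j : ℝ) ≤ 2 := by exact_mod_cast (by omega : N j ≤ 2)
      have h6 : log (N j) ≤ 1 := by
        have := log_le_log (by exact_mod_cast (by omega : 0 < N j)) hnr
        linarith [log_two_lt_d9]
      have h7 : (1 : ℝ) ≤ 2 ^ j := one_le_pow₀ (by norm_num)
      have h8 : 1 ≤ exp (1 + C₀) := Real.one_le_exp (by linarith)
      nlinarith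
  have hC1 : 1 ≤ exp (1 + C₀) := Real.one_le_exp (by linarith)
  obtain ⟨C, hC⟩ : ∃ C : ℝ, C = 2 * exp (1 + C₀) := ⟨_, rfl⟩
  rw [← hC] at hlow hup
  have hCpos : 0 < C := by rw [hC]; positivity
  obtain ⟨j₀, hj₀⟩ : ∃ j₀ : ℕ, 4 * F.natDegree * C ^ 2 + C * (F.leadingCoeff.natAbs + 1) ≤ 2 ^ j₀ :=
    pow_unbounded_of_one_lt _ (by norm_num : (1 : ℝ) < 2) |>.imp fun _ h => h.le
  refine ⟨N, C, by linarith, hNmono, j₀ + 1, fun j hj => ⟨hlow j (by omega), hup j (by omega), ?_⟩⟩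
  have h2j : (2 : ℝ) ^ j₀ ≤ 2 ^ j := pow_le_pow_right₀ (by norm_num) (by omega)
  have hN2' := hNge2 j (by omega)
  have hNpos : (0 : ℝ) < N j := by exact_mod_cast (by omega : 0 < N j)
  have hlogN : 2 ^ j / C ≤ log (N j) := hlow j (by omega)
  have hNexp : exp (2 ^ j / C) ≤ N j := (le_log_iff_exp_le hNpos).mp hlogN
  have hNlc : F.leadingCoeff.natAbs < N j := by
    have h1 : 2 ^ j / C ≤ N j := by linarith [add_one_le_exp ((2 : ℝ) ^ j / C)]
    rw [div_le_iff₀ hCpos] at h1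
    have h2 : C * ((F.leadingCoeff.natAbs : ℝ) + 1) ≤ C * N j := by
      have : (0 : ℝ) ≤ 4 * F.natDegree * C ^ 2 := by positivity
      linarith
    have h3 := le_of_mul_le_mul_left h2 hCpos
    have : F.leadingCoeff.natAbs + 1 ≤ N j := by exact_mod_cast h3
    omega
  have hNg : (F.natDegree : ℝ) / N j ≤ (1 / 2) ^ (j + 1) := by
    have h1 : (2 ^ j / C) ^ 2 / 2 ≤ N j := by
      have := Real.quadratic_le_exp_of_nonneg (by positivity : 0 ≤ (2 : ℝ) ^ j / C)
      have h0 : 0 ≤ (2 : ℝ) ^ j / C := by positivity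
      linarith
    rw [div_le_iff₀ hNpos]
    have h2 : (F.natDegree : ℝ) * 2 ^ (j + 1) ≤ N j := by
      refine le_trans ?_ h1
      rw [div_pow, div_div, le_div_iff₀ (by positivity), pow_succ]
      have h3 : 4 * F.natDegree * C ^ 2 ≤ 2 ^ j := by
        have : (0 : ℝ) ≤ C * (F.leadingCoeff.natAbs + 1) := by positivity
        linarith
      nlinarith [pow_pos (by norm_num : (0 : ℝ) < 2) j]
    have h4 : ((1 : ℝ) / 2) ^ (j + 1) * 2 ^ (j + 1) = 1 := by
      rw [← mul_pow]; norm_num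
    calc (F.natDegree : ℝ) = (1 / 2) ^ (j + 1) * (F.natDegree * 2 ^ (j + 1)) := by
          linear_combination -(F.natDegree : ℝ) * h4
      _ ≤ _ := by gcongr
  have hjump : S (N j) ≤ θ j + F.natDegree / N j := by
    obtain ⟨n, hn⟩ : ∃ n, N j = n + 1 := ⟨N j - 1, by omega⟩
    have h1 := (hN2 j n (by omega)).le
    have h2 : S (N j) ≤ S n + F.natDegree / N j := by
      have hsub : primesIoc 0 (N j : ℝ) ⊆ primesIoc 0 (n : ℝ) ∪ (primesIoc n (N j : ℝ)) := by
        intro p hp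
        obtain ⟨h1, h2, h3⟩ := mem_primesIoc.mp hp
        rw [mem_union, mem_primesIoc, mem_primesIoc]
        by_cases h : (p : ℝ) ≤ n
        · exact Or.inl ⟨h1, h2, h⟩
        · exact Or.inr ⟨h1, not_le.mp h, h3⟩
      have hone : primesIoc n (N j : ℝ) ⊆ {N j} := by
        intro p hp
        obtain ⟨h1, h2, h3⟩ := mem_primesIoc.mp hp
        have h2' : n < p := by exact_mod_cast h2
        have h3' : p ≤ N j := by exact_mod_cast h3
        rw [Finset.mem_singleton]
        omega
      calc S (N j) ≤ ∑ p ∈ primesIoc 0 (n : ℝ) ∪ (primesIoc n (N j : ℝ)), (rootCount F p : ℝ) / p :=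
            sum_le_sum_of_subset_of_nonneg hsub (fun _ _ _ => by positivity)
        _ ≤ S n + ∑ p ∈ primesIoc n (N j : ℝ), (rootCount F p : ℝ) / p := by
            rw [← Finset.sum_union_inter]
            exact le_add_of_nonneg_right (sum_nonneg (fun _ _ => by positivity))
        _ ≤ S n + F.natDegree / N j := by
            gcongr
            rcases Finset.subset_singleton_iff.mp hone with h | h
            · rw [h, Finset.sum_empty]; positivity
            · rw [h, Finset.sum_singleton]
              have hp : (N j).Prime := (mem_primesIoc.mp (h ▸ Finset.mem_singleton_self _)).1
              have := rootCount_le_natDegree hdeg hp (fun hd => by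
                have := Nat.le_of_dvd (Int.natAbs_pos.mpr (leadingCoeff_ne_zero.mpr hF.ne_zero))
                  (Int.natCast_dvd.mp hd)
                omega)
              gcongr
    linarith
  have hsplit : S (N (j + 1)) = S (N j) +
      ∑ p ∈ primesIoc (N j) (N (j + 1)), (rootCount F p : ℝ) / p := by
    have hle : (N j : ℝ) ≤ N (j + 1) := by exact_mod_cast hNmono (Nat.le_succ j)
    rw [hS]
    simp only
    rw [← sum_union]
    · congr 1
      ext p
      rw [mem_union, mem_primesIoc, mem_primesIoc, mem_primesIoc]
      constructor
      · rintro ⟨h1, h2, h3⟩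
        by_cases h : (p : ℝ) ≤ N j
        · exact Or.inl ⟨h1, h2, h⟩
        · exact Or.inr ⟨h1, not_le.mp h, h3⟩
      · rintro (⟨h1, h2, h3⟩ | ⟨h1, h2, h3⟩)
        · exact ⟨h1, h2, h3.trans hle⟩
        · exact ⟨h1, hNpos.trans h2, h3⟩
    · rw [Finset.disjoint_left]
      intro p hp hp'
      linarith [(mem_primesIoc.mp hp).2.2, (mem_primesIoc.mp hp').2.1]
  have hfin := hN1 (j + 1)
  simp only [hθ] at hfin hjump
  push_cast at hfin
  have e : ((1 : ℝ) / 2) ^ j = 2 * (1 / 2) ^ (j + 1) := by rw [pow_succ]; ring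
  linarith

end primeBlocks

/-- number of balls placed in boxes with index `< n` -/
noncomputable def boxCount {k J : ℕ} (c : Fin k → Fin J) (n : ℕ) : ℕ :=
  (univ.filter (fun i => (c i : ℕ) < n)).card

/-- the cluster weight of an allocation of `k` balls to `J` boxes -/
noncomputable def boxWeight {k J : ℕ} (c : Fin k → Fin J) : ℝ :=
  1 + ∑ j ∈ range J, (2 : ℝ) ^ boxCount c (j + 1) * 2 ^ J / (2 ^ k * 2 ^ j)

theorem one_le_boxWeight {k J : ℕ} (c : Fin k → Fin J) : 1 ≤ boxWeight c := by
  unfold boxWeight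
  have : 0 ≤ ∑ j ∈ range J, (2 : ℝ) ^ boxCount c (j + 1) * 2 ^ J / (2 ^ k * 2 ^ j) :=
    sum_nonneg (fun j _ => by positivity)
  linarith

theorem boxCount_update_le {k J : ℕ} (c : Fin k → Fin J) (i : Fin k) (j : Fin J) (n : ℕ) :
    boxCount (Function.update c i j) n ≤ boxCount c n + 1 := by
  unfold boxCount
  have : (univ.filter (fun i' => ((Function.update c i j) i' : ℕ) < n)) ⊆
      insert i (univ.filter (fun i' => (c i' : ℕ) < n)) := by
    intro a ha
    by_cases h : a = i
    · simp [h]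
    · simp [Function.update, h] at ha ⊢
      exact ha
  exact (card_le_card this).trans (Finset.card_insert_le _ _)

theorem boxWeight_update_le {k J : ℕ} (c : Fin k → Fin J) (i : Fin k) (j : Fin J) :
    boxWeight (Function.update c i j) ≤ 2 * boxWeight c := by
  unfold boxWeight
  rw [mul_add, mul_sum]
  refine add_le_add (by norm_num) (sum_le_sum fun n _ => ?_)
  · calc _ ≤ (2 : ℝ) ^ (boxCount c (n + 1) + 1) * 2 ^ J / (2 ^ k * 2 ^ n) := by
          gcongr
          · norm_num
          · exact boxCount_update_le c i j _
      _ = _ := by ring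

theorem sum_fiber_le_of_update {α : Type*} [Fintype α] [DecidableEq α] {k : ℕ}
    (f : (Fin k → α) → ℝ) (i : Fin k) (h : ∀ c j, f c ≤ 2 * f (Function.update c i j)) (j : α) :
    (Fintype.card α : ℝ) * ∑ c with c i = j, f c ≤ 2 * ∑ c, f c := by
  have key : ∀ j' : α, ∑ c with c i = j, f c ≤ 2 * ∑ c with c i = j', f c := by
    intro j'
    rw [mul_sum]
    calc ∑ c with c i = j, f c ≤ ∑ c with c i = j, 2 * f (Function.update c i j') :=
          sum_le_sum (fun c _ => h c j')
      _ = ∑ c with c i = j', 2 * f c := by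
          refine Finset.sum_bij' (fun c _ => Function.update c i j')
            (fun c _ => Function.update c i j) ?_ ?_ ?_ ?_ ?_
          · intro c _; simp
          · intro c _; simp
          · intro c hc
            simp only [mem_filter] at hc
            simp [← hc.2]
          · intro c hc
            simp only [mem_filter] at hc
            simp [← hc.2]
          · intro c _; rfl
  have : ∑ j' : α, ∑ c with c i = j, f c ≤ ∑ j' : α, 2 * ∑ c with c i = j', f c :=
    sum_le_sum (fun j' _ => key j')
  rw [sum_const, card_univ, nsmul_eq_mul, ← mul_sum] at this
  refine this.trans_eq ?_
  congr 1
  exact Finset.sum_fiberwise _ _ _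

theorem inv_boxWeight_update {k J : ℕ} (c : Fin k → Fin J) (i : Fin k) (j : Fin J) :
    1 / boxWeight c ≤ 2 * (1 / boxWeight (Function.update c i j)) := by
  have h1 := one_le_boxWeight c
  have h2 := one_le_boxWeight (Function.update c i j)
  have h3 := boxWeight_update_le c i j
  rw [mul_one_div, div_le_div_iff₀ (by linarith) (by linarith)]
  linarith

theorem sum_inv_boxWeight_fiber {k J : ℕ} (i : Fin k) (j : Fin J) :
    (J : ℝ) * ∑ c : Fin k → Fin J with c i = j, 1 / boxWeight c
      ≤ 2 * ∑ c : Fin k → Fin J, 1 / boxWeight c := by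
  have := sum_fiber_le_of_update (fun c : Fin k → Fin J => 1 / boxWeight c) i
    (fun c j => inv_boxWeight_update c i j) j
  simpa using this

theorem sum_inv_boxWeight_pair {k J : ℕ} (i i' : Fin k) (hi : i ≠ i') (j : Fin J) :
    (J : ℝ) ^ 2 * ∑ c : Fin k → Fin J with c i = j ∧ c i' = j, 1 / boxWeight c
      ≤ 4 * ∑ c : Fin k → Fin J, 1 / boxWeight c := by
  have h1 := sum_fiber_le_of_update
    (fun c : Fin k → Fin J => if c i' = j then 1 / boxWeight c else 0) i
    (fun c j' => by
      simp only [Function.update_of_ne hi.symm]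
      split_ifs
      · exact inv_boxWeight_update c i j'
      · simp) j
  simp only [Fintype.card_fin] at h1
  have h2 := sum_inv_boxWeight_fiber (J := J) i' j
  rw [← sum_filter, ← sum_filter, Finset.filter_filter] at h1
  have h0 : (0:ℝ) ≤ J := Nat.cast_nonneg J
  nlinarith [mul_le_mul_of_nonneg_left h1 h0]

section growth

variable {k J : ℕ} (c : Fin k → Fin J)

/-- normalized cumulative count -/
private noncomputable def uu (n : ℕ) : ℝ := (2 : ℝ) ^ boxCount c n / 2 ^ n

private noncomputable def ee (n : ℕ) : ℝ :=
  if boxCount c (n + 1) ≠ boxCount c n then uu c (n + 1) else 0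

private noncomputable def EE (n : ℕ) : ℝ := ∑ j ∈ range n, ee c j

private theorem uu_pos (n : ℕ) : 0 < uu c n := by unfold uu; positivity

private theorem ee_nonneg (n : ℕ) : 0 ≤ ee c n := by
  unfold ee
  split_ifs
  · exact (uu_pos c _).le
  · exact le_rfl

private theorem EE_succ (n : ℕ) : EE c (n + 1) = EE c n + ee c n := Finset.sum_range_succ _ _

private theorem EE_nonneg (n : ℕ) : 0 ≤ EE c n := sum_nonneg (fun j _ => ee_nonneg c j)

private theorem EE_mono : Monotone (EE c) :=
  monotone_nat_of_le_succ (fun n => by rw [EE_succ]; linarith [ee_nonneg c n])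

theorem boxCount_zero : boxCount c 0 = 0 := by simp [boxCount]

theorem boxCount_top : boxCount c J = k := by simp [boxCount]

theorem boxCount_succ (n : ℕ) :
    boxCount c (n + 1) = boxCount c n + (univ.filter (fun i => (c i : ℕ) = n)).card := by
  unfold boxCount
  rw [← Finset.card_union_of_disjoint]
  · congr 1
    ext i
    simp
    omega
  · rw [Finset.disjoint_filter]
    intro i _ h1 h2
    omega

private theorem uu_le (n : ℕ) : uu c n ≤ 1 + EE c n := by
  induction n with
  | zero => simp [uu, boxCount_zero, EE]
  | succ n ih =>
    rw [EE_succ]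
    by_cases h : boxCount c (n + 1) = boxCount c n
    · have : uu c (n + 1) = uu c n / 2 := by
        unfold uu; rw [h, pow_succ]; field_simp
      have := uu_pos c n
      have := ee_nonneg c n
      linarith
    · have : ee c n = uu c (n + 1) := by simp [ee, h]
      have := EE_nonneg c n
      linarith

private theorem sum_uu_le (n : ℕ) :
    ∑ j ∈ range n, uu c (j + 1) + uu c n ≤ 2 * EE c n + 1 := by
  induction n with
  | zero => simp [uu, boxCount_zero, EE]
  | succ n ih =>
    rw [EE_succ, Finset.sum_range_succ]
    by_cases h : boxCount c (n + 1) = boxCount c n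
    · have : uu c (n + 1) = uu c n / 2 := by
        unfold uu; rw [h, pow_succ]; field_simp
      have := ee_nonneg c n
      linarith
    · have : ee c n = uu c (n + 1) := by simp [ee, h]
      have := uu_pos c n
      linarith

private theorem uu_top (h : J ≤ k) : uu c J = 2 ^ (k - J) := by
  unfold uu
  rw [boxCount_top, div_eq_iff (by positivity), ← pow_add]
  congr 1
  omega

private theorem boxWeight_eq :
    boxWeight c = 1 + 2 * 2 ^ J / 2 ^ k * ∑ j ∈ range J, uu c (j + 1) := by
  unfold boxWeight uu
  rw [mul_sum]
  congr 1
  refine sum_congr rfl (fun j _ => ?_)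
  rw [pow_succ (2:ℝ) j]
  field_simp

private theorem boxWeight_le_EE (h : J < k) :
    boxWeight c ≤ 2 * (1 + 2 * 2 ^ J / 2 ^ k * EE c J) := by
  rw [boxWeight_eq]
  have h1 := sum_uu_le c J
  have h2 := uu_pos c J
  have h3 : (2:ℝ) * 2 ^ J / 2 ^ k ≤ 1 := by
    rw [div_le_one (by positivity), ← pow_succ']
    exact pow_le_pow_right₀ (by norm_num) h
  have h4 : (0:ℝ) < 2 * 2 ^ J / 2 ^ k := by positivity
  nlinarith

private noncomputable def PP (n : ℕ) : ℝ := EE c J / (2 ^ (k - J) - 1) + EE c n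

private theorem two_pow_sub_one_pos (h : J < k) : (0:ℝ) < 2 ^ (k - J) - 1 := by
  have : (2:ℝ) ^ 1 ≤ 2 ^ (k - J) := pow_le_pow_right₀ (by norm_num) (by omega)
  linarith

private theorem uu_le_PP (h : J < k) (n : ℕ) : uu c n ≤ PP c n := by
  have h1 := uu_le c n
  have h2 := uu_le c J
  rw [uu_top c h.le] at h2
  have h3 : 1 ≤ EE c J / (2 ^ (k - J) - 1) := by
    rw [le_div_iff₀ (two_pow_sub_one_pos h)]
    linarith
  unfold PP
  linarith

private theorem PP_pos (h : J < k) (n : ℕ) : 0 < PP c n := (uu_pos c n).trans_le (uu_le_PP c h n)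

private theorem PP_top (h : J < k) : PP c J = 2 ^ (k - J) * PP c 0 := by
  have := (two_pow_sub_one_pos h).ne'
  have h0 : EE c 0 = 0 := by simp [EE]
  unfold PP
  rw [h0]
  field_simp
  ring

private theorem log_step (h : J < k) (n : ℕ) :
    log (PP c (n + 1)) - log (PP c n) ≤
      2 * ((univ.filter (fun i => (c i : ℕ) = n)).card * (uu c (n + 1) / PP c (n + 1))) := by
  have hN := boxCount_succ c n
  generalize (univ.filter (fun i => (c i : ℕ) = n)).card = b at hN ⊢
  have hP : PP c (n + 1) = PP c n + ee c n := by unfold PP; rw [EE_succ]; ring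
  have p0 := PP_pos c h n
  have p1 := PP_pos c h (n + 1)
  have u1 := uu_pos c (n + 1)
  rcases Nat.eq_zero_or_pos b with hb | hb
  · have : ee c n = 0 := by simp [ee, hN, hb]
    rw [hP, this, hb]
    simp
  · have he : ee c n = uu c (n + 1) := by
      have : boxCount c (n + 1) ≠ boxCount c n := by omega
      simp [ee, this]
    rw [he] at hP
    have hb1 : (1:ℝ) ≤ b := by exact_mod_cast hb
    set v := uu c (n + 1) / PP c (n + 1) with hv
    have v0 : 0 < v := by positivity
    rw [← log_div p1.ne' p0.ne']
    by_cases hv2 : v ≤ 1 / 2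
    · have h1 := log_le_sub_one_of_pos (show 0 < PP c (n + 1) / PP c n by positivity)
      have h2 : uu c (n + 1) ≤ PP c n := by
        rw [hv, div_le_iff₀ p1] at hv2
        linarith
      have h3 : PP c (n + 1) / PP c n - 1 = uu c (n + 1) / PP c n := by
        rw [hP]; field_simp; ring
      have h4 : uu c (n + 1) / PP c n ≤ 2 * v := by
        rw [hv, ← mul_div_assoc, div_le_div_iff₀ p0 p1]
        nlinarith
      nlinarith
    · push Not at hv2
      have h1 : uu c (n + 1) = 2 ^ (b - 1) * uu c n := by
        unfold uu
        rw [hN]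
        obtain ⟨m, rfl⟩ : ∃ m, b = m + 1 := ⟨b - 1, by omega⟩
        simp only [Nat.add_sub_cancel]
        rw [pow_add, pow_succ, pow_succ]
        field_simp
      have h2 := uu_le_PP c h n
      have h3 : PP c (n + 1) / PP c n ≤ 2 ^ b := by
        rw [div_le_iff₀ p0, hP, h1]
        obtain ⟨m, hm⟩ : ∃ m, b = m + 1 := ⟨b - 1, by omega⟩
        rw [hm]
        simp only [Nat.add_sub_cancel]
        have : (1:ℝ) ≤ 2 ^ m := one_le_pow₀ (by norm_num)
        rw [pow_succ]
        nlinarith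
      have h4 := log_le_log (by positivity) h3
      rw [log_pow] at h4
      have h5 := log_two_lt_d9
      nlinarith

private theorem sum_growth (h : J < k) :
    ((k - J : ℕ) : ℝ) / 3 ≤ ∑ i : Fin k, uu c (c i + 1) / PP c (c i + 1) := by
  have h1 : ∑ n ∈ range J, (log (PP c (n + 1)) - log (PP c n)) ≤
      ∑ n ∈ range J, 2 * ((univ.filter (fun i => (c i : ℕ) = n)).card *
        (uu c (n + 1) / PP c (n + 1))) := sum_le_sum (fun n _ => log_step c h n)
  rw [Finset.sum_range_sub (fun n => log (PP c n)), PP_top c h, log_mul (by positivity) (PP_pos c h 0).ne',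
    log_pow, ← mul_sum] at h1
  have h2 : ∑ n ∈ range J, ((univ.filter (fun i => (c i : ℕ) = n)).card *
        (uu c (n + 1) / PP c (n + 1))) = ∑ i : Fin k, uu c (c i + 1) / PP c (c i + 1) := by
    rw [← Finset.sum_fiberwise_of_maps_to (s := univ) (t := range J)
      (g := fun i : Fin k => (c i : ℕ)) (fun i _ => by simp)]
    refine sum_congr rfl (fun n _ => ?_)
    rw [sum_congr rfl (g := fun _ => uu c (n + 1) / PP c (n + 1)), sum_const,
      nsmul_eq_mul]
    intro i hi
    simp only [mem_filter] at hi
    rw [hi.2]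
  rw [h2] at h1
  have h5 := log_two_gt_d9
  have : (0:ℝ) ≤ ((k - J : ℕ) : ℝ) := by positivity
  nlinarith

private theorem ee_eq (n : ℕ) : ee c n =
    if (univ.filter (fun i => (c i : ℕ) = n)).card = 0 then 0 else uu c (n + 1) := by
  unfold ee
  rw [boxCount_succ]
  split_ifs <;> first | rfl | omega

private theorem val_add_rev (a t : Fin J) :
    ((a + Fin.rev t : Fin J) : ℕ) = if (a : ℕ) ≤ t then (a : ℕ) + (J - 1 - t) else a - t - 1 := by
  rw [Fin.val_add, Fin.val_rev]
  have := a.2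
  have := t.2
  split_ifs with h
  · rw [Nat.mod_eq_of_lt (by omega)]; omega
  · have : (a : ℕ) + (J - (t + 1)) = (a - t - 1) + J := by omega
    rw [this, Nat.add_mod_right, Nat.mod_eq_of_lt (by omega)]

private theorem boxCount_rot_high (t j : Fin J) (h : (t : ℕ) < j) :
    boxCount (fun i => c i + Fin.rev t) ((j : ℕ) - t) + boxCount c (t + 1) = boxCount c (j + 1) := by
  unfold boxCount
  rw [← Finset.card_union_of_disjoint]
  · congr 1
    ext i
    simp only [mem_union, mem_filter, mem_univ, true_and, val_add_rev]
    have := t.2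
    have := j.2
    have := (c i).2
    split_ifs <;> omega
  · rw [Finset.disjoint_filter]
    intro i _ h1 h2
    rw [val_add_rev] at h1
    have := t.2
    have := j.2
    split_ifs at h1 <;> omega

private theorem boxCount_rot_low (t j : Fin J) (h : (j : ℕ) ≤ t) :
    boxCount (fun i => c i + Fin.rev t) ((j : ℕ) + J - t) + boxCount c (t + 1)
      = k + boxCount c (j + 1) := by
  have h0 : boxCount c (t + 1) + (univ.filter (fun i => ¬ (c i : ℕ) < t + 1)).card = k := by
    unfold boxCount
    rw [Finset.card_filter_add_card_filter_not]
    simp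
  have h1 : boxCount (fun i => c i + Fin.rev t) ((j : ℕ) + J - t) =
      (univ.filter (fun i => ¬ (c i : ℕ) < t + 1)).card + boxCount c (j + 1) := by
    unfold boxCount
    rw [← Finset.card_union_of_disjoint]
    · congr 1
      ext i
      simp only [mem_union, mem_filter, mem_univ, true_and, val_add_rev]
      have := t.2
      have := j.2
      have := (c i).2
      split_ifs <;> omega
    · rw [Finset.disjoint_filter]
      intro i _ h1 h2
      omega
  omega

private theorem uu_rot_high (t j : Fin J) (h : (t : ℕ) < j) :
    uu (fun i => c i + Fin.rev t) ((j : ℕ) - t) = uu c (j + 1) / uu c (t + 1) := by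
  have h1 := boxCount_rot_high c t j h
  unfold uu
  rw [← h1]
  obtain ⟨m, hm⟩ : ∃ m, (j : ℕ) = t + m := ⟨j - t, by omega⟩
  rw [hm, pow_add, pow_add, pow_add, pow_add]
  simp only [Nat.add_sub_cancel_left]
  field_simp

private theorem uu_rot_low (t j : Fin J) (h : (j : ℕ) ≤ t) :
    uu (fun i => c i + Fin.rev t) ((j : ℕ) + J - t)
      = 2 ^ k / 2 ^ J * (uu c (j + 1) / uu c (t + 1)) := by
  have h1 := boxCount_rot_low c t j h
  have h2 : (2 : ℝ) ^ boxCount (fun i => c i + Fin.rev t) ((j : ℕ) + J - t)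
      * 2 ^ boxCount c (t + 1) = 2 ^ k * 2 ^ boxCount c (j + 1) := by
    rw [← pow_add, h1, pow_add]
  unfold uu
  have h3 : (2 : ℝ) ^ ((j : ℕ) + J - t) * 2 ^ (t + 1 : ℕ) = 2 ^ J * 2 ^ (j + 1 : ℕ) := by
    rw [← pow_add, ← pow_add]
    congr 1
    have := t.2
    omega
  rw [div_div_div_eq, div_mul_div_comm, div_eq_div_iff (by positivity) (by positivity)]
  linear_combination (2 ^ J * (2 ^ (j + 1 : ℕ)) : ℝ) * h2
    - (2 : ℝ) ^ k * 2 ^ boxCount c (j + 1) * h3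

private theorem ee_rot (t j : Fin J) :
    ee (fun i => c i + Fin.rev t) ((j + Fin.rev t : Fin J) : ℕ) =
      (if (j : ℕ) ≤ t then 2 ^ k / 2 ^ J else 1) * (ee c j / uu c (t + 1)) := by
  rw [ee_eq, ee_eq]
  have h0 : (univ.filter (fun i : Fin k => ((c i + Fin.rev t : Fin J) : ℕ) =
      ((j + Fin.rev t : Fin J) : ℕ))) = univ.filter (fun i => (c i : ℕ) = j) := by
    ext i
    simp only [mem_filter, mem_univ, true_and, Fin.val_inj]
    have : NeZero J := ⟨by have := t.2; omega⟩
    exact add_left_inj _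
  rw [h0]
  split_ifs with h1 h2 h2
  · simp
  · simp
  · rw [val_add_rev, if_pos h2, ← uu_rot_low c t j h2]
    congr 1
    have := t.2
    omega
  · rw [val_add_rev, if_neg h2, one_mul, ← uu_rot_high c t j (by omega)]
    congr 1
    omega

private theorem EE_rot (t : Fin J) :
    EE (fun i => c i + Fin.rev t) J =
      (2 ^ k / 2 ^ J * EE c (t + 1) + (EE c J - EE c (t + 1))) / uu c (t + 1) := by
  have : NeZero J := ⟨by have := t.2; omega⟩
  have h1 : EE (fun i => c i + Fin.rev t) J =
      ∑ j : Fin J, ee (fun i => c i + Fin.rev t) ((j + Fin.rev t : Fin J) : ℕ) := by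
    unfold EE
    rw [Finset.sum_range]
    exact (Equiv.sum_comp (Equiv.addRight (Fin.rev t))
      (fun j : Fin J => ee (fun i => c i + Fin.rev t) (j : ℕ))).symm
  have h2 : ∀ j : Fin J, ee (fun i => c i + Fin.rev t) ((j + Fin.rev t : Fin J) : ℕ) =
      ((2 ^ k / 2 ^ J - 1) / uu c (t + 1)) * (if (j : ℕ) < t + 1 then ee c j else 0)
        + (1 / uu c (t + 1)) * ee c j := by
    intro j
    rw [ee_rot]
    have := uu_pos c (t + 1)
    by_cases h : (j : ℕ) ≤ t
    · rw [if_pos h, if_pos (by omega)]; field_simp; ring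
    · rw [if_neg h, if_neg (by omega)]; field_simp; ring
  have h3 : ∑ j : Fin J, (if (j : ℕ) < t + 1 then ee c j else 0) = EE c (t + 1) := by
    unfold EE
    rw [← Finset.sum_range (fun j => if j < (t : ℕ) + 1 then ee c j else 0), ← sum_filter]
    refine sum_congr ?_ (fun _ _ => rfl)
    ext j
    have := t.2
    simp
    omega
  have h4 : ∑ j : Fin J, ee c j = EE c J := by
    unfold EE
    rw [Finset.sum_range]
  rw [h1, sum_congr rfl (fun j _ => h2 j), sum_add_distrib, ← mul_sum,
    ← mul_sum, h3, h4]
  have := uu_pos c (t + 1)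
  field_simp
  ring

private theorem boxWeight_rot_le (h : J < k) (i : Fin k) :
    boxWeight (fun i' => c i' + Fin.rev (c i)) ≤ 6 * (PP c (c i + 1) / uu c (c i + 1)) := by
  have h1 := boxWeight_le_EE (fun i' => c i' + Fin.rev (c i)) h
  rw [EE_rot] at h1
  have hu := uu_pos c (c i + 1)
  have hP := uu_le_PP c h (c i + 1)
  have h2 : (2 : ℝ) * 2 ^ J / 2 ^ k * ((2 ^ k / 2 ^ J * EE c (c i + 1)
      + (EE c J - EE c (c i + 1))) / uu c (c i + 1)) ≤ 2 * (PP c (c i + 1) / uu c (c i + 1)) := by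
    have h3 : (2 : ℝ) * 2 ^ J / 2 ^ k * ((2 ^ k / 2 ^ J * EE c (c i + 1)
      + (EE c J - EE c (c i + 1))) / uu c (c i + 1)) =
      2 * ((EE c (c i + 1) + 2 ^ J / 2 ^ k * (EE c J - EE c (c i + 1))) / uu c (c i + 1)) := by
      field_simp
    rw [h3]
    gcongr
    unfold PP
    have h4 : (2:ℝ) ^ J / 2 ^ k * (EE c J - EE c (c i + 1)) ≤ EE c J / (2 ^ (k - J) - 1) := by
      have h5 : (2:ℝ) ^ J / 2 ^ k = 1 / 2 ^ (k - J) := by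
        rw [div_eq_div_iff (by positivity) (by positivity), ← pow_add, one_mul]
        congr 1
        omega
      rw [h5]
      have h6 := two_pow_sub_one_pos h
      have h7 := EE_nonneg c (c i + 1)
      have h8 := EE_nonneg c J
      rw [div_mul_eq_mul_div, one_mul]
      apply div_le_div₀ h8 (by linarith) h6 (by linarith)
    linarith
  have h9 : 1 ≤ PP c (c i + 1) / uu c (c i + 1) := by rwa [one_le_div hu]
  linarith

end growth

theorem sum_inv_boxWeight_ge {k J : ℕ} (hJ : 0 < J) (h : J < k) :
    (J : ℝ) ^ k * (k - J : ℕ) ≤ 36 * k * ∑ c : Fin k → Fin J, 1 / boxWeight c := by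
  have : NeZero J := ⟨hJ.ne'⟩
  have h1 : ∑ c : Fin k → Fin J, ((k - J : ℕ) : ℝ) / 3 ≤ ∑ c : Fin k → Fin J,
      ∑ i : Fin k, 6 * (1 / boxWeight (fun i' => c i' + Fin.rev (c i))) := by
    refine sum_le_sum (fun c _ => (sum_growth c h).trans ?_)
    refine sum_le_sum (fun i _ => ?_)
    have h2 := boxWeight_rot_le c h i
    have hu := uu_pos c (c i + 1)
    have hP := PP_pos c h (c i + 1)
    have hw := one_le_boxWeight (fun i' => c i' + Fin.rev (c i))
    rw [← mul_div_assoc, le_div_iff₀ hu] at h2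
    rw [mul_one_div, div_le_div_iff₀ hP (by linarith)]
    linarith
  rw [sum_const, sum_comm] at h1
  have h2 : ∀ i : Fin k, ∑ c : Fin k → Fin J,
      6 * (1 / boxWeight (fun i' => c i' + Fin.rev (c i))) ≤
        12 * ∑ c : Fin k → Fin J, 1 / boxWeight c := by
    intro i
    rw [← mul_sum, ← Finset.sum_fiberwise (s := univ)
      (g := fun c : Fin k → Fin J => c i)]
    have h3 : ∀ t : Fin J, ∑ c : Fin k → Fin J with c i = t,
        1 / boxWeight (fun i' => c i' + Fin.rev (c i)) =
        ∑ c : Fin k → Fin J with c i = Fin.rev 0, 1 / boxWeight c := by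
      intro t
      have ht : t + Fin.rev t = Fin.rev 0 := by
        apply Fin.ext
        rw [val_add_rev, if_pos le_rfl, Fin.val_rev]
        have := t.2
        simp
        omega
      refine Finset.sum_bij' (fun c _ => fun i' => c i' + Fin.rev t)
        (fun c _ => fun i' => c i' - Fin.rev t) ?_ ?_ ?_ ?_ ?_
      · intro c hc
        simp only [mem_filter, mem_univ, true_and] at hc ⊢
        rw [hc, ht]
      · intro c hc
        simp only [mem_filter, mem_univ, true_and] at hc ⊢
        rw [hc, ← ht, add_sub_cancel_right]
      · intro c _; simp
      · intro c _; simp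
      · intro c hc
        simp only [mem_filter, mem_univ, true_and] at hc
        rw [hc]
    rw [sum_congr rfl (fun t _ => h3 t), sum_const, card_univ,
      Fintype.card_fin, nsmul_eq_mul]
    linarith [sum_inv_boxWeight_fiber i (Fin.rev (0 : Fin J))]
  have h4 := h1.trans (sum_le_sum (fun i _ => h2 i))
  rw [sum_const, card_univ, card_univ, Fintype.card_fun, Fintype.card_fin,
    Fintype.card_fin, nsmul_eq_mul, nsmul_eq_mul] at h4
  push_cast at h4
  linarith

section weightedTuples

theorem sum_piFinset_filter_le {k : ℕ} (E : Fin k → Finset ℕ) (w : ℕ → ℝ) (hw : ∀ p, 0 ≤ w p)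
    (b : Fin k) (Q : (Fin k → ℕ) → Prop) (B : ℝ) (hσ : 0 < ∑ p ∈ E b, w p)
    (h : ∀ P ∈ Fintype.piFinset E, ∑ p ∈ E b with Q (Function.update P b p), w p ≤
      B * ∑ p ∈ E b, w p) :
    ∑ P ∈ Fintype.piFinset E with Q P, ∏ i, w (P i) ≤ B * ∏ i, ∑ p ∈ E i, w p := by
  have hmul : ∀ (P : Fin k → ℕ) (p : ℕ),
      w p * ∏ i, w (P i) = w (P b) * ∏ i, w (Function.update P b p i) := by
    intro P p
    rw [← Finset.mul_prod_erase _ _ (mem_univ b),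
      ← Finset.mul_prod_erase _ (fun i => w (Function.update P b p i)) (mem_univ b)]
    rw [Function.update_self]
    have : ∏ i ∈ univ.erase b, w (Function.update P b p i) =
        ∏ i ∈ univ.erase b, w (P i) :=
      prod_congr rfl (fun i hi => by rw [Function.update_of_ne (Finset.ne_of_mem_erase hi)])
    rw [this]
    ring
  have hswap : (∑ p ∈ E b, w p) * ∑ P ∈ Fintype.piFinset E with Q P, ∏ i, w (P i) =
      ∑ P ∈ Fintype.piFinset E, (∏ i, w (P i)) *
        ∑ p ∈ E b with Q (Function.update P b p), w p := by
    simp_rw [sum_filter, mul_sum, sum_mul]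
    rw [← Finset.sum_product', ← Finset.sum_product']
    refine Finset.sum_nbij' (fun z => (Function.update z.1 b z.2, z.1 b))
      (fun z => (Function.update z.1 b z.2, z.1 b)) ?_ ?_ ?_ ?_ ?_
    · rintro ⟨P, p⟩ hz
      obtain ⟨h1, h2⟩ := mem_product.mp hz
      refine mem_product.mpr ⟨Fintype.mem_piFinset.mpr (fun i => ?_),
        Fintype.mem_piFinset.mp h1 b⟩
      by_cases hi : i = b
      · subst hi; simpa using h2
      · simpa [Function.update_of_ne hi] using Fintype.mem_piFinset.mp h1 i
    · rintro ⟨P, p⟩ hz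
      obtain ⟨h1, h2⟩ := mem_product.mp hz
      refine mem_product.mpr ⟨Fintype.mem_piFinset.mpr (fun i => ?_),
        Fintype.mem_piFinset.mp h1 b⟩
      by_cases hi : i = b
      · subst hi; simpa using h2
      · simpa [Function.update_of_ne hi] using Fintype.mem_piFinset.mp h1 i
    · rintro ⟨P, p⟩ _
      simp
    · rintro ⟨P, p⟩ _
      simp
    · rintro ⟨P, p⟩ _
      simp only [Function.update_idem, Function.update_eq_self]
      split_ifs
      · rw [hmul, mul_comm]
      · simp
  rw [← mul_le_mul_iff_right₀ hσ, hswap, Finset.prod_univ_sum]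
  calc _ ≤ ∑ P ∈ Fintype.piFinset E, (∏ i, w (P i)) * (B * ∑ p ∈ E b, w p) :=
        sum_le_sum (fun P hP => mul_le_mul_of_nonneg_left (h P hP)
          (prod_nonneg (fun i _ => hw _)))
    _ = _ := by rw [← sum_mul]; ring

/-- the number of ordered pairs of subsets with the same label -/
noncomputable def pairCount {k : ℕ} (f : Finset (Fin k) → ℤ) : ℕ :=
  (univ.filter (fun z : Finset (Fin k) × Finset (Fin k) => f z.1 = f z.2)).card

theorem four_pow_le_card_image_mul_pairCount {k : ℕ} (f : Finset (Fin k) → ℤ) :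
    (4 : ℝ) ^ k ≤ ((univ.image f).card : ℝ) * pairCount f := by
  have h1 : (univ : Finset (Finset (Fin k))).card =
      ∑ m ∈ univ.image f, (univ.filter (fun S => f S = m)).card :=
    Finset.card_eq_sum_card_image _ _
  have h2 : pairCount f =
      ∑ m ∈ univ.image f, (univ.filter (fun S => f S = m)).card ^ 2 := by
    unfold pairCount
    rw [Finset.card_eq_sum_card_fiberwise (f := fun z : Finset (Fin k) × Finset (Fin k) => f z.1)
      (t := univ.image f) (fun z _ => Finset.mem_image_of_mem _ (mem_univ _))]
    refine sum_congr rfl (fun m _ => ?_)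
    rw [pow_two, ← Finset.card_product]
    congr 1
    ext ⟨S, S'⟩
    simp only [mem_filter, mem_univ, true_and, mem_product]
    constructor
    · rintro ⟨h, rfl⟩; exact ⟨rfl, h.symm⟩
    · rintro ⟨rfl, h⟩; exact ⟨h.symm, rfl⟩
  have h3 := sq_sum_le_card_mul_sum_sq (s := univ.image f)
    (f := fun m => (univ.filter (fun S => f S = m)).card)
  rw [← h1, ← h2, card_univ, Fintype.card_finset, Fintype.card_fin] at h3
  have h4 : ((2 : ℝ) ^ k) ^ 2 ≤ ((univ.image f).card : ℝ) * pairCount f := by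
    exact_mod_cast h3
  calc (4 : ℝ) ^ k = (2 ^ k) ^ 2 := by rw [← pow_mul, mul_comm, pow_mul]; norm_num
    _ ≤ _ := h4

theorem card_symmDiff_subset_le {k : ℕ} (S L : Finset (Fin k)) :
    (univ.filter (fun S' => symmDiff S S' ⊆ L)).card ≤ 2 ^ L.card := by
  rw [← Finset.card_powerset]
  refine card_le_card_of_injOn (fun S' => symmDiff S S') (fun S' hS' => ?_) ?_
  · exact mem_powerset.mpr (mem_filter.mp hS').2
  · intro S₁ _ S₂ _ h
    exact symmDiff_right_injective S h

theorem sum_weight_mul_pairCount_le {k J : ℕ} (c : Fin k → Fin J) (X : Finset (Fin k → ℕ))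
    (w : (Fin k → ℕ) → ℝ) (f : (Fin k → ℕ) → Finset (Fin k) → ℤ) (B : ℕ → ℝ) (hB : ∀ j, 0 ≤ B j)
    (A : ℝ) (hA0 : 0 ≤ A) (hA : ∑ P ∈ X, w P ≤ A)
    (h : ∀ S S', S ≠ S' → ∃ b, (∀ b' ∈ symmDiff S S', c b' ≤ c b) ∧
      ∑ P ∈ X with f P S = f P S', w P ≤ B (c b) * A) :
    ∑ P ∈ X, w P * pairCount (f P) ≤
      A * 2 ^ k * (1 + ∑ j ∈ range J, B j * 2 ^ boxCount c (j + 1)) := by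
  have e1 : ∑ P ∈ X, w P * pairCount (f P) =
      ∑ S : Finset (Fin k), ∑ S' : Finset (Fin k), ∑ P ∈ X with f P S = f P S', w P := by
    have : ∀ P ∈ X, w P * pairCount (f P) =
        ∑ S : Finset (Fin k), ∑ S' : Finset (Fin k), if f P S = f P S' then w P else 0 := by
      intro P _
      unfold pairCount
      rw [← Finset.sum_product', Finset.univ_product_univ, ← sum_filter, sum_const,
        nsmul_eq_mul, mul_comm]
    rw [sum_congr rfl this, sum_comm]
    refine sum_congr rfl (fun S _ => ?_)
    rw [sum_comm]
    exact sum_congr rfl (fun S' _ => (sum_filter _ _).symm)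
  have e2 : ∀ S S' : Finset (Fin k), ∑ P ∈ X with f P S = f P S', w P ≤
      (if S = S' then A else 0) + ∑ j ∈ range J,
        if symmDiff S S' ⊆ univ.filter (fun b => (c b : ℕ) < j + 1) then B j * A else 0 := by
    intro S S'
    have hnn : ∀ j ∈ range J, 0 ≤
        if symmDiff S S' ⊆ univ.filter (fun b => (c b : ℕ) < j + 1) then B j * A else 0 := by
      intro j _
      split_ifs
      · exact mul_nonneg (hB j) hA0
      · exact le_rfl
    by_cases hS : S = S'
    · subst hS
      rw [if_pos rfl]
      refine le_trans (le_of_eq_of_le ?_ hA) (le_add_of_nonneg_right (sum_nonneg hnn))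
      exact sum_congr (Finset.filter_true_of_mem (fun _ _ => rfl)) (fun _ _ => rfl)
    · rw [if_neg hS, zero_add]
      obtain ⟨b, hb1, hb2⟩ := h S S' hS
      refine hb2.trans ?_
      refine le_trans (le_of_eq ?_) (single_le_sum hnn (mem_range.mpr (c b).2))
      rw [if_pos]
      intro b' hb'
      refine mem_filter.mpr ⟨mem_univ _, ?_⟩
      have : (c b' : ℕ) ≤ c b := hb1 b' hb'
      omega
  rw [e1]
  calc _ ≤ ∑ S : Finset (Fin k), ∑ S' : Finset (Fin k), ((if S = S' then A else 0) +
        ∑ j ∈ range J, if symmDiff S S' ⊆ univ.filter (fun b => (c b : ℕ) < j + 1)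
          then B j * A else 0) :=
        sum_le_sum (fun S _ => sum_le_sum (fun S' _ => e2 S S'))
    _ ≤ ∑ S : Finset (Fin k), (A + ∑ j ∈ range J, 2 ^ boxCount c (j + 1) * (B j * A)) := by
        refine sum_le_sum (fun S _ => ?_)
        rw [sum_add_distrib, Finset.sum_ite_eq, if_pos (mem_univ _), sum_comm]
        refine add_le_add le_rfl (sum_le_sum (fun j _ => ?_))
        rw [← sum_filter, sum_const, nsmul_eq_mul]
        refine mul_le_mul_of_nonneg_right ?_ (mul_nonneg (hB j) hA0)
        exact_mod_cast card_symmDiff_subset_le S _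
    _ = _ := by
        rw [sum_const, card_univ, Fintype.card_finset, Fintype.card_fin,
          nsmul_eq_mul, mul_add, mul_add, mul_sum, mul_sum]
        push_cast
        congr 1
        · ring
        · exact sum_congr rfl (fun j _ => by ring)

theorem prod_sum_mul_le_sum_injective {k J : ℕ} (c : Fin k → Fin J) (E : Fin k → Finset ℕ)
    (w : ℕ → ℝ) (hw : ∀ p, 0 ≤ w p) (τ : Fin k → ℝ)
    (hσ : ∀ b, 0 < ∑ p ∈ E b, w p) (hτ : ∀ b, ∀ p ∈ E b, w p ≤ τ b * ∑ p ∈ E b, w p)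
    (hdisj : ∀ b b', c b ≠ c b' → Disjoint (E b) (E b')) :
    (∏ i, ∑ p ∈ E i, w p) * (1 - ∑ b, ∑ b', if b ≠ b' ∧ c b = c b' then τ b else 0) ≤
      ∑ P ∈ Fintype.piFinset E with Function.Injective P, ∏ i, w (P i) := by
  have hnn : ∀ P : Fin k → ℕ, 0 ≤ ∏ i, w (P i) := fun P => prod_nonneg (fun i _ => hw _)
  have hpair : ∀ b b', ∑ P ∈ Fintype.piFinset E with b ≠ b' ∧ P b = P b', ∏ i, w (P i) ≤
      (if b ≠ b' ∧ c b = c b' then τ b else 0) * ∏ i, ∑ p ∈ E i, w p := by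
    intro b b'
    have hA0 : 0 ≤ ∏ i, ∑ p ∈ E i, w p := prod_nonneg (fun i _ => (hσ i).le)
    split_ifs with hbb
    · refine le_of_eq_of_le ?_ (sum_piFinset_filter_le E w hw b (fun P => b ≠ b' ∧ P b = P b') (τ b)
        (hσ b) (fun P hP => ?_))
      · congr!
      have hsub : (E b).filter (fun p => b ≠ b' ∧
          Function.update P b p b = Function.update P b p b') ⊆ (E b).filter (fun p => p = P b') := by
        intro p hp
        obtain ⟨h1, -, h2⟩ := mem_filter.mp hp
        rw [Function.update_self, Function.update_of_ne hbb.1.symm] at h2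
        exact mem_filter.mpr ⟨h1, h2⟩
      have hle := sum_le_sum_of_subset_of_nonneg hsub (fun p _ _ => hw p)
      refine le_of_eq_of_le (sum_congr (by congr!) (fun _ _ => rfl)) (hle.trans ?_)
      rw [Finset.filter_eq']
      split_ifs with hm
      · rw [Finset.sum_singleton]; exact hτ b _ hm
      · rw [Finset.sum_empty]
        obtain ⟨p, hp⟩ : (E b).Nonempty := by
          by_contra hne
          have := hσ b
          rw [Finset.not_nonempty_iff_eq_empty.mp hne, Finset.sum_empty] at this
          exact lt_irrefl _ this
        exact (hw p).trans (hτ b p hp)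
    · rw [zero_mul]
      refine le_of_eq (sum_eq_zero (fun P hP => ?_))
      exfalso
      obtain ⟨h1, h2, h3⟩ := mem_filter.mp hP
      have h4 : c b ≠ c b' := fun h => hbb ⟨h2, h⟩
      have h5 := Fintype.mem_piFinset.mp h1 b
      have h6 := Fintype.mem_piFinset.mp h1 b'
      rw [← h3] at h6
      exact Finset.disjoint_left.mp (hdisj b b' h4) h5 h6
  have hnoninj : ∑ P ∈ Fintype.piFinset E with ¬ Function.Injective P, ∏ i, w (P i) ≤
      ∑ b, ∑ b', ∑ P ∈ Fintype.piFinset E with b ≠ b' ∧ P b = P b', ∏ i, w (P i) := by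
    simp_rw [sum_filter]
    calc _ ≤ ∑ P ∈ Fintype.piFinset E, ∑ b, ∑ b',
          (if b ≠ b' ∧ P b = P b' then ∏ i, w (P i) else 0) := by
          refine sum_le_sum (fun P _ => ?_)
          have hnn' : ∀ b b' : Fin k,
              0 ≤ if b ≠ b' ∧ P b = P b' then ∏ i, w (P i) else 0 := by
            intro b b'
            split_ifs
            · exact hnn P
            · exact le_rfl
          by_cases hP : Function.Injective P
          · rw [if_neg (not_not.mpr hP)]
            exact sum_nonneg (fun b _ => sum_nonneg (fun b' _ => hnn' b b'))
          · rw [if_pos hP]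
            obtain ⟨b, b', h1, h2⟩ : ∃ b b', P b = P b' ∧ b ≠ b' := by
              unfold Function.Injective at hP
              push Not at hP
              exact hP
            calc _ = (if b ≠ b' ∧ P b = P b' then ∏ i, w (P i) else 0) := by
                  rw [if_pos ⟨h2, h1⟩]
              _ ≤ ∑ b', (if b ≠ b' ∧ P b = P b' then ∏ i, w (P i) else 0) :=
                  single_le_sum (f := fun b' => if b ≠ b' ∧ P b = P b' then
                    ∏ i, w (P i) else 0) (fun b' _ => hnn' b b') (mem_univ b')
              _ ≤ _ := single_le_sum (f := fun b => ∑ b', if b ≠ b' ∧ P b = P b' then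
                    ∏ i, w (P i) else 0)
                    (fun b _ => sum_nonneg (fun b' _ => hnn' b b')) (mem_univ b)
      _ = _ := by
          rw [sum_comm]
          exact sum_congr rfl (fun b _ => sum_comm)
  have hsplit := Finset.sum_filter_add_sum_filter_not (Fintype.piFinset E)
    (fun P => Function.Injective P) (fun P => ∏ i, w (P i))
  rw [← Finset.prod_univ_sum] at hsplit
  have hbound : ∑ b, ∑ b', ∑ P ∈ Fintype.piFinset E with b ≠ b' ∧ P b = P b', ∏ i, w (P i) ≤
      (∑ b, ∑ b', if b ≠ b' ∧ c b = c b' then τ b else 0) * ∏ i, ∑ p ∈ E i, w p := by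
    rw [sum_mul]
    refine sum_le_sum (fun b _ => ?_)
    rw [sum_mul]
    exact sum_le_sum (fun b' _ => hpair b b')
  linarith

theorem le_sum_mul_of_mul_pairCount_le {ι : Type*} (X : Finset ι) (w M W : ι → ℝ) {A Ψ κ V : ℝ}
    (hw : ∀ P ∈ X, 0 ≤ w P) (hM : ∀ P ∈ X, 0 ≤ M P) (hW : ∀ P ∈ X, 0 < W P) {k : ℕ}
    (hMW : ∀ P ∈ X, 4 ^ k ≤ M P * W P) (hA : V ^ k ≤ A) (hV : 0 < V) (hΨ : 0 < Ψ)
    (hκ : 0 ≤ κ) (hD : A * (1 - κ) ≤ ∑ P ∈ X, w P)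
    (hwW : ∑ P ∈ X, w P * W P ≤ A * 2 ^ k * Ψ) :
    (2 * V) ^ k * (1 - 2 * κ) / Ψ ≤ ∑ P ∈ X, w P * M P := by
  have hnn : 0 ≤ ∑ P ∈ X, w P * M P :=
    sum_nonneg (fun P hP => mul_nonneg (hw P hP) (hM P hP))
  have hVk : 0 < V ^ k := by positivity
  have hA0 : 0 < A := lt_of_lt_of_le hVk hA
  by_cases h2κ : 1 - 2 * κ ≤ 0
  · refine le_trans ?_ hnn
    exact div_nonpos_of_nonpos_of_nonneg (mul_nonpos_of_nonneg_of_nonpos (by positivity) h2κ) hΨ.le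
  · push Not at h2κ
    have hcs := Finset.sum_sq_le_sum_mul_sum_of_sq_le_mul X (r := fun P => w P * 2 ^ k)
      (f := fun P => w P * (4 ^ k / W P)) (g := fun P => w P * W P)
      (fun P hP => mul_nonneg (hw P hP) (div_nonneg (by positivity) (hW P hP).le))
      (fun P hP => mul_nonneg (hw P hP) (hW P hP).le)
      (fun P hP => by
        have := (hW P hP).ne'
        have e : (4 : ℝ) ^ k = (2 ^ k) ^ 2 := by rw [← pow_mul, mul_comm, pow_mul]; norm_num
        rw [e]
        refine le_of_eq ?_
        field_simp)
    rw [← sum_mul] at hcs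
    have hf : ∑ P ∈ X, w P * (4 ^ k / W P) ≤ ∑ P ∈ X, w P * M P := by
      refine sum_le_sum (fun P hP => mul_le_mul_of_nonneg_left ?_ (hw P hP))
      rw [div_le_iff₀ (hW P hP)]
      exact hMW P hP
    have h1 : (A * (1 - κ) * 2 ^ k) ^ 2 ≤ (∑ P ∈ X, w P * M P) * (A * 2 ^ k * Ψ) := by
      have h0 : 0 ≤ A * (1 - κ) := mul_nonneg hA0.le (by linarith)
      calc _ ≤ ((∑ P ∈ X, w P) * 2 ^ k) ^ 2 := by gcongr
        _ ≤ _ := hcs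
        _ ≤ _ := mul_le_mul hf hwW
          (sum_nonneg (fun P hP => mul_nonneg (hw P hP) (hW P hP).le)) hnn
    rw [div_le_iff₀ hΨ]
    have h2 : A * (1 - 2 * κ) * 2 ^ k ≤ (∑ P ∈ X, w P * M P) * Ψ := by
      have h3 : 0 < A * 2 ^ k := by positivity
      refine le_of_mul_le_mul_right ?_ h3
      calc A * (1 - 2 * κ) * 2 ^ k * (A * 2 ^ k) = (A * 2 ^ k) ^ 2 * (1 - 2 * κ) := by ring
        _ ≤ (A * 2 ^ k) ^ 2 * (1 - κ) ^ 2 := by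
            gcongr; nlinarith
        _ = (A * (1 - κ) * 2 ^ k) ^ 2 := by ring
        _ ≤ _ := h1
        _ = _ := by ring
    refine le_trans ?_ h2
    rw [mul_pow]
    calc _ = V ^ k * (1 - 2 * κ) * 2 ^ k := by ring
      _ ≤ _ := by gcongr

end weightedTuples

theorem exists_sum_inv_primesIoc_short_le : ∃ C : ℝ, 0 < C ∧ ∀ (N N' η τ : ℝ), 1 < N → 0 < η →
    η ≤ 1 / 100 → 2 * log (1 / η) ≤ log N →
    ∑ p ∈ (primesIoc N N').filter (fun p : ℕ => |log p - τ| ≤ η / 2), (1 : ℝ) / p ≤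
      C * η / log N := by
  obtain ⟨C, hC, hBT⟩ := exists_card_primesIoc_le
  refine ⟨16 * C, by positivity, fun N N' η τ hN hη hη1 hlog => ?_⟩
  have hlogN : 0 < log N := log_pos hN
  obtain hem | ⟨p₁, hp₁⟩ :=
    ((primesIoc N N').filter (fun p : ℕ => |log p - τ| ≤ η / 2)).eq_empty_or_nonempty
  · rw [hem, Finset.sum_empty]
    positivity
  obtain ⟨h1, h1τ⟩ := mem_filter.mp hp₁
  obtain ⟨hp1, hNp, -⟩ := mem_primesIoc.mp h1
  have hp1pos : (0 : ℝ) < p₁ := by exact_mod_cast hp1.pos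
  have hlogp : log N < log p₁ := log_lt_log (by linarith) hNp
  have hηlog : log (1 / η) = -log η := by rw [one_div, log_inv]
  have hηp : log (η * p₁) = log η + log p₁ := log_mul hη.ne' hp1pos.ne'
  have hηp1 : 100 ≤ η * p₁ := by
    have h2 : log (1 / η) ≤ log (η * p₁) := by linarith
    have h3 := (log_le_log_iff (by positivity) (by positivity)).mp h2
    have h4 : 100 ≤ 1 / η := by rw [le_div_iff₀ hη]; linarith
    linarith
  have hsub : (primesIoc N N').filter (fun p : ℕ => |log p - τ| ≤ η / 2) ⊆
      primesIoc (p₁ * (1 - 2 * η)) (p₁ * (1 - 2 * η) + 4 * (η * p₁)) := by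
    intro p hp
    obtain ⟨h2, h2τ⟩ := mem_filter.mp hp
    obtain ⟨hp2, -, -⟩ := mem_primesIoc.mp h2
    have hppos : (0 : ℝ) < p := by exact_mod_cast hp2.pos
    have hup : log p ≤ log p₁ + η := by
      have := (abs_le.mp h2τ).2; have := (abs_le.mp h1τ).1; linarith
    have hlow : log p₁ - η ≤ log p := by
      have := (abs_le.mp h2τ).1; have := (abs_le.mp h1τ).2; linarith
    refine mem_primesIoc.mpr ⟨hp2, ?_, ?_⟩
    · calc (p₁ : ℝ) * (1 - 2 * η) < p₁ * exp (-η) := by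
            gcongr; linarith [add_one_le_exp (-η)]
        _ = exp (log p₁ - η) := by
            rw [sub_eq_add_neg, exp_add, exp_log hp1pos]
        _ ≤ exp (log p) := exp_le_exp.mpr hlow
        _ = p := exp_log hppos
    · have hexp : exp η ≤ 1 + 2 * η := by
        have := exp_bound_div_one_sub_of_interval hη.le (by linarith : η < 1)
        refine this.trans ?_
        rw [div_le_iff₀ (by linarith)]
        nlinarith
      calc (p : ℝ) = exp (log p) := (exp_log hppos).symm
        _ ≤ exp (log p₁ + η) := exp_le_exp.mpr hup
        _ = p₁ * exp η := by rw [exp_add, exp_log hp1pos]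
        _ ≤ p₁ * (1 + 2 * η) := by gcongr
        _ = _ := by ring
  have hcard := (Nat.cast_le (α := ℝ).mpr (card_le_card hsub)).trans
    (hBT (p₁ * (1 - 2 * η)) (4 * (η * p₁)) (mul_nonneg hp1pos.le (by linarith)) (by linarith))
  have hlogh : log N / 2 ≤ log (4 * (η * p₁)) := by
    have : log (η * p₁) ≤ log (4 * (η * p₁)) :=
      log_le_log (by positivity) (by linarith)
    linarith
  calc _ ≤ ∑ p ∈ (primesIoc N N').filter (fun p : ℕ => |log p - τ| ≤ η / 2), 2 / (p₁ : ℝ) := by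
        refine sum_le_sum (fun p hp => ?_)
        obtain ⟨hp2, h3, -⟩ := mem_primesIoc.mp (hsub hp)
        have hppos : (0 : ℝ) < p := by exact_mod_cast hp2.pos
        rw [div_le_div_iff₀ hppos hp1pos]
        nlinarith
    _ = _ * (2 / (p₁ : ℝ)) := by rw [sum_const, nsmul_eq_mul]
    _ ≤ (C * (4 * (η * p₁)) / (log N / 2)) * (2 / (p₁ : ℝ)) := by
        gcongr
        refine hcard.trans ?_
        gcongr
    _ = 16 * C * η / log N := by field_simp; ring

open Polynomial

/-- tuples of distinct primes, the `b`-th taken from the block of level `e (c b)` -/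
noncomputable def blockTuples {k J : ℕ} (N e : ℕ → ℕ) (c : Fin k → Fin J) : Finset (Fin k → ℕ) :=
  (Fintype.piFinset fun b => primesIoc (N (e (c b))) (N (e (c b) + 1))).filter
    (fun P => Function.Injective P)

theorem mem_blockTuples {k J : ℕ} {N e : ℕ → ℕ} {c : Fin k → Fin J} {P : Fin k → ℕ} :
    P ∈ blockTuples N e c ↔
      (∀ b, P b ∈ primesIoc (N (e (c b))) (N (e (c b) + 1))) ∧ Function.Injective P := by
  unfold blockTuples
  rw [mem_filter, Fintype.mem_piFinset]

/-- the number of cells met by the subproducts of a tuple -/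
noncomputable def tupleCells {k : ℕ} (η y : ℝ) (P : Fin k → ℕ) : ℕ :=
  (univ.image (fun S : Finset (Fin k) => cellIndex η y (∏ i ∈ S, P i))).card

theorem abs_log_sub_log_le_of_cellIndex_eq {η y : ℝ} (hη : 0 < η) (hy : 0 < y) {d d' : ℕ}
    (hd : 0 < d) (hd' : 0 < d') (h : cellIndex η y d = cellIndex η y d') :
    |log d - log d'| ≤ η / 2 := by
  have hdr : (d : ℝ) ≠ 0 := by exact_mod_cast hd.ne'
  have hdr' : (d' : ℝ) ≠ 0 := by exact_mod_cast hd'.ne'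
  unfold cellIndex at h
  have h1 := Int.ceil_lt_add_one (2 * log (y / d) / η)
  have h2 := Int.le_ceil (2 * log (y / d) / η)
  have h3 := Int.ceil_lt_add_one (2 * log (y / d') / η)
  have h4 := Int.le_ceil (2 * log (y / d') / η)
  rw [h] at h1 h2
  set m := ⌈2 * log (y / d') / η⌉
  rw [log_div hy.ne' hdr] at h1 h2
  rw [log_div hy.ne' hdr'] at h3 h4
  have h5 : 2 * (log y - log d) / η < 2 * (log y - log d') / η + 1 := by linarith
  have h6 : 2 * (log y - log d') / η < 2 * (log y - log d) / η + 1 := by linarith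
  rw [div_add_one hη.ne', div_lt_div_iff_of_pos_right hη] at h5 h6
  rw [abs_le]
  constructor <;> linarith

theorem eq_of_abs_log_sub_log_le {η : ℝ} (hη : 0 < η) {u v : ℕ} (hu : 0 < u) (hv : 0 < v)
    (hul : log u ≤ log (1 / (2 * η))) (hvl : log v ≤ log (1 / (2 * η)))
    (h : |log u - log v| ≤ η / 2) : u = v := by
  wlog huv : u < v generalizing u v
  · rcases lt_or_eq_of_le (not_lt.mp huv) with h1 | h1
    · exact (this hv hu hvl hul (by rwa [abs_sub_comm]) h1).symm
    · exact h1.symm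
  exfalso
  have hur : (0 : ℝ) < u := by exact_mod_cast hu
  have hvr : (0 : ℝ) < v := by exact_mod_cast hv
  have h1 : (v : ℝ) ≤ 1 / (2 * η) := (log_le_log_iff hvr (by positivity)).mp hvl
  have h2 : log (u / v) ≤ u / v - 1 := log_le_sub_one_of_pos (by positivity)
  rw [log_div hur.ne' hvr.ne'] at h2
  have h3 : (u : ℝ) + 1 ≤ v := by exact_mod_cast huv
  have h4 : (u : ℝ) / v - 1 ≤ -(2 * η) := by
    rw [le_div_iff₀ (by positivity)] at h1
    rw [div_sub_one hvr.ne', div_le_iff₀ hvr]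
    nlinarith
  have := (abs_le.mp h).1
  linarith

theorem prod_ne_prod_of_disjoint {k : ℕ} {P : Fin k → ℕ} (hP : ∀ b, (P b).Prime)
    (hinj : Function.Injective P) {S T : Finset (Fin k)} (hST : Disjoint S T) (hne : S ≠ T) :
    ∏ i ∈ S, P i ≠ ∏ i ∈ T, P i := by
  have key : ∀ S T : Finset (Fin k), Disjoint S T → ∏ i ∈ S, P i = ∏ i ∈ T, P i → S = ∅ := by
    intro S T hd h
    by_contra hS
    obtain ⟨b, hb⟩ := Finset.nonempty_iff_ne_empty.mpr hS
    have h1 : P b ∣ ∏ i ∈ T, P i := h ▸ Finset.dvd_prod_of_mem P hb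
    obtain ⟨b', hb', h2⟩ := (hP b).prime.exists_mem_finset_dvd h1
    have h3 := hinj ((Nat.prime_dvd_prime_iff_eq (hP b) (hP b')).mp h2)
    subst h3
    exact Finset.disjoint_left.mp hd hb hb'
  intro h
  exact hne ((key S T hST h).trans (key T S hST.symm h.symm).symm)

theorem log_prod_natCast {k : ℕ} {P : Fin k → ℕ} (hP : ∀ b, 0 < P b) (S : Finset (Fin k)) :
    log ((∏ i ∈ S, P i : ℕ) : ℝ) = ∑ i ∈ S, log (P i) := by
  rw [Nat.cast_prod, log_prod]
  intro i _
  exact_mod_cast (hP i).ne'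

theorem sum_log_update_sub {k : ℕ} (P : Fin k → ℕ) {S T : Finset (Fin k)} {b : Fin k}
    (hb : b ∈ S) (hb' : b ∉ T) (p : ℕ) :
    ∑ i ∈ S, log (Function.update P b p i) - ∑ i ∈ T, log (Function.update P b p i) =
      log p - (∑ i ∈ T, log (P i) - ∑ i ∈ S.erase b, log (P i)) := by
  rw [← Finset.add_sum_erase _ _ hb, Function.update_self]
  have h1 : ∑ i ∈ S.erase b, log (Function.update P b p i) = ∑ i ∈ S.erase b, log (P i) :=
    sum_congr rfl (fun i hi => by rw [Function.update_of_ne (Finset.ne_of_mem_erase hi)])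
  have h2 : ∑ i ∈ T, log (Function.update P b p i) = ∑ i ∈ T, log (P i) :=
    sum_congr rfl (fun i hi => by
      rw [Function.update_of_ne (fun h : i = b => hb' (h ▸ hi))])
  rw [h1, h2]
  ring

theorem exists_sum_log_update_sub {k : ℕ} (P : Fin k → ℕ) {S S' : Finset (Fin k)} {b : Fin k}
    (hb : b ∈ symmDiff S S') : ∃ τ : ℝ, ∀ p : ℕ,
    |∑ i ∈ S, log (Function.update P b p i) - ∑ i ∈ S', log (Function.update P b p i)| =
      |log p - τ| := by
  rcases Finset.mem_symmDiff.mp hb with ⟨h1, h2⟩ | ⟨h1, h2⟩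
  · exact ⟨_, fun p => by rw [sum_log_update_sub P h1 h2 p]⟩
  · exact ⟨_, fun p => by rw [abs_sub_comm, sum_log_update_sub P h1 h2 p]⟩

theorem sum_blockTuples_same_cell_small {k J : ℕ} {N e : ℕ → ℕ} {c : Fin k → Fin J} {i₀ : ℕ}
    {η y : ℝ} (hη : 0 < η) (hy : 0 < y)
    (hsmall : ∑ b with (c b : ℕ) < i₀, log (N (e (c b) + 1)) ≤ log (1 / (2 * η)))
    {S S' : Finset (Fin k)} (hS : S ≠ S') (hlt : ∀ b ∈ symmDiff S S', (c b : ℕ) < i₀)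
    {P : Fin k → ℕ} (hP : P ∈ blockTuples N e c) :
    cellIndex η y (∏ i ∈ S, P i) ≠ cellIndex η y (∏ i ∈ S', P i) := by
  intro hcell
  obtain ⟨hPm, hinj⟩ := mem_blockTuples.mp hP
  have hPp : ∀ b, (P b).Prime := fun b => (mem_primesIoc.mp (hPm b)).1
  have hpos : ∀ T : Finset (Fin k), 0 < ∏ i ∈ T, P i :=
    fun T => prod_pos (fun i _ => (hPp i).pos)
  have hlog0 : ∀ b, 0 ≤ log (P b) := fun b =>
    log_natCast_nonneg _
  have hle := abs_log_sub_log_le_of_cellIndex_eq hη hy (hpos S) (hpos S') hcell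
  have hbound : ∀ T : Finset (Fin k), (∀ b ∈ T, (c b : ℕ) < i₀) →
      log ((∏ i ∈ T, P i : ℕ) : ℝ) ≤ log (1 / (2 * η)) := by
    intro T hT
    refine le_trans ?_ hsmall
    rw [log_prod_natCast (fun b => (hPp b).pos)]
    calc _ ≤ ∑ b with (c b : ℕ) < i₀, log (P b) :=
          sum_le_sum_of_subset_of_nonneg
            (fun b hb => mem_filter.mpr ⟨mem_univ _, hT b hb⟩) (fun b _ _ => hlog0 b)
      _ ≤ _ := sum_le_sum (fun b _ => by
          obtain ⟨h1, -, h2⟩ := mem_primesIoc.mp (hPm b)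
          exact log_le_log (by exact_mod_cast h1.pos) h2)
  have hsd : ∀ A B : Finset (Fin k), log ((∏ i ∈ A, P i : ℕ) : ℝ) =
      log ((∏ i ∈ A \ B, P i : ℕ) : ℝ) + ∑ i ∈ A ∩ B, log (P i) := by
    intro A B
    rw [log_prod_natCast (fun b => (hPp b).pos), log_prod_natCast (fun b => (hPp b).pos), add_comm]
    exact (Finset.sum_inter_add_sum_sdiff A B _).symm
  rw [hsd S S', hsd S' S, Finset.inter_comm S' S, add_sub_add_right_eq_sub] at hle
  refine prod_ne_prod_of_disjoint hPp hinj (disjoint_sdiff_sdiff (x := S) (y := S')) ?_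
    (eq_of_abs_log_sub_log_le hη (hpos _) (hpos _) (hbound _ fun b hb => ?_)
      (hbound _ fun b hb => ?_) hle)
  · intro h
    exact hS (by
      ext b
      have := congrArg (fun A : Finset (Fin k) => b ∈ A) h
      simp only [Finset.mem_sdiff, eq_iff_iff] at this
      tauto)
  · exact hlt b (Finset.mem_symmDiff.mpr (Or.inl (Finset.mem_sdiff.mp hb)))
  · exact hlt b (Finset.mem_symmDiff.mpr (Or.inr (Finset.mem_sdiff.mp hb)))

theorem sum_blockTuples_same_cell_le {F : ℤ[X]} (hdeg : F.natDegree ≠ 0) :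
    ∃ C : ℝ, 0 < C ∧ ∀ {k J : ℕ} (N e : ℕ → ℕ) (c : Fin k → Fin J) (η y : ℝ),
      0 < η → η ≤ 1 / 100 → 0 < y →
      (∀ b, F.leadingCoeff.natAbs ≤ N (e (c b)) ∧ 1 < N (e (c b)) ∧
        log 2 ≤ ∑ p ∈ primesIoc (N (e (c b))) (N (e (c b) + 1)), (rootCount F p : ℝ) / p) →
      ∀ {S S' : Finset (Fin k)} {b : Fin k}, b ∈ symmDiff S S' →
      2 * log (1 / η) ≤ log (N (e (c b))) →
      ∑ P ∈ (blockTuples N e c).filter (fun P : Fin k → ℕ => cellIndex η y (∏ i ∈ S, P i) =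
          cellIndex η y (∏ i ∈ S', P i)), ∏ i, (rootCount F (P i) : ℝ) / P i ≤
        C * η / log (N (e (c b))) * ∏ i, ∑ p ∈ primesIoc (N (e (c i))) (N (e (c i) + 1)),
          (rootCount F p : ℝ) / p := by
  obtain ⟨C, hC, hshort⟩ := exists_sum_inv_primesIoc_short_le
  have hl2 : 0 < log 2 := log_pos (by norm_num)
  have hg : (0 : ℝ) < F.natDegree := by exact_mod_cast Nat.pos_of_ne_zero hdeg
  refine ⟨F.natDegree * C / log 2, by positivity,
    fun {k J} N e c η y hη hη1 hy hb {S S' b} hbm hbig => ?_⟩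
  obtain ⟨hlc, hN1, hσ⟩ := hb b
  have hw0 : ∀ p : ℕ, 0 ≤ (rootCount F p : ℝ) / p := fun p => by positivity
  set Q : (Fin k → ℕ) → Prop := fun P =>
    |∑ i ∈ S, log (P i) - ∑ i ∈ S', log (P i)| ≤ η / 2 with hQ
  have hlogN : 0 < log (N (e (c b))) := log_pos (by exact_mod_cast hN1)
  have hswap := sum_piFinset_filter_le
    (fun i => primesIoc (N (e (c i))) (N (e (c i) + 1))) (fun p => (rootCount F p : ℝ) / p) hw0 b Q
    (F.natDegree * C / log 2 * η / log (N (e (c b)))) (lt_of_lt_of_le hl2 hσ)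
    (fun P _ => by
      obtain ⟨τ, hτ⟩ := exists_sum_log_update_sub P hbm
      have hle : ∀ p ∈ primesIoc (N (e (c b))) (N (e (c b) + 1)),
          (rootCount F p : ℝ) / p ≤ F.natDegree * (1 / p) := by
        intro p hp
        obtain ⟨hp1, hp2, -⟩ := mem_primesIoc.mp hp
        rw [mul_one_div]
        gcongr
        refine rootCount_le_natDegree hdeg hp1 (fun hdvd => ?_)
        have h1 := Nat.le_of_dvd (Int.natAbs_pos.mpr (Polynomial.leadingCoeff_ne_zero.mpr
          (fun h => hdeg (by rw [h, Polynomial.natDegree_zero])))) (Int.natCast_dvd.mp hdvd)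
        have h2 : N (e (c b)) < p := by exact_mod_cast hp2
        omega
      calc _ ≤ ∑ p ∈ (primesIoc (N (e (c b))) (N (e (c b) + 1))).filter
            (fun p : ℕ => |log p - τ| ≤ η / 2), (rootCount F p : ℝ) / p := by
            refine sum_le_sum_of_subset_of_nonneg (fun p hp => ?_) (fun p _ _ => hw0 p)
            obtain ⟨h1, h2⟩ := mem_filter.mp hp
            refine mem_filter.mpr ⟨h1, ?_⟩
            rw [← hτ p]
            exact h2
        _ ≤ ∑ p ∈ (primesIoc (N (e (c b))) (N (e (c b) + 1))).filter
            (fun p : ℕ => |log p - τ| ≤ η / 2), F.natDegree * (1 / (p : ℝ)) :=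
            sum_le_sum (fun p hp => hle p (mem_filter.mp hp).1)
        _ ≤ F.natDegree * (C * η / log (N (e (c b)))) := by
            rw [← mul_sum]
            exact mul_le_mul_of_nonneg_left
              (hshort _ _ η τ (by exact_mod_cast hN1) hη hη1 hbig) hg.le
        _ = F.natDegree * C / log 2 * η / log (N (e (c b))) * log 2 := by
            field_simp
        _ ≤ _ := by gcongr)
  refine le_trans (sum_le_sum_of_subset_of_nonneg (fun P hP => ?_)
    (fun P _ _ => prod_nonneg (fun i _ => hw0 _))) hswap
  obtain ⟨h1, h2⟩ := mem_filter.mp hP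
  obtain ⟨h3, -⟩ := mem_blockTuples.mp h1
  have hPp : ∀ b, (P b).Prime := fun b => (mem_primesIoc.mp (h3 b)).1
  have hpos : ∀ T : Finset (Fin k), 0 < ∏ i ∈ T, P i :=
    fun T => prod_pos (fun i _ => (hPp i).pos)
  refine mem_filter.mpr ⟨Fintype.mem_piFinset.mpr h3, ?_⟩
  have h4 := abs_log_sub_log_le_of_cellIndex_eq hη hy (hpos S) (hpos S') h2
  rwa [log_prod_natCast (fun b => (hPp b).pos), log_prod_natCast (fun b => (hPp b).pos)] at h4

set_option maxHeartbeats 1000000 in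
theorem exists_sum_blockTuples_tupleCells_ge {F : ℤ[X]} (hdeg : F.natDegree ≠ 0) {C₁ : ℝ}
    (hC₁ : 1 ≤ C₁) :
    ∃ C : ℝ, 1 ≤ C ∧ ∀ {k J : ℕ} (N e : ℕ → ℕ) (c : Fin k → Fin J) (η y : ℝ) (i₀ : ℕ),
      0 < η → η ≤ 1 / 100 → 0 < y → Monotone N → StrictMono e →
      (∀ j, F.leadingCoeff.natAbs ≤ N (e j) ∧ 1 < N (e j) ∧ 2 ^ e j / C₁ ≤ log (N (e j)) ∧
        log 2 ≤ ∑ p ∈ primesIoc (N (e j)) (N (e j + 1)), (rootCount F p : ℝ) / p) →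
      (∀ j, i₀ ≤ j → 2 * log (1 / η) ≤ log (N (e j))) →
      ∑ b with (c b : ℕ) < i₀, log (N (e (c b) + 1)) ≤ log (1 / (2 * η)) →
      η ≤ 2 ^ J / 2 ^ k →
      (2 * log 2) ^ k *
          (1 - 2 * ∑ b, ∑ b', if b ≠ b' ∧ c b = c b' then C / 2 ^ e (c b) else 0) /
          (C * boxWeight c) ≤
        ∑ P ∈ blockTuples N e c, (∏ i, (rootCount F (P i) : ℝ) / P i) * tupleCells η y P := by
  obtain ⟨C₂, hC₂, hlarge⟩ := sum_blockTuples_same_cell_le hdeg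
  have hl2 : 0 < log 2 := log_pos (by norm_num)
  have hg : (0 : ℝ) < F.natDegree := by exact_mod_cast Nat.pos_of_ne_zero hdeg
  have hC₁0 : 0 < C₁ := by linarith
  refine ⟨1 + C₂ * C₁ + F.natDegree * C₁ / log 2,
    by have : 0 ≤ C₂ * C₁ + F.natDegree * C₁ / log 2 := by positivity
       linarith, ?_⟩
  set C := 1 + C₂ * C₁ + F.natDegree * C₁ / log 2 with hC
  have hC1 : 1 ≤ C := by
    have : 0 ≤ C₂ * C₁ + F.natDegree * C₁ / log 2 := by positivity
    linarith
  have hC2 : C₂ * C₁ ≤ C := by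
    have : 0 ≤ F.natDegree * C₁ / log 2 := by positivity
    linarith
  have hC3 : F.natDegree * C₁ / log 2 ≤ C := by
    have : 0 ≤ C₂ * C₁ := by positivity
    linarith
  intro k J N e c η y i₀ hη hη1 hy hNmono he hblk hbig hsmall hkJ
  set E : Fin k → Finset ℕ := fun b => primesIoc (N (e (c b))) (N (e (c b) + 1)) with hE
  set w : ℕ → ℝ := fun p => (rootCount F p : ℝ) / p with hw
  have hw0 : ∀ p : ℕ, 0 ≤ w p := fun p => by simp only [hw]; positivity
  have hσ : ∀ b, log 2 ≤ ∑ p ∈ E b, w p := fun b => (hblk (c b)).2.2.2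
  have hlogN : ∀ j, 0 < log (N (e j)) := fun j =>
    log_pos (by exact_mod_cast (hblk j).2.1)
  have hprod0 : ∀ P : Fin k → ℕ, 0 ≤ ∏ i, w (P i) := fun P =>
    prod_nonneg (fun i _ => hw0 _)
  have hA0 : 0 ≤ ∏ i, ∑ p ∈ E i, w p := prod_nonneg (fun i _ => hl2.le.trans (hσ i))
  have hA : ∑ P ∈ blockTuples N e c, ∏ i, w (P i) ≤ ∏ i, ∑ p ∈ E i, w p := by
    rw [Finset.prod_univ_sum]
    exact sum_le_sum_of_subset_of_nonneg (filter_subset _ _) (fun P _ _ => hprod0 P)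
  have hpairs := sum_weight_mul_pairCount_le c (blockTuples N e c) (fun P => ∏ i, w (P i))
    (fun P S => cellIndex η y (∏ i ∈ S, P i)) (fun j => C₂ * η / log (N (e j)))
    (fun j => by have := hlogN j; positivity) _ hA0 hA (fun S S' hS => by
      have hne : (symmDiff S S').Nonempty := by
        rw [Finset.nonempty_iff_ne_empty]
        intro h
        exact hS (symmDiff_eq_bot.mp h)
      obtain ⟨b, hb, hmax⟩ := Finset.exists_max_image (symmDiff S S') c hne
      refine ⟨b, hmax, ?_⟩
      by_cases hbi : i₀ ≤ (c b : ℕ)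
      · exact hlarge N e c η y hη hη1 hy
          (fun b => ⟨(hblk (c b)).1, (hblk (c b)).2.1, (hblk (c b)).2.2.2⟩) hb (hbig _ hbi)
      · rw [Finset.filter_false_of_mem, Finset.sum_empty]
        · have := hlogN (c b)
          positivity
        · intro P hP
          refine sum_blockTuples_same_cell_small hη hy hsmall hS (fun b' hb' => ?_) hP
          have : (c b' : ℕ) ≤ c b := hmax b' hb'
          omega)
  have hweight : 1 + ∑ j ∈ range J, C₂ * η / log (N (e j)) * 2 ^ boxCount c (j + 1) ≤
      C * boxWeight c := by
    unfold boxWeight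
    rw [mul_add, mul_one, mul_sum]
    refine add_le_add hC1 (sum_le_sum (fun j _ => ?_))
    have h1 : (2 : ℝ) ^ j / C₁ ≤ log (N (e j)) := by
      refine le_trans ?_ (hblk j).2.2.1
      gcongr
      · norm_num
      · exact he.id_le j
    calc C₂ * η / log (N (e j)) * 2 ^ boxCount c (j + 1) ≤
          C₂ * (2 ^ J / 2 ^ k) / (2 ^ j / C₁) * 2 ^ boxCount c (j + 1) := by gcongr
      _ = C₂ * C₁ * (2 ^ boxCount c (j + 1) * 2 ^ J / (2 ^ k * 2 ^ j)) := by field_simp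
      _ ≤ _ := by gcongr
  have hbw : 0 < boxWeight c := lt_of_lt_of_le one_pos (one_le_boxWeight c)
  have hτ : ∀ b, ∀ p ∈ E b, w p ≤ C / 2 ^ e (c b) * ∑ p ∈ E b, w p := by
    intro b p hp
    obtain ⟨hp1, hp2, -⟩ := mem_primesIoc.mp hp
    obtain ⟨h1, h2, h3, h4⟩ := hblk (c b)
    have hppos : (0 : ℝ) < p := by exact_mod_cast hp1.pos
    have hρ : rootCount F p ≤ F.natDegree := by
      refine rootCount_le_natDegree hdeg hp1 (fun hdvd => ?_)
      have h1' := Nat.le_of_dvd (Int.natAbs_pos.mpr (Polynomial.leadingCoeff_ne_zero.mpr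
        (fun h => hdeg (by rw [h, Polynomial.natDegree_zero])))) (Int.natCast_dvd.mp hdvd)
      have h2' : N (e (c b)) < p := by exact_mod_cast hp2
      omega
    have hpl : (2 : ℝ) ^ e (c b) / C₁ ≤ p :=
      h3.trans ((log_le_self (Nat.cast_nonneg _)).trans hp2.le)
    calc w p ≤ F.natDegree / (2 ^ e (c b) / C₁) := by
          simp only [hw]
          gcongr
      _ = F.natDegree * C₁ / log 2 / 2 ^ e (c b) * log 2 := by field_simp
      _ ≤ _ := by
          have := hσ b
          gcongr
  have hinj := prod_sum_mul_le_sum_injective c E w hw0 (fun b => C / 2 ^ e (c b))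
    (fun b => lt_of_lt_of_le hl2 (hσ b)) hτ (fun b b' hbb => by
      have key : ∀ b b', (c b : ℕ) < c b' → Disjoint (E b) (E b') := by
        intro b b' h
        refine Finset.disjoint_left.mpr (fun p hp hp' => ?_)
        have h1 := (mem_primesIoc.mp hp).2.2
        have h2 := (mem_primesIoc.mp hp').2.1
        have h3 : N (e (c b) + 1) ≤ N (e (c b')) := hNmono (he h)
        have h4 : (N (e (c b) + 1) : ℝ) ≤ N (e (c b')) := by exact_mod_cast h3
        linarith
      rcases lt_or_gt_of_ne hbb with h | h
      · exact key b b' h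
      · exact (key b' b h).symm)
  have hMW : ∀ P ∈ blockTuples N e c, (4 : ℝ) ^ k ≤ (tupleCells η y P : ℝ) *
      pairCount (fun S => cellIndex η y (∏ i ∈ S, P i)) := fun P _ =>
    four_pow_le_card_image_mul_pairCount _
  refine le_sum_mul_of_mul_pairCount_le (blockTuples N e c) (fun P => ∏ i, w (P i))
    (fun P => (tupleCells η y P : ℝ))
    (fun P => (pairCount (fun S => cellIndex η y (∏ i ∈ S, P i)) : ℝ))
    (A := ∏ i, ∑ p ∈ E i, w p) (V := log 2) (fun P _ => hprod0 P) (fun P _ => Nat.cast_nonneg _)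
    (fun P hP => ?_) hMW ?_ hl2 (by positivity) ?_ hinj ?_
  · have h1 : 0 < pairCount (fun S => cellIndex η y (∏ i ∈ S, P i)) :=
      card_pos.mpr ⟨(∅, ∅), mem_filter.mpr ⟨mem_univ _, rfl⟩⟩
    exact_mod_cast h1
  · calc log 2 ^ k = ∏ _i : Fin k, log 2 := by
          rw [prod_const, card_univ, Fintype.card_fin]
      _ ≤ _ := prod_le_prod (fun _ _ => hl2.le) (fun i _ => hσ i)
  · refine sum_nonneg (fun b _ => sum_nonneg (fun b' _ => ?_))
    split_ifs
    · positivity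
    · exact le_rfl
  · refine hpairs.trans ?_
    gcongr

section allocations

variable {k J : ℕ}

theorem inv_boxWeight_nonneg (c : Fin k → Fin J) : 0 ≤ 1 / boxWeight c :=
  div_nonneg zero_le_one (zero_le_one.trans (one_le_boxWeight c))

theorem sum_level_div_boxWeight_le (hJ : 0 < J) (hk : k ≤ 2 * J) (h : ℕ → ℝ) (h0 : ∀ j, 0 ≤ h j) :
    ∑ c : Fin k → Fin J, (∑ b, h (c b)) * (1 / boxWeight c) ≤
      4 * (∑ j : Fin J, h j) * ∑ c : Fin k → Fin J, 1 / boxWeight c := by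
  set Z := ∑ c : Fin k → Fin J, 1 / boxWeight c with hZ
  have hZ0 : 0 ≤ Z := sum_nonneg (fun c _ => inv_boxWeight_nonneg c)
  have hJr : (0 : ℝ) < J := by exact_mod_cast hJ
  have hkr : (k : ℝ) ≤ 2 * J := by exact_mod_cast hk
  have h1 : ∀ b : Fin k, ∑ c : Fin k → Fin J, h (c b) * (1 / boxWeight c) ≤
      (∑ j : Fin J, h j) * (2 * Z / J) := by
    intro b
    rw [← Finset.sum_fiberwise univ (fun c : Fin k → Fin J => c b), sum_mul]
    refine sum_le_sum (fun j _ => ?_)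
    have h2 : ∑ c : Fin k → Fin J with c b = j, h (c b) * (1 / boxWeight c) =
        h j * ∑ c : Fin k → Fin J with c b = j, 1 / boxWeight c := by
      rw [mul_sum]
      exact sum_congr rfl (fun c hc => by rw [(mem_filter.mp hc).2])
    rw [h2]
    refine mul_le_mul_of_nonneg_left ?_ (h0 _)
    rw [le_div_iff₀ hJr, mul_comm]
    exact sum_inv_boxWeight_fiber b j
  simp_rw [sum_mul]
  rw [sum_comm]
  have hs0 : 0 ≤ ∑ j : Fin J, h j := sum_nonneg (fun j _ => h0 _)
  calc _ ≤ ∑ _b : Fin k, (∑ j : Fin J, h j) * (2 * Z / J) := sum_le_sum (fun b _ => h1 b)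
    _ = k * ((∑ j : Fin J, h j) * (2 * Z / J)) := by
        rw [sum_const, card_univ, Fintype.card_fin, nsmul_eq_mul]
    _ ≤ (2 * J) * ((∑ j : Fin J, h j) * (2 * Z / J)) := by gcongr
    _ = _ := by field_simp; ring

theorem sum_inv_boxWeight_level_gt_le (hJ : 0 < J) (hk : k ≤ 2 * J) (h : ℕ → ℝ)
    (h0 : ∀ j, 0 ≤ h j) {L ε : ℝ} (hL : 0 < L) (hε : 4 * ∑ j : Fin J, h j ≤ ε * L) :
    ∑ c : Fin k → Fin J with L < ∑ b, h (c b), 1 / boxWeight c ≤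
      ε * ∑ c : Fin k → Fin J, 1 / boxWeight c := by
  have h1 := sum_level_div_boxWeight_le hJ hk h h0
  have hZ0 : 0 ≤ ∑ c : Fin k → Fin J, 1 / boxWeight c :=
    sum_nonneg (fun c _ => inv_boxWeight_nonneg c)
  refine le_of_mul_le_mul_left ?_ hL
  calc L * ∑ c : Fin k → Fin J with L < ∑ b, h (c b), 1 / boxWeight c ≤
        ∑ c : Fin k → Fin J with L < ∑ b, h (c b), (∑ b, h (c b)) * (1 / boxWeight c) := by
        rw [mul_sum]
        exact sum_le_sum (fun c hc => mul_le_mul_of_nonneg_right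
          (mem_filter.mp hc).2.le (inv_boxWeight_nonneg c))
    _ ≤ ∑ c : Fin k → Fin J, (∑ b, h (c b)) * (1 / boxWeight c) :=
        sum_le_sum_of_subset_of_nonneg (filter_subset _ _) (fun c _ _ =>
          mul_nonneg (sum_nonneg (fun b _ => h0 _)) (inv_boxWeight_nonneg c))
    _ ≤ _ := h1
    _ ≤ ε * L * ∑ c : Fin k → Fin J, 1 / boxWeight c := by gcongr
    _ = _ := by ring

theorem sum_pair_div_boxWeight_le (hJ : 0 < J) (hk : k ≤ 2 * J) (h : ℕ → ℝ) (h0 : ∀ j, 0 ≤ h j) :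
    ∑ c : Fin k → Fin J, (∑ b, ∑ b', if b ≠ b' ∧ c b = c b' then h (c b) else 0) *
        (1 / boxWeight c) ≤
      16 * (∑ j : Fin J, h j) * ∑ c : Fin k → Fin J, 1 / boxWeight c := by
  set Z := ∑ c : Fin k → Fin J, 1 / boxWeight c with hZ
  have hZ0 : 0 ≤ Z := sum_nonneg (fun c _ => inv_boxWeight_nonneg c)
  have hJr : (0 : ℝ) < J := by exact_mod_cast hJ
  have hkr : (k : ℝ) ≤ 2 * J := by exact_mod_cast hk
  have hs0 : 0 ≤ ∑ j : Fin J, h j := sum_nonneg (fun j _ => h0 _)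
  have h1 : ∀ b b' : Fin k, ∑ c : Fin k → Fin J,
      (if b ≠ b' ∧ c b = c b' then h (c b) else 0) * (1 / boxWeight c) ≤
      (∑ j : Fin J, h j) * (4 * Z / J ^ 2) := by
    intro b b'
    by_cases hb : b = b'
    · rw [sum_eq_zero]
      · positivity
      · intro c _
        rw [if_neg (fun h => h.1 hb), zero_mul]
    · rw [← Finset.sum_fiberwise univ (fun c : Fin k → Fin J => c b), sum_mul]
      refine sum_le_sum (fun j _ => ?_)
      have h2 : ∑ c : Fin k → Fin J with c b = j,
          (if b ≠ b' ∧ c b = c b' then h (c b) else 0) * (1 / boxWeight c) =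
          h j * ∑ c : Fin k → Fin J with c b = j ∧ c b' = j, 1 / boxWeight c := by
        rw [mul_sum, sum_filter, sum_filter]
        refine sum_congr rfl (fun c _ => ?_)
        by_cases h3 : c b = j
        · by_cases h4 : c b' = j
          · rw [if_pos h3, if_pos ⟨hb, h3.trans h4.symm⟩, if_pos ⟨h3, h4⟩, h3]
          · rw [if_pos h3, if_neg (fun h => h4 (h.2.symm.trans h3)), if_neg (fun h => h4 h.2),
              zero_mul]
        · rw [if_neg h3, if_neg (fun h => h3 h.1)]
      rw [h2]
      refine mul_le_mul_of_nonneg_left ?_ (h0 _)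
      rw [le_div_iff₀ (by positivity), mul_comm]
      exact sum_inv_boxWeight_pair b b' hb j
  simp_rw [sum_mul]
  rw [sum_comm]
  calc _ = ∑ b : Fin k, ∑ b' : Fin k, ∑ c : Fin k → Fin J,
        (if b ≠ b' ∧ c b = c b' then h (c b) else 0) * (1 / boxWeight c) :=
        sum_congr rfl (fun b _ => sum_comm)
    _ ≤ ∑ _b : Fin k, ∑ _b' : Fin k, (∑ j : Fin J, h j) * (4 * Z / J ^ 2) :=
        sum_le_sum (fun b _ => sum_le_sum (fun b' _ => h1 b b'))
    _ = k * (k * ((∑ j : Fin J, h j) * (4 * Z / J ^ 2))) := by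
        simp only [sum_const, card_univ, Fintype.card_fin, nsmul_eq_mul]
    _ ≤ (2 * J) * ((2 * J) * ((∑ j : Fin J, h j) * (4 * Z / J ^ 2))) := by gcongr
    _ = _ := by field_simp; ring

theorem half_sum_inv_boxWeight_le (hJ : 0 < J) (hk : k ≤ 2 * J) (h₁ h₂ h₃ : ℕ → ℝ)
    (h₁0 : ∀ j, 0 ≤ h₁ j) (h₂0 : ∀ j, 0 ≤ h₂ j) (h₃0 : ∀ j, 0 ≤ h₃ j) {L₁ L₂ : ℝ} (hL₁ : 0 < L₁)
    (hL₂ : 0 < L₂) (hb₁ : 32 * ∑ j : Fin J, h₁ j ≤ L₁) (hb₂ : 32 * ∑ j : Fin J, h₂ j ≤ L₂)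
    (hb₃ : 128 * ∑ j : Fin J, h₃ j ≤ 1) :
    (∑ c : Fin k → Fin J, 1 / boxWeight c) / 2 ≤
      ∑ c : Fin k → Fin J with ∑ b, h₁ (c b) ≤ L₁ ∧ ∑ b, h₂ (c b) ≤ L₂,
        (1 - 2 * ∑ b, ∑ b', if b ≠ b' ∧ c b = c b' then h₃ (c b) else 0) * (1 / boxWeight c) := by
  have e1 := sum_inv_boxWeight_level_gt_le hJ hk h₁ h₁0 (ε := 1 / 8) hL₁ (by linarith)
  have e2 := sum_inv_boxWeight_level_gt_le hJ hk h₂ h₂0 (ε := 1 / 8) hL₂ (by linarith)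
  have e3 := sum_pair_div_boxWeight_le hJ hk h₃ h₃0
  set Z := ∑ c : Fin k → Fin J, 1 / boxWeight c with hZ
  have hZ0 : 0 ≤ Z := sum_nonneg (fun c _ => inv_boxWeight_nonneg c)
  have e3' : ∑ c : Fin k → Fin J, (∑ b, ∑ b', if b ≠ b' ∧ c b = c b' then h₃ (c b) else 0) *
      (1 / boxWeight c) ≤ Z / 8 := e3.trans (by nlinarith)
  have hκ0 : ∀ c : Fin k → Fin J,
      0 ≤ (∑ b, ∑ b', if b ≠ b' ∧ c b = c b' then h₃ (c b) else 0) * (1 / boxWeight c) := by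
    intro c
    refine mul_nonneg (sum_nonneg (fun b _ => sum_nonneg (fun b' _ => ?_)))
      (inv_boxWeight_nonneg c)
    split_ifs
    · exact h₃0 _
    · exact le_rfl
  have e4 : Z ≤ ∑ c : Fin k → Fin J with ∑ b, h₁ (c b) ≤ L₁ ∧ ∑ b, h₂ (c b) ≤ L₂, 1 / boxWeight c +
      ∑ c : Fin k → Fin J with L₁ < ∑ b, h₁ (c b), 1 / boxWeight c +
      ∑ c : Fin k → Fin J with L₂ < ∑ b, h₂ (c b), 1 / boxWeight c := by
    rw [hZ, sum_filter, sum_filter, sum_filter, ← sum_add_distrib,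
      ← sum_add_distrib]
    refine sum_le_sum (fun c _ => ?_)
    have := inv_boxWeight_nonneg c
    by_cases h1 : ∑ b, h₁ (c b) ≤ L₁
    · by_cases h2 : ∑ b, h₂ (c b) ≤ L₂
      · rw [if_pos ⟨h1, h2⟩, if_neg (not_lt.mpr h1), if_neg (not_lt.mpr h2)]
        linarith
      · rw [if_neg (fun h => h2 h.2), if_neg (not_lt.mpr h1), if_pos (not_le.mp h2)]
        linarith
    · rw [if_neg (fun h => h1 h.1), if_pos (not_le.mp h1)]
      split_ifs <;> linarith
  have e5 : ∑ c : Fin k → Fin J with ∑ b, h₁ (c b) ≤ L₁ ∧ ∑ b, h₂ (c b) ≤ L₂,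
      (∑ b, ∑ b', if b ≠ b' ∧ c b = c b' then h₃ (c b) else 0) * (1 / boxWeight c) ≤ Z / 8 :=
    (sum_le_sum_of_subset_of_nonneg (filter_subset _ _)
      (fun c _ _ => hκ0 c)).trans e3'
  have e6 : ∑ c : Fin k → Fin J with ∑ b, h₁ (c b) ≤ L₁ ∧ ∑ b, h₂ (c b) ≤ L₂,
        (1 - 2 * ∑ b, ∑ b', if b ≠ b' ∧ c b = c b' then h₃ (c b) else 0) * (1 / boxWeight c) =
      ∑ c : Fin k → Fin J with ∑ b, h₁ (c b) ≤ L₁ ∧ ∑ b, h₂ (c b) ≤ L₂, 1 / boxWeight c -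
      2 * ∑ c : Fin k → Fin J with ∑ b, h₁ (c b) ≤ L₁ ∧ ∑ b, h₂ (c b) ≤ L₂,
        (∑ b, ∑ b', if b ≠ b' ∧ c b = c b' then h₃ (c b) else 0) * (1 / boxWeight c) := by
    rw [mul_sum, ← sum_sub_distrib]
    exact sum_congr rfl (fun c _ => by ring)
  rw [e6]
  linarith

end allocations

section integersFromTuples

variable {k J : ℕ} {N e : ℕ → ℕ}

/-- the products of the tuples attached to a family of allocations -/
noncomputable def blockProducts (N e : ℕ → ℕ) (G : Finset (Fin k → Fin J)) : Finset ℕ :=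
  (G.biUnion (fun c => blockTuples N e c)).image (fun P => ∏ i, P i)

theorem mem_blockProducts {G : Finset (Fin k → Fin J)} {a : ℕ} :
    a ∈ blockProducts N e G ↔ ∃ c ∈ G, ∃ P ∈ blockTuples N e c, ∏ i, P i = a := by
  unfold blockProducts
  simp only [mem_image, mem_biUnion]
  constructor
  · rintro ⟨P, ⟨c, hc, hP⟩, h⟩
    exact ⟨c, hc, P, hP, h⟩
  · rintro ⟨c, hc, P, hP, h⟩
    exact ⟨P, ⟨c, hc, hP⟩, h⟩

theorem prime_of_mem_blockTuples {c : Fin k → Fin J} {P : Fin k → ℕ} (hP : P ∈ blockTuples N e c)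
    (b : Fin k) : (P b).Prime :=
  (mem_primesIoc.mp ((mem_blockTuples.mp hP).1 b)).1

theorem primeFactors_prod_eq_image {P : Fin k → ℕ} (hP : ∀ b, (P b).Prime) :
    (∏ i, P i).primeFactors = univ.image P := by
  ext p
  rw [Nat.mem_primeFactors_of_ne_zero (Finset.prod_ne_zero_iff.mpr (fun i _ => (hP i).ne_zero)),
    mem_image]
  constructor
  · rintro ⟨hp, hd⟩
    obtain ⟨i, hi, h⟩ := hp.prime.exists_mem_finset_dvd hd
    exact ⟨i, hi, ((Nat.prime_dvd_prime_iff_eq hp (hP i)).mp h).symm⟩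
  · rintro ⟨i, hi, rfl⟩
    exact ⟨hP i, Finset.dvd_prod_of_mem P hi⟩

theorem squarefree_prod_of_injective {P : Fin k → ℕ} (hP : ∀ b, (P b).Prime)
    (hinj : Function.Injective P) : Squarefree (∏ i, P i) := by
  refine Finset.squarefree_prod_of_pairwise_isCoprime (fun i _ j _ hij => ?_)
    (fun i _ => (hP i).squarefree)
  exact Nat.coprime_iff_isRelPrime.mp
    ((Nat.coprime_primes (hP i) (hP j)).mpr (fun h => hij (hinj h)))

theorem card_primeFactors_of_mem_blockProducts {G : Finset (Fin k → Fin J)} {a : ℕ}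
    (ha : a ∈ blockProducts N e G) : a.primeFactors.card = k := by
  obtain ⟨c, -, P, hP, rfl⟩ := mem_blockProducts.mp ha
  rw [primeFactors_prod_eq_image (prime_of_mem_blockTuples hP),
    Finset.card_image_of_injective _ (mem_blockTuples.mp hP).2, card_univ, Fintype.card_fin]

theorem card_filter_prod_eq_le_factorial (X : Finset (Fin k → ℕ))
    (hX : ∀ P ∈ X, (∀ b, (P b).Prime) ∧ Function.Injective P) (a : ℕ) :
    (X.filter (fun P => ∏ i, P i = a)).card ≤ k.factorial := by
  obtain h | ⟨P₀, hP₀⟩ := (X.filter (fun P => ∏ i, P i = a)).eq_empty_or_nonempty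
  · rw [h, Finset.card_empty]
    exact Nat.zero_le _
  obtain ⟨h1, h2⟩ := mem_filter.mp hP₀
  have hsub : X.filter (fun P => ∏ i, P i = a) ⊆
      (univ : Finset (Equiv.Perm (Fin k))).image (fun σ => fun i => P₀ (σ i)) := by
    intro P hP
    obtain ⟨h3, h4⟩ := mem_filter.mp hP
    have h5 : ∀ i, ∃ j, P₀ j = P i := by
      intro i
      have h6 : P i ∈ (∏ i, P₀ i).primeFactors := by
        rw [h2, ← h4, primeFactors_prod_eq_image (hX P h3).1]
        exact Finset.mem_image_of_mem _ (mem_univ i)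
      rw [primeFactors_prod_eq_image (hX P₀ h1).1] at h6
      obtain ⟨j, -, hj⟩ := mem_image.mp h6
      exact ⟨j, hj⟩
    choose σ hσ using h5
    have hσi : Function.Injective σ := fun i j hij => (hX P h3).2 (by rw [← hσ i, ← hσ j, hij])
    refine mem_image.mpr ⟨Equiv.ofBijective σ (Finite.injective_iff_bijective.mp hσi),
      mem_univ _, ?_⟩
    funext i
    exact hσ i
  calc _ ≤ _ := card_le_card hsub
    _ ≤ (univ : Finset (Equiv.Perm (Fin k))).card := Finset.card_image_le
    _ = k.factorial := by rw [card_univ, Fintype.card_perm, Fintype.card_fin]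

theorem prod_rootCount_le_rootCount_prod (F : ℤ[X]) {P : Fin k → ℕ} (hP : ∀ b, (P b).Prime)
    (hinj : Function.Injective P) (S : Finset (Fin k)) :
    ∏ i ∈ S, rootCount F (P i) ≤ rootCount F (∏ i ∈ S, P i) := by
  induction S using Finset.induction_on with
  | empty => simp [rootCount, rootsMod]
  | insert b S hb ih =>
    rw [prod_insert hb, prod_insert hb]
    refine (Nat.mul_le_mul_left _ ih).trans (rootCount_mul_rootCount_le F ?_ (hP b).pos
      (prod_pos (fun i _ => (hP i).pos)))
    refine Nat.Coprime.prod_right (fun i hi => ?_)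
    exact (Nat.coprime_primes (hP b) (hP i)).mpr (fun h => hb (hinj h ▸ hi))

theorem sum_blockTuples_le_factorial_mul (F : ℤ[X]) (hN : Monotone N) (he : StrictMono e)
    (G : Finset (Fin k → Fin J)) (η y : ℝ) :
    ∑ c ∈ G, ∑ P ∈ blockTuples N e c, (∏ i, (rootCount F (P i) : ℝ) / P i) * tupleCells η y P ≤
      k.factorial * ∑ a ∈ blockProducts N e G, (rootCount F a : ℝ) / a * cellCount η y a := by
  have hdisj : Set.PairwiseDisjoint (G : Set (Fin k → Fin J)) (fun c => blockTuples N e c) := by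
    intro c _ c' _ hcc
    refine Finset.disjoint_left.mpr (fun P hP hP' => hcc ?_)
    have key : ∀ c c' : Fin k → Fin J, P ∈ blockTuples N e c → P ∈ blockTuples N e c' →
        ∀ b, ¬ (c b : ℕ) < c' b := by
      intro c c' h h' b hlt
      have h1 := (mem_primesIoc.mp ((mem_blockTuples.mp h).1 b)).2.2
      have h2 := (mem_primesIoc.mp ((mem_blockTuples.mp h').1 b)).2.1
      have h3 : (N (e (c b) + 1) : ℝ) ≤ N (e (c' b)) := by exact_mod_cast hN (he hlt)
      linarith
    funext b
    exact Fin.ext (le_antisymm (not_lt.mp (key c' c hP' hP b)) (not_lt.mp (key c c' hP hP' b)))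
  have hX : ∀ P ∈ G.biUnion (fun c => blockTuples N e c),
      (∀ b, (P b).Prime) ∧ Function.Injective P := by
    intro P hP
    obtain ⟨c, -, h⟩ := mem_biUnion.mp hP
    exact ⟨prime_of_mem_blockTuples h, (mem_blockTuples.mp h).2⟩
  rw [← sum_biUnion hdisj, ← Finset.sum_fiberwise_of_maps_to
    (g := fun P : Fin k → ℕ => ∏ i, P i) (t := blockProducts N e G)
    (fun P hP => Finset.mem_image_of_mem _ hP), mul_sum]
  refine sum_le_sum (fun a _ => ?_)
  have hterm : ∀ P ∈ (G.biUnion (fun c => blockTuples N e c)).filter (fun P => ∏ i, P i = a),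
      (∏ i, (rootCount F (P i) : ℝ) / P i) * tupleCells η y P ≤
        (rootCount F a : ℝ) / a * cellCount η y a := by
    intro P hP
    obtain ⟨h1, rfl⟩ := mem_filter.mp hP
    obtain ⟨h2, h3⟩ := hX P h1
    have hcells : tupleCells η y P ≤ cellCount η y (∏ i, P i) := by
      unfold tupleCells cellCount
      refine card_le_card (fun m hm => ?_)
      obtain ⟨S, -, rfl⟩ := mem_image.mp hm
      exact Finset.mem_image_of_mem _ (Nat.mem_divisors.mpr
        ⟨Finset.prod_dvd_prod_of_subset _ _ _ (Finset.subset_univ S),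
          Finset.prod_ne_zero_iff.mpr (fun i _ => (h2 i).ne_zero)⟩)
    rw [Finset.prod_div_distrib, Nat.cast_prod]
    gcongr
    exact_mod_cast prod_rootCount_le_rootCount_prod F h2 h3 univ
  calc _ ≤ ∑ _P ∈ (G.biUnion (fun c => blockTuples N e c)).filter (fun P => ∏ i, P i = a),
        (rootCount F a : ℝ) / a * cellCount η y a := sum_le_sum hterm
    _ = _ := by rw [sum_const, nsmul_eq_mul]
    _ ≤ _ := by
        gcongr
        exact card_filter_prod_eq_le_factorial _ hX a

end integersFromTuples

theorem exists_two_pow_threshold {A L : ℝ} (hA : 0 < A) :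
    ∃ i : ℕ, (i = 0 ∨ A * 2 ^ i ≤ L) ∧ L ≤ A * 2 ^ (i + 1) := by
  have hex : ∃ i : ℕ, L ≤ A * 2 ^ (i + 1) := by
    obtain ⟨n, hn⟩ := pow_unbounded_of_one_lt (L / A) (by norm_num : (1 : ℝ) < 2)
    refine ⟨n, ?_⟩
    rw [div_lt_iff₀ hA] at hn
    have : (2 : ℝ) ^ n ≤ 2 ^ (n + 1) := pow_le_pow_right₀ (by norm_num) (Nat.le_succ n)
    nlinarith
  refine ⟨Nat.find hex, ?_, Nat.find_spec hex⟩
  rcases Nat.eq_zero_or_pos (Nat.find hex) with h | h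
  · exact Or.inl h
  · right
    have := Nat.find_min hex (m := Nat.find hex - 1) (by omega)
    rw [Nat.sub_add_cancel h] at this
    exact (not_le.mp this).le

theorem sum_fin_two_pow_le (J : ℕ) : ∑ j : Fin J, (2 : ℝ) ^ (j : ℕ) ≤ 2 ^ J := by
  rw [Fin.sum_univ_eq_sum_range (fun j => (2 : ℝ) ^ j), geom_sum_eq (by norm_num)]
  norm_num

theorem sum_fin_inv_two_pow_le (J : ℕ) : ∑ j : Fin J, 1 / (2 : ℝ) ^ (j : ℕ) ≤ 2 := by
  rw [Fin.sum_univ_eq_sum_range (fun j => 1 / (2 : ℝ) ^ j)]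
  have := sum_geometric_two_le J
  refine le_trans (le_of_eq (sum_congr rfl (fun j _ => ?_))) this
  rw [one_div_pow]

set_option maxHeartbeats 1000000 in
theorem exists_sum_cellCount_ge {F : ℤ[X]} (hF : Irreducible F) (hdeg : F.natDegree ≠ 0) (p₀ : ℕ) :
    ∃ c K : ℝ, 0 < c ∧ 1 ≤ K ∧ ∀ (η y : ℝ) (k J : ℕ), 0 < η → η ≤ 1 / 100 → 0 < y → 0 < J → J < k →
      k ≤ 2 * J → η ≤ 2 ^ J / 2 ^ k → ∃ 𝒜 : Finset ℕ,
      (∀ a ∈ 𝒜, a.primeFactors.card = k ∧ Squarefree a ∧ log a ≤ K * 2 ^ J ∧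
        ∀ p : ℕ, p.Prime → p ∣ a → p₀ < p ∧ log p ≤ K * 2 ^ J) ∧
      c * ((2 * log 2) ^ k * J ^ k / k.factorial * ((k - J : ℕ) / k)) ≤
        ∑ a ∈ 𝒜, (rootCount F a : ℝ) / a * cellCount η y a := by
  obtain ⟨N, C₁, hC₁, hNmono, j₀, hN⟩ := exists_prime_blocks hF hdeg
  obtain ⟨C, hC, hfix⟩ := exists_sum_blockTuples_tupleCells_ge hdeg hC₁
  have hC₁0 : 0 < C₁ := by linarith
  have hC0 : 0 < C := by linarith
  have hl2 : 0 < log 2 := log_pos (by norm_num)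
  obtain ⟨M₁, hM₁⟩ := pow_unbounded_of_one_lt (256 * C + C₁ * (p₀ + F.leadingCoeff.natAbs + 2))
    (by norm_num : (1 : ℝ) < 2)
  obtain ⟨K', hK'⟩ := pow_unbounded_of_one_lt (512 * C₁ ^ 2) (by norm_num : (1 : ℝ) < 2)
  obtain ⟨M, hMj, hM⟩ : ∃ M : ℕ, j₀ ≤ M ∧
      256 * C + C₁ * (p₀ + F.leadingCoeff.natAbs + 2) ≤ (2 : ℝ) ^ M :=
    ⟨max j₀ M₁, le_max_left _ _, hM₁.le.trans
      (pow_le_pow_right₀ (by norm_num) (le_max_right _ _))⟩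
  have hMC : 256 * C ≤ (2 : ℝ) ^ M := by
    have : 0 ≤ C₁ * ((p₀ : ℝ) + F.leadingCoeff.natAbs + 2) := by positivity
    linarith
  have hMN : C₁ * ((p₀ : ℝ) + F.leadingCoeff.natAbs + 2) ≤ (2 : ℝ) ^ M := by linarith
  have hNbig : ∀ j, M ≤ j → p₀ + F.leadingCoeff.natAbs + 2 ≤ N j := by
    intro j hj
    have h1 : ((p₀ : ℝ) + F.leadingCoeff.natAbs + 2) ≤ N j := by
      have h2 : (2 : ℝ) ^ M / C₁ ≤ log (N j) := by
        refine le_trans ?_ (hN j (hMj.trans hj)).1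
        gcongr
        norm_num
      have h3 : ((p₀ : ℝ) + F.leadingCoeff.natAbs + 2) ≤ 2 ^ M / C₁ := by
        rw [le_div_iff₀ hC₁0, mul_comm]
        exact hMN
      exact (h3.trans h2).trans (log_le_self (Nat.cast_nonneg _))
    exact_mod_cast h1
  refine ⟨1 / (72 * C), C₁ * 2 ^ (M + K' + 1) * 32, by positivity, ?_, ?_⟩
  · have : (1 : ℝ) ≤ 2 ^ (M + K' + 1) := one_le_pow₀ (by norm_num)
    nlinarith
  intro η y k J hη hη1 hy hJ hJk hk hηk
  have hL₁ : log 2 < log (1 / (2 * η)) := by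
    refine log_lt_log (by norm_num) ?_
    rw [lt_div_iff₀ (by positivity)]
    linarith
  have hLη : log (1 / η) = log (1 / (2 * η)) + log 2 := by
    rw [← log_mul (by positivity) (by norm_num)]
    congr 1
    field_simp
  obtain ⟨i₀, hi₀, hi₀'⟩ := exists_two_pow_threshold (A := 64 * C₁ * 2 ^ M)
    (L := log (1 / (2 * η))) (by positivity)
  set e : ℕ → ℕ := fun j => M + j + if j < i₀ then 0 else K' with he
  have heM : ∀ j, M + j ≤ e j := fun j => Nat.le_add_right _ _
  have heK : ∀ j, e j ≤ M + K' + j := by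
    intro j
    simp only [he]
    split_ifs <;> omega
  have hestrict : StrictMono e := by
    intro i j hij
    simp only [he]
    split_ifs <;> omega
  have hup : ∀ j, log (N (e j + 1)) ≤ C₁ * 2 ^ (e j + 1) := fun j =>
    (hN _ (by have := heM j; omega)).2.1
  have hblk : ∀ j, F.leadingCoeff.natAbs ≤ N (e j) ∧ 1 < N (e j) ∧
      2 ^ e j / C₁ ≤ log (N (e j)) ∧
      log 2 ≤ ∑ p ∈ primesIoc (N (e j)) (N (e j + 1)), (rootCount F p : ℝ) / p := by
    intro j
    have h1 := hNbig (e j) (by have := heM j; omega)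
    have h2 := hN (e j) (by have := heM j; omega)
    exact ⟨by omega, by omega, h2.1, h2.2.2⟩
  have hbig : ∀ j, i₀ ≤ j → 2 * log (1 / η) ≤ log (N (e j)) := by
    intro j hj
    refine le_trans ?_ (hblk j).2.2.1
    have h1 : (2 : ℝ) ^ (M + i₀ + K') ≤ 2 ^ e j := by
      refine pow_le_pow_right₀ (by norm_num) ?_
      simp only [he]
      rw [if_neg (by omega)]
      omega
    rw [le_div_iff₀ hC₁0]
    refine le_trans ?_ h1
    rw [pow_add, pow_add]
    rw [pow_succ] at hi₀'
    have h2 : 2 * log (1 / η) ≤ 512 * C₁ * (2 ^ M * 2 ^ i₀) := by linarith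
    calc 2 * log (1 / η) * C₁ ≤ 512 * C₁ * (2 ^ M * 2 ^ i₀) * C₁ := by gcongr
      _ = 2 ^ M * 2 ^ i₀ * (512 * C₁ ^ 2) := by ring
      _ ≤ _ := by gcongr
  set h₁ : ℕ → ℝ := fun j => if j < i₀ then log (N (e j + 1)) else 0 with hh₁
  have hh₁0 : ∀ j, 0 ≤ h₁ j := by
    intro j
    simp only [hh₁]
    split_ifs
    · exact log_natCast_nonneg _
    · exact le_rfl
  have hh₁b : 32 * ∑ j : Fin J, h₁ j ≤ log (1 / (2 * η)) := by
    rcases hi₀ with h | h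
    · have : ∀ j, h₁ j = 0 := fun j => by simp only [hh₁]; rw [if_neg (by omega)]
      simp_rw [this]
      rw [Finset.sum_const_zero]
      linarith
    · have h2 : ∑ j : Fin J, h₁ j ≤ C₁ * 2 ^ (M + 1) * 2 ^ i₀ := by
        calc ∑ j : Fin J, h₁ j = ∑ j ∈ range J, h₁ j :=
              Fin.sum_univ_eq_sum_range (fun j => h₁ j) J
          _ ≤ ∑ j ∈ range i₀, C₁ * 2 ^ (M + 1) * 2 ^ j := by
              simp only [hh₁]
              rw [← sum_filter]
              refine (sum_le_sum (g := fun j => C₁ * 2 ^ (M + 1) * 2 ^ j)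
                (fun j hj => ?_)).trans (sum_le_sum_of_subset_of_nonneg
                (fun j hj => mem_range.mpr (mem_filter.mp hj).2)
                (fun j _ _ => by positivity))
              refine (hup j).trans (le_of_eq ?_)
              simp only [he]
              rw [if_pos (mem_filter.mp hj).2]
              ring
          _ = C₁ * 2 ^ (M + 1) * ∑ j ∈ range i₀, (2 : ℝ) ^ j := by rw [mul_sum]
          _ ≤ _ := by
              gcongr
              rw [geom_sum_eq (by norm_num)]
              norm_num
      calc _ ≤ 32 * (C₁ * 2 ^ (M + 1) * 2 ^ i₀) := by gcongr
        _ = 64 * C₁ * 2 ^ M * 2 ^ i₀ := by ring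
        _ ≤ _ := h
  have hh₂b : 32 * ∑ j : Fin J, (2 : ℝ) ^ (j : ℕ) ≤ 32 * 2 ^ J := by
    gcongr
    exact sum_fin_two_pow_le J
  have hh₃b : 128 * ∑ j : Fin J, C / 2 ^ e j ≤ 1 := by
    have h1 : ∑ j : Fin J, C / 2 ^ e j ≤ C / 2 ^ M * 2 := by
      calc _ ≤ ∑ j : Fin J, C / 2 ^ M * (1 / 2 ^ (j : ℕ)) := by
            refine sum_le_sum (fun j _ => ?_)
            rw [div_mul_div_comm, mul_one, ← pow_add]
            gcongr
            · norm_num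
            · exact heM j
        _ ≤ _ := by
            rw [← mul_sum]
            gcongr
            exact sum_fin_inv_two_pow_le J
    have h2 : C / 2 ^ M ≤ 1 / 256 := by
      rw [div_le_div_iff₀ (by positivity) (by norm_num)]
      linarith
    linarith
  have hhalf := half_sum_inv_boxWeight_le (k := k) hJ hk h₁ (fun j => 2 ^ j)
    (fun j => C / 2 ^ e j) hh₁0 (fun j => by positivity) (fun j => by positivity)
    (hl2.trans hL₁) (by positivity : (0 : ℝ) < 32 * 2 ^ J) hh₁b hh₂b hh₃b
  obtain ⟨G, hG⟩ : ∃ G : Finset (Fin k → Fin J), G = univ.filter (fun c : Fin k → Fin J =>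
    ∑ b, h₁ (c b) ≤ log (1 / (2 * η)) ∧ ∑ b, (2 : ℝ) ^ (c b : ℕ) ≤ 32 * 2 ^ J) := ⟨_, rfl⟩
  rw [← hG] at hhalf
  have hGm : ∀ c ∈ G, ∑ b, h₁ (c b) ≤ log (1 / (2 * η)) ∧
      ∑ b, (2 : ℝ) ^ (c b : ℕ) ≤ 32 * 2 ^ J := fun c hc => by
    rw [hG] at hc
    exact (mem_filter.mp hc).2
  refine ⟨blockProducts N e G, fun a ha => ?_, ?_⟩
  · refine ⟨card_primeFactors_of_mem_blockProducts ha, ?_⟩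
    obtain ⟨c, hc, P, hP, rfl⟩ := mem_blockProducts.mp ha
    have hPp := prime_of_mem_blockTuples hP
    obtain ⟨hPm, hinj⟩ := mem_blockTuples.mp hP
    have hlog : log ((∏ i, P i : ℕ) : ℝ) ≤ C₁ * 2 ^ (M + K' + 1) * 32 * 2 ^ J := by
      rw [log_prod_natCast (fun b => (hPp b).pos)]
      calc _ ≤ ∑ b, C₁ * 2 ^ (M + K' + 1) * 2 ^ (c b : ℕ) := by
            refine sum_le_sum (fun b _ => ?_)
            have h1 : log (P b) ≤ log (N (e (c b) + 1)) :=
              log_le_log (by exact_mod_cast (hPp b).pos) (mem_primesIoc.mp (hPm b)).2.2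
            refine (h1.trans (hup _)).trans ?_
            calc C₁ * 2 ^ (e (c b) + 1) ≤ C₁ * 2 ^ (M + K' + 1 + (c b : ℕ)) := by
                  have h2 := heK (c b)
                  exact mul_le_mul_of_nonneg_left
                    (pow_le_pow_right₀ (by norm_num) (by omega)) hC₁0.le
              _ = _ := by rw [pow_add _ (M + K' + 1)]; ring
        _ ≤ C₁ * 2 ^ (M + K' + 1) * (32 * 2 ^ J) := by
            rw [← mul_sum]
            gcongr
            exact (hGm c hc).2
        _ = _ := by ring
    refine ⟨squarefree_prod_of_injective hPp hinj, hlog, fun p hp hdvd => ?_⟩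
    have h2 : p ∈ univ.image P := by
      rw [← primeFactors_prod_eq_image hPp]
      exact Nat.mem_primeFactors.mpr
        ⟨hp, hdvd, Finset.prod_ne_zero_iff.mpr (fun i _ => (hPp i).ne_zero)⟩
    obtain ⟨b, -, rfl⟩ := mem_image.mp h2
    constructor
    · have h3 := (mem_primesIoc.mp (hPm b)).2.1
      have h4 : N (e (c b)) < P b := by exact_mod_cast h3
      have h5 := hNbig (e (c b)) (by have := heM (c b); omega)
      omega
    · refine le_trans (log_le_log (by exact_mod_cast hp.pos) ?_) hlog
      exact_mod_cast Nat.le_of_dvd (prod_pos (fun i _ => (hPp i).pos)) hdvd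
  · have hsum := sum_blockTuples_le_factorial_mul F hNmono hestrict G η y
    have hfact : (0 : ℝ) < k.factorial := by exact_mod_cast k.factorial_pos
    have hk0 : (0 : ℝ) < k := by exact_mod_cast (hJ.trans hJk)
    have hlow : (2 * log 2) ^ k / C * ((∑ c : Fin k → Fin J, 1 / boxWeight c) / 2) ≤
        ∑ c ∈ G, ∑ P ∈ blockTuples N e c,
          (∏ i, (rootCount F (P i) : ℝ) / P i) * tupleCells η y P := by
      refine (mul_le_mul_of_nonneg_left hhalf (by positivity)).trans ?_
      rw [mul_sum]
      refine sum_le_sum (fun c hc => ?_)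
      refine le_trans (le_of_eq ?_) (hfix N e c η y i₀ hη hη1 hy hNmono hestrict hblk hbig ?_ hηk)
      · have : boxWeight c ≠ 0 := (lt_of_lt_of_le one_pos (one_le_boxWeight c)).ne'
        field_simp
      · have := (hGm c hc).1
        simp only [hh₁] at this
        rwa [sum_filter]
    have hZ := sum_inv_boxWeight_ge hJ hJk
    refine le_of_mul_le_mul_left ?_ hfact
    refine le_trans ?_ (hlow.trans hsum)
    calc (k.factorial : ℝ) * (1 / (72 * C) * ((2 * log 2) ^ k * J ^ k / k.factorial *
          ((k - J : ℕ) / k))) =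
          (2 * log 2) ^ k / C * ((J : ℝ) ^ k * (k - J : ℕ)) / (72 * k) := by
          field_simp
      _ ≤ (2 * log 2) ^ k / C * (36 * k * ∑ c : Fin k → Fin J, 1 / boxWeight c) / (72 * k) := by
          gcongr
      _ = _ := by field_simp; ring

theorem factorial_le_exp_mul_sqrt_mul_pow {k : ℕ} (hk : 0 < k) :
    (k.factorial : ℝ) ≤ exp 1 * √k * (k / exp 1) ^ k := by
  obtain ⟨n, rfl⟩ := Nat.exists_eq_succ_of_ne_zero hk.ne'
  have h := Stirling.stirlingSeq'_antitone (Nat.zero_le n)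
  simp only [Function.comp, Nat.succ_eq_add_one, zero_add, Stirling.stirlingSeq] at h
  rw [div_le_iff₀ (by positivity)] at h
  refine h.trans (le_of_eq ?_)
  rw [Nat.factorial_one, Nat.cast_one, mul_one, Real.sqrt_mul zero_le_two ((n + 1 : ℕ) : ℝ)]
  have : √(2 : ℝ) ≠ 0 := by positivity
  field_simp

/-- A lower bound for the Poisson weight `(2 * a) ^ k / k!` near `k = v * l`, `a = l`. -/
theorem exp_le_mul_pow_div_factorial {l a v D B : ℝ} {k : ℕ} (hl : 0 < l) (hlk : l ≤ k)
    (hkv : k ≤ v * l) (hv : v ≤ 2) (hD : v * l - k ≤ D) (hal : a ≤ l) (hla : l ≤ 2 * a)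
    (hB : l - a ≤ B) :
    exp (l * (v * log (2 * exp 1 / v))) ≤
      exp 1 * √(2 * l) * exp (4 * B + D ^ 2 / l + D * (2 - v)) *
        ((2 * a) ^ k / k.factorial) := by
  have hk : (0 : ℝ) < k := hl.trans_le hlk
  have ha : 0 < a := by linarith
  have hv0 : 0 < v := by
    by_contra! h
    nlinarith
  have hK : 0 < v * l := by positivity
  have hB0 : 0 ≤ B := by linarith
  have hlog : log (2 * exp 1 / v) = log (2 * a * exp 1 / k) +
      log (l / a) + log (k / (v * l)) := by
    rw [← log_mul (by positivity) (by positivity),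
      ← log_mul (by positivity) (by positivity)]
    congr 1
    field_simp
  have h1 : v * l * log (k / (v * l)) ≤ k - v * l := by
    calc _ ≤ v * l * (k / (v * l) - 1) := by
          gcongr
          exact log_le_sub_one_of_pos (by positivity)
      _ = _ := by field_simp
  have h2 : v * l * log (l / a) ≤ 4 * B := by
    calc _ ≤ v * l * (l / a - 1) := by
          gcongr
          exact log_le_sub_one_of_pos (by positivity)
      _ = v * l * ((l - a) / a) := by field_simp
      _ ≤ 2 * (2 * a) * (B / a) := by gcongr
      _ = _ := by field_simp; ring
  have h3 : (v * l - k) * log (2 * a * exp 1 / k) ≤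
      (v * l - k) + (D ^ 2 / l + D * (2 - v)) := by
    have h4 : log (2 * a * exp 1 / k) ≤ 2 * l / k := by
      rw [mul_div_right_comm, log_mul (by positivity) (by positivity), log_exp]
      have h5 := log_le_sub_one_of_pos (show 0 < 2 * a / k by positivity)
      have h6 : 2 * a / k ≤ 2 * l / k := by gcongr
      linarith
    have hD0 : 0 ≤ D := by linarith
    calc _ ≤ (v * l - k) * (2 * l / k) := by gcongr
      _ = (v * l - k) + (v * l - k) * ((v * l - k + (2 - v) * l) / k) := by field_simp; ring
      _ ≤ (v * l - k) + D * ((D + (2 - v) * l) / l) := by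
          have : 0 ≤ (2 - v) * l := mul_nonneg (by linarith) hl.le
          gcongr
      _ = _ := by field_simp
  have hk' : 0 < k := by exact_mod_cast hk
  have h5 : exp (k * log (2 * a * exp 1 / k)) ≤
      exp 1 * √(2 * l) * ((2 * a) ^ k / k.factorial) := by
    rw [exp_nat_mul, exp_log (by positivity), ← mul_div_assoc,
      le_div_iff₀ (by positivity)]
    calc _ ≤ (2 * a * exp 1 / k) ^ k * (exp 1 * √k * (k / exp 1) ^ k) := by
          gcongr
          exact factorial_le_exp_mul_sqrt_mul_pow hk'
      _ = exp 1 * √k * (2 * a) ^ k := by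
          rw [div_pow, div_pow, mul_pow]
          field_simp
      _ ≤ _ := by
          gcongr
          nlinarith
  calc _ ≤ exp ((4 * B + D ^ 2 / l + D * (2 - v)) +
        k * log (2 * a * exp 1 / k)) := by
        gcongr
        rw [hlog]
        nlinarith
    _ ≤ exp (4 * B + D ^ 2 / l + D * (2 - v)) *
        (exp 1 * √(2 * l) * ((2 * a) ^ k / k.factorial)) := by
        rw [exp_add]
        gcongr
    _ = _ := by ring

set_option maxHeartbeats 1000000 in
theorem exists_sum_poisson_ge {C : ℝ} (hC : 1 < C) (M : ℕ) : ∃ c l₀ : ℝ, 0 < c ∧ ∀ l β : ℝ,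
    l₀ ≤ l → 0 < β → β ≤ C → 4 * log 2 ≤ β * l → ∃ (𝒦 : Finset ℕ) (J : ℕ), 0 < J ∧
    J * log 2 + M * log 2 ≤ l ∧
    (∀ k ∈ 𝒦, J < k ∧ k ≤ 2 * J ∧ ((k - J : ℕ) : ℝ) * log 2 ≤ β * l) ∧
    c * β / max 1 (-((β - (log 4 - 1)) * √l)) *
      exp (l * (min ((1 + β) / log 2) 2 *
        log (2 * exp 1 / min ((1 + β) / log 2) 2))) ≤
      ∑ k ∈ 𝒦, (2 * log 2) ^ k * J ^ k / k.factorial * ((k - J : ℕ) / k) := by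
  have h2a := log_two_gt_d9
  have h2b := log_two_lt_d9
  obtain ⟨t, ht⟩ : ∃ t, t = log 2 := ⟨_, rfl⟩
  rw [log_four_eq, ← ht]
  rw [← ht] at h2a h2b
  have ht0 : 0 < t := by linarith
  obtain ⟨E, hE⟩ : ∃ E : ℝ, E = 4 * (M + 1) + (2 * (M + 2) ^ 2 + 1 + (2 * (M + 2) + 1)) :=
    ⟨_, rfl⟩
  obtain ⟨A, hA⟩ : ∃ A : ℝ, A = exp 1 * √2 * exp E := ⟨_, rfl⟩
  have hA0 : 0 < A := by rw [hA]; positivity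
  refine ⟨1 / (A * (120 * C)), 100 + 4 * (M + 1), by positivity, ?_⟩
  intro l β hl hβ hβC hβl
  have hM0 : (0 : ℝ) ≤ M := by positivity
  have hl100 : 100 ≤ l := by linarith
  have hl0 : 0 < l := by linarith
  have hs : 0 < √l := Real.sqrt_pos.mpr hl0
  have hsq : √l ^ 2 = l := Real.sq_sqrt hl0.le
  have hs10 : 10 ≤ √l := Real.le_sqrt_of_sq_le (by linarith)
  obtain ⟨X, hX⟩ : ∃ X, X = max 1 (-((β - (2 * t - 1)) * √l)) := ⟨_, rfl⟩
  obtain ⟨v, hv⟩ : ∃ v, v = min ((1 + β) / t) 2 := ⟨_, rfl⟩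
  rw [← hX, ← hv]
  have hX1 : 1 ≤ X := hX ▸ le_max_left _ _
  have hX2 : (2 * t - 1 - β) * √l ≤ X :=
    (le_of_eq (by ring)).trans (hX ▸ le_max_right _ _)
  obtain ⟨m, hm⟩ : ∃ m, m = √l / X := ⟨_, rfl⟩
  have hm0 : 0 < m := by rw [hm]; positivity
  have hm1 : m ≤ √l := hm ▸ div_le_self hs.le hX1
  have hm2 : m * (2 * t - 1 - β) ≤ 1 := by
    rw [hm, div_mul_eq_mul_div, div_le_one (by linarith)]
    linarith
  obtain ⟨b, hb⟩ : ∃ b, b = min β (2 * t - 1) := ⟨_, rfl⟩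
  have hvb : v = (1 + b) / t := by
    rw [hv, hb, ← min_add_add_left, ← min_div_div_right ht0.le]
    congr 1
    field_simp
    ring
  have hb0 : 0 < b := by rw [hb]; exact lt_min hβ (by linarith)
  have hbβ : b ≤ β := hb ▸ min_le_left _ _
  have hbt : b ≤ 2 * t - 1 := hb ▸ min_le_right _ _
  have hmb : m * (2 * t - 1 - b) ≤ 1 := by
    rcases min_choice β (2 * t - 1) with h | h <;> rw [hb, h]
    · exact hm2
    · simp
  have hbC : β / (3 * C) ≤ b := by
    rw [hb]
    refine le_min ?_ ?_ <;> rw [div_le_iff₀ (by positivity)]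
    · exact le_mul_of_one_le_right hβ.le (by linarith)
    · linarith [mul_le_mul_of_nonneg_right (show 1 / 3 ≤ 2 * t - 1 by linarith)
        (show 0 ≤ 3 * C by linarith)]
  obtain ⟨u, hu⟩ : ∃ u, u = b * l / t := ⟨_, rfl⟩
  have hut : u * t = b * l := by rw [hu]; field_simp
  have hu4 : 4 ≤ u ∧ m / 10 ≤ u / 4 := by
    by_cases h : β ≤ (2 * t - 1) / 2
    · have : b = β := by rw [hb]; exact min_eq_left (by linarith)
      have h4 : 4 ≤ u := by rw [hu, le_div_iff₀ ht0, this]; exact hβl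
      have h5 := mul_le_mul_of_nonneg_left (show 19 / 100 ≤ 2 * t - 1 - β by linarith) hm0.le
      exact ⟨h4, by linarith⟩
    · have h4 : 19 / 100 ≤ b := by rw [hb]; exact le_min (by linarith) (by linarith)
      have h5 : 19 / 100 * l ≤ u := by
        rw [hu, le_div_iff₀ ht0]
        linarith [mul_le_mul_of_nonneg_right h4 hl0.le,
          mul_le_mul_of_nonneg_right (show t ≤ 1 by linarith) hl0.le]
      have h6 := mul_le_mul_of_nonneg_left hs10 hs.le
      rw [← sq, hsq] at h6
      exact ⟨by linarith, by linarith⟩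
  have hul : u ≤ l := by
    rw [hu, div_le_iff₀ ht0, mul_comm l]
    exact mul_le_mul_of_nonneg_right (by linarith) hl0.le
  have hvl : v * l = l / t + u := by rw [hvb, hu]; field_simp
  have hv2 : v ≤ 2 := hv ▸ min_le_right _ _
  have hmv : m * (2 - v) ≤ 2 := by
    have : 2 - v = (2 * t - 1 - b) / t := by rw [hvb]; field_simp; ring
    rw [this, ← mul_div_assoc, div_le_iff₀ ht0]
    linarith
  have hv0 : 0 < v := by rw [hvb]; positivity
  have hq := Nat.floor_le (show 0 ≤ u by linarith [hu4.1])
  have hq' := Nat.lt_floor_add_one u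
  have hw := Nat.floor_le (show 0 ≤ m / 10 by positivity)
  have hw' := Nat.lt_floor_add_one (m / 10)
  have hP := Nat.floor_le (show 0 ≤ l / t by positivity)
  have hP' := Nat.lt_floor_add_one (l / t)
  obtain ⟨q, hqd⟩ : ∃ q, q = ⌊u⌋₊ := ⟨_, rfl⟩
  obtain ⟨w, hwd⟩ : ∃ w, w = ⌊m / 10⌋₊ := ⟨_, rfl⟩
  obtain ⟨P, hPd⟩ : ∃ P, P = ⌊l / t⌋₊ := ⟨_, rfl⟩
  rw [← hqd] at hq hq'
  rw [← hwd] at hw hw'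
  rw [← hPd] at hP hP'
  have hlt : l / t * t = l := by field_simp
  have hlt' : 14 / 10 * l ≤ l / t := by
    rw [le_div_iff₀ ht0]
    linarith [mul_le_mul_of_nonneg_right (show t ≤ 7 / 10 by linarith) hl0.le]
  have hPM : M ≤ P := by
    have : (M : ℝ) ≤ P := by linarith
    exact_mod_cast this
  obtain ⟨J, rfl⟩ := Nat.exists_eq_add_of_le' hPM
  push_cast at hP hP'
  have hJl : l ≤ J := by linarith
  have hwq : w ≤ q := by
    have : (w : ℝ) ≤ q := by linarith
    exact_mod_cast this
  have ha1 : (J : ℝ) * t + M * t ≤ l := by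
    linarith [mul_le_mul_of_nonneg_right hP ht0.le]
  have ha2 : l - J * t ≤ M + 1 := by
    linarith [mul_le_mul_of_nonneg_right hP'.le ht0.le,
      mul_le_mul_of_nonneg_left (show t ≤ 1 by linarith) hM0]
  refine ⟨Icc (J + q - w) (J + q), J, ?_, ha1, ?_, ?_⟩
  · have : (0 : ℝ) < J := by linarith
    exact_mod_cast this
  · intro k hk
    obtain ⟨hk1, hk2⟩ := mem_Icc.mp hk
    have h1 : (k : ℝ) ≤ J + q := by exact_mod_cast hk2
    have h2 : (J : ℝ) + q ≤ k + w := by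
      have : J + q ≤ k + w := by omega
      exact_mod_cast this
    have h3 : J < k := by
      have : (J : ℝ) < k := by linarith
      exact_mod_cast this
    have h4 : (k : ℝ) ≤ 2 * J := by linarith
    refine ⟨h3, by exact_mod_cast h4, ?_⟩
    rw [Nat.cast_sub h3.le]
    calc _ ≤ u * t := by gcongr; linarith
      _ = b * l := hut
      _ ≤ _ := by gcongr
  · have hterm : ∀ k ∈ Icc (J + q - w) (J + q),
        exp (l * (v * log (2 * exp 1 / v))) * (β / (12 * C)) / (A * √l) ≤
        (2 * t) ^ k * J ^ k / k.factorial * ((k - J : ℕ) / k) := by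
      intro k hk
      obtain ⟨hk1, hk2⟩ := mem_Icc.mp hk
      have h1 : (k : ℝ) ≤ J + q := by exact_mod_cast hk2
      have h2 : (J : ℝ) + q ≤ k + w := by
        have : J + q ≤ k + w := by omega
        exact_mod_cast this
      have hJk : (J : ℝ) ≤ k := by linarith
      have h5 := exp_le_mul_pow_div_factorial (l := l) (a := J * t) (v := v)
        (D := M + 2 + m / 10) (B := M + 1) (k := k) hl0 (by linarith) (by linarith) hv2
        (by linarith) (by linarith [mul_nonneg hM0 ht0.le]) (by linarith) ha2
      have h6 : 4 * ((M : ℝ) + 1) + (M + 2 + m / 10) ^ 2 / l + (M + 2 + m / 10) * (2 - v) ≤ E := by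
        have h7 : (M + 2 + m / 10) ^ 2 / l ≤ 2 * ((M : ℝ) + 2) ^ 2 + 1 := by
          rw [div_le_iff₀ hl0]
          have h8 : m ^ 2 ≤ l := by rw [← hsq]; gcongr
          linarith [sq_nonneg ((M : ℝ) + 2 - m / 10), mul_le_mul_of_nonneg_left
            (show 1 ≤ l by linarith) (sq_nonneg ((M : ℝ) + 2))]
        rw [hE]
        linarith [mul_le_mul_of_nonneg_left (show 2 - v ≤ 2 by linarith)
          (show 0 ≤ (M : ℝ) + 2 by linarith)]
      have h9 : β / (12 * C) ≤ ((k - J : ℕ) : ℝ) / k := by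
        have hJk' : J ≤ k := by exact_mod_cast hJk
        have hk0 : (0 : ℝ) < k := by linarith
        rw [Nat.cast_sub hJk', le_div_iff₀ hk0]
        have : β / (12 * C) = β / (3 * C) / 4 := by field_simp; ring
        rw [this]
        calc β / (3 * C) / 4 * k ≤ b / 4 * (2 * l) := by
              gcongr
              linarith [mul_le_mul_of_nonneg_right hv2 hl0.le]
          _ = u * t / 2 := by rw [hut]; ring
          _ ≤ u / 2 := by
              linarith [mul_le_mul_of_nonneg_left (show t ≤ 1 by linarith)
                (show 0 ≤ u by linarith [hu4.1])]
          _ ≤ _ := by linarith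
      have h10 : exp (l * (v * log (2 * exp 1 / v))) ≤
          A * √l * ((2 * t) ^ k * J ^ k / k.factorial) := by
        refine h5.trans ?_
        rw [Real.sqrt_mul zero_le_two, hA]
        calc _ ≤ exp 1 * (√2 * √l) * exp E *
              ((2 * (J * t)) ^ k / k.factorial) := by gcongr
          _ = _ := by rw [← mul_pow]; ring_nf
      rw [div_le_iff₀ (by positivity)]
      calc _ ≤ A * √l * ((2 * t) ^ k * J ^ k / k.factorial) * (((k - J : ℕ) : ℝ) / k) := by
            gcongr
        _ = _ := by ring
    refine le_trans ?_ (card_nsmul_le_sum _ _ _ hterm)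
    have hcard : m / 10 ≤ ((Icc (J + q - w) (J + q)).card : ℝ) := by
      rw [Nat.card_Icc, show J + q + 1 - (J + q - w) = w + 1 by omega]
      push_cast
      exact hw'.le
    rw [nsmul_eq_mul]
    calc _ = m / 10 * (exp (l * (v * log (2 * exp 1 / v))) * (β / (12 * C)) /
          (A * √l)) := by rw [hm]; field_simp; ring
      _ ≤ _ := by gcongr

theorem min_mul_log_two_mul_exp_one_div_min (β : ℝ) (hβ : 0 < β) :
    min ((1 + β) / log 2) 2 * log (2 * exp 1 / min ((1 + β) / log 2) 2) =
      2 + β - (if log 4 - 1 ≤ β then β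
        else (1 + β) / log 2 * log ((1 + β) / (exp 1 * log 2)) + 1) := by
  have ht : 0 < log 2 := log_pos one_lt_two
  rw [log_four_eq]
  split_ifs with h
  · rw [min_eq_right (by rw [le_div_iff₀ ht]; linarith), mul_div_cancel_left₀ _ two_ne_zero,
      log_exp]
    ring
  · rw [min_eq_left (by rw [div_le_iff₀ ht]; linarith)]
    have h1 : 2 * exp 1 / ((1 + β) / log 2) =
        2 / ((1 + β) / (exp 1 * log 2)) := by field_simp
    rw [h1, log_div two_ne_zero (by positivity), mul_sub, div_mul_cancel₀ _ ht.ne']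
    ring

theorem polyH_of_nonpos (F : ℤ[X]) {x : ℝ} (hx : x ≤ 0) (y z : ℝ) : polyH F x y z = 0 := by
  have h : {n : ℕ | 0 < n ∧ (n : ℝ) ≤ x ∧
      ∃ d : ℕ, 0 < d ∧ (d : ℤ) ∣ F.eval (n : ℤ) ∧ y < (d : ℝ) ∧ (d : ℝ) ≤ z} = ∅ := by
    refine Set.eq_empty_iff_forall_notMem.mpr (fun n hn => ?_)
    have h1 : (0 : ℝ) < n := by exact_mod_cast hn.1
    linarith [hn.2.1]
  rw [polyH, h, Set.ncard_empty]

theorem stmt11 (F : Polynomial ℤ) (hF : Irreducible F) (hdeg : 2 ≤ F.natDegree)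
    (δ C : ℝ) (hδ0 : 0 < δ) (hδ1 : δ < 1) (hC : 1 < C) :
    ∃ y₀ c : ℝ, 0 < c ∧
      ∀ x y z η : ℝ, y₀ ≤ y → y ≤ x ^ (1 - δ) → z = Real.exp η * y →
        (Real.log y) ^ (-C) ≤ η → η ≤ 1 / 100 →
        ∀ β ξ Gβ : ℝ,
          β = -Real.log η / Real.log (Real.log y) →
          ξ = (β - (Real.log 4 - 1)) * Real.sqrt (Real.log (Real.log y)) →
          Gβ = (if Real.log 4 - 1 ≤ β then β
                else (1 + β) / Real.log 2 * Real.log ((1 + β) / (Real.exp 1 * Real.log 2)) + 1) →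
          c * β * x / (max 1 (-ξ) * (Real.log y) ^ Gβ) ≤
            (polyH F x y z : ℝ) - (polyH F (x / 2) y z : ℝ) := by
  obtain ⟨κ, p₀, hκ0, -, -, -, hH⟩ := exists_polyH_sub_ge hF hdeg hδ0 hδ1
  obtain ⟨c₁, y₁, hc₁, -, hH⟩ := hH C
  obtain ⟨c₂, K, hc₂, hK, hcell⟩ := exists_sum_cellCount_ge hF (by omega) p₀
  obtain ⟨M, hM⟩ := pow_unbounded_of_one_lt (K / min (δ / 2) κ) one_lt_two
  obtain ⟨c₃, l₀, hc₃, hpoisson⟩ := exists_sum_poisson_ge hC M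
  have hmin : 0 < min (δ / 2) κ := lt_min (by linarith) hκ0
  rw [div_lt_iff₀ hmin] at hM
  refine ⟨max y₁ (exp (exp (max l₀ 1))), c₁ * c₂ * c₃, by positivity, ?_⟩
  rintro x y z η hy hyx rfl hη hη1 β ξ Gβ hβ hξ hGβ
  have hy0 : 0 < y := (exp_pos _).trans_le ((le_max_right _ _).trans hy)
  have hL : exp (max l₀ 1) ≤ log y :=
    (le_log_iff_exp_le hy0).mpr ((le_max_right _ _).trans hy)
  obtain ⟨L, hLd⟩ : ∃ L, L = log y := ⟨_, rfl⟩
  rw [← hLd] at hL hη hβ hξ ⊢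
  have hL0 : 0 < L := (exp_pos _).trans_le hL
  have hl : max l₀ 1 ≤ log L := (le_log_iff_exp_le hL0).mpr hL
  obtain ⟨l, hld⟩ : ∃ l, l = log L := ⟨_, rfl⟩
  rw [← hld] at hl hβ hξ
  have hl1 : 0 < l := by linarith [le_max_right l₀ 1]
  have hη0 : 0 < η := (rpow_pos_of_pos hL0 _).trans_le hη
  have hβl : β * l = -log η := by rw [hβ]; field_simp
  have hηe : η = exp (-(β * l)) := by rw [hβl, neg_neg, exp_log hη0]
  have hLe : ∀ s : ℝ, L ^ s = exp (l * s) := fun s => by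
    rw [rpow_def_of_pos hL0, hld]
  have hβl4 : 4 * log 2 ≤ β * l := by
    rw [hβl, ← log_inv, show (4 : ℝ) = ((4 : ℕ) : ℝ) by norm_num, ← log_pow]
    refine log_le_log (by norm_num) ((le_inv_comm₀ (by norm_num) hη0).mpr ?_)
    exact hη1.trans (by norm_num)
  have hβ0 : 0 < β := by
    have : 0 < β * l := lt_of_lt_of_le (by positivity) hβl4
    exact pos_of_mul_pos_left this hl1.le
  have hβC : β ≤ C := by
    rw [hLe, hηe, exp_le_exp] at hη
    nlinarith
  rcases le_or_gt x 0 with hx | hx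
  · rw [polyH_of_nonpos F hx, polyH_of_nonpos F (by linarith), sub_self]
    refine div_nonpos_of_nonpos_of_nonneg ?_ (by positivity)
    exact mul_nonpos_of_nonneg_of_nonpos (by positivity) hx
  obtain ⟨𝒦, J, hJ, hJM, h𝒦, hsum⟩ := hpoisson l β ((le_max_left _ _).trans hl) hβ0 hβC hβl4
  rw [← hξ, min_mul_log_two_mul_exp_one_div_min β hβ0, ← hGβ] at hsum
  have hJL : (2 : ℝ) ^ J * 2 ^ M ≤ L := by
    calc _ = exp (J * log 2 + M * log 2) := by
          rw [exp_add, exp_nat_mul, exp_nat_mul, exp_log two_pos]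
      _ ≤ exp l := by gcongr
      _ = L := by rw [hld, exp_log hL0]
  have hKJ : K * 2 ^ J ≤ L * min (δ / 2) κ := by
    calc _ ≤ 2 ^ M * min (δ / 2) κ * 2 ^ J := by gcongr
      _ = 2 ^ J * 2 ^ M * min (δ / 2) κ := by ring
      _ ≤ _ := by gcongr
  have hle_rpow : ∀ n : ℕ, 0 < n → ∀ s, min (δ / 2) κ ≤ s → log n ≤ K * 2 ^ J →
      (n : ℝ) ≤ y ^ s := fun n hn s hs hn' => by
    rw [rpow_def_of_pos hy0, ← hLd, ← log_le_iff_le_exp (by exact_mod_cast hn)]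
    exact hn'.trans (hKJ.trans (by gcongr))
  have hex : ∀ k ∈ 𝒦, ∃ 𝒜 : Finset ℕ, (∀ a ∈ 𝒜, a.primeFactors.card = k ∧ Squarefree a ∧
      log a ≤ K * 2 ^ J ∧ ∀ p : ℕ, p.Prime → p ∣ a → p₀ < p ∧ log p ≤ K * 2 ^ J) ∧
      c₂ * ((2 * log 2) ^ k * J ^ k / k.factorial * ((k - J : ℕ) / k)) ≤
        ∑ a ∈ 𝒜, (rootCount F a : ℝ) / a * cellCount η y a := by
    intro k hk
    obtain ⟨hJk, hk2, hkη⟩ := h𝒦 k hk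
    refine hcell η y k J hη0 hη1 hy0 hJ hJk hk2 ?_
    rw [hηe]
    calc _ ≤ exp (-(((k - J : ℕ) : ℝ) * log 2)) := by gcongr
      _ = _ := by
          rw [exp_neg, exp_nat_mul, exp_log two_pos, pow_sub₀ _ two_ne_zero hJk.le,
            mul_inv, inv_inv, div_eq_mul_inv, mul_comm]
  choose! 𝒜 h𝒜 h𝒜sum using hex
  have hmain := hH x y η ((le_max_left _ _).trans hy) hx hyx hη0 (hLd ▸ hη) hη1 (𝒦.biUnion 𝒜)
    (fun a ha => by
      obtain ⟨k, hk, hak⟩ := mem_biUnion.mp ha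
      obtain ⟨-, hsq, hlog, hp⟩ := h𝒜 k hk a hak
      exact ⟨hsq, hle_rpow a (Nat.pos_of_ne_zero hsq.ne_zero) _ (min_le_left _ _) hlog,
        fun p hpp hpa => ⟨(hp p hpp hpa).1,
          hle_rpow p hpp.pos _ (min_le_right _ _) (hp p hpp hpa).2⟩⟩)
  rw [sum_biUnion (fun k hk k' hk' hkk' => Finset.disjoint_left.mpr (fun a ha ha' =>
    hkk' ((h𝒜 k hk a ha).1.symm.trans (h𝒜 k' hk' a ha').1))), ← hLd] at hmain
  refine le_trans ?_ hmain
  have hexp : η / L ^ 2 * exp (l * (2 + β - Gβ)) = 1 / L ^ Gβ := by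
    rw [hLe Gβ, ← rpow_natCast L 2, hLe, hηe, ← exp_sub, ← exp_add, one_div,
      ← exp_neg]
    congr 1
    push_cast
    ring
  calc c₁ * c₂ * c₃ * β * x / (max 1 (-ξ) * L ^ Gβ)
      = c₁ * c₂ * c₃ * β * x / max 1 (-ξ) * (1 / L ^ Gβ) := by field_simp
    _ = c₁ * x * η / L ^ 2 *
          (c₂ * (c₃ * β / max 1 (-ξ) * exp (l * (2 + β - Gβ)))) := by rw [← hexp]; ring
    _ ≤ _ := by
        gcongr
        refine (mul_le_mul_of_nonneg_left hsum hc₂.le).trans ?_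
        rw [mul_sum]
        exact sum_le_sum h𝒜sum
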